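/- (Nguyen) Let K be a number field, f ∈ K[X] a polynomial that is not linearly conjugate to a monomial or to a Chebyshev polynomial, and φ = (f,...,f) the corresponding split polynomial self-map of (ℙ^1)^n. Let C be an irreducible non-vertical curve in (ℙ^1)^n not contained in any φ-periodic hypersurface. Then the points in ⋃_V (C(ℚ̄) ∩ V(ℚ̄)), where V ranges over all φ-periodic hypersurfaces of (ℙ^1)^n, have bounded absolute logarithmic Weil height. -/

import Mathlib

noncomputable section
abbrev Qbar : Type := AlgebraicClosure ℚ

noncomputable def weilHeight (α : Qbar) : ℝ :=
  (Real.log (((minpoly ℚ α).support.lcm fun i => ((minpoly ℚ α).coeff i).den : ℕ) : ℝ) +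
      (((minpoly ℚ α).aroots ℂ).map fun z => Real.log (max 1 ‖z‖)).sum) /
    ((minpoly ℚ α).natDegree : ℝ)

/-- The projective line over the algebraic numbers. -/
abbrev P1 : Type := Projectivization Qbar (Fin 2 → Qbar)

/-- `v` is a homogeneous-coordinate representative of `P`. -/
def IsRep (P : P1) (v : Fin 2 → Qbar) : Prop :=
  ∃ h : v ≠ 0, Projectivization.mk Qbar v h = P

abbrev PPt (n : ℕ) : Type := Fin n → P1

/-- Zariski-closed subsets of `(ℙ¹)ⁿ`, via vanishing of polynomials in the
homogeneous coordinates on all representatives. -/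
def PClosed {n : ℕ} (S : Set (PPt n)) : Prop :=
  ∃ I : Set (MvPolynomial (Fin n × Fin 2) Qbar),
    S = {P : PPt n | ∀ f ∈ I, ∀ v : Fin n → Fin 2 → Qbar,
      (∀ i, IsRep (P i) (v i)) → MvPolynomial.eval (fun q => v q.1 q.2) f = 0}

def PIrred {n : ℕ} (S : Set (PPt n)) : Prop :=
  S.Nonempty ∧ ∀ Z₁ Z₂ : Set (PPt n), PClosed Z₁ → PClosed Z₂ →
    S ⊆ Z₁ ∪ Z₂ → S ⊆ Z₁ ∨ S ⊆ Z₂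

def pdim {n : ℕ} (S : Set (PPt n)) : ℕ :=
  sSup {d : ℕ | ∃ Z : Fin (d + 1) → Set (PPt n),
    (∀ i, PClosed (Z i) ∧ PIrred (Z i) ∧ Z i ⊆ S) ∧
    ∀ i j : Fin (d + 1), i < j → Z i ⊂ Z j}

/-- Homogenization of the polynomial map induced by `f` on homogeneous coordinates. -/
noncomputable def pvec (f : Polynomial Qbar) (v : Fin 2 → Qbar) : Fin 2 → Qbar :=
  ![∑ j ∈ Finset.range (f.natDegree + 1), f.coeff j * v 0 ^ j * v 1 ^ (f.natDegree - j),
    v 1 ^ f.natDegree]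

open scoped Classical in
/-- The action of a polynomial `f` on `ℙ¹`. -/
noncomputable def pact (f : Polynomial Qbar) (P : P1) : P1 :=
  if h : pvec f (Projectivization.rep P) ≠ 0 then Projectivization.mk Qbar _ h else P

/-- The split self-map of `(ℙ¹)ⁿ` determined by polynomials `fs i`. -/
noncomputable def splitMap {n : ℕ} (fs : Fin n → Polynomial Qbar) (P : PPt n) : PPt n :=
  fun i => pact (fs i) (P i)

/-- A periodic hypersurface for the split map determined by `fs`. -/
def IsPeriodicHyp {n : ℕ} (fs : Fin n → Polynomial Qbar) (V : Set (PPt n)) : Prop :=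
  PClosed V ∧ PIrred V ∧ pdim V + 1 = n ∧ ∃ k : ℕ, 1 ≤ k ∧ (splitMap fs)^[k] '' V = V

def IsCurve {n : ℕ} (C : Set (PPt n)) : Prop := PClosed C ∧ PIrred C ∧ pdim C = 1

/-- `C` surjects onto each `ℙ¹` factor. -/
def NonVertical {n : ℕ} (C : Set (PPt n)) : Prop :=
  ∀ i : Fin n, ∀ y : P1, ∃ P ∈ C, P i = y

/-- The Weil height of a point of `ℙ¹` (with `h(∞) = 0`). -/
noncomputable def hP1 (P : P1) : ℝ :=
  weilHeight (Projectivization.rep P 0 / Projectivization.rep P 1)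

/-- `P` is a periodic point of `f` on `ℙ¹`. -/
def PerPt (f : Polynomial Qbar) (P : P1) : Prop :=
  ∃ m : ℕ, 1 ≤ m ∧ (pact f)^[m] P = P

/-- `P ∈ ℙ¹(L)`. -/
def P1Over (L : IntermediateField ℚ Qbar) (P : P1) : Prop :=
  ∃ v : Fin 2 → Qbar, (∀ j, v j ∈ L) ∧ IsRep P v

/-- `f` is linearly conjugate to a monomial or to a (±)Chebyshev polynomial. -/
def IsSpecial (f : Polynomial Qbar) : Prop :=
  ∃ a b : Qbar, a ≠ 0 ∧ ∃ g : Polynomial Qbar,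
    ((∃ d : ℕ, g = Polynomial.X ^ d) ∨
     (∃ d, g = Polynomial.Chebyshev.T Qbar d) ∨
     (∃ d, g = -Polynomial.Chebyshev.T Qbar d)) ∧
    f.comp (Polynomial.C a * Polynomial.X + Polynomial.C b) =
      (Polynomial.C a * Polynomial.X + Polynomial.C b).comp g

def IsRootOfUnity (α : Qbar) : Prop := ∃ k : ℕ, 1 ≤ k ∧ α ^ k = 1

def HasBogomolov (L : IntermediateField ℚ Qbar) : Prop :=
  ∃ C : ℝ, 0 < C ∧ ∀ α : Qbar, α ∈ L → α ≠ 0 → ¬ IsRootOfUnity α → C ≤ weilHeight α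

def cycClosure (K : IntermediateField ℚ Qbar) : IntermediateField ℚ Qbar :=
  K ⊔ IntermediateField.adjoin ℚ {x : Qbar | IsRootOfUnity x}


set_option linter.all false

noncomputable section
open Polynomial

/-- data for the key theorem -/
structure R1Data (k F L : Type) [Field k] [Field F] [Algebra k[X] F] [Field L] [Algebra F L]
    [Algebra k L] where
  g : k[X]
  hg : 2 ≤ g.natDegree
  y : L
  σF : F →+* F
  σ : L →+* L
  hF : ∀ a : k[X], σF (algebraMap k[X] F a) = algebraMap k[X] F (a.comp g)
  hσ : ∀ c : F, σ (algebraMap F L c) = algebraMap F L (σF c)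
  hσy : σ y = aeval y g
  gen : IntermediateField.adjoin F {y} = ⊤
  gen' : IntermediateField.adjoin F {σ y} = ⊤

section
variable {k F L : Type} [Field k] [IsAlgClosed k] [CharZero k] [Field F] [Algebra k[X] F]
  [IsFractionRing k[X] F] [Field L] [Algebra F L] [Algebra k L] [Algebra k F]
  [IsScalarTower k k[X] F] [IsScalarTower k F L] [FiniteDimensional F L]

lemma exists_powerBasis_gen (u : L) (h : IntermediateField.adjoin F {u} = ⊤) :
    ∃ pb : PowerBasis F L, pb.gen = u := by
  have hu : IsIntegral F u := IsIntegral.of_finite F _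
  have h' : Algebra.adjoin F {u} = ⊤ := by
    rw [← IntermediateField.adjoin_simple_toSubalgebra_of_isAlgebraic hu.isAlgebraic, h]
    rfl
  exact ⟨PowerBasis.ofAdjoinEqTop hu h', by simp⟩

/-- semilinear lift of linear functionals -/
lemma R1Data.lift (d : R1Data k F L) {r : ℕ} (ψ : L →ₗ[F] (Fin r → F)) :
    ∃ ψ' : L →ₗ[F] (Fin r → F), ∀ l i, ψ' (d.σ l) i = d.σF (ψ l i) := by
  obtain ⟨pb, hgen⟩ := exists_powerBasis_gen d.y d.gen
  obtain ⟨pb', hgen'⟩ := exists_powerBasis_gen (d.σ d.y) d.gen'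
  have hdim : pb.dim = pb'.dim := by rw [← pb.finrank, ← pb'.finrank]
  let b' := pb'.basis.reindex (finCongr hdim.symm)
  have hb' : ∀ i, b' i = d.σ (pb.basis i) := by
    intro i
    simp [b', hgen, hgen']
  refine ⟨b'.constr F (fun i => d.σF ∘ ψ (pb.basis i)), fun l i => ?_⟩
  conv_lhs => rw [← pb.basis.sum_repr l]
  conv_rhs => rw [← pb.basis.sum_repr l]
  simp only [map_sum, Finset.sum_apply, Algebra.smul_def, map_mul, d.hσ, ← hb']
  simp only [← Algebra.smul_def, map_smul, Module.Basis.constr_basis]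
  simp

lemma R1Data.minpoly_sigma (d : R1Data k F L) (u : L) :
    minpoly F (d.σ u) = (minpoly F u).map d.σF := by
  have hu : IsIntegral F u := IsIntegral.of_finite F _
  have hroot : aeval (d.σ u) ((minpoly F u).map d.σF) = 0 := by
    have := congrArg d.σ (minpoly.aeval F u)
    rw [map_zero, aeval_def, hom_eval₂] at this
    rw [aeval_def, eval₂_map]
    convert this using 1
    congr 1
    ext c
    exact (d.hσ c).symm
  symm
  apply minpoly.unique' F _ ((minpoly.monic hu).map _) hroot
  intro q hq
  by_contra hcon
  push Not at hcon
  obtain ⟨hq0, h0⟩ := hcon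
  set r := (minpoly F u).natDegree with hr
  have hli : LinearIndependent F (fun i : Fin r => u ^ (i : ℕ)) := linearIndependent_pow u
  let φ : (Fin r → F) →ₗ[F] L := Fintype.linearCombination F (fun i : Fin r => u ^ (i : ℕ))
  have hφ : LinearMap.ker φ = ⊥ := by
    rw [LinearMap.ker_eq_bot]
    exact linearIndependent_iff_injective_fintypeLinearCombination.mp hli
  obtain ⟨ψ, hψ⟩ := LinearMap.exists_leftInverse_of_injective φ hφ
  obtain ⟨ψ', hψ'⟩ := d.lift ψ
  have hψu : ∀ j : Fin r, ψ (u ^ (j : ℕ)) = Pi.single j 1 := by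
    intro j
    have : φ (Pi.single j 1) = u ^ (j : ℕ) := by
      simp [φ, Fintype.linearCombination_apply_single]
    rw [← this]
    exact LinearMap.congr_fun hψ _
  have hdeg : q.natDegree < r := by
    rw [degree_map] at hq
    have := natDegree_lt_natDegree hq0 hq
    simpa using this
  have hq' : q = 0 := by
    ext n
    by_cases hn : n < r
    · have h1 := congrFun (congrArg ψ' h0) ⟨n, hn⟩
      rw [aeval_eq_sum_range' hdeg] at h1
      simp only [map_sum, map_smul, map_zero, Pi.zero_apply, Finset.sum_apply, Pi.smul_apply] at h1
      rw [Finset.sum_eq_single n] at h1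
      · rw [← map_pow, hψ', hψu ⟨n, hn⟩] at h1
        simpa using h1
      · intro m hm hmn
        have hm' := Finset.mem_range.mp hm
        rw [← map_pow, hψ', hψu ⟨m, hm'⟩]
        rw [Pi.single_eq_of_ne]
        · simp
        · intro h; apply hmn; simpa using (congrArg Fin.val h).symm
      · intro h; exact absurd (Finset.mem_range.mpr hn) h
    · rw [coeff_eq_zero_of_natDegree_lt (by omega)]; simp
  exact hq0 hq'
end

noncomputable section
open Polynomial
section
variable {k : Type} (F : Type) {L : Type} [Field k] [IsAlgClosed k] [CharZero k] [Field F] [Algebra k[X] F]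
  [IsFractionRing k[X] F] [Field L] [Algebra F L] [Algebra k L] [Algebra k F]
  [IsScalarTower k k[X] F] [IsScalarTower k F L] [FiniteDimensional F L]

lemma frac_red {F : Type} [Field F] [Algebra k[X] F] [IsFractionRing k[X] F] (c : F) :
    ∃ a b : k[X], b ≠ 0 ∧ IsCoprime a b ∧ c * algebraMap k[X] F b = algebraMap k[X] F a := by
  obtain ⟨a, b, h, e⟩ := IsFractionRing.exists_reduced_fraction k[X] c
  refine ⟨a, b, nonZeroDivisors.ne_zero b.2, ?_, ?_⟩
  · exact h.isCoprime
  · rw [← e, IsLocalization.mk'_spec]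

lemma iota_inj {F : Type} [Field F] [Algebra k[X] F] [IsFractionRing k[X] F] {a b : k[X]} :
    algebraMap k[X] F a = algebraMap k[X] F b ↔ a = b :=
  (IsFractionRing.injective k[X] F).eq_iff

lemma iota_ne {F : Type} [Field F] [Algebra k[X] F] [IsFractionRing k[X] F] {b : k[X]} (h : b ≠ 0) :
    algebraMap k[X] F b ≠ 0 := by
  rw [← map_zero (algebraMap k[X] F), Ne, iota_inj]; exact h

/-- local ring at a point -/
def OZ (z : k) : ValuationSubring F where
  carrier := {c | ∃ a b : k[X], b.eval z ≠ 0 ∧ c * algebraMap k[X] F b = algebraMap k[X] F a}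
  mul_mem' := by
    rintro c c' ⟨a, b, hb, h⟩ ⟨a', b', hb', h'⟩
    refine ⟨a * a', b * b', by simp [hb, hb'], ?_⟩
    rw [map_mul, map_mul, ← h, ← h']; ring
  one_mem' := ⟨1, 1, by simp, by simp⟩
  add_mem' := by
    rintro c c' ⟨a, b, hb, h⟩ ⟨a', b', hb', h'⟩
    refine ⟨a * b' + a' * b, b * b', by simp [hb, hb'], ?_⟩
    rw [map_add, map_mul, map_mul, map_mul, ← h, ← h']; ring
  zero_mem' := ⟨0, 1, by simp, by simp⟩
  neg_mem' := by
    rintro c ⟨a, b, hb, h⟩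
    exact ⟨-a, b, hb, by rw [map_neg, ← h]; ring⟩
  mem_or_inv_mem' := by
    intro c
    obtain ⟨a, b, hb, hab, h⟩ := frac_red (k := k) c
    by_cases hz : b.eval z = 0
    · right
      have ha : a.eval z ≠ 0 := by
        intro ha
        obtain ⟨u, v, huv⟩ := hab
        have := congrArg (eval z) huv
        simp [ha, hz] at this
      refine ⟨b, a, ha, ?_⟩
      have hc : c ≠ 0 := by
        rintro rfl
        rw [zero_mul] at h
        have : a = 0 := by rw [← iota_inj (F := F), ← h, map_zero]
        simp [this] at ha
      rw [← h]; field_simp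
    · left; exact ⟨a, b, hz, h⟩

/-- local ring at infinity -/
def OI : ValuationSubring F where
  carrier := {c | ∃ a b : k[X], b ≠ 0 ∧ a.natDegree ≤ b.natDegree ∧
    c * algebraMap k[X] F b = algebraMap k[X] F a}
  mul_mem' := by
    rintro c c' ⟨a, b, hb, hd, h⟩ ⟨a', b', hb', hd', h'⟩
    refine ⟨a * a', b * b', by simp [hb, hb'], ?_, ?_⟩
    · rw [natDegree_mul hb hb']; exact natDegree_mul_le.trans (by omega)
    rw [map_mul, map_mul, ← h, ← h']; ring
  one_mem' := ⟨1, 1, by simp, by simp⟩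
  add_mem' := by
    rintro c c' ⟨a, b, hb, hd, h⟩ ⟨a', b', hb', hd', h'⟩
    refine ⟨a * b' + a' * b, b * b', by simp [hb, hb'], ?_, ?_⟩
    · rw [natDegree_mul hb hb']
      refine (natDegree_add_le _ _).trans (max_le ?_ ?_) <;>
      exact natDegree_mul_le.trans (by omega)
    rw [map_add, map_mul, map_mul, map_mul, ← h, ← h']; ring
  zero_mem' := ⟨0, 1, by simp, by simp⟩
  neg_mem' := by
    rintro c ⟨a, b, hb, hd, h⟩
    exact ⟨-a, b, hb, by simpa using hd, by rw [map_neg, ← h]; ring⟩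
  mem_or_inv_mem' := by
    intro c
    obtain ⟨a, b, hb, hab, h⟩ := frac_red (k := k) c
    by_cases hz : a.natDegree ≤ b.natDegree
    · left; exact ⟨a, b, hb, hz, h⟩
    · right
      have ha : a ≠ 0 := by rintro rfl; simp at hz
      refine ⟨b, a, ha, by omega, ?_⟩
      have hc : c ≠ 0 := by
        rintro rfl
        rw [zero_mul] at h
        have : a = 0 := by rw [← iota_inj (F := F), ← h, map_zero]
        exact ha this
      rw [← h]; field_simp

variable {F}

lemma mem_OZ {z : k} {c : F} : c ∈ OZ F z ↔
    ∃ a b : k[X], b.eval z ≠ 0 ∧ c * algebraMap k[X] F b = algebraMap k[X] F a := Iff.rfl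

lemma mem_OI {c : F} : c ∈ OI (k := k) F ↔
    ∃ a b : k[X], b ≠ 0 ∧ a.natDegree ≤ b.natDegree ∧
    c * algebraMap k[X] F b = algebraMap k[X] F a := Iff.rfl

lemma iota_mem_OZ (z : k) (a : k[X]) : algebraMap k[X] F a ∈ OZ F z := ⟨a, 1, by simp, by simp⟩

lemma inv_iota_mem_OZ (z : k) (a : k[X]) (h : a.eval z ≠ 0) : (algebraMap k[X] F a)⁻¹ ∈ OZ F z := by
  refine ⟨1, a, h, ?_⟩
  have : a ≠ 0 := by rintro rfl; simp at h
  rw [inv_mul_cancel₀ (iota_ne this), map_one]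

lemma mem_all_OZ {c : F} (h : ∀ z : k, c ∈ OZ F z) : ∃ a : k[X], c = algebraMap k[X] F a := by
  obtain ⟨a, b, hb, hab, e⟩ := frac_red (k := k) c
  have hu : IsUnit b := by
    by_contra hu
    obtain ⟨z, hz⟩ := IsAlgClosed.exists_root b (by
      intro h; exact hu (Polynomial.isUnit_iff_degree_eq_zero.mpr h))
    obtain ⟨a', b', hb', e'⟩ := h z
    have : a * b' = a' * b := by
      rw [← iota_inj (F := F), map_mul, map_mul, ← e, ← e']; ring
    have h1 := congrArg (eval z) this
    rw [eval_mul, eval_mul, hz.eq_zero, mul_zero] at h1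
    have ha : a.eval z = 0 := (mul_eq_zero.mp h1).resolve_right hb'
    obtain ⟨u, v, huv⟩ := hab
    have := congrArg (eval z) huv
    simp [ha, hz.eq_zero] at this
  obtain ⟨b', hb'⟩ := hu.exists_right_inv
  refine ⟨a * b', ?_⟩
  rw [map_mul, ← e, mul_assoc, ← map_mul, hb', map_one, mul_one]

lemma finite_not_mem_OZ (c : F) : {z : k | c ∉ OZ F z}.Finite := by
  obtain ⟨a, b, hb, hab, e⟩ := frac_red (k := k) c
  classical
  refine (b.roots.toFinset.finite_toSet).subset ?_
  intro z hz
  simp only [Finset.mem_coe, Multiset.mem_toFinset, mem_roots hb, IsRoot.def]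
  by_contra h
  exact hz ⟨a, b, h, e⟩

lemma R1Data.sigmaF_OZ (d : R1Data k F L) (x0 : k) (c : F) :
    d.σF c ∈ OZ F x0 ↔ c ∈ OZ F (d.g.eval x0) := by
  constructor
  · rintro ⟨p, q, hq, h⟩
    obtain ⟨a, b, hb, hab, e⟩ := frac_red (k := k) c
    have e' := congrArg d.σF e
    rw [map_mul, d.hF, d.hF] at e'
    refine ⟨a, b, ?_, e⟩
    intro hz
    have : (a.comp d.g) * q = p * (b.comp d.g) := by
      rw [← iota_inj (F := F), map_mul, map_mul, ← h, ← e']; ring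
    have h1 := congrArg (eval x0) this
    rw [eval_mul, eval_mul, eval_comp, eval_comp, hz, mul_zero] at h1
    have ha := (mul_eq_zero.mp h1).resolve_right hq
    obtain ⟨u, v, huv⟩ := hab
    have := congrArg (eval (d.g.eval x0)) huv
    simp [ha, hz] at this
  · rintro ⟨a, b, hb, e⟩
    have e' := congrArg d.σF e
    rw [map_mul, d.hF, d.hF] at e'
    exact ⟨_, _, by rwa [eval_comp], e'⟩

lemma R1Data.sigmaF_OI (d : R1Data k F L) (c : F) :
    d.σF c ∈ OI (k := k) F ↔ c ∈ OI (k := k) F := by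
  have hg := d.hg
  constructor
  · rintro ⟨p, q, hq, hd, h⟩
    obtain ⟨a, b, hb, hab, e⟩ := frac_red (k := k) c
    have e' := congrArg d.σF e
    rw [map_mul, d.hF, d.hF] at e'
    refine ⟨a, b, hb, ?_, e⟩
    by_cases ha : a = 0
    · simp [ha]
    have : (a.comp d.g) * q = p * (b.comp d.g) := by
      rw [← iota_inj (F := F), map_mul, map_mul, ← h, ← e']; ring
    have h1 := congrArg natDegree this
    have hag : a.comp d.g ≠ 0 := by
      intro h0
      rw [comp_eq_zero_iff] at h0
      rcases h0 with h0 | ⟨_, h0⟩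
      · exact ha h0
      · rw [h0] at hg; simp at hg
    rw [natDegree_mul hag hq, natDegree_comp] at h1
    have h2 : (p * b.comp d.g).natDegree ≤ _ := natDegree_mul_le
    rw [natDegree_comp] at h2
    have : a.natDegree * d.g.natDegree ≤ b.natDegree * d.g.natDegree := by omega
    exact Nat.le_of_mul_le_mul_right this (by omega)
  · rintro ⟨a, b, hb, hd, e⟩
    have e' := congrArg d.σF e
    rw [map_mul, d.hF, d.hF] at e'
    refine ⟨_, _, ?_, ?_, e'⟩
    · intro h0
      rw [comp_eq_zero_iff] at h0
      rcases h0 with h0 | ⟨_, h0⟩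
      · exact hb h0
      · rw [h0] at hg; simp at hg
    · rw [natDegree_comp, natDegree_comp]; exact Nat.mul_le_mul_right _ hd

lemma int_iff (O : ValuationSubring F) (u : L) :
    IsIntegral O u ↔ ∀ i, (minpoly F u).coeff i ∈ O := by
  constructor
  · intro h i
    rw [minpoly.isIntegrallyClosed_eq_field_fractions' F h, coeff_map]
    exact ((minpoly O u).coeff i).2
  · intro h
    have hu : IsIntegral F u := IsIntegral.of_finite F _
    have : (minpoly F u) ∈ lifts (algebraMap O F) := by
      rw [lifts_iff_coeff_lifts]
      intro i
      exact ⟨⟨_, h i⟩, rfl⟩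
    obtain ⟨q, hq, -, hm⟩ := lifts_and_natDegree_eq_and_monic this (minpoly.monic hu)
    refine ⟨q, hm, ?_⟩
    have h1 := minpoly.aeval F u
    rw [← hq, aeval_map_algebraMap] at h1
    exact h1

lemma R1Data.int_OZ (d : R1Data k F L) (x0 : k) (u : L) :
    IsIntegral (OZ F x0) (d.σ u) ↔ IsIntegral (OZ F (d.g.eval x0)) u := by
  simp only [int_iff, d.minpoly_sigma, coeff_map, d.sigmaF_OZ]

lemma R1Data.int_OI (d : R1Data k F L) (u : L) :
    IsIntegral (OI (k := k) F) (d.σ u) ↔ IsIntegral (OI (k := k) F) u := by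
  simp only [int_iff, d.minpoly_sigma, coeff_map, d.sigmaF_OI]

lemma int_of_mem (O : ValuationSubring F) {c : F} (h : c ∈ O) : IsIntegral O (algebraMap F L c) :=
  isIntegral_algebraMap (R := O) (A := L) (x := ⟨c, h⟩)

lemma int_const (z : k) (c : k) : IsIntegral (OZ F z) (algebraMap k L c) := by
  rw [IsScalarTower.algebraMap_apply k F L]
  apply int_of_mem
  rw [IsScalarTower.algebraMap_apply k k[X] F]
  exact iota_mem_OZ z _

lemma int_aeval (z : k) (u : L) (hu : IsIntegral (OZ F z) u) (p : k[X]) :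
    IsIntegral (OZ F z) (aeval u p) := by
  rw [aeval_eq_sum_range]
  refine IsIntegral.sum _ fun i _ => ?_
  rw [Algebra.smul_def]
  exact (int_const z _).mul (hu.pow _)
end

noncomputable section
open Polynomial
section
variable {k : Type} [Field k] [IsAlgClosed k] [CharZero k]

lemma dvd_of_mult (A T : k[X]) (hA : A ≠ 0) (hT : T ≠ 0)
    (h : ∀ x, A.IsRoot x → A.rootMultiplicity x ≤ T.rootMultiplicity x) : A ∣ T := by
  classical
  have hs : A.Splits := IsAlgClosed.splits A
  rw [hs.dvd_iff_roots_le_roots hA hT]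
  rw [Multiset.le_iff_count]
  intro x
  rw [count_roots, count_roots]
  by_cases hx : A.IsRoot x
  · exact h x hx
  · rw [rootMultiplicity_eq_zero hx]; exact Nat.zero_le _

lemma natDegree_sub_const (g : k[X]) (z : k) (hg : 2 ≤ g.natDegree) : (g - C z).natDegree = g.natDegree :=
  natDegree_sub_C

lemma sub_const_ne (g : k[X]) (z : k) (hg : 2 ≤ g.natDegree) : g - C z ≠ 0 := by
  intro h
  have := natDegree_sub_const g z hg
  rw [h] at this; simp at this; omega

lemma mult_prod (g : k[X]) (hg : 2 ≤ g.natDegree) (Z : Finset k) (x : k) (hx : g.eval x ∈ Z) :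
    (∏ z ∈ Z, (g - C z)).rootMultiplicity x = (g - C (g.eval x)).rootMultiplicity x := by
  classical
  rw [← Finset.mul_prod_erase Z _ hx, rootMultiplicity_mul]
  · rw [rootMultiplicity_eq_zero (p := ∏ z ∈ Z.erase (g.eval x), (g - C z)), add_zero]
    rw [IsRoot.def, eval_prod, Finset.prod_eq_zero_iff]
    rintro ⟨z, hz, h⟩
    simp only [eval_sub, eval_C, sub_eq_zero] at h
    exact (Finset.mem_erase.mp hz).1 h.symm
  · refine mul_ne_zero (sub_const_ne _ _ hg) (Finset.prod_ne_zero_iff.mpr fun z _ => sub_const_ne _ _ hg)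

lemma mult_prodX (Z : Finset k) (x : k) (hx : x ∈ Z) :
    1 ≤ (∏ z ∈ Z, (X - C z : k[X])).rootMultiplicity x := by
  rw [Nat.one_le_iff_ne_zero, ← Nat.pos_iff_ne_zero, rootMultiplicity_pos]
  · rw [IsRoot.def, eval_prod, Finset.prod_eq_zero_iff]
    exact ⟨x, hx, by simp⟩
  · exact Finset.prod_ne_zero_iff.mpr fun z _ => X_sub_C_ne_zero z

lemma mult_deriv (g : k[X]) (x : k) :
    (derivative g).rootMultiplicity x = (g - C (g.eval x)).rootMultiplicity x - 1 := by
  have := derivative_rootMultiplicity_of_root (p := g - C (g.eval x)) (t := x) (by simp)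
  simpa using this

lemma root_prod (g : k[X]) (Z : Finset k) (x : k) : (∏ z ∈ Z, (g - C z)).IsRoot x ↔ g.eval x ∈ Z := by
  rw [IsRoot.def, eval_prod, Finset.prod_eq_zero_iff]
  constructor
  · rintro ⟨z, hz, h⟩
    simp only [eval_sub, eval_C, sub_eq_zero] at h
    rwa [h]
  · intro h; exact ⟨_, h, by simp⟩

lemma deriv_ne (g : k[X]) (hg : 2 ≤ g.natDegree) : derivative g ≠ 0 := by
  intro h
  have := natDegree_eq_zero_of_derivative_eq_zero h
  omega

lemma natDegree_prod_sub (g : k[X]) (hg : 2 ≤ g.natDegree) (Z : Finset k) :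
    (∏ z ∈ Z, (g - C z)).natDegree = Z.card * g.natDegree := by
  rw [natDegree_prod _ _ (fun z _ => sub_const_ne _ _ hg)]
  simp [natDegree_sub_const _ _ hg]

lemma natDegree_prodX (Z : Finset k) :
    (∏ z ∈ Z, (X - C z : k[X])).natDegree = Z.card := by
  rw [natDegree_prod _ _ (fun z _ => X_sub_C_ne_zero z)]
  simp

lemma natDegree_deriv (g : k[X]) (hg : 2 ≤ g.natDegree) :
    (derivative g).natDegree = g.natDegree - 1 := by
  apply natDegree_eq_of_degree_eq_some
  exact degree_derivative_eq g (by omega)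

lemma leadingCoeff_deriv (g : k[X]) (hg : 2 ≤ g.natDegree) :
    (derivative g).leadingCoeff = g.leadingCoeff * g.natDegree := by
  rw [leadingCoeff, natDegree_deriv g hg, coeff_derivative, leadingCoeff]
  have : g.natDegree - 1 + 1 = g.natDegree := by omega
  rw [this]
  congr 1
  rw [Nat.cast_sub (by omega)]; simp

lemma eq_of_dvd_deg {A T : k[X]} (hT : T ≠ 0) (h : A ∣ T) (hd : A.natDegree = T.natDegree) :
    C A.leadingCoeff * T = C T.leadingCoeff * A := by
  obtain ⟨B, rfl⟩ := h
  have hA : A ≠ 0 := left_ne_zero_of_mul hT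
  have hB : B ≠ 0 := right_ne_zero_of_mul hT
  rw [natDegree_mul hA hB] at hd
  have : B.natDegree = 0 := by omega
  obtain ⟨b, rfl⟩ := natDegree_eq_zero.mp this
  rw [leadingCoeff_mul, leadingCoeff_C, C_mul]; ring

lemma leadingCoeff_sub_const (g : k[X]) (z : k) (hg : 2 ≤ g.natDegree) :
    (g - C z).leadingCoeff = g.leadingCoeff := by
  rw [leadingCoeff, natDegree_sub_const g z hg, coeff_sub, coeff_C_ne_zero (by omega), sub_zero]; rfl

lemma count1 (g : k[X]) (hg : 2 ≤ g.natDegree) (Z : Finset k)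
    (h : ∀ x, g.eval x ∈ Z → x ∈ Z) :
    Z = ∅ ∨ ∃ z, C (g.natDegree : k) * (g - C z) = derivative g * (X - C z) := by
  classical
  have hX : (∏ z ∈ Z, (X - C z : k[X])) ≠ 0 := Finset.prod_ne_zero_iff.mpr fun z _ => X_sub_C_ne_zero z
  have hT : derivative g * ∏ z ∈ Z, (X - C z) ≠ 0 := mul_ne_zero (deriv_ne g hg) hX
  have hA : (∏ z ∈ Z, (g - C z)) ≠ 0 := Finset.prod_ne_zero_iff.mpr fun z _ => sub_const_ne _ _ hg
  have hd : (∏ z ∈ Z, (g - C z)) ∣ derivative g * ∏ z ∈ Z, (X - C z) := by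
    apply dvd_of_mult _ _ hA hT
    intro x hx
    rw [root_prod] at hx
    rw [mult_prod g hg Z x hx, rootMultiplicity_mul hT, mult_deriv]
    have := mult_prodX Z x (h x hx)
    omega
  have hdeg := natDegree_le_of_dvd hd hT
  rw [natDegree_prod_sub g hg, natDegree_mul (deriv_ne g hg) hX, natDegree_prodX,
    natDegree_deriv g hg] at hdeg
  obtain ⟨M, hM⟩ : ∃ M, g.natDegree = M + 2 := ⟨g.natDegree - 2, by omega⟩
  have hc : Z.card ≤ 1 := by
    by_contra hc
    push Not at hc
    rw [hM] at hdeg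
    have : M + 2 - 1 = M + 1 := by omega
    rw [this] at hdeg
    nlinarith
  rcases Nat.le_one_iff_eq_zero_or_eq_one.mp hc with hc | hc
  · left; exact Finset.card_eq_zero.mp hc
  right
  obtain ⟨z, rfl⟩ := Finset.card_eq_one.mp hc
  refine ⟨z, ?_⟩
  simp only [Finset.prod_singleton] at hd hT hA
  have e := eq_of_dvd_deg hT hd (by
    rw [natDegree_mul (deriv_ne g hg) (X_sub_C_ne_zero z), natDegree_X_sub_C, natDegree_deriv g hg,
      natDegree_sub_const g z hg]; omega)
  rw [leadingCoeff_mul, leadingCoeff_X_sub_C, mul_one, leadingCoeff_deriv g hg,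
    leadingCoeff_sub_const g z hg, C_mul, mul_assoc] at e
  have h0 : C g.leadingCoeff ≠ (0 : k[X]) := by
    simp only [ne_eq, C_eq_zero, leadingCoeff_eq_zero]
    rintro rfl; simp at hg
  exact (mul_left_cancel₀ h0 e).symm

lemma count2 (g : k[X]) (hg : 2 ≤ g.natDegree) (Z : Finset k)
    (h : ∀ x, g.eval x ∈ Z → x ∈ Z ∨ (derivative g).eval x = 0) :
    Z.card ≤ 1 ∨ ∃ s1 s2, s1 ≠ s2 ∧ C (g.natDegree : k) ^ 2 * ((g - C s1) * (g - C s2)) =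
      derivative g ^ 2 * ((X - C s1) * (X - C s2)) := by
  classical
  have hX : (∏ z ∈ Z, (X - C z : k[X])) ≠ 0 := Finset.prod_ne_zero_iff.mpr fun z _ => X_sub_C_ne_zero z
  have hg2 : derivative g ^ 2 ≠ 0 := pow_ne_zero _ (deriv_ne g hg)
  have hT : derivative g ^ 2 * ∏ z ∈ Z, (X - C z) ≠ 0 := mul_ne_zero hg2 hX
  have hA : (∏ z ∈ Z, (g - C z)) ≠ 0 := Finset.prod_ne_zero_iff.mpr fun z _ => sub_const_ne _ _ hg
  have hd : (∏ z ∈ Z, (g - C z)) ∣ derivative g ^ 2 * ∏ z ∈ Z, (X - C z) := by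
    apply dvd_of_mult _ _ hA hT
    intro x hx
    rw [root_prod] at hx
    rw [mult_prod g hg Z x hx, rootMultiplicity_mul hT, pow_two, rootMultiplicity_mul (by rw [← pow_two]; exact hg2), mult_deriv]
    rcases h x hx with h1 | h1
    · have := mult_prodX Z x h1
      omega
    · have h2 : 0 < (derivative g).rootMultiplicity x := (rootMultiplicity_pos (deriv_ne g hg)).mpr h1
      rw [mult_deriv] at h2
      omega
  have hdeg := natDegree_le_of_dvd hd hT
  rw [natDegree_prod_sub g hg, natDegree_mul hg2 hX, natDegree_prodX, natDegree_pow,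
    natDegree_deriv g hg] at hdeg
  obtain ⟨M, hM⟩ : ∃ M, g.natDegree = M + 2 := ⟨g.natDegree - 2, by omega⟩
  have hc : Z.card ≤ 2 := by
    by_contra hc
    push Not at hc
    rw [hM] at hdeg
    have : M + 2 - 1 = M + 1 := by omega
    rw [this] at hdeg
    nlinarith
  rcases Nat.lt_or_ge Z.card 2 with hc1 | hc1
  · left; omega
  right
  obtain ⟨s1, s2, hne, rfl⟩ := Finset.card_eq_two.mp (le_antisymm hc hc1)
  refine ⟨s1, s2, hne, ?_⟩
  simp only [Finset.prod_pair hne] at hd hT hA hX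
  have e := eq_of_dvd_deg hT hd (by
    rw [natDegree_mul hg2 hX, natDegree_pow, natDegree_mul (sub_const_ne _ _ hg) (sub_const_ne _ _ hg),
      natDegree_mul (X_sub_C_ne_zero _) (X_sub_C_ne_zero _), natDegree_X_sub_C, natDegree_X_sub_C,
      natDegree_deriv g hg,
      natDegree_sub_const g _ hg, natDegree_sub_const g _ hg]; omega)
  simp only [leadingCoeff_mul, leadingCoeff_X_sub_C, mul_one, leadingCoeff_deriv g hg, leadingCoeff_pow,
    leadingCoeff_sub_const g _ hg, C_mul, C_pow] at e
  have h0 : C g.leadingCoeff ≠ (0 : k[X]) := by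
    simp only [ne_eq, C_eq_zero, leadingCoeff_eq_zero]
    rintro rfl; simp at hg
  apply mul_left_cancel₀ (pow_ne_zero 2 h0)
  linear_combination -e
end

noncomputable section
open Polynomial
section
variable {k F L : Type} [Field k] [IsAlgClosed k] [CharZero k] [Field F] [Algebra k[X] F]
  [IsFractionRing k[X] F] [Field L] [Algebra F L] [Algebra k L] [Algebra k F]
  [IsScalarTower k k[X] F] [IsScalarTower k F L] [FiniteDimensional F L]

variable (k F L) in
lemma exists_deriv : ∃ D : Derivation k L L, ∀ p : k[X],
    D (algebraMap F L (algebraMap k[X] F p)) = algebraMap F L (algebraMap k[X] F (derivative p)) := by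
  letI : Algebra k[X] L := ((algebraMap F L).comp (algebraMap k[X] F)).toAlgebra
  haveI : IsScalarTower k[X] F L := IsScalarTower.of_algebraMap_eq fun _ => rfl
  haveI : IsScalarTower k k[X] L := IsScalarTower.of_algebraMap_eq fun c => by
    rw [IsScalarTower.algebraMap_apply k F L, IsScalarTower.algebraMap_apply k k[X] F]; rfl
  haveI : CharZero F := charZero_of_injective_algebraMap (algebraMap k F).injective
  haveI h1 : Algebra.FormallyEtale k[X] F := Algebra.FormallyEtale.of_isLocalization (nonZeroDivisors k[X])
  haveI h2 : Algebra.FormallyEtale F L := Algebra.FormallyEtale.of_isSeparable F L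
  haveI h3 : Algebra.FormallyEtale k[X] L := Algebra.FormallyEtale.comp k[X] F L
  let D0 : Derivation k k[X] L := (Algebra.linearMap k[X] L).compDer derivative'
  let e := KaehlerDifferential.tensorKaehlerEquivOfFormallyEtale k k[X] L
  let l : TensorProduct k[X] L (Ω[k[X]⁄k]) →ₗ[L] L := D0.liftKaehlerDifferential.liftBaseChange L
  refine ⟨(l ∘ₗ e.symm.toLinearMap).compDer (KaehlerDifferential.D k L), fun p => ?_⟩
  have : e.symm (KaehlerDifferential.D k L (algebraMap k[X] L p)) = 1 ⊗ₜ (KaehlerDifferential.D k k[X] p) := by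
    exact KaehlerDifferential.tensorKaehlerEquivOfFormallyEtale_symm_D_algebraMap k k[X] L p
  change l (e.symm (KaehlerDifferential.D k L (algebraMap k[X] L p))) = _
  rw [this]
  simp [l, D0]
  rfl

variable (k F) in
lemma exists_derivF : ∃ D : Derivation k F F, ∀ p : k[X],
    D (algebraMap k[X] F p) = algebraMap k[X] F (derivative p) := by
  obtain ⟨D, h⟩ := exists_deriv k F F
  exact ⟨D, by simpa using h⟩

lemma DF_formula (DF : Derivation k F F)
    (hDF : ∀ p : k[X], DF (algebraMap k[X] F p) = algebraMap k[X] F (derivative p))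
    {c : F} {a b : k[X]} (h : c * algebraMap k[X] F b = algebraMap k[X] F a) :
    DF c * algebraMap k[X] F (b * b) = algebraMap k[X] F (derivative a * b - a * derivative b) := by
  have h1 := congrArg DF h
  rw [Derivation.leibniz, hDF, hDF, smul_eq_mul, smul_eq_mul] at h1
  simp only [map_sub, map_mul]
  linear_combination (algebraMap k[X] F b) * h1 - (algebraMap k[X] F (derivative b)) * h

lemma D_F (D : Derivation k L L) (hD : ∀ p : k[X],
      D (algebraMap F L (algebraMap k[X] F p)) = algebraMap F L (algebraMap k[X] F (derivative p)))
    (DF : Derivation k F F)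
    (hDF : ∀ p : k[X], DF (algebraMap k[X] F p) = algebraMap k[X] F (derivative p)) (c : F) :
    D (algebraMap F L c) = algebraMap F L (DF c) := by
  obtain ⟨a, b, hb, hab, e⟩ := frac_red (k := k) c
  have h1 := congrArg DF e
  have h2 := congrArg D (congrArg (algebraMap F L) e)
  rw [map_mul, Derivation.leibniz, hD, hD, smul_eq_mul, smul_eq_mul] at h2
  rw [Derivation.leibniz, hDF, hDF, smul_eq_mul, smul_eq_mul] at h1
  have h3 := congrArg (algebraMap F L) h1
  simp only [map_add, map_mul] at h3
  rw [← h3] at h2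
  have hb' : algebraMap F L (algebraMap k[X] F b) ≠ 0 := by
    rw [Ne, map_eq_zero]; exact iota_ne hb
  exact mul_left_cancel₀ hb' (add_left_cancel h2)

lemma DF_OZ (DF : Derivation k F F)
    (hDF : ∀ p : k[X], DF (algebraMap k[X] F p) = algebraMap k[X] F (derivative p))
    (z : k) {c : F} (h : c ∈ OZ F z) : DF c ∈ OZ F z := by
  obtain ⟨a, b, hb, e⟩ := h
  exact ⟨_, _, by simp [hb], DF_formula DF hDF e⟩

lemma DF_OI (DF : Derivation k F F)
    (hDF : ∀ p : k[X], DF (algebraMap k[X] F p) = algebraMap k[X] F (derivative p))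
    (s : k) {c : F} (h : c ∈ OI (k := k) F) :
    algebraMap k[X] F (X - C s) * DF c ∈ OI (k := k) F := by
  obtain ⟨a, b, hb, hd, e⟩ := h
  refine ⟨(X - C s) * (derivative a * b - a * derivative b), b * b, mul_ne_zero hb hb, ?_, ?_⟩
  · rw [natDegree_mul hb hb]
    by_cases h0 : b.natDegree = 0
    · have ha : a.natDegree = 0 := by omega
      rw [derivative_of_natDegree_zero h0, derivative_of_natDegree_zero ha]; simp
    refine natDegree_mul_le.trans ?_
    rw [natDegree_X_sub_C]
    have h1 : (derivative a * b - a * derivative b).natDegree ≤ b.natDegree + b.natDegree - 1 := by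
      refine (natDegree_sub_le _ _).trans (max_le ?_ ?_)
      · by_cases ha : a.natDegree = 0
        · rw [derivative_of_natDegree_zero ha]; simp
        · refine natDegree_mul_le.trans ?_
          have := natDegree_derivative_lt ha
          omega
      · refine natDegree_mul_le.trans ?_
        have := natDegree_derivative_lt h0
        omega
    omega
  · rw [map_mul _ (X - C s), ← DF_formula DF hDF e]; ring

lemma twisted_aeval {σ : L →+* L} (δ : L →+ L) (hδ : ∀ a b, δ (a * b) = σ a * δ b + σ b * δ a)
    (h0 : ∀ c : F, δ (algebraMap F L c) = 0) (u : L) (p : F[X]) :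
    δ (aeval u p) = σ (aeval u (derivative p)) * δ u := by
  induction p using Polynomial.induction_on' with
  | add p q hp hq => simp only [map_add, hp, hq]; ring
  | monomial n c =>
    have hpow : ∀ n : ℕ, δ (u ^ n) = n * σ u ^ (n - 1) * δ u := by
      intro n
      induction n with
      | zero => simpa using h0 1
      | succ n ih =>
        rw [pow_succ, hδ, ih]
        rcases n with _ | n
        · simp
        · simp only [Nat.add_sub_cancel, Nat.cast_add, Nat.cast_one, pow_succ, map_mul, map_pow]; ring
    rw [derivative_monomial]
    simp only [aeval_monomial, hδ, hpow, h0, map_mul, map_pow, map_natCast]; ring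

lemma twisted_zero [CharZero F] {σ : L →+* L} (δ : L →+ L) (hδ : ∀ a b, δ (a * b) = σ a * δ b + σ b * δ a)
    (h0 : ∀ c : F, δ (algebraMap F L c) = 0) (u : L) : δ u = 0 := by
  have h := twisted_aeval δ hδ h0 u (minpoly F u)
  rw [minpoly.aeval, map_zero] at h
  have hs : (minpoly F u).Separable := Algebra.IsSeparable.isSeparable F u
  have := hs.aeval_derivative_ne_zero (minpoly.aeval F u)
  rcases mul_eq_zero.mp h.symm with h | h
  · exact absurd ((map_eq_zero σ).mp h) this
  · exact h

lemma R1Data.D_sigma (d : R1Data k F L) (D : Derivation k L L) (hD : ∀ p : k[X],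
      D (algebraMap F L (algebraMap k[X] F p)) = algebraMap F L (algebraMap k[X] F (derivative p)))
    (h : L) : D (d.σ h) = algebraMap F L (algebraMap k[X] F (derivative d.g)) * d.σ (D h) := by
  obtain ⟨DF, hDF⟩ := exists_derivF k F
  let δ : L →+ L :=
    { toFun := fun h => D (d.σ h) - algebraMap F L (algebraMap k[X] F (derivative d.g)) * d.σ (D h)
      map_zero' := by simp
      map_add' := fun a b => by simp only [map_add]; ring }
  have hδ : ∀ a b, δ (a * b) = d.σ a * δ b + d.σ b * δ a := by
    intro a b
    simp only [δ, AddMonoidHom.coe_mk, ZeroHom.coe_mk, map_mul, Derivation.leibniz, smul_eq_mul, map_add]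
    ring
  have hp : ∀ p : k[X], δ (algebraMap F L (algebraMap k[X] F p)) = 0 := by
    intro p
    simp only [δ, AddMonoidHom.coe_mk, ZeroHom.coe_mk]
    rw [d.hσ, d.hF, hD, hD, d.hσ, d.hF, derivative_comp]
    simp only [map_mul]; ring
  have h0 : ∀ c : F, δ (algebraMap F L c) = 0 := by
    intro c
    obtain ⟨a, b, hb, hab, e⟩ := frac_red (k := k) c
    have h2 := congrArg δ (congrArg (algebraMap F L) e)
    rw [map_mul, hδ, hp, hp, mul_zero, zero_add] at h2
    rcases mul_eq_zero.mp h2 with h | h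
    · rw [map_eq_zero, map_eq_zero] at h; exact absurd h (iota_ne hb)
    · exact h
  haveI : CharZero F := charZero_of_injective_algebraMap (algebraMap k F).injective
  exact sub_eq_zero.mp (twisted_zero δ hδ h0 h)
end

noncomputable section
open Polynomial

def NN1 {k : Type} [Field k] (g : k[X]) : Prop :=
  ∀ z, C (g.natDegree : k) * (g - C z) ≠ derivative g * (X - C z)
def NN2 {k : Type} [Field k] (g : k[X]) : Prop :=
  ∀ s1 s2, s1 ≠ s2 → C (g.natDegree : k) ^ 2 * ((g - C s1) * (g - C s2)) ≠
      derivative g ^ 2 * ((X - C s1) * (X - C s2))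

section
variable {k F L : Type} [Field k] [IsAlgClosed k] [CharZero k] [Field F] [Algebra k[X] F]
  [IsFractionRing k[X] F] [Field L] [Algebra F L] [Algebra k L] [Algebra k F]
  [IsScalarTower k k[X] F] [IsScalarTower k F L] [FiniteDimensional F L]

lemma finite_not_int (u : L) : {z : k | ¬ IsIntegral (OZ F z) u}.Finite := by
  have : {z : k | ¬ IsIntegral (OZ F z) u} ⊆
      ⋃ i ∈ Finset.range ((minpoly F u).natDegree + 1), {z : k | (minpoly F u).coeff i ∉ OZ F z} := by
    intro z hz
    simp only [Set.mem_setOf_eq, int_iff, not_forall] at hz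
    obtain ⟨i, hi⟩ := hz
    simp only [Set.mem_iUnion, Set.mem_setOf_eq]
    refine ⟨i, ?_, hi⟩
    rw [Finset.mem_range]
    by_contra hlt
    apply hi
    rw [coeff_eq_zero_of_natDegree_lt (by omega)]
    exact zero_mem _
  refine Set.Finite.subset ?_ this
  exact Set.Finite.biUnion (Finset.finite_toSet _) (fun i _ => finite_not_mem_OZ _)

lemma R1Data.y_int (d : R1Data k F L) (h1 : NN1 d.g) (z : k) : IsIntegral (OZ F z) d.y := by
  classical
  have hfin := finite_not_int (k := k) (F := F) d.y
  by_contra hz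
  rcases count1 d.g d.hg hfin.toFinset (by
    intro x hx
    simp only [Set.Finite.mem_toFinset, Set.mem_setOf_eq] at hx ⊢
    intro hx'
    apply hx
    rw [← d.int_OZ, d.hσy]
    exact int_aeval x _ hx' _) with h | ⟨w, h⟩
  · have : z ∈ hfin.toFinset := by simpa using hz
    rw [h] at this; simp at this
  · exact h1 w h

lemma deriv_int_of_adjoin (O : ValuationSubring F) (T : L → L) (hT0 : T 0 = 0) (hadd : ∀ a b, T (a + b) = T a + T b)
    (B : L) (hmul : ∀ a b, IsIntegral O a → IsIntegral O b → IsIntegral O (B * T a) → IsIntegral O (B * T b) →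
      IsIntegral O (B * T (a * b)))
    (hF : ∀ c : F, c ∈ O → IsIntegral O (B * T (algebraMap F L c)))
    (y : L) (hy : IsIntegral O y) (hTy : IsIntegral O (B * T y)) (h : L) (hh : h ∈ Algebra.adjoin O {y}) :
    IsIntegral O h ∧ IsIntegral O (B * T h) := by
  induction hh using Algebra.adjoin_induction with
  | mem x hx => rw [Set.mem_singleton_iff.mp hx]; exact ⟨hy, hTy⟩
  | algebraMap r => exact ⟨int_of_mem O r.2, hF _ r.2⟩
  | add a b _ _ ha hb => exact ⟨ha.1.add hb.1, by rw [hadd, mul_add]; exact ha.2.add hb.2⟩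
  | mul a b _ _ ha hb => exact ⟨ha.1.mul hb.1, hmul a b ha.1 hb.1 ha.2 hb.2⟩

lemma R1Data.step2 (d : R1Data k F L) (h1 : NN1 d.g) (h2 : NN2 d.g) (D : Derivation k L L) (hD : ∀ p : k[X],
      D (algebraMap F L (algebraMap k[X] F p)) = algebraMap F L (algebraMap k[X] F (derivative p))) :
    ∃ s : k, ∀ z, z ≠ s → ∀ h : L, IsIntegral (OZ F z) h → IsIntegral (OZ F z) (D h) := by
  classical
  haveI : CharZero F := charZero_of_injective_algebraMap (algebraMap k F).injective
  obtain ⟨DF, hDF⟩ := exists_derivF k F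
  have hDD := D_F D hD DF hDF
  obtain ⟨pb, hgen⟩ := exists_powerBasis_gen d.y d.gen
  set δ := Algebra.discr F pb.basis with hδ
  have hδ0 : δ ≠ 0 := Algebra.discr_not_zero_of_basis F pb.basis
  let S : Set k := {z | ∃ h : L, IsIntegral (OZ F z) h ∧ ¬ IsIntegral (OZ F z) (D h)}
  have hS : S.Finite := by
    refine ((finite_not_mem_OZ (k := k) (δ⁻¹)).union (finite_not_int (k := k) (F := F) (D d.y))).subset ?_
    rintro z ⟨h, hi, hn⟩
    by_contra hc
    simp only [Set.mem_union, Set.mem_setOf_eq, not_or, not_not] at hc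
    apply hn
    have hmem := Algebra.discr_mul_isIntegral_mem_adjoin (R := OZ F z) F (B := pb)
      (by rw [hgen]; exact d.y_int h1 z) hi
    rw [hgen] at hmem
    have hmem2 : h ∈ Algebra.adjoin (OZ F z) {d.y} := by
      have := Subalgebra.smul_mem _ hmem (⟨δ⁻¹, hc.1⟩ : OZ F z)
      convert this using 1
      change h = δ⁻¹ • (δ • h)
      rw [smul_smul, inv_mul_cancel₀ hδ0, one_smul]
    have := deriv_int_of_adjoin (OZ F z) (fun h => D h) (by simp) (by simp) 1 (by
        intro a b ha hb ha' hb'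
        rw [one_mul] at ha' hb' ⊢
        rw [Derivation.leibniz, smul_eq_mul, smul_eq_mul]
        exact (ha.mul hb').add (hb.mul ha')) (by
        intro c hc'
        rw [one_mul, hDD]
        exact int_of_mem _ (DF_OZ DF hDF z hc')) d.y (d.y_int h1 z) (by rw [one_mul]; exact hc.2) h hmem2
    simpa using this.2
  rcases count2 d.g d.hg hS.toFinset (by
    intro x hx
    simp only [Set.Finite.mem_toFinset] at hx ⊢
    by_contra hcon
    push Not at hcon
    obtain ⟨hxS, hx0⟩ := hcon
    obtain ⟨h, hi, hn⟩ := hx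
    apply hn
    rw [← d.int_OZ]
    have e := d.D_sigma D hD h
    have h3 : IsIntegral (OZ F x) (D (d.σ h)) := by
      by_contra h4
      exact hxS ⟨d.σ h, (d.int_OZ x h).mpr hi, h4⟩
    have e2 : d.σ (D h) = algebraMap F L ((algebraMap k[X] F (derivative d.g))⁻¹) * D (d.σ h) := by
      rw [e, ← mul_assoc, ← map_mul, inv_mul_cancel₀ (iota_ne (deriv_ne _ d.hg)), map_one, one_mul]
    rw [e2]
    exact (int_of_mem _ (inv_iota_mem_OZ _ _ hx0)).mul h3) with h | ⟨s1, s2, hne, h⟩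
  · have : ∃ s, ∀ z ∈ S, z = s := by
      rw [Finset.card_le_one] at h
      by_cases hne : S.Nonempty
      · obtain ⟨s, hs⟩ := hne
        exact ⟨s, fun z hz => h z (by simpa using hz) s (by simpa using hs)⟩
      · exact ⟨0, fun z hz => absurd ⟨z, hz⟩ hne⟩
    obtain ⟨s, hs⟩ := this
    refine ⟨s, fun z hz h hi => ?_⟩
    by_contra hn
    exact hz (hs z ⟨h, hi, hn⟩)
  · exact absurd h (h2 s1 s2 hne)

lemma R1Data.step3 (d : R1Data k F L) (h1 : NN1 d.g) (D : Derivation k L L) (hD : ∀ p : k[X],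
      D (algebraMap F L (algebraMap k[X] F p)) = algebraMap F L (algebraMap k[X] F (derivative p)))
    (s : k) (hs : ∀ z, z ≠ s → ∀ h : L, IsIntegral (OZ F z) h → IsIntegral (OZ F z) (D h))
    (z : k) (h : L) (hh : IsIntegral (OZ F z) h) :
    IsIntegral (OZ F z) (algebraMap F L (algebraMap k[X] F (X - C s)) * D h) := by
  classical
  by_cases hz : z = s
  swap
  · exact (int_of_mem _ (iota_mem_OZ _ _)).mul (hs z hz h hh)
  subst hz
  obtain ⟨x0, hx0, hne⟩ : ∃ x0, d.g.eval x0 = z ∧ x0 ≠ z := by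
    by_contra hcon
    push Not at hcon
    rcases count1 d.g d.hg {z} (by simpa using hcon) with h | ⟨w, h⟩
    · simp at h
    · exact h1 w h
  have hgz := sub_const_ne d.g z d.hg
  obtain ⟨u, hu, hu0⟩ := exists_eq_pow_rootMultiplicity_mul_and_not_dvd _ hgz x0
  rw [dvd_iff_isRoot, IsRoot.def] at hu0
  have he : 0 < (d.g - C z).rootMultiplicity x0 := by
    rw [rootMultiplicity_pos hgz]; simp [hx0]
  obtain ⟨e, he'⟩ : ∃ e, (d.g - C z).rootMultiplicity x0 = e + 1 := ⟨_, (Nat.succ_pred_eq_of_pos he).symm⟩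
  rw [he'] at hu
  set u1 : k[X] := (e + 1 : k[X]) * u + (X - C x0) * derivative u with hu1
  have hu1z : u1.eval x0 ≠ 0 := by
    simp only [hu1, eval_add, eval_mul, eval_sub, eval_X, eval_C, sub_self, zero_mul, add_zero,
      eval_natCast, eval_one]
    exact mul_ne_zero (by exact_mod_cast Nat.succ_ne_zero e) hu0
  have hg' : derivative d.g = (X - C x0) ^ e * u1 := by
    have := congrArg derivative hu
    rw [derivative_sub, derivative_C, sub_zero, derivative_mul, derivative_pow_succ, derivative_sub,
      derivative_X, derivative_C, sub_zero, mul_one] at this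
    rw [this, hu1]
    simp only [map_add, map_natCast, map_one]
    ring
  have hu1' : u1 ≠ 0 := by rintro h; rw [h] at hu1z; simp at hu1z
  subst hx0
  rw [← d.int_OZ]
  have e2 : d.σ (algebraMap F L (algebraMap k[X] F (X - C (d.g.eval x0))) * D h) =
      algebraMap F L (algebraMap k[X] F ((X - C x0) * u) * (algebraMap k[X] F u1)⁻¹) * D (d.σ h) := by
    rw [d.D_sigma D hD, map_mul, d.hσ, d.hF, hg']
    rw [sub_comp, X_comp, C_comp, hu, ← mul_assoc, ← map_mul]
    congr 2
    have := iota_ne (F := F) hu1'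
    simp only [map_mul, map_pow]
    field_simp
    ring
  rw [e2]
  refine (int_of_mem _ (mul_mem (iota_mem_OZ _ _) (inv_iota_mem_OZ _ _ hu1z))).mul ?_
  exact hs x0 hne _ ((d.int_OZ x0 h).mpr hh)
end

noncomputable section
open Polynomial

section
variable {k F L : Type} [Field k] [IsAlgClosed k] [CharZero k] [Field F] [Algebra k[X] F]
  [IsFractionRing k[X] F] [Field L] [Algebra F L] [Algebra k L] [Algebra k F]
  [IsScalarTower k k[X] F] [IsScalarTower k F L] [FiniteDimensional F L]

lemma frac_mem_OI {a b : k[X]} (hb : b ≠ 0) (h : a.natDegree ≤ b.natDegree) :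
    algebraMap k[X] F a * (algebraMap k[X] F b)⁻¹ ∈ OI (k := k) F :=
  ⟨a, b, hb, h, by rw [mul_assoc, inv_mul_cancel₀ (iota_ne hb), mul_one]⟩

lemma natDegree_le_of_mem_OI {a b : k[X]} (hb : b ≠ 0)
    (h : algebraMap k[X] F a * (algebraMap k[X] F b)⁻¹ ∈ OI (k := k) F) : a.natDegree ≤ b.natDegree := by
  obtain ⟨p, q, hq, hd, e⟩ := h
  by_cases ha : a = 0
  · simp [ha]
  have hb' := iota_ne (F := F) hb
  have : a * q = p * b := by
    rw [← iota_inj (F := F), map_mul, map_mul, ← e]; field_simp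
  have h2 := congrArg natDegree this
  rw [natDegree_mul ha hq] at h2
  have h3 : (p * b).natDegree ≤ _ := natDegree_mul_le
  omega

variable (k F) in
def xi : F := (algebraMap k[X] F X)⁻¹

lemma xi_pow_mem (n : ℕ) : xi k F ^ n ∈ OI (k := k) F := by
  apply pow_mem
  have := frac_mem_OI (F := F) (a := (1 : k[X])) (b := X) X_ne_zero (by simp)
  simpa [xi] using this

lemma xi_ne : xi k F ≠ 0 := inv_ne_zero (iota_ne X_ne_zero)

lemma exists_pow_mem_OI (c : F) : ∃ N, xi k F ^ N * c ∈ OI (k := k) F := by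
  obtain ⟨a, b, hb, hab, e⟩ := frac_red (k := k) c
  refine ⟨a.natDegree, a, X ^ a.natDegree * b, mul_ne_zero (pow_ne_zero _ X_ne_zero) hb, ?_, ?_⟩
  · rw [natDegree_mul (pow_ne_zero _ X_ne_zero) hb]; simp
  · have := iota_ne (F := F) (k := k) X_ne_zero
    rw [map_mul, map_pow, ← e, xi, inv_pow]
    field_simp

lemma exists_pow_int (u : L) : ∃ N, IsIntegral (OI (k := k) F) (algebraMap F L (xi k F ^ N) * u) := by
  have halg : IsAlgebraic (OI (k := k) F) u := by
    have : IsAlgebraic F u := (IsIntegral.of_finite F u).isAlgebraic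
    exact (IsFractionRing.isAlgebraic_iff (OI (k := k) F) F L).mpr this
  obtain ⟨y, hy, h⟩ := halg.exists_integral_multiple
  obtain ⟨N, hN⟩ := exists_pow_mem_OI (k := k) ((y : F)⁻¹)
  refine ⟨N, ?_⟩
  have hy' : (y : F) ≠ 0 := by simpa using hy
  have : algebraMap F L (xi k F ^ N) * u = algebraMap F L (xi k F ^ N * (y : F)⁻¹) * (y • u) := by
    change _ = _ * ((y : F) • u)
    rw [Algebra.smul_def, ← mul_assoc, ← map_mul, mul_assoc, inv_mul_cancel₀ hy', mul_one]
  rw [this]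
  exact (int_of_mem _ hN).mul h

lemma step4a (y : L) (gen : IntermediateField.adjoin F {y} = ⊤) (θ : Derivation k L L) (θF : F → F)
    (hθ : ∀ c, θ (algebraMap F L c) = algebraMap F L (θF c))
    (hOI : ∀ c, c ∈ OI (k := k) F → θF c ∈ OI (k := k) F) :
    ∃ N, ∀ h, IsIntegral (OI (k := k) F) h → IsIntegral (OI (k := k) F) (algebraMap F L (xi k F ^ N) * θ h) := by
  haveI : CharZero F := charZero_of_injective_algebraMap (algebraMap k F).injective
  obtain ⟨a, ha⟩ := exists_pow_int (k := k) (F := F) y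
  set u0 := algebraMap F L (xi k F ^ a) * y with hu0
  have hgen0 : IntermediateField.adjoin F {u0} = ⊤ := by
    rw [eq_top_iff, ← gen, IntermediateField.adjoin_le_iff, Set.singleton_subset_iff]
    have hx : algebraMap F L (xi k F ^ a) ≠ 0 := by
      rw [Ne, map_eq_zero]; exact pow_ne_zero _ xi_ne
    have : y = (algebraMap F L (xi k F ^ a))⁻¹ * u0 := by rw [hu0]; field_simp
    rw [SetLike.mem_coe, this]
    exact mul_mem (inv_mem (IntermediateField.algebraMap_mem _ _)) (IntermediateField.mem_adjoin_simple_self F u0)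
  obtain ⟨pb, hgen⟩ := exists_powerBasis_gen u0 hgen0
  set δ := Algebra.discr F pb.basis with hδ
  have hδ0 : δ ≠ 0 := Algebra.discr_not_zero_of_basis F pb.basis
  obtain ⟨N1, hN1⟩ := exists_pow_int (k := k) (F := F) (θ u0)
  obtain ⟨N2, hN2⟩ := exists_pow_mem_OI (k := k) (δ⁻¹)
  obtain ⟨N3, hN3⟩ := exists_pow_mem_OI (k := k) (θF δ * δ⁻¹)
  refine ⟨N1 + N2 + N3, fun h hi => ?_⟩
  have hmem := Algebra.discr_mul_isIntegral_mem_adjoin (R := OI (k := k) F) F (B := pb)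
      (by rw [hgen]; exact ha) hi
  rw [hgen] at hmem
  have := deriv_int_of_adjoin (OI (k := k) F) (fun h => θ h) (by simp) (by simp) (algebraMap F L (xi k F ^ N1)) (by
        intro a b ha hb ha' hb'
        rw [Derivation.leibniz, smul_eq_mul, smul_eq_mul]
        have e1 := (ha.mul hb').add (hb.mul ha')
        have e2 : algebraMap F L (xi k F ^ N1) * (a * θ b + b * θ a) = a * (algebraMap F L (xi k F ^ N1) * θ b) +
          b * (algebraMap F L (xi k F ^ N1) * θ a) := by ring
        rw [e2]; exact e1) (by
        intro c hc'
        rw [hθ, ← map_mul]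
        exact int_of_mem _ (mul_mem (xi_pow_mem _) (hOI c hc'))) u0 ha hN1 _ hmem
  have h2 := this.2
  have e : θ (δ • h) = algebraMap F L δ * θ h + algebraMap F L (θF δ) * h := by
    rw [Algebra.smul_def, Derivation.leibniz, hθ, smul_eq_mul, smul_eq_mul]; ring
  have e2 : algebraMap F L (xi k F ^ (N1 + N2 + N3)) * θ h =
      algebraMap F L (xi k F ^ N3) * (algebraMap F L (xi k F ^ N2 * δ⁻¹) *
        (algebraMap F L (xi k F ^ N1) * θ (δ • h))) -
      algebraMap F L (xi k F ^ (N1 + N2)) * (algebraMap F L (xi k F ^ N3 * (θF δ * δ⁻¹)) * h) := by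
    rw [e]
    have hδ1 : algebraMap F L δ ≠ 0 := by rw [Ne, map_eq_zero]; exact hδ0
    simp only [map_mul, map_pow, map_inv₀, pow_add]
    field_simp
    ring
  rw [e2]
  exact ((int_of_mem _ (xi_pow_mem _)).mul ((int_of_mem _ hN2).mul h2)).sub
    ((int_of_mem _ (xi_pow_mem _)).mul ((int_of_mem _ hN3).mul hi))

lemma R1Data.step4b (d : R1Data k F L) (N : ℕ) (w : L)
    (hw : ∀ j, IsIntegral (OI (k := k) F) (algebraMap F L (xi k F ^ N) * d.σ^[j] w)) :
    IsIntegral (OI (k := k) F) w := by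
  have hmp : ∀ j, minpoly F (d.σ^[j] w) = (minpoly F w).map (d.σF ^ j) := by
    intro j
    induction j with
    | zero => simp only [Function.iterate_zero, id_eq, pow_zero]; exact (Polynomial.map_id).symm
    | succ j ih =>
      rw [Function.iterate_succ_apply', d.minpoly_sigma, ih, Polynomial.map_map, pow_succ']
      rfl
  have hit : ∀ j (a : k[X]), (d.σF ^ j) (algebraMap k[X] F a) = algebraMap k[X] F (a.comp (d.g.comp^[j] X)) := by
    intro j
    induction j with
    | zero => intro a; simp
    | succ j ih =>
      intro a
      rw [pow_succ', RingHom.mul_def, RingHom.comp_apply, ih, d.hF, Function.iterate_succ_apply', comp_assoc]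
      congr 2
      clear ih
      induction j with
      | zero => simp
      | succ j ih => rw [Function.iterate_succ_apply', comp_assoc, ih]
  have hdeg : ∀ j, (d.g.comp^[j] X).natDegree = d.g.natDegree ^ j := by
    intro j; rw [natDegree_iterate_comp]; simp
  rw [int_iff]
  intro i
  obtain ⟨a, b, hb, hab, e⟩ := frac_red (k := k) ((minpoly F w).coeff i)
  have hbF := iota_ne (F := F) hb
  refine ⟨a, b, hb, ?_, e⟩
  by_contra hlt
  push Not at hlt
  have key : ∀ j, d.g.natDegree ^ j * a.natDegree ≤ d.g.natDegree ^ j * b.natDegree +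
      N * ((minpoly F w).natDegree - i) := by
    intro j
    have h1 := (int_iff _ _).mp (hw j) i
    rw [← Algebra.smul_def, IsIntegrallyClosed.minpoly_smul (pow_ne_zero _ xi_ne) (IsIntegral.of_finite F _), coeff_scaleRoots, hmp, coeff_map,
      natDegree_map, ← pow_mul] at h1
    set m := N * ((minpoly F w).natDegree - i)
    set gj := d.g.comp^[j] X with hgj
    have hgj0 : gj ≠ C (gj.coeff 0) := by
      intro h
      have h2 := hdeg j
      rw [← hgj, h, natDegree_C] at h2
      have := d.hg
      have : 0 < d.g.natDegree ^ j := by positivity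
      omega
    have hbg : b.comp gj ≠ 0 := by
      intro h0
      rw [comp_eq_zero_iff] at h0
      rcases h0 with h0 | ⟨_, h0⟩
      · exact hb h0
      · exact hgj0 h0
    have e3 : (minpoly F w).coeff i = algebraMap k[X] F a * (algebraMap k[X] F b)⁻¹ := by
      rw [← e]; field_simp
    rw [e3, map_mul, map_inv₀, hit, hit, ← hgj] at h1
    have h4 := natDegree_le_of_mem_OI (F := F) (a := a.comp gj) (b := b.comp gj * X ^ m)
      (mul_ne_zero hbg (pow_ne_zero _ X_ne_zero)) (by
        convert h1 using 1
        rw [map_mul, map_pow, mul_inv, xi, inv_pow]; ring)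
    rw [natDegree_mul hbg (pow_ne_zero _ X_ne_zero), natDegree_comp, natDegree_comp, hgj, hdeg, natDegree_X_pow] at h4
    linarith [mul_comm (d.g.natDegree ^ j) a.natDegree, mul_comm (d.g.natDegree ^ j) b.natDegree]
  set m := N * ((minpoly F w).natDegree - i)
  have h1 := key m
  have h2 : m < d.g.natDegree ^ m := Nat.lt_pow_self (by have := d.hg; omega)
  nlinarith [Nat.mul_le_mul_left (d.g.natDegree ^ m) hlt]

lemma R1Data.step4 (d : R1Data k F L) (D : Derivation k L L) (hD : ∀ p : k[X],
      D (algebraMap F L (algebraMap k[X] F p)) = algebraMap F L (algebraMap k[X] F (derivative p)))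
    (s : k) (h : L) (hh : IsIntegral (OI (k := k) F) h) :
    IsIntegral (OI (k := k) F) (algebraMap F L (algebraMap k[X] F (X - C s)) * D h) := by
  obtain ⟨DF, hDF⟩ := exists_derivF k F
  have hDD := D_F D hD DF hDF
  obtain ⟨N, hN⟩ := step4a d.y d.gen ((algebraMap F L (algebraMap k[X] F (X - C s))) • D)
    (fun c => algebraMap k[X] F (X - C s) * DF c) (by intro c; simp [hDD]) (fun c hc => DF_OI DF hDF s hc)
  set gs : k[X] := d.g - C s with hgs
  have hgs0 : gs ≠ 0 := sub_const_ne _ _ d.hg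
  have hg0 : (X - C s) * derivative d.g ≠ 0 := mul_ne_zero (X_sub_C_ne_zero s) (deriv_ne _ d.hg)
  set ρ : F := algebraMap k[X] F gs * (algebraMap k[X] F ((X - C s) * derivative d.g))⁻¹ with hρ
  have hρm : ρ ∈ OI (k := k) F := by
    apply frac_mem_OI hg0
    rw [natDegree_mul (X_sub_C_ne_zero s) (deriv_ne _ d.hg), natDegree_X_sub_C, natDegree_deriv _ d.hg,
      natDegree_sub_const _ _ d.hg]; omega
  have hσθ : ∀ h, d.σ (algebraMap F L (algebraMap k[X] F (X - C s)) * D h) =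
      algebraMap F L ρ * (algebraMap F L (algebraMap k[X] F (X - C s)) * D (d.σ h)) := by
    intro h
    rw [d.D_sigma D hD, map_mul, d.hσ, d.hF, sub_comp, X_comp, C_comp, ← mul_assoc, ← mul_assoc,
      ← map_mul, ← map_mul]
    congr 2
    rw [hρ, ← hgs, mul_assoc, mul_assoc, ← map_mul, inv_mul_cancel₀ (iota_ne hg0), mul_one]
  have P : ∀ j h, IsIntegral (OI (k := k) F) h → IsIntegral (OI (k := k) F)
      (algebraMap F L (xi k F ^ N) * d.σ^[j] (algebraMap F L (algebraMap k[X] F (X - C s)) * D h)) := by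
    intro j
    induction j with
    | zero => intro h hh; exact hN h hh
    | succ j ih =>
      intro h hh
      rw [Function.iterate_succ_apply, hσθ]
      have h1 : ∀ (c : F) (hc : c ∈ OI (k := k) F) (u : L), ∃ c' ∈ OI (k := k) F,
          d.σ^[j] (algebraMap F L c * u) = algebraMap F L c' * d.σ^[j] u := by
        clear ih
        intro c hc u
        induction j with
        | zero => exact ⟨c, hc, rfl⟩
        | succ j ih =>
          obtain ⟨c', hc', e⟩ := ih
          refine ⟨d.σF c', (d.sigmaF_OI c').mpr hc', ?_⟩
          rw [Function.iterate_succ_apply', e, map_mul, d.hσ, Function.iterate_succ_apply']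
      obtain ⟨c', hc', e⟩ := h1 ρ hρm (algebraMap F L (algebraMap k[X] F (X - C s)) * D (d.σ h))
      rw [e]
      have := (int_of_mem (L := L) _ hc').mul (ih (d.σ h) ((d.int_OI h).mpr hh))
      rw [mul_left_comm] at this
      exact this
  exact d.step4b N _ (fun j => P j h hh)
end

noncomputable section
open Polynomial

section
variable {k F L : Type} [Field k] [IsAlgClosed k] [CharZero k] [Field F] [Algebra k[X] F]
  [IsFractionRing k[X] F] [Field L] [Algebra F L] [Algebra k L] [Algebra k F]
  [IsScalarTower k k[X] F] [IsScalarTower k F L] [FiniteDimensional F L]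

lemma const_OZ (s : k) {c : k} {ψ : F} (hψ : ψ ∈ OZ F s)
    (h : algebraMap k[X] F (X - C s) * ψ = algebraMap k F c) : c = 0 := by
  obtain ⟨a, b, hb, e⟩ := hψ
  rw [IsScalarTower.algebraMap_apply k k[X] F] at h
  have : (X - C s) * a = C c * b := by
    rw [← iota_inj (F := F), map_mul, map_mul, ← e, ← mul_assoc, h]; rfl
  have := congrArg (eval s) this
  simp only [eval_mul, eval_sub, eval_X, eval_C, sub_self, zero_mul] at this
  exact (mul_eq_zero.mp this.symm).resolve_right hb

lemma unit_fac (s : k) {c : F} (hc : c ≠ 0) : ∃ (e : ℤ) (ψ : F), ψ ≠ 0 ∧ ψ ∈ OZ F s ∧ ψ⁻¹ ∈ OZ F s ∧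
    c = algebraMap k[X] F (X - C s) ^ e * ψ := by
  obtain ⟨a, b, hb, hab, e⟩ := frac_red (k := k) c
  have hbF := iota_ne (F := F) hb
  have ha : a ≠ 0 := by
    rintro rfl
    rw [map_zero, mul_eq_zero] at e
    exact e.elim hc hbF
  obtain ⟨u, hu, hu0⟩ := exists_eq_pow_rootMultiplicity_mul_and_not_dvd _ ha s
  obtain ⟨v, hv, hv0⟩ := exists_eq_pow_rootMultiplicity_mul_and_not_dvd _ hb s
  rw [dvd_iff_isRoot, IsRoot.def] at hu0 hv0
  set m := a.rootMultiplicity s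
  set n := b.rootMultiplicity s
  have hu1 : u ≠ 0 := by rintro rfl; simp at hu0
  have hv1 : v ≠ 0 := by rintro rfl; simp at hv0
  have hX := iota_ne (F := F) (X_sub_C_ne_zero s)
  refine ⟨m - n, algebraMap k[X] F u * (algebraMap k[X] F v)⁻¹, mul_ne_zero (iota_ne hu1) (inv_ne_zero (iota_ne hv1)),
    mul_mem (iota_mem_OZ _ _) (inv_iota_mem_OZ _ _ hv0), ?_, ?_⟩
  · rw [mul_inv, inv_inv]
    exact mul_mem (inv_iota_mem_OZ _ _ hu0) (iota_mem_OZ _ _)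
  · have : c = algebraMap k[X] F a * (algebraMap k[X] F b)⁻¹ := by rw [← e]; field_simp
    rw [this, hu, hv, zpow_sub₀ hX, zpow_natCast, zpow_natCast]
    have := iota_ne (F := F) hv1
    simp only [map_mul, map_pow]
    field_simp

section
variable (DF : Derivation k F F)
    (hDF : ∀ p : k[X], DF (algebraMap k[X] F p) = algebraMap k[X] F (derivative p)) (s : k)

lemma theta_pow (hDF : ∀ p : k[X], DF (algebraMap k[X] F p) = algebraMap k[X] F (derivative p)) (e : ℤ) (ψ : F) :
   algebraMap k[X] F (X - C s) * DF (algebraMap k[X] F (X - C s) ^ e * ψ) =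
    algebraMap k[X] F (X - C s) ^ e * (algebraMap k F e * ψ + algebraMap k[X] F (X - C s) * DF ψ) := by
  have hX := iota_ne (F := F) (X_sub_C_ne_zero s)
  rw [Derivation.leibniz, Derivation.leibniz_zpow, hDF]
  simp only [smul_eq_mul, derivative_sub, derivative_X, derivative_C, sub_zero, map_one, map_intCast,
    zsmul_eq_mul, mul_one]
  rw [zpow_sub_one₀ hX]
  field_simp
  ring

lemma eig_int (hDF : ∀ p : k[X], DF (algebraMap k[X] F p) = algebraMap k[X] F (derivative p))
    {c : F} (hc : c ≠ 0) (μ : k) (h : algebraMap k[X] F (X - C s) * DF c = algebraMap k F μ * c) :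
    ∃ e : ℤ, μ = e := by
  obtain ⟨e, ψ, h0, hψ, hψ', rfl⟩ := unit_fac s hc
  refine ⟨e, ?_⟩
  rw [theta_pow DF s hDF] at h
  have hX := zpow_ne_zero e (iota_ne (F := F) (X_sub_C_ne_zero s))
  rw [mul_left_comm] at h
  have h2 := mul_left_cancel₀ hX h
  have := const_OZ (F := F) s (c := μ - e) (mul_mem (DF_OZ DF hDF s hψ) hψ') (by
    rw [map_sub (algebraMap k F), ← mul_assoc]
    field_simp
    linear_combination h2)
  exact sub_eq_zero.mp this

lemma no_log (hDF : ∀ p : k[X], DF (algebraMap k[X] F p) = algebraMap k[X] F (derivative p))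
    {c : F} (r : k) (h : algebraMap k[X] F (X - C s) * DF c = algebraMap k F r) : r = 0 := by
  by_cases hc : c = 0
  · rw [hc, map_zero, mul_zero] at h
    exact ((map_eq_zero _).mp h.symm)
  obtain ⟨e, ψ, h0, hψ, hψ', rfl⟩ := unit_fac s hc
  have hX := (iota_ne (F := F) (X_sub_C_ne_zero s))
  rcases le_or_gt 0 e with he | he
  · obtain ⟨n, rfl⟩ := Int.eq_ofNat_of_zero_le he
    refine const_OZ (F := F) s (DF_OZ DF hDF s ?_) h
    rw [zpow_natCast]
    exact mul_mem (pow_mem (iota_mem_OZ _ _) _) hψ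
  · obtain ⟨n, rfl⟩ : ∃ n : ℕ, e = -((n : ℤ) + 1) := ⟨(-e - 1).toNat, by omega⟩
    rw [theta_pow DF s hDF] at h
    have h1 : algebraMap k F ((-((n : ℤ) + 1) : ℤ) : k) * ψ + algebraMap k[X] F (X - C s) * DF ψ =
        algebraMap k[X] F (X - C s) * (algebraMap k[X] F (X - C s) ^ n * algebraMap k F r) := by
      rw [← h, zpow_neg]
      have : algebraMap k[X] F (X - C s) ^ ((n : ℤ) + 1) = algebraMap k[X] F (X - C s) ^ (n + 1) := by
        rw [← zpow_natCast]; push_cast; rfl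
      rw [this, pow_succ]
      field_simp
    have := const_OZ (F := F) s (c := ((-((n : ℤ) + 1) : ℤ) : k)) (ψ := (algebraMap k[X] F (X - C s) ^ n * algebraMap k F r - DF ψ) * ψ⁻¹)
      (mul_mem (sub_mem (mul_mem (pow_mem (iota_mem_OZ _ _) _) (by
        rw [IsScalarTower.algebraMap_apply k k[X] F]; exact iota_mem_OZ _ _)) (DF_OZ DF hDF s hψ)) hψ') (by
        rw [← mul_assoc]
        field_simp
        linear_combination -h1)
    have h3 : (-((n : ℤ) + 1) : ℤ) = 0 := by exact_mod_cast this
    omega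

lemma DF_zero (hDF : ∀ p : k[X], DF (algebraMap k[X] F p) = algebraMap k[X] F (derivative p))
    {c : F} (h : DF c = 0) : ∃ a : k, c = algebraMap k F a := by
  obtain ⟨a, b, hb, hab, e⟩ := frac_red (k := k) c
  have h1 := DF_formula DF hDF e
  rw [h, zero_mul, eq_comm, ← map_zero (algebraMap k[X] F), iota_inj, sub_eq_zero] at h1
  have hb' : derivative b = 0 := by
    by_contra hne
    have hd : b ∣ derivative b := hab.symm.dvd_of_dvd_mul_left (Dvd.intro_left _ h1)
    have := natDegree_le_of_dvd hd hne
    have h0 : b.natDegree ≠ 0 := by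
      intro h0; exact hne (derivative_of_natDegree_zero h0)
    have := natDegree_derivative_lt h0
    omega
  have ha' : derivative a = 0 := by
    rw [hb', mul_zero] at h1
    exact (mul_eq_zero.mp h1).resolve_right hb
  obtain ⟨a0, rfl⟩ := natDegree_eq_zero.mp (natDegree_eq_zero_of_derivative_eq_zero ha')
  obtain ⟨b0, rfl⟩ := natDegree_eq_zero.mp (natDegree_eq_zero_of_derivative_eq_zero hb')
  have hb0 : b0 ≠ 0 := by rintro rfl; simp at hb
  refine ⟨a0 / b0, ?_⟩
  have h1 : ∀ c : k, algebraMap k F c = algebraMap k[X] F (C c) := fun c => IsScalarTower.algebraMap_apply k k[X] F c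
  rw [← h1, ← h1] at e
  rw [map_div₀, ← e]
  have : algebraMap k F b0 ≠ 0 := by rwa [Ne, map_eq_zero]
  field_simp
end

lemma deriv_aeval (θ : Derivation k L L) (θF : Derivation k F F)
    (hθ : ∀ c, θ (algebraMap F L c) = algebraMap F L (θF c)) (u : L) (p : F[X]) :
    ∃ q : F[X], (∀ i, q.coeff i = θF (p.coeff i)) ∧ θ (aeval u p) = aeval u q + aeval u (derivative p) * θ u := by
  induction p using Polynomial.induction_on' with
  | add p p' hp hp' =>
    obtain ⟨q, h1, h2⟩ := hp
    obtain ⟨q', h1', h2'⟩ := hp'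
    refine ⟨q + q', fun i => by simp [h1, h1'], ?_⟩
    simp only [map_add, h2, h2']; ring
  | monomial n c =>
    refine ⟨monomial n (θF c), fun i => ?_, ?_⟩
    · rw [coeff_monomial, coeff_monomial]; split_ifs <;> simp
    · rw [aeval_monomial, Derivation.leibniz, Derivation.leibniz_pow, hθ, derivative_monomial, aeval_monomial,
        aeval_monomial]
      simp only [smul_eq_mul, nsmul_eq_mul, map_mul, map_natCast]; ring

lemma kill_eq (u : L) (Q : F[X]) (hQ : Q.natDegree ≤ (minpoly F u).natDegree) (h : aeval u Q = 0) :
    Q = C (Q.coeff (minpoly F u).natDegree) * minpoly F u := by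
  have hu : IsIntegral F u := IsIntegral.of_finite F _
  have hm := minpoly.monic hu
  rw [← sub_eq_zero]
  by_contra hne
  set R := Q - C (Q.coeff (minpoly F u).natDegree) * minpoly F u with hR
  have h1 : aeval u R = 0 := by simp [hR, h]
  have h2 := minpoly.degree_le_of_ne_zero F u hne h1
  have h3 := natDegree_le_natDegree h2
  have hle : R.natDegree ≤ (minpoly F u).natDegree := by
    refine (natDegree_sub_le _ _).trans (max_le hQ ?_)
    exact natDegree_C_mul_le _ _
  have heq : R.natDegree = (minpoly F u).natDegree := le_antisymm hle h3
  have : R.coeff R.natDegree = 0 := by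
    rw [heq, hR, coeff_sub, coeff_C_mul, hm.coeff_natDegree, mul_one, sub_self]
  exact hne (leadingCoeff_eq_zero.mp this)

section
variable (θ : Derivation k L L) (DF : Derivation k F F)
    (hDF : ∀ p : k[X], DF (algebraMap k[X] F p) = algebraMap k[X] F (derivative p)) (s : k)
    (hθ : ∀ c, θ (algebraMap F L c) = algebraMap F L (algebraMap k[X] F (X - C s) * DF c))

/-- general relation on minimal polynomial coefficients when `θ u = aeval u v` -/
lemma mp_rel (hθ : ∀ c, θ (algebraMap F L c) = algebraMap F L (algebraMap k[X] F (X - C s) * DF c))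
    (u : L) (v : F[X]) (hv : v.natDegree ≤ 1) (hu : θ u = aeval u v) :
    ∃ w : F, ∀ i, algebraMap k[X] F (X - C s) * DF ((minpoly F u).coeff i) +
      (derivative (minpoly F u) * v).coeff i = w * (minpoly F u).coeff i := by
  obtain ⟨q, h1, h2⟩ := deriv_aeval θ ((algebraMap k[X] F (X - C s)) • DF) (by simpa using hθ) u (minpoly F u)
  rw [minpoly.aeval, map_zero, hu, ← map_mul, ← map_add] at h2
  have hd : (q + derivative (minpoly F u) * v).natDegree ≤ (minpoly F u).natDegree := by
    refine (natDegree_add_le _ _).trans (max_le ?_ ?_)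
    · rw [natDegree_le_iff_coeff_eq_zero]
      intro N hN
      rw [h1, coeff_eq_zero_of_natDegree_lt hN, map_zero]
    · refine natDegree_mul_le.trans ?_
      have hpos : (minpoly F u).natDegree ≠ 0 := (minpoly.natDegree_pos (IsIntegral.of_finite F u)).ne'
      have := natDegree_derivative_lt hpos
      omega
  refine ⟨(q + derivative (minpoly F u) * v).coeff (minpoly F u).natDegree, fun i => ?_⟩
  have := congrArg (fun p => coeff p i) (kill_eq u _ hd h2.symm)
  rw [coeff_C_mul, coeff_add, h1] at this
  exact this

lemma eig_rat (hDF : ∀ p : k[X], DF (algebraMap k[X] F p) = algebraMap k[X] F (derivative p))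
    (hθ : ∀ c, θ (algebraMap F L c) = algebraMap F L (algebraMap k[X] F (X - C s) * DF c))
    (h : L) (h0 : h ≠ 0) (lam : k) (hl : θ h = algebraMap k L lam * h) :
    ∃ e : ℤ, (Module.finrank F L : k) * lam = e := by
  have hIntg : IsIntegral F h := IsIntegral.of_finite F h
  obtain ⟨w, hw⟩ := mp_rel θ DF s hθ h (C (algebraMap k F lam) * X) ((natDegree_C_mul_le _ _).trans (by simp)) (by
    rw [hl, map_mul, aeval_C, aeval_X, ← IsScalarTower.algebraMap_apply])
  set r := (minpoly F h).natDegree with hr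
  have hrpos : 0 < r := minpoly.natDegree_pos hIntg
  have hcr : (minpoly F h).coeff r = 1 := (minpoly.monic hIntg).coeff_natDegree
  have e1 := hw r
  obtain ⟨r', hr'⟩ : ∃ r', r = r' + 1 := ⟨r - 1, by omega⟩
  rw [hcr] at e1
  rw [mul_left_comm, coeff_C_mul, hr', coeff_mul_X, coeff_derivative, ← hr', hcr] at e1
  simp only [map_one_eq_zero, mul_zero, zero_add, mul_one, one_mul] at e1
  have e0 := hw 0
  rw [mul_left_comm, coeff_C_mul, coeff_mul_X_zero, mul_zero, add_zero, ← e1] at e0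
  have hc0 : (minpoly F h).coeff 0 ≠ 0 := by
    intro hc; exact h0 ((minpoly.coeff_zero_eq_zero hIntg).mp hc)
  obtain ⟨e, he⟩ := eig_int DF s hDF hc0 ((r : k) * lam) (by
    rw [e0, map_mul, map_natCast]
    have : (r : F) = r' + 1 := by rw [hr']; push_cast; rfl
    rw [this]
    have : DF 1 = 0 := by simp
    simp only [this]
    ring)
  obtain ⟨m, hm⟩ : r ∣ Module.finrank F L := minpoly.degree_dvd hIntg
  refine ⟨m * e, ?_⟩
  rw [hm]; push_cast
  rw [← he]; ring

lemma no_one (hDF : ∀ p : k[X], DF (algebraMap k[X] F p) = algebraMap k[X] F (derivative p))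
    (hθ : ∀ c, θ (algebraMap F L c) = algebraMap F L (algebraMap k[X] F (X - C s) * DF c))
    (u : L) : θ u ≠ 1 := by
  intro hu
  have hIntg : IsIntegral F u := IsIntegral.of_finite F u
  obtain ⟨w, hw⟩ := mp_rel θ DF s hθ u 1 (by simp) (by rw [hu, map_one])
  set r := (minpoly F u).natDegree with hr
  have hrpos : 0 < r := minpoly.natDegree_pos hIntg
  have hcr : (minpoly F u).coeff r = 1 := (minpoly.monic hIntg).coeff_natDegree
  have e1 := hw r
  rw [hcr, mul_one, coeff_derivative, coeff_eq_zero_of_natDegree_lt (by omega)] at e1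
  obtain ⟨r', hr'⟩ : ∃ r', r = r' + 1 := ⟨r - 1, by omega⟩
  have hw0 : w = 0 := by
    have : DF 1 = 0 := by simp
    rw [this] at e1
    simpa using e1.symm
  have e2 := hw r'
  rw [mul_one, coeff_derivative, ← hr', hcr, hw0] at e2
  have := no_log DF s hDF (c := (minpoly F u).coeff r') (-(r : k)) (by
    have e3 : (r : F) = r' + 1 := by rw [hr']; push_cast; rfl
    rw [map_neg, map_natCast, e3]
    linear_combination e2)
  rw [neg_eq_zero] at this
  have : r = 0 := by exact_mod_cast this
  omega

lemma ker_theta (hDF : ∀ p : k[X], DF (algebraMap k[X] F p) = algebraMap k[X] F (derivative p))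
    (hθ : ∀ c, θ (algebraMap F L c) = algebraMap F L (algebraMap k[X] F (X - C s) * DF c))
    (u : L) (hu : θ u = 0) : ∃ a : k, u = algebraMap k L a := by
  have hIntg : IsIntegral F u := IsIntegral.of_finite F u
  obtain ⟨w, hw⟩ := mp_rel θ DF s hθ u 0 (by simp) (by rw [hu, map_zero])
  set r := (minpoly F u).natDegree with hr
  have hcr : (minpoly F u).coeff r = 1 := (minpoly.monic hIntg).coeff_natDegree
  have e1 := hw r
  have hw0 : w = 0 := by
    have : DF 1 = 0 := by simp
    rw [hcr, this] at e1
    simpa using e1.symm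
  have hX := (iota_ne (F := F) (X_sub_C_ne_zero s))
  have hc : ∀ i, ∃ a : k, (minpoly F u).coeff i = algebraMap k F a := by
    intro i
    apply DF_zero DF hDF
    have := hw i
    rw [hw0, mul_zero, coeff_zero, add_zero, zero_mul] at this
    exact (mul_eq_zero.mp this).resolve_left hX
  have hlift : (minpoly F u) ∈ lifts (algebraMap k F) := by
    rw [lifts_iff_coeff_lifts]
    intro i
    obtain ⟨a, ha⟩ := hc i
    exact ⟨a, ha.symm⟩
  obtain ⟨q, hq, -, hm⟩ := lifts_and_natDegree_eq_and_monic hlift (minpoly.monic hIntg)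
  have hk : IsIntegral k u := by
    refine ⟨q, hm, ?_⟩
    have h1 := minpoly.aeval F u
    rw [← hq, aeval_map_algebraMap] at h1
    exact h1
  have := IsAlgClosed.degree_eq_one_of_irreducible k (minpoly.irreducible hk)
  obtain ⟨a, ha⟩ := minpoly.mem_range_of_degree_eq_one k u this
  exact ⟨a, ha.symm⟩
end
end

noncomputable section
open Polynomial

section
variable {k F L : Type} [Field k] [IsAlgClosed k] [CharZero k] [Field F] [Algebra k[X] F]
  [IsFractionRing k[X] F] [Field L] [Algebra F L] [Algebra k L] [Algebra k F]
  [IsScalarTower k k[X] F] [IsScalarTower k F L] [FiniteDimensional F L]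

lemma int_constI (c : k) : IsIntegral (OI (k := k) F) (algebraMap k L c) := by
  rw [IsScalarTower.algebraMap_apply k F L]
  apply int_of_mem
  rw [IsScalarTower.algebraMap_apply k k[X] F]
  exact ⟨C c, 1, one_ne_zero, by simp, by simp⟩

variable (k F L) in
def Mb (β : ℕ) : Submodule k L where
  carrier := {h | (∀ z : k, IsIntegral (OZ F z) h) ∧ IsIntegral (OI (k := k) F) (algebraMap F L (xi k F ^ β) * h)}
  add_mem' := by
    rintro a b ⟨ha, ha'⟩ ⟨hb, hb'⟩
    exact ⟨fun z => (ha z).add (hb z), by rw [mul_add]; exact ha'.add hb'⟩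
  zero_mem' := ⟨fun z => isIntegral_zero, by rw [mul_zero]; exact isIntegral_zero⟩
  smul_mem' := by
    rintro c a ⟨ha, ha'⟩
    refine ⟨fun z => ?_, ?_⟩
    · rw [Algebra.smul_def]; exact (int_const z c).mul (ha z)
    · rw [Algebra.smul_def, mul_left_comm]; exact (int_constI c).mul ha'

lemma mem_of_int (O : ValuationSubring F) {c : F} (h : IsIntegral O (algebraMap F L c)) : c ∈ O := by
  have h1 : IsIntegral O c := (isIntegral_algebraMap_iff (algebraMap F L).injective).mp h
  obtain ⟨y, hy⟩ := IsIntegrallyClosed.isIntegral_iff.mp h1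
  rw [← hy]; exact y.2

lemma trace_mem (O : ValuationSubring F) {u : L} (h : IsIntegral O u) : Algebra.trace F L u ∈ O := by
  have h1 : IsIntegral O (Algebra.trace F L u) := Algebra.isIntegral_trace h
  obtain ⟨y, hy⟩ := IsIntegrallyClosed.isIntegral_iff.mp h1
  rw [← hy]; exact y.2

lemma natDegree_le_of_xi {a : k[X]} {m : ℕ} (h : xi k F ^ m * algebraMap k[X] F a ∈ OI (k := k) F) :
    a.natDegree ≤ m := by
  have := natDegree_le_of_mem_OI (F := F) (a := a) (b := X ^ m) (pow_ne_zero _ X_ne_zero) (by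
    rw [map_pow, ← inv_pow, mul_comm]; exact h)
  simpa using this

lemma Mb_finite (y : L) (gen : IntermediateField.adjoin F {y} = ⊤) (hy : ∀ z : k, IsIntegral (OZ F z) y) (β : ℕ) :
    FiniteDimensional k (Mb k F L β) := by
  haveI : CharZero F := charZero_of_injective_algebraMap (algebraMap k F).injective
  obtain ⟨pb, hgen⟩ := exists_powerBasis_gen y gen
  obtain ⟨a, ha⟩ := exists_pow_int (k := k) (F := F) y
  let T : L →ₗ[k] (Fin pb.dim → F) :=
    { toFun := fun h j => Algebra.trace F L (h * y ^ (j : ℕ))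
      map_add' := fun u v => by ext j; simp [add_mul]
      map_smul' := fun c u => by
        ext j
        simp only [smul_mul_assoc, RingHom.id_apply, Pi.smul_apply]
        rw [← algebraMap_smul F c, map_smul, algebraMap_smul] }
  have hinj : Function.Injective T := by
    rw [injective_iff_map_eq_zero]
    intro h hh
    have hnd := traceForm_nondegenerate F L
    apply hnd.1
    intro v
    rw [← pb.basis.sum_repr v, map_sum]
    apply Finset.sum_eq_zero
    intro j _
    rw [map_smul]
    have := congrFun hh j
    have h2 : Algebra.trace F L (h * y ^ (j : ℕ)) = 0 := this
    rw [Algebra.traceForm_apply, pb.coe_basis, hgen]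
    simp [h2]
  let ιl : k[X] →ₗ[k] F := (IsScalarTower.toAlgHom k k[X] F).toLinearMap
  let P : Submodule k F := (degreeLT k (β + a * pb.dim + 1)).map ιl
  haveI : Module.Finite k (degreeLT k (β + a * pb.dim + 1)) :=
    Module.Finite.equiv (degreeLTEquiv k _).symm
  haveI : FiniteDimensional k P := inferInstance
  have hmem : ∀ h ∈ Mb k F L β, ∀ j, T h j ∈ P := by
    rintro h ⟨h1, h2⟩ j
    have h3 : ∀ z : k, T h j ∈ OZ F z := fun z => trace_mem _ ((h1 z).mul ((hy z).pow _))
    obtain ⟨p, hp⟩ := mem_all_OZ h3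
    have h4 : xi k F ^ (β + a * j) * T h j ∈ OI (k := k) F := by
      have : xi k F ^ (β + a * j) * T h j =
          Algebra.trace F L ((algebraMap F L (xi k F ^ β) * h) * (algebraMap F L (xi k F ^ a) * y) ^ (j : ℕ)) := by
        change _ * Algebra.trace F L (h * y ^ (j : ℕ)) = _
        rw [← smul_eq_mul, ← map_smul]
        congr 1
        rw [Algebra.smul_def, mul_pow]
        simp only [map_pow, pow_add, pow_mul, map_mul]; ring
      rw [this]
      exact trace_mem _ (h2.mul (ha.pow _))
    rw [hp] at h4
    have h5 := natDegree_le_of_xi h4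
    refine ⟨p, ?_, ?_⟩
    · rw [SetLike.mem_coe, mem_degreeLT]
      refine lt_of_le_of_lt degree_le_natDegree ?_
      have : a * (j : ℕ) ≤ a * pb.dim := Nat.mul_le_mul_left _ j.2.le
      exact_mod_cast (by omega : p.natDegree < β + a * pb.dim + 1)
    · exact hp.symm
  let T' : Mb k F L β →ₗ[k] (Fin pb.dim → P) :=
    { toFun := fun h j => ⟨T h j, hmem h h.2 j⟩
      map_add' := fun u v => by ext j; simp
      map_smul' := fun c u => by ext j; simp }
  apply FiniteDimensional.of_injective T'
  intro u v huv
  apply Subtype.ext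
  apply hinj
  ext j
  exact congrArg Subtype.val (congrFun huv j)

section
variable (θ : Derivation k L L) (DF : Derivation k F F) (s : k)

lemma exists_tau (hDF : ∀ p : k[X], DF (algebraMap k[X] F p) = algebraMap k[X] F (derivative p))
    (hθ : ∀ c, θ (algebraMap F L c) = algebraMap F L (algebraMap k[X] F (X - C s) * DF c)) :
    ∃ (n : ℕ) (τ : L), 1 ≤ n ∧ τ ^ n = algebraMap F L (algebraMap k[X] F (X - C s)) ∧
      ∀ (h : L) (lam : k), θ h = algebraMap k L lam * h → ∃ (c : k) (j : ℤ), h = algebraMap k L c * τ ^ j := by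
  set N := Module.finrank F L with hN
  have hNpos : 0 < N := Module.finrank_pos
  have hNk : (N : k) ≠ 0 := by exact_mod_cast hNpos.ne'
  set x : L := algebraMap F L (algebraMap k[X] F (X - C s)) with hx
  have hX := (iota_ne (F := F) (X_sub_C_ne_zero s))
  have hx0 : x ≠ 0 := by rw [hx, Ne, map_eq_zero]; exact hX
  have hθx : θ x = x := by rw [hx, hθ, hDF]; simp
  let G : AddSubgroup ℤ :=
    { carrier := {e | ∃ h : L, h ≠ 0 ∧ (N : L) * θ h = e * h}
      zero_mem' := ⟨1, one_ne_zero, by simp⟩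
      add_mem' := by
        rintro a b ⟨h, h0, e⟩ ⟨h', h0', e'⟩
        refine ⟨h * h', mul_ne_zero h0 h0', ?_⟩
        rw [Derivation.leibniz, smul_eq_mul, smul_eq_mul]; push_cast
        linear_combination h * e' + h' * e
      neg_mem' := by
        rintro a ⟨h, h0, e⟩
        refine ⟨h⁻¹, inv_ne_zero h0, ?_⟩
        rw [Derivation.leibniz_inv, smul_eq_mul]
        have hh : (N : L) * (-h⁻¹ ^ 2 * θ h) = -(h⁻¹ ^ 2) * ((N : L) * θ h) := by ring
        rw [hh, e]; push_cast; field_simp }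
  obtain ⟨n1, hn1⟩ := Int.subgroup_cyclic G
  have hG : ∀ e : ℤ, e ∈ G ↔ n1 ∣ e := by
    intro e
    rw [hn1, ← AddSubgroup.zmultiples_eq_closure, Int.mem_zmultiples_iff]
  have hNG : (N : ℤ) ∈ G := ⟨x, hx0, by rw [hθx]; simp⟩
  set n0 := n1.natAbs with hn0
  have hn0G : (n0 : ℤ) ∈ G := by rw [hG, hn0]; exact Int.dvd_natAbs.mpr (dvd_refl _)
  obtain ⟨n, hn⟩ : n0 ∣ N := by
    have := (hG _).mp hNG
    rw [hn0]; exact_mod_cast Int.natAbs_dvd.mpr this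
  have hn1' : 1 ≤ n := by
    rcases Nat.eq_zero_or_pos n with h | h
    · rw [h, mul_zero] at hn; omega
    · exact h
  have hNL : (N : L) ≠ 0 := by
    haveI : CharZero L := charZero_of_injective_algebraMap (algebraMap k L).injective
    exact_mod_cast hNpos.ne'
  obtain ⟨τ0, hτ0, eτ0⟩ := hn0G
  have e1 : θ (τ0 ^ n) = τ0 ^ n := by
    rw [Derivation.leibniz_pow, nsmul_eq_mul, smul_eq_mul]
    apply mul_left_cancel₀ hNL
    obtain ⟨n', rfl⟩ : ∃ n', n = n' + 1 := ⟨n - 1, by omega⟩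
    have : (N : L) = (n0 : L) * ((n' + 1 : ℕ) : L) := by rw [hn]; push_cast; ring
    rw [Nat.add_sub_cancel, pow_succ]
    have h2 : (N : L) * (((n' + 1 : ℕ) : L) * (τ0 ^ n' * θ τ0)) = ((n' + 1 : ℕ) : L) * τ0 ^ n' * ((N : L) * θ τ0) := by ring
    rw [h2, eτ0, this]
    push_cast; ring
  obtain ⟨a, ha⟩ := ker_theta θ DF s hDF hθ (τ0 ^ n / x) (by
    rw [Derivation.leibniz_div, e1, hθx]; simp only [smul_eq_mul]; ring)
  have ha0 : a ≠ 0 := by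
    rintro rfl
    rw [map_zero, div_eq_zero_iff] at ha
    exact ha.elim (pow_ne_zero _ hτ0) hx0
  obtain ⟨b, hb⟩ := IsAlgClosed.exists_pow_nat_eq a hn1'
  have hb0 : b ≠ 0 := by rintro rfl; rw [zero_pow (by omega)] at hb; exact ha0 hb.symm
  have hbL : algebraMap k L b ≠ 0 := by rwa [Ne, map_eq_zero]
  refine ⟨n, τ0 / algebraMap k L b, hn1', ?_, ?_⟩
  · rw [div_pow, ← map_pow, hb, ← ha]
    have := pow_ne_zero n hτ0
    field_simp
  · intro h lam hl
    by_cases h0 : h = 0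
    · exact ⟨0, 0, by simp [h0]⟩
    obtain ⟨e, he⟩ := eig_rat θ DF s hDF hθ h h0 lam hl
    have heL : (N : L) * algebraMap k L lam = e := by
      have := congrArg (algebraMap k L) he
      simpa using this
    have heG : e ∈ G := ⟨h, h0, by rw [hl, ← mul_assoc, heL]⟩
    have : (n0 : ℤ) ∣ e := by
      rw [hn0]; exact Int.natAbs_dvd.mpr ((hG e).mp heG)
    obtain ⟨j, rfl⟩ := this
    set τ := τ0 / algebraMap k L b with hτ
    have hτn : τ ≠ 0 := div_ne_zero hτ0 hbL
    have eτ : (N : L) * θ τ = n0 * τ := by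
      have eτ0' : (N : L) * θ τ0 = n0 * τ0 := by simpa using eτ0
      have e9 : τ = algebraMap k L b⁻¹ * τ0 := by rw [hτ, div_eq_mul_inv, ← map_inv₀, mul_comm τ0]
      have e10 : θ τ = algebraMap k L b⁻¹ * θ τ0 := by
        rw [e9, Derivation.leibniz, Derivation.map_algebraMap]; simp
      rw [e10, e9]
      linear_combination (algebraMap k L b⁻¹) * eτ0'
    have hkey : θ (h / τ ^ j) = 0 := by
      apply mul_left_cancel₀ hNL
      rw [Derivation.leibniz_div, Derivation.leibniz_zpow, mul_zero]
      simp only [smul_eq_mul, zsmul_eq_mul]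
      have hl' : (N : L) * θ h = (n0 : L) * j * h := by
        rw [hl, ← mul_assoc, heL]; push_cast; ring
      rw [zpow_sub_one₀ hτn]
      have hz := zpow_ne_zero j hτn
      have e3 : (N : L) * ((τ ^ j)⁻¹ ^ 2 * (τ ^ j * θ h - h * (j * (τ ^ j * τ⁻¹ * θ τ)))) =
         (τ ^ j)⁻¹ ^ 2 * (τ ^ j * ((N : L) * θ h) - h * (j * (τ ^ j * τ⁻¹ * ((N : L) * θ τ)))) := by ring
      rw [e3, hl', eτ]
      field_simp
      ring
    obtain ⟨c, hc⟩ := ker_theta θ DF s hDF hθ _ hkey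
    refine ⟨c, j, ?_⟩
    rw [← hc]
    have hz := zpow_ne_zero j hτn
    field_simp

lemma jordan (hDF : ∀ p : k[X], DF (algebraMap k[X] F p) = algebraMap k[X] F (derivative p))
    (hθ : ∀ c, θ (algebraMap F L c) = algebraMap F L (algebraMap k[X] F (X - C s) * DF c))
    (V : Submodule k L) (T : V →ₗ[k] V) (hT : ∀ v, (T v : L) = θ v) (μ : k) (w : V) (n : ℕ)
    (h : ((T - algebraMap k (Module.End k V) μ) ^ (n + 1)) w = 0) :
    (T - algebraMap k (Module.End k V) μ) w = 0 := by
  induction n with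
  | zero => simpa using h
  | succ n ih =>
    apply ih
    set A := (T - algebraMap k (Module.End k V) μ) with hA
    have hAv : ∀ v, ((A v : V) : L) = θ v - algebraMap k L μ * v := by
      intro v
      simp [hA, hT, Algebra.smul_def]
    set w' := (A ^ n) w with hw'
    have h1 : A (A w') = 0 := by
      rw [pow_succ', Module.End.mul_apply, pow_succ', Module.End.mul_apply] at h; exact h
    have h2 : (A ^ (n + 1)) w = A w' := by rw [pow_succ', Module.End.mul_apply]
    rw [h2]
    by_contra hne
    set v := A w' with hv
    have hvL : (v : L) ≠ 0 := by simpa using hne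
    have hθv : θ (v : L) = algebraMap k L μ * v := by
      have := congrArg Subtype.val h1
      rw [hAv] at this
      exact sub_eq_zero.mp this
    have hθw : θ (w' : L) = algebraMap k L μ * w' + v := by
      rw [hv, hAv]; ring
    apply no_one θ DF s hDF hθ ((w' : L) / v)
    rw [Derivation.leibniz_div, hθv, hθw]
    simp only [smul_eq_mul]
    field_simp
    ring
end

theorem R1Data.main (d : R1Data k F L) (h1 : NN1 d.g) (h2 : NN2 d.g) :
    ∃ (s : k) (n : ℕ) (τ : L) (q p : k[X]), 1 ≤ n ∧ τ ^ n = algebraMap F L (algebraMap k[X] F (X - C s)) ∧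
      d.y = aeval τ q ∧ d.σ τ = aeval τ p := by
  obtain ⟨D, hD⟩ := exists_deriv k F L
  obtain ⟨DF, hDF⟩ := exists_derivF k F
  have hDD := D_F D hD DF hDF
  obtain ⟨s, hs⟩ := d.step2 h1 h2 D hD
  have h3 := d.step3 h1 D hD s hs
  have h4 := d.step4 D hD s
  set θ : Derivation k L L := (algebraMap F L (algebraMap k[X] F (X - C s))) • D with hθdef
  have hθ : ∀ c, θ (algebraMap F L c) = algebraMap F L (algebraMap k[X] F (X - C s) * DF c) := by
    intro c; simp [hθdef, hDD]
  have hθz : ∀ z (h : L), IsIntegral (OZ F z) h → IsIntegral (OZ F z) (θ h) := h3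
  have hθI : ∀ h : L, IsIntegral (OI (k := k) F) h → IsIntegral (OI (k := k) F) (θ h) := h4
  obtain ⟨n, τ, hn, hτ, hτ'⟩ := exists_tau θ DF s hDF hθ
  have hX := (iota_ne (F := F) (X_sub_C_ne_zero s))
  have hτ0 : τ ≠ 0 := by
    rintro rfl
    rw [zero_pow (by omega), eq_comm, map_eq_zero] at hτ
    exact hX hτ
  have key : ∀ w : L, (∀ z : k, IsIntegral (OZ F z) w) → ∃ q : k[X], w = aeval τ q := by
    intro w hw
    obtain ⟨β, hβ⟩ := exists_pow_int (k := k) (F := F) w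
    have hwM : w ∈ Mb k F L β := ⟨hw, hβ⟩
    haveI := Mb_finite d.y d.gen (d.y_int h1) β
    have hstab : ∀ h ∈ Mb k F L β, θ h ∈ Mb k F L β := by
      rintro h ⟨ha, hb⟩
      refine ⟨fun z => hθz z h (ha z), ?_⟩
      have e := hθI _ hb
      rw [Derivation.leibniz, hθ, smul_eq_mul, smul_eq_mul] at e
      have e2 : algebraMap k[X] F (X - C s) * DF (xi k F ^ β) =
          -(β : F) * (algebraMap k[X] F (X - C s) * (algebraMap k[X] F X)⁻¹) * xi k F ^ β := by
        have := iota_ne (F := F) (k := k) X_ne_zero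
        rw [Derivation.leibniz_pow, xi, Derivation.leibniz_inv, hDF]
        rcases β with _ | β
        · simp
        · simp only [derivative_X, map_one, smul_eq_mul, nsmul_eq_mul, Nat.add_sub_cancel, inv_pow, one_div, div_eq_mul_inv, one_mul, pow_succ, mul_inv]
          field_simp
      rw [e2] at e
      have e3 : IsIntegral (OI (k := k) F) (algebraMap F L (-(β : F) * (algebraMap k[X] F (X - C s) * (algebraMap k[X] F X)⁻¹)) *
          (algebraMap F L (xi k F ^ β) * h)) := by
        refine (int_of_mem _ (mul_mem (neg_mem (natCast_mem _ _)) (frac_mem_OI X_ne_zero (by simp)))).mul hb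
      have e4 := e.sub e3
      have e5 : algebraMap F L (xi k F ^ β) * θ h = algebraMap F L (xi k F ^ β) * θ h + h * algebraMap F L (-(β : F) * (algebraMap k[X] F (X - C s) * (algebraMap k[X] F X)⁻¹) * xi k F ^ β) - algebraMap F L (-(β : F) * (algebraMap k[X] F (X - C s) * (algebraMap k[X] F X)⁻¹)) *
          (algebraMap F L (xi k F ^ β) * h) := by
        rw [map_mul (algebraMap F L) (-(β : F) * (algebraMap k[X] F (X - C s) * (algebraMap k[X] F X)⁻¹))]; ring
      change IsIntegral (OI (k := k) F) (algebraMap F L (xi k F ^ β) * θ h)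
      rw [e5]; exact e4
    let T : Mb k F L β →ₗ[k] Mb k F L β :=
      { toFun := fun v => ⟨θ v, hstab v v.2⟩
        map_add' := fun u v => by ext; simp
        map_smul' := fun c u => by ext; simp }
    have hT : ∀ v, (T v : L) = θ v := fun v => rfl
    have htop := Module.End.iSup_maxGenEigenspace_eq_top T
    let A : Submodule k L := Subalgebra.toSubmodule (Algebra.adjoin k {τ})
    have hle : ⨆ μ, Module.End.maxGenEigenspace T μ ≤ A.comap (Mb k F L β).subtype := by
      apply iSup_le
      intro μ v hv
      rw [Module.End.mem_maxGenEigenspace] at hv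
      obtain ⟨m, hm⟩ := hv
      have hm' : ((T - algebraMap k (Module.End k (Mb k F L β)) μ) ^ (m + 1)) v = 0 := by
        rw [pow_succ', Module.End.mul_apply, Algebra.algebraMap_eq_smul_one, hm, map_zero]
      have h5 := jordan θ DF s hDF hθ _ T hT μ v m hm'
      have h6 : θ (v : L) = algebraMap k L μ * v := by
        have := congrArg Subtype.val h5
        simp [hT, Algebra.smul_def] at this
        exact sub_eq_zero.mp this
      obtain ⟨c, j, hcj⟩ := hτ' _ _ h6
      change (v : L) ∈ Algebra.adjoin k {τ}
      by_cases hc : c = 0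
      · rw [hcj, hc]; simp
      have hcL : algebraMap k L c ≠ 0 := by rwa [Ne, map_eq_zero]
      rcases le_or_gt 0 j with hj | hj
      · obtain ⟨m, rfl⟩ := Int.eq_ofNat_of_zero_le hj
        rw [hcj, zpow_natCast]
        exact mul_mem (Subalgebra.algebraMap_mem _ _) (pow_mem (Algebra.self_mem_adjoin_singleton k τ) _)
      · exfalso
        obtain ⟨m, rfl⟩ : ∃ m : ℕ, j = -((m : ℤ) + 1) := ⟨(-j - 1).toNat, by omega⟩
        have h7 : IsIntegral (OZ F s) ((v : L) ^ n) := (v.2.1 s).pow n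
        have h8 : algebraMap F L ((algebraMap k[X] F (X - C s))⁻¹) =
            algebraMap k L ((c⁻¹) ^ n) * (algebraMap F L (algebraMap k[X] F (X - C s)) ^ m * (v : L) ^ n) := by
          rw [hcj, ← hτ, map_inv₀, ← hτ, map_pow, map_inv₀, zpow_neg]
          have : τ ^ ((m : ℤ) + 1) = τ ^ (m + 1) := by rw [← zpow_natCast]; push_cast; rfl
          rw [this, mul_pow, inv_pow, inv_pow, ← pow_mul, ← pow_mul]
          have e11 : τ ^ ((m + 1) * n) = τ ^ (n * m) * τ ^ n := by rw [← pow_add]; congr 1; ring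
          rw [e11]
          have := pow_ne_zero (n * m) hτ0
          have := pow_ne_zero n hτ0
          field_simp
        have h9 : IsIntegral (OZ F s) (algebraMap F L ((algebraMap k[X] F (X - C s))⁻¹)) := by
          rw [h8]
          exact (int_const s _).mul (((int_of_mem _ (iota_mem_OZ s _)).pow _).mul h7)
        have := const_OZ (F := F) s (c := 1) (mem_of_int _ h9) (by rw [mul_inv_cancel₀ hX, map_one])
        exact one_ne_zero this
    rw [htop] at hle
    have hmem : w ∈ Algebra.adjoin k {τ} := hle (x := ⟨w, hwM⟩) Submodule.mem_top
    rw [Algebra.adjoin_singleton_eq_range_aeval] at hmem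
    obtain ⟨q, hq⟩ := hmem
    exact ⟨q, hq.symm⟩
  obtain ⟨q, hq⟩ := key d.y (d.y_int h1)
  have hτint : ∀ z : k, IsIntegral (OZ F z) τ := by
    intro z
    apply IsIntegral.of_pow (n := n) (by omega)
    rw [hτ]; exact int_of_mem _ (iota_mem_OZ _ _)
  obtain ⟨p, hp⟩ := key (d.σ τ) (fun z => (d.int_OZ z τ).mpr (hτint _))
  exact ⟨s, n, τ, q, p, hn, hτ, hq, hp⟩
end

noncomputable section
open Polynomial

section
variable {k F E : Type} [Field k] [IsAlgClosed k] [CharZero k] [Field F] [Algebra k[X] F]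
  [IsFractionRing k[X] F] [Field E] [Algebra F E] [Algebra k E] [Algebra k F]
  [IsScalarTower k k[X] F] [IsScalarTower k F E]

lemma R1_aux (σ : E →+* E) (σF : F →+* F) (g : k[X]) (hg : 2 ≤ g.natDegree) (h1 : NN1 g) (h2 : NN2 g)
    (y : E) (hy : IsAlgebraic F y)
    (hF : ∀ a : k[X], σF (algebraMap k[X] F a) = algebraMap k[X] F (a.comp g))
    (hσ : ∀ c : F, σ (algebraMap F E c) = algebraMap F E (σF c))
    (hσk : ∀ c : k, σ (algebraMap k E c) = algebraMap k E c)
    (hσy : σ y = aeval y g) :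
    ∃ (K : ℕ) (s : k) (n : ℕ) (τ : E) (q p : k[X]), 1 ≤ n ∧
      τ ^ n = algebraMap F E (algebraMap k[X] F (X - C s)) ∧
      σ^[K] y = aeval τ q ∧ σ τ = aeval τ p := by
  have hit : ∀ j, σ (σ^[j] y) = aeval (σ^[j] y) g := by
    intro j
    rw [← Function.iterate_succ_apply' σ j y, Function.iterate_succ_apply σ j y, hσy]
    induction j with
    | zero => rfl
    | succ j ih =>
      rw [Function.iterate_succ_apply', ih, Function.iterate_succ_apply', aeval_def, hom_eval₂, aeval_def]
      congr 1
      ext c; exact hσk c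
  let Lj : ℕ → IntermediateField F E := fun j => IntermediateField.adjoin F {σ^[j] y}
  have hle : ∀ j, Lj (j + 1) ≤ Lj j := by
    intro j
    apply IntermediateField.adjoin_le_iff.mpr
    rw [Set.singleton_subset_iff, Function.iterate_succ_apply', hit]
    have : (aeval (σ^[j] y)) g = aeval (σ^[j] y) (g.map (algebraMap k F)) := by rw [aeval_map_algebraMap]
    rw [this]
    exact IntermediateField.algebra_adjoin_le_adjoin F _ (aeval_mem_adjoin_singleton F (σ^[j] y))
  have hfin : ∀ j, FiniteDimensional F (Lj j) := by
    intro j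
    induction j with
    | zero => exact IntermediateField.adjoin.finiteDimensional hy.isIntegral
    | succ j ih =>
      exact FiniteDimensional.of_injective (IntermediateField.inclusion (hle j)).toLinearMap
        (IntermediateField.inclusion_injective (hle j))
  have hstab : ∃ K, Lj (K + 1) = Lj K := by
    by_contra hcon
    push Not at hcon
    have : ∀ j, Module.finrank F (Lj j) + j ≤ Module.finrank F (Lj 0) := by
      intro j
      induction j with
      | zero => simp
      | succ j ih =>
        haveI := hfin j
        have h3 : Module.finrank F (Lj (j + 1)) < Module.finrank F (Lj j) := by
          rcases lt_or_ge (Module.finrank F (Lj (j + 1))) (Module.finrank F (Lj j)) with h | h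
          · exact h
          · exact absurd (IntermediateField.eq_of_le_of_finrank_le (hle j) h) (hcon j)
        omega
    have h4 := this (Module.finrank F (Lj 0) + 1)
    omega
  obtain ⟨K, hK⟩ := hstab
  haveI := hfin K
  haveI : IsScalarTower k (Lj K) E := IsScalarTower.of_algebraMap_eq (fun c => by
    rw [IsScalarTower.algebraMap_apply k F E, IsScalarTower.algebraMap_apply k F (Lj K)]; rfl)
  have hmem : ∀ u ∈ Lj K, σ u ∈ Lj K := by
    intro u hu
    rw [← hK]
    refine IntermediateField.adjoin_induction F (p := fun x _ => σ x ∈ Lj (K+1)) ?_ ?_ ?_ ?_ ?_ hu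
    · intro x hx
      rw [Set.mem_singleton_iff] at hx
      subst hx
      rw [← Function.iterate_succ_apply' σ K y]
      exact IntermediateField.mem_adjoin_simple_self F _
    · intro c; rw [hσ]; exact IntermediateField.algebraMap_mem _ _
    · intro a b _ _ ha hb; rw [map_add]; exact add_mem ha hb
    · intro a _ ha; rw [map_inv₀]; exact inv_mem ha
    · intro a b _ _ ha hb; rw [map_mul]; exact mul_mem ha hb
  let d : R1Data k F (Lj K) :=
    { g := g
      hg := hg
      y := ⟨σ^[K] y, IntermediateField.mem_adjoin_simple_self F _⟩
      σF := σF
      σ := (σ.comp (algebraMap (Lj K) E)).codRestrict (Lj K).toSubring (fun u => hmem u u.2)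
      hF := hF
      hσ := fun c => by ext; exact hσ c
      hσy := by
        apply Subtype.ext
        have e1 := hit K
        rw [← show algebraMap (Lj K) E (⟨σ^[K] y, IntermediateField.mem_adjoin_simple_self F _⟩ : Lj K) = σ^[K] y from rfl, aeval_algebraMap_apply] at e1
        exact e1
      gen := by
        apply IntermediateField.lift_injective
        rw [IntermediateField.lift_adjoin_simple, IntermediateField.lift_top]
      gen' := by
        apply IntermediateField.lift_injective
        rw [IntermediateField.lift_adjoin_simple, IntermediateField.lift_top]
        refine Eq.trans ?_ hK
        change IntermediateField.adjoin F {σ (σ^[K] y)} = IntermediateField.adjoin F {σ^[K+1] y}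
        rw [Function.iterate_succ_apply'] }
  obtain ⟨s, n, τ, q, p, hn, e1, e2, e3⟩ := d.main h1 h2
  refine ⟨K, s, n, τ, q, p, hn, ?_, ?_, ?_⟩
  · exact congrArg Subtype.val e1
  · have := congrArg (algebraMap (Lj K) E) e2
    rw [← aeval_algebraMap_apply] at this
    exact this
  · have := congrArg (algebraMap (Lj K) E) e3
    rw [← aeval_algebraMap_apply] at this
    exact this
end

section
variable {k E : Type} [Field k] [Field E] [Algebra k E]

variable (k) in
def Dep (x y : E) : Prop := ∃ G : k[X][X], G ≠ 0 ∧ G.aevalAeval x y = 0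

lemma aevalAeval_eq (x y : E) (G : k[X][X]) :
    G.aevalAeval x y = eval₂ (aeval x : k[X] →ₐ[k] E).toRingHom y G := by
  induction G using Polynomial.induction_on' with
  | add p q hp hq => rw [map_add, hp, hq, eval₂_add]
  | monomial n a =>
    rw [eval₂_monomial, ← C_mul_X_pow_eq_monomial, map_mul, map_pow, aevalAeval_C, aevalAeval_Y]; rfl

lemma Dep.symm {x y : E} (h : Dep k x y) : Dep k y x := by
  obtain ⟨G, hG, h⟩ := h
  refine ⟨Bivariate.swap G, by simpa using hG, ?_⟩
  rw [Bivariate.aevalAeval_swap]; exact h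

lemma Dep.isAlg {x y : E} (h : Dep k x y) (hx : Transcendental k x) (A : Type) [CommRing A] [Algebra A E]
    (j : k[X] →+* A) (hj : ∀ a, algebraMap A E (j a) = aeval x a) : IsAlgebraic A y := by
  obtain ⟨G, hG, h⟩ := h
  have hinj : Function.Injective j := by
    intro a b hab
    apply transcendental_iff_injective.mp hx
    rw [← hj, ← hj, hab]
  refine ⟨G.map j, by rwa [Ne, Polynomial.map_eq_zero_iff hinj], ?_⟩
  rw [aeval_def, eval₂_map, ← h]
  have : (algebraMap A E).comp j = (aeval x : k[X] →ₐ[k] E).toRingHom := by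
    ext a <;> simp [hj]
  rw [this]
  rw [aevalAeval_eq]

lemma Dep.of_isAlg {x y : E} (h : IsAlgebraic (Algebra.adjoin k {x}) y) : Dep k x y := by
  obtain ⟨P, hP, h⟩ := h
  let j : k[X] →+* Algebra.adjoin k {x} :=
    (aeval x : k[X] →ₐ[k] E).toRingHom.codRestrict (Algebra.adjoin k {x}).toSubring (fun a => aeval_mem_adjoin_singleton k x)
  have hj : ∀ a, algebraMap (Algebra.adjoin k {x}) E (j a) = aeval x a := fun a => rfl
  have hs : Function.Surjective j := by
    rintro ⟨u, hu⟩
    have hu' := hu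
    rw [Algebra.adjoin_singleton_eq_range_aeval] at hu'
    obtain ⟨a, ha⟩ := hu'
    exact ⟨a, Subtype.ext ha⟩
  obtain ⟨G, rfl⟩ := Polynomial.map_surjective j hs P
  refine ⟨G, by rintro rfl; simp at hP, ?_⟩
  rw [aeval_def, eval₂_map] at h
  rw [← h]
  have : (algebraMap _ E).comp j = (aeval x : k[X] →ₐ[k] E).toRingHom := by
    ext a <;> simp [hj]
  rw [this]
  rw [aevalAeval_eq]

lemma Dep.trans {x y z : E} (h : Dep k x y) (h' : Dep k y z) (hx : Transcendental k x)
    (hy : Transcendental k y) : Dep k x z := by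
  apply Dep.of_isAlg
  have hA := h.isAlg hx (Algebra.adjoin k {x})
    ((aeval x : k[X] →ₐ[k] E).toRingHom.codRestrict (Algebra.adjoin k {x}).toSubring (fun a => aeval_mem_adjoin_singleton k x))
    (fun a => rfl)
  let A := Subalgebra.algebraicClosure (Algebra.adjoin k {x}) E
  have hyA : y ∈ A := hA
  have := h'.isAlg hy A ((aeval (⟨y, hyA⟩ : A) : k[X] →ₐ[k] A).toRingHom) (fun a => by
    change algebraMap A E (aeval (⟨y, hyA⟩ : A) a) = _
    rw [← aeval_algebraMap_apply]; rfl)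
  exact this.restrictScalars _

lemma Dep.map {E' : Type} [Field E'] [Algebra k E'] (φ : E →ₐ[k] E') {x y : E} (h : Dep k x y) :
    Dep k (φ x) (φ y) := by
  obtain ⟨G, hG, h⟩ := h
  refine ⟨G, hG, ?_⟩
  have : (aevalAeval (φ x) (φ y) : k[X][X] →ₐ[k] E') = φ.comp (aevalAeval x y) := by
    apply Polynomial.algHom_ext'
    · ext; simp
    · simp
  rw [this, AlgHom.comp_apply, h, map_zero]

lemma Dep.of_map {E' : Type} [Field E'] [Algebra k E'] (φ : E →ₐ[k] E') {x y : E} (h : Dep k (φ x) (φ y)) :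
    Dep k x y := by
  obtain ⟨G, hG, h⟩ := h
  refine ⟨G, hG, (map_eq_zero_iff φ φ.injective).mp ?_⟩
  have : (aevalAeval (φ x) (φ y) : k[X][X] →ₐ[k] E') = φ.comp (aevalAeval x y) := by
    apply Polynomial.algHom_ext'
    · ext; simp
    · simp
  rw [this, AlgHom.comp_apply] at h
  exact h

lemma Dep.aeval_self (x : E) (g : k[X]) : Dep k x (aeval x g) := by
  refine ⟨X - C g, X_sub_C_ne_zero g, ?_⟩
  simp

lemma transc_aeval {x : E} (hx : Transcendental k x) (g : k[X]) (hg : 1 ≤ g.natDegree) :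
    Transcendental k (aeval x g) := hx.aeval g (by omega) (by
      rw [mem_nonZeroDivisors_iff_ne_zero, Ne, leadingCoeff_eq_zero]
      rintro rfl
      simp at hg)

end

section
variable {k E : Type} [Field k] [IsAlgClosed k] [CharZero k] [Field E] [Algebra k E]

theorem R1gen (σ : E →ₐ[k] E) (g : k[X]) (hg : 2 ≤ g.natDegree) (h1 : NN1 g) (h2 : NN2 g)
    (x y : E) (hx : Transcendental k x) (hxy : Dep k x y)
    (hσx : σ x = aeval x g) (hσy : σ y = aeval y g) :
    ∃ (K : ℕ) (s : k) (n : ℕ) (τ : E) (q p : k[X]), 1 ≤ n ∧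
      x = algebraMap k E s + τ ^ n ∧
      σ^[K] y = aeval τ q ∧ σ τ = aeval τ p := by
  let F := FractionRing k[X]
  have hinj : Function.Injective (aeval x : k[X] →ₐ[k] E).toRingHom := transcendental_iff_injective.mp hx
  let jF : F →+* E := IsFractionRing.lift hinj
  have hjF : ∀ a : k[X], jF (algebraMap k[X] F a) = aeval x a := fun a => IsFractionRing.lift_algebraMap hinj a
  letI : Algebra F E := jF.toAlgebra
  have hAl : ∀ a : k[X], algebraMap F E (algebraMap k[X] F a) = aeval x a := hjF
  haveI : IsScalarTower k F E := IsScalarTower.of_algebraMap_eq (fun c => by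
    rw [IsScalarTower.algebraMap_apply k k[X] F, hAl, Polynomial.algebraMap_eq, aeval_C])
  have hginj : Function.Injective ((algebraMap k[X] F).comp (compRingHom g)) := by
    apply (IsFractionRing.injective k[X] F).comp
    have hgt : Transcendental k g := (transc_aeval hx g (by omega)).of_aeval
    intro a b hab
    apply transcendental_iff_injective.mp hgt
    simpa [aeval_def, comp] using hab
  let σF : F →+* F := IsFractionRing.lift hginj
  have hF : ∀ a : k[X], σF (algebraMap k[X] F a) = algebraMap k[X] F (a.comp g) :=
    fun a => IsFractionRing.lift_algebraMap hginj a
  have hσF : ∀ c : F, σ (algebraMap F E c) = algebraMap F E (σF c) := by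
    have : (σ : E →+* E).comp (algebraMap F E) = (algebraMap F E).comp σF := by
      apply IsLocalization.ringHom_ext (nonZeroDivisors k[X])
      ext a
      · simp [hAl, hF]
      · simp only [RingHom.comp_apply, hAl, hF, aeval_X, X_comp]; exact hσx
    intro c
    exact DFunLike.congr_fun this c
  obtain ⟨K, s, n, τ, q, p, hn, e1, e2, e3⟩ := R1_aux (F := F) (σ : E →+* E) σF g hg h1 h2 y
    (hxy.isAlg hx F (algebraMap k[X] F) hAl) hF hσF (fun c => σ.commutes c) hσy
  refine ⟨K, s, n, τ, q, p, hn, ?_, e2, e3⟩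
  rw [e1, hAl]; simp
end

noncomputable section
open Polynomial

abbrev LS (k : Type) [Field k] : Type := LaurentSeries k

instance lsAlg (k : Type) [Field k] : Algebra k (LS k) := HahnSeries.instAlgebra

section
variable {k : Type} [Field k]

/-- leading term predicate -/
def Lead (x : LS k) (N : ℤ) (e : k) : Prop := (∀ i < N, x.coeff i = 0) ∧ x.coeff N = e

lemma Lead.mul {x y : LS k} {N M : ℤ} {a b : k} (hx : Lead x N a) (hy : Lead y M b) :
    Lead (x * y) (N + M) (a * b) := by
  constructor
  · intro i hi
    rw [HahnSeries.coeff_mul]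
    apply Finset.sum_eq_zero
    rintro ⟨p, q⟩ hpq
    rw [Finset.mem_addAntidiagonal] at hpq
    obtain ⟨_, _, h⟩ := hpq
    simp only at h
    by_cases hp : p < N
    · rw [hx.1 p hp, zero_mul]
    · rw [hy.1 q (by omega), mul_zero]
  · rw [HahnSeries.coeff_mul]
    by_cases ha : x.coeff N = 0
    · rw [← hx.2, ha, zero_mul]
      apply Finset.sum_eq_zero
      rintro ⟨p, q⟩ hpq
      rw [Finset.mem_addAntidiagonal] at hpq
      obtain ⟨_, _, h⟩ := hpq
      simp only at h
      rcases lt_trichotomy p N with hp | hp | hp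
      · rw [hx.1 p hp, zero_mul]
      · rw [hp, ha, zero_mul]
      · rw [hy.1 q (by omega), mul_zero]
    by_cases hb : y.coeff M = 0
    · rw [← hy.2, hb, mul_zero]
      apply Finset.sum_eq_zero
      rintro ⟨p, q⟩ hpq
      rw [Finset.mem_addAntidiagonal] at hpq
      obtain ⟨_, _, h⟩ := hpq
      simp only at h
      rcases lt_trichotomy q M with hp | hp | hp
      · rw [hy.1 q hp, mul_zero]
      · rw [hp, hb, mul_zero]
      · rw [hx.1 p (by omega), zero_mul]
    rw [Finset.sum_eq_single (N, M)]
    · rw [hx.2, hy.2]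
    · rintro ⟨p, q⟩ hpq hne
      rw [Finset.mem_addAntidiagonal] at hpq
      obtain ⟨_, _, h⟩ := hpq
      simp only at h
      by_cases hp : p < N
      · rw [hx.1 p hp, zero_mul]
      · by_cases hq : q < M
        · rw [hy.1 q hq, mul_zero]
        · exfalso; apply hne; ext <;> simp <;> omega
    · intro h
      exfalso; apply h
      rw [Finset.mem_addAntidiagonal]
      exact ⟨ha, hb, rfl⟩

lemma Lead.add {x y : LS k} {N : ℤ} {a b : k} (hx : Lead x N a) (hy : Lead y N b) :
    Lead (x + y) N (a + b) :=
  ⟨fun i hi => by rw [HahnSeries.coeff_add, hx.1 i hi, hy.1 i hi, add_zero], by rw [HahnSeries.coeff_add, hx.2, hy.2]⟩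

lemma Lead.neg {x : LS k} {N : ℤ} {a : k} (hx : Lead x N a) : Lead (-x) N (-a) :=
  ⟨fun i hi => by rw [HahnSeries.coeff_neg, hx.1 i hi, neg_zero], by rw [HahnSeries.coeff_neg, hx.2]⟩

lemma Lead.sub {x y : LS k} {N : ℤ} {a b : k} (hx : Lead x N a) (hy : Lead y N b) :
    Lead (x - y) N (a - b) := by
  rw [sub_eq_add_neg, sub_eq_add_neg]; exact hx.add hy.neg

lemma Lead.mono {x : LS k} {N M : ℤ} {a : k} (hx : Lead x N a) (h : M < N) : Lead x M 0 :=
  ⟨fun i hi => hx.1 i (by omega), hx.1 M h⟩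

lemma Lead.succ {x : LS k} {N : ℤ} (hx : Lead x N 0) : ∃ a, Lead x (N + 1) a :=
  ⟨x.coeff (N + 1), fun i hi => by
    rcases lt_or_eq_of_le (show i ≤ N by omega) with h | h
    · exact hx.1 i h
    · rw [h]; exact hx.2, rfl⟩

lemma Lead.zero (N : ℤ) : Lead (0 : LS k) N 0 := ⟨fun i _ => rfl, rfl⟩

lemma Lead.one : Lead (1 : LS k) 0 1 :=
  ⟨fun i hi => by rw [HahnSeries.coeff_one, if_neg hi.ne], by rw [HahnSeries.coeff_one, if_pos rfl]⟩

lemma Lead.algebraMap (c : k) : Lead (algebraMap k (LS k) c) 0 c := by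
  rw [HahnSeries.algebraMap_apply]
  simp only [Algebra.algebraMap_self, RingHom.id_apply]
  refine ⟨fun i hi => ?_, ?_⟩
  · rw [HahnSeries.C_apply, HahnSeries.coeff_single_of_ne hi.ne]
  · rw [HahnSeries.C_apply, HahnSeries.coeff_single_same]

lemma Lead.single (n : ℤ) (c : k) : Lead (HahnSeries.single n c : LS k) n c :=
  ⟨fun i hi => HahnSeries.coeff_single_of_ne hi.ne, HahnSeries.coeff_single_same _ _⟩

lemma Lead.pow {x : LS k} {N : ℤ} {a : k} (hx : Lead x N a) (m : ℕ) : Lead (x ^ m) (m * N) (a ^ m) := by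
  induction m with
  | zero => simpa using Lead.one
  | succ m ih =>
    rw [pow_succ, pow_succ]
    have := ih.mul hx
    rwa [show ((m + 1 : ℕ) : ℤ) * N = m * N + N by push_cast; ring]

lemma exists_lead {x : LS k} (hx : x ≠ 0) : ∃ N a, a ≠ 0 ∧ Lead x N a :=
  ⟨x.order, x.coeff x.order, by simpa using hx, fun i hi => HahnSeries.coeff_eq_zero_of_lt_order hi, rfl⟩

lemma Lead.ne_zero {x : LS k} {N : ℤ} {a : k} (hx : Lead x N a) (ha : a ≠ 0) : x ≠ 0 := by
  rintro rfl
  exact ha hx.2.symm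

lemma Lead.unique {x : LS k} {N M : ℤ} {a b : k} (hx : Lead x N a) (hx' : Lead x M b) (ha : a ≠ 0) (hb : b ≠ 0) :
    N = M ∧ a = b := by
  have : N = M := by
    rcases lt_trichotomy N M with h | h | h
    · exact absurd (hx'.1 N h) (by rw [hx.2]; exact ha)
    · exact h
    · exact absurd (hx.1 M h) (by rw [hx'.2]; exact hb)
  subst this
  exact ⟨rfl, by rw [← hx.2, hx'.2]⟩

lemma lead_sum {ι : Type} (s : Finset ι) (x : ι → LS k) (N : ℤ) (a : ι → k) (h : ∀ i ∈ s, Lead (x i) N (a i)) :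
    Lead (∑ i ∈ s, x i) N (∑ i ∈ s, a i) := by
  classical
  induction s using Finset.induction_on with
  | empty => simpa using Lead.zero N
  | insert i s hi ih =>
    rw [Finset.sum_insert hi, Finset.sum_insert hi]
    exact (h i (by simp)).add (ih (fun j hj => h j (by simp [hj])))

/-- value of polynomial on series with pole -/
lemma lead_aeval {x : LS k} {B : ℤ} (hB : 0 < B) {a : k} (hx : Lead x (-B) a) (p : k[X]) :
    Lead (aeval x p) (-(p.natDegree * B)) (p.leadingCoeff * a ^ p.natDegree) := by
  rw [aeval_eq_sum_range]
  have h := lead_sum (Finset.range (p.natDegree + 1)) (fun i => p.coeff i • x ^ i) (-(p.natDegree * B))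
    (fun i => if i = p.natDegree then p.leadingCoeff * a ^ p.natDegree else 0) (by
      intro i hi
      rw [Finset.mem_range] at hi
      rw [Algebra.smul_def]
      have h1 := (Lead.algebraMap (p.coeff i)).mul (hx.pow i)
      split_ifs with h
      · subst h
        convert h1 using 1
        · ring
        · rfl
      · apply h1.mono
        have : (i : ℤ) < p.natDegree := by exact_mod_cast (show i < p.natDegree by omega)
        nlinarith)
  simpa using h

lemma lead_cancel {x y : LS k} {N M : ℤ} {a c : k} (ha : a ≠ 0) (hx : Lead x N a) (hxy : Lead (x * y) (N + M) c) :
    Lead y M (c / a) := by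
  by_cases hy : y = 0
  · subst hy
    have : c = 0 := by rw [← hxy.2]; simp
    rw [this, zero_div]; exact Lead.zero M
  obtain ⟨M', b, hb, h⟩ := exists_lead hy
  have h1 := hx.mul h
  rcases lt_trichotomy M M' with hM | hM | hM
  · have := h1.mono (show N + M < N + M' by omega)
    have : c = 0 := by rw [← hxy.2, this.2]
    rw [this, zero_div]; exact h.mono hM
  · subst hM
    have : c = a * b := by rw [← hxy.2, h1.2]
    rw [this, mul_div_cancel_left₀ _ ha]; exact h
  · exfalso
    have := hxy.1 (N + M') (by omega)
    rw [h1.2] at this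
    exact mul_ne_zero ha hb this

lemma transc_lead {x : LS k} {B : ℤ} (hB : 0 < B) {a : k} (ha : a ≠ 0) (hx : Lead x (-B) a) : Transcendental k x := by
  rw [transcendental_iff]
  intro p hp
  by_contra hne
  have := (lead_aeval hB hx p).2
  rw [hp] at this
  exact mul_ne_zero (leadingCoeff_ne_zero.mpr hne) (pow_ne_zero _ ha) this.symm

/-- scaling -/
def scl (c : kˣ) : LS k →ₐ[k] LS k where
  toFun x := ⟨fun n => ((c ^ (-n) : kˣ) : k) * x.coeff n, x.isPWO_support.mono (by
    intro n hn
    simp only [Function.mem_support] at hn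
    exact right_ne_zero_of_mul hn)⟩
  map_one' := by
    ext n
    rcases eq_or_ne n 0 with rfl | h
    · simp
    · simp [HahnSeries.coeff_one, h]
  map_mul' x y := by
    ext n
    change _ * (x * y).coeff n = _
    have hs : ∀ z : LS k, Function.support (fun n => ((c ^ (-n) : kˣ) : k) * z.coeff n) ⊆ z.support := by
      intro z n hn
      simp only [Function.mem_support] at hn
      exact right_ne_zero_of_mul hn
    rw [HahnSeries.coeff_mul_left' (x := ⟨fun n => ((c ^ (-n) : kˣ) : k) * x.coeff n, _⟩) x.isPWO_support (hs x),
      HahnSeries.coeff_mul, Finset.mul_sum]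
    have : (Function.support fun n => ((c ^ (-n) : kˣ) : k) * y.coeff n) = y.support := by
      ext n; simp only [Function.mem_support, HahnSeries.mem_support, ne_eq, mul_eq_zero, Units.ne_zero, false_or]
    simp only [HahnSeries.support, this]
    apply Finset.sum_congr rfl
    rintro ⟨p, q⟩ hpq
    rw [Finset.mem_addAntidiagonal] at hpq
    obtain ⟨_, _, h⟩ := hpq
    simp only at h ⊢
    rw [← h, neg_add, zpow_add, Units.val_mul]
    ring
  map_zero' := by ext n; simp
  map_add' x y := by ext n; simp [mul_add]
  commutes' r := by
    ext n
    rw [HahnSeries.algebraMap_apply]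
    rcases eq_or_ne n 0 with rfl | h
    · simp
    · simp [HahnSeries.C_apply, HahnSeries.coeff_single_of_ne h]

lemma scl_coeff (c : kˣ) (x : LS k) (n : ℤ) : (scl c x).coeff n = ((c ^ (-n) : kˣ) : k) * x.coeff n := rfl

def expo (m : ℕ) : LS k →ₐ[k] LS k :=
  if h : 0 < m then
    HahnSeries.embDomainAlgHom (AddMonoidHom.mulLeft (m : ℤ))
      (fun a b hab => by simpa [h.ne'] using hab)
      (fun a b => by simp [h])
  else AlgHom.id k _

lemma expo_coeff {m : ℕ} (h : 0 < m) (x : LS k) (n : ℤ) : (expo m x).coeff (m * n) = x.coeff n := by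
  rw [expo, dif_pos h]
  exact HahnSeries.embDomain_coeff (f := ⟨⟨fun a : ℤ => (m : ℤ) * a, _⟩, _⟩)

lemma expo_coeff' {m : ℕ} (h : 0 < m) (x : LS k) (n : ℤ) (hn : ¬ (m : ℤ) ∣ n) : (expo m x).coeff n = 0 := by
  rw [expo, dif_pos h]
  refine HahnSeries.embDomain_of_notMem_range (f := ⟨⟨fun a : ℤ => (m : ℤ) * a, _⟩, _⟩) ?_
  rintro ⟨a, rfl⟩
  exact hn ⟨a, rfl⟩

/-- substitution z ↦ c z^m -/
def sbt (c : kˣ) (m : ℕ) : LS k →ₐ[k] LS k := (expo m).comp (scl c)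

lemma sbt_coeff (c : kˣ) {m : ℕ} (h : 0 < m) (x : LS k) (n : ℤ) :
    (sbt c m x).coeff (m * n) = ((c ^ (-n) : kˣ) : k) * x.coeff n := by
  rw [sbt, AlgHom.comp_apply, expo_coeff h, scl_coeff]

lemma sbt_coeff' (c : kˣ) {m : ℕ} (h : 0 < m) (x : LS k) (n : ℤ) (hn : ¬ (m : ℤ) ∣ n) : (sbt c m x).coeff n = 0 := by
  rw [sbt, AlgHom.comp_apply, expo_coeff' h _ _ hn]

lemma sbt_sbt (c c' : kˣ) {m m' : ℕ} (h : 0 < m) (h' : 0 < m') (x : LS k) :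
    sbt c m (sbt c' m' x) = sbt (c' * c ^ m') (m' * m) x := by
  ext n
  have hmm : 0 < m' * m := Nat.mul_pos h' h
  by_cases h1 : (m : ℤ) ∣ n
  · obtain ⟨j, rfl⟩ := h1
    rw [sbt_coeff c h]
    by_cases h2 : (m' : ℤ) ∣ j
    · obtain ⟨i, rfl⟩ := h2
      rw [sbt_coeff c' h']
      have : (m : ℤ) * (m' * i) = ((m' * m : ℕ) : ℤ) * i := by push_cast; ring
      rw [this, sbt_coeff _ hmm, ← mul_assoc, ← Units.val_mul]
      congr 2
      rw [mul_zpow, ← zpow_natCast, ← zpow_mul, mul_comm, mul_neg]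
    · rw [sbt_coeff' c' h' _ _ h2, sbt_coeff' _ hmm, mul_zero]
      rintro ⟨i, hi⟩
      apply h2
      refine ⟨i, ?_⟩
      have : (m : ℤ) ≠ 0 := by exact_mod_cast h.ne'
      apply mul_left_cancel₀ this
      rw [hi]; push_cast; ring
  · rw [sbt_coeff' c h _ _ h1, sbt_coeff' _ hmm]
    rintro ⟨i, hi⟩
    apply h1
    refine ⟨m' * i, ?_⟩
    rw [hi]; push_cast; ring

lemma sbt_one (x : LS k) : sbt 1 1 x = x := by
  ext n
  have := sbt_coeff (1 : kˣ) one_pos x n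
  simpa using this

lemma lead_sbt {x : LS k} {N : ℤ} {a : k} (hx : Lead x N a) (c : kˣ) {m : ℕ} (h : 0 < m) :
    Lead (sbt c m x) (m * N) (((c ^ (-N) : kˣ) : k) * a) := by
  constructor
  · intro i hi
    by_cases h1 : (m : ℤ) ∣ i
    · obtain ⟨j, rfl⟩ := h1
      rw [sbt_coeff c h, hx.1 j, mul_zero]
      have : (0 : ℤ) < m := by exact_mod_cast h
      exact lt_of_mul_lt_mul_left hi this.le
    · exact sbt_coeff' c h _ _ h1
  · rw [sbt_coeff c h, hx.2]

def eulFun (x : LS k) : LS k := ⟨fun n => (-(n : k)) * x.coeff n, x.isPWO_support.mono (by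
        intro n hn
        simp only [Function.mem_support] at hn
        exact right_ne_zero_of_mul hn)⟩

lemma eulFun_coeff (x : LS k) (n : ℤ) : (eulFun x).coeff n = -(n : k) * x.coeff n := rfl

lemma eulFun_supp (x : LS k) : (eulFun x).support ⊆ x.support := by
  intro n hn
  rw [HahnSeries.mem_support, eulFun_coeff] at hn
  exact right_ne_zero_of_mul hn

/-- the Euler derivation -/
def eul : Derivation k (LS k) (LS k) :=
  Derivation.mk'
   { toFun := eulFun
     map_add' := fun x y => by ext n; simp [eulFun_coeff, mul_add]
     map_smul' := fun c x => by ext n; simp [eulFun_coeff]; ring }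
   (by
    intro x y
    ext n
    change (eulFun (x * y)).coeff n = (x • eulFun y + y • eulFun x).coeff n
    rw [eulFun_coeff, HahnSeries.coeff_add, smul_eq_mul, smul_eq_mul, mul_comm y]
    rw [HahnSeries.coeff_mul, HahnSeries.coeff_mul_left' (y := y) x.isPWO_support (eulFun_supp x), HahnSeries.coeff_mul_right' y.isPWO_support (eulFun_supp y), Finset.mul_sum, ← Finset.sum_add_distrib]
    apply Finset.sum_congr rfl
    rintro ⟨p, q⟩ hpq
    rw [Finset.mem_addAntidiagonal] at hpq
    obtain ⟨_, _, h⟩ := hpq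
    simp only at h
    simp only [eulFun_coeff]
    rw [← h]; push_cast
    ring)

lemma eul_coeff (x : LS k) (n : ℤ) : (eul x).coeff n = -(n : k) * x.coeff n := rfl

lemma eul_sbt (c : kˣ) {m : ℕ} (h : 0 < m) (x : LS k) : eul (sbt c m x) = (m : LS k) * sbt c m (eul x) := by
  ext n
  rw [eul_coeff, ← nsmul_eq_mul, HahnSeries.coeff_nsmul]
  by_cases h1 : (m : ℤ) ∣ n
  · obtain ⟨j, rfl⟩ := h1
    rw [Pi.smul_apply, sbt_coeff c h, sbt_coeff c h, eul_coeff]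
    simp; ring
  · rw [Pi.smul_apply, sbt_coeff' c h _ _ h1, sbt_coeff' c h _ _ h1]; simp

lemma lead_eul {x : LS k} {N : ℤ} {a : k} (hx : Lead x N a) : Lead (eul x) N (-(N : k) * a) :=
  ⟨fun i hi => by rw [eul_coeff, hx.1 i hi, mul_zero], by rw [eul_coeff, hx.2]⟩

end

noncomputable section
open Polynomial

section
variable {k : Type} [Field k]

lemma lead_pow_diff {x δ : LS k} {B N : ℤ} {a e : k} (hx : Lead x (-B) a) (hN : -B < N) (hδ : Lead δ N e) (i : ℕ) :
    Lead ((x + δ) ^ i - x ^ i) (N - (i - 1) * B) (i * a ^ (i - 1) * e) := by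
  have hxd : Lead (x + δ) (-B) a := by simpa using hx.add (hδ.mono hN)
  rw [← geom_sum₂_mul, add_sub_cancel_left]
  have h1 := lead_sum (Finset.range i) (fun j => (x + δ) ^ j * x ^ (i - 1 - j)) (-((i - 1) * B)) (fun j => a ^ (i - 1)) (by
    intro j hj
    rw [Finset.mem_range] at hj
    have := (hxd.pow j).mul (hx.pow (i - 1 - j))
    convert this using 1
    · rw [show ((i - 1 - j : ℕ) : ℤ) = i - 1 - j by omega]; ring
    · rw [← pow_add]; congr 1; omega)
  have h2 := h1.mul hδ
  convert h2 using 1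
  · ring
  · simp

lemma lead_aeval_diff {x δ : LS k} {B N : ℤ} (hB : 0 < B) {a e : k} (hx : Lead x (-B) a) (hN : -B < N) (hδ : Lead δ N e) (p : k[X]) :
    Lead (aeval (x + δ) p - aeval x p) (N - (p.natDegree - 1) * B) (p.leadingCoeff * (p.natDegree * a ^ (p.natDegree - 1) * e)) := by
  rw [aeval_eq_sum_range, aeval_eq_sum_range, ← Finset.sum_sub_distrib]
  have h := lead_sum (Finset.range (p.natDegree + 1)) (fun i => p.coeff i • (x + δ) ^ i - p.coeff i • x ^ i) (N - (p.natDegree - 1) * B)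
    (fun i => if i = p.natDegree then p.leadingCoeff * (p.natDegree * a ^ (p.natDegree - 1) * e) else 0) (by
      intro i hi
      rw [Finset.mem_range] at hi
      rw [← smul_sub, Algebra.smul_def]
      have h1 := (Lead.algebraMap (p.coeff i)).mul (lead_pow_diff hx hN hδ i)
      split_ifs with h
      · subst h
        convert h1 using 1
        · ring
        · rfl
      · apply h1.mono
        have : (i : ℤ) < p.natDegree := by exact_mod_cast (show i < p.natDegree by omega)
        nlinarith)
  simpa using h

lemma fix_unique [CharZero k] {g : k[X]} (hg : 2 ≤ g.natDegree) (γ : kˣ) {Y Y' : LS k} {B : ℤ} (hB : 0 < B) {a : k} (ha : a ≠ 0)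
    (hY : Lead Y (-B) a) (hY' : Lead Y' (-B) a) (h : aeval Y g = sbt γ g.natDegree Y)
    (h' : aeval Y' g = sbt γ g.natDegree Y') : Y' = Y := by
  by_contra hne
  have hne' : Y' - Y ≠ 0 := sub_ne_zero.mpr hne
  obtain ⟨N, e, he, hδ⟩ := exists_lead hne'
  have hN : -B < N := by
    by_contra hcon
    have h1 : Lead (Y' - Y) (-B) 0 := by simpa using hY'.sub hY
    rcases lt_or_eq_of_le (not_lt.mp hcon) with h2 | h2
    · have := h1.1 N h2; rw [hδ.2] at this; exact he this
    · rw [h2] at hδ; have := h1.2; rw [hδ.2] at this; exact he this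
  have h1 := lead_aeval_diff hB hY hN hδ g
  rw [add_sub_cancel, h, h', ← map_sub] at h1
  have h2 := lead_sbt hδ γ (show 0 < g.natDegree by omega)
  have hlc : g.leadingCoeff ≠ 0 := by rw [Ne, leadingCoeff_eq_zero]; rintro rfl; simp at hg
  have := (h1.unique h2 (mul_ne_zero hlc (mul_ne_zero (mul_ne_zero (by exact_mod_cast (by omega)) (pow_ne_zero _ ha)) he))
    (mul_ne_zero (Units.ne_zero _) he)).1
  have hg' : (2 : ℤ) ≤ g.natDegree := by exact_mod_cast hg
  nlinarith

theorem bottcher [IsAlgClosed k] [CharZero k] (p : k[X]) (hd : 2 ≤ p.natDegree) :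
    ∃ (Ψ : LS k) (a : k), a ≠ 0 ∧ Lead Ψ (-1) a ∧ aeval Ψ p = sbt 1 p.natDegree Ψ := by
  set d := p.natDegree with hdd
  have hlc : p.leadingCoeff ≠ 0 := by rw [Ne, leadingCoeff_eq_zero]; rintro rfl; simp at hdd; omega
  obtain ⟨a, ha⟩ := IsAlgClosed.exists_pow_nat_eq (p.leadingCoeff⁻¹) (show 0 < d - 1 by omega)
  have ha0 : a ≠ 0 := by
    rintro rfl
    rw [zero_pow (by omega)] at ha
    exact hlc (by simpa using ha.symm)
  have hla : p.leadingCoeff * a ^ (d - 1) = 1 := by rw [ha, mul_inv_cancel₀ hlc]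
  have hla' : p.leadingCoeff * a ^ d = a := by
    conv_rhs => rw [← one_mul a, ← hla]
    rw [mul_assoc, ← pow_succ]; congr 2; omega
  have hdk : (d : k) ≠ 0 := by exact_mod_cast (show d ≠ 0 by omega)
  let Φ : LS k → LS k := fun h => aeval h p - sbt 1 d h
  let cc : ℕ → LS k → k := fun n h => -((Φ h).coeff (n - (d - 1))) / d
  let hs : ℕ → LS k := fun n => Nat.rec (HahnSeries.single (-1) a) (fun n h => h + HahnSeries.single (n : ℤ) (cc n h)) n
  have hs0 : hs 0 = HahnSeries.single (-1) a := rfl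
  have hss : ∀ n, hs (n + 1) = hs n + HahnSeries.single (n : ℤ) (cc n (hs n)) := fun n => rfl
  have hlead : ∀ n, Lead (hs n) (-1) a ∧ ∃ e, Lead (Φ (hs n)) (n - (d - 1)) e := by
    intro n
    induction n with
    | zero =>
      have h1 : Lead (hs 0) (-1) a := by rw [hs0]; exact Lead.single _ _
      refine ⟨h1, ?_⟩
      have h2 := lead_aeval one_pos h1 p
      rw [← hdd, hla'] at h2
      have h3 := lead_sbt h1 1 (show 0 < d by omega)
      have h4 : Lead (Φ (hs 0)) (-d) 0 := by
        have := (show (-((d : ℤ) * 1)) = d * -1 by ring) ▸ h2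
        have := this.sub h3
        rw [show (d : ℤ) * -1 = -d by ring] at this
        simpa using this
      obtain ⟨e, he⟩ := h4.succ
      refine ⟨e, ?_⟩
      convert he using 1
      push_cast; ring
    | succ n ih =>
      obtain ⟨h1, e, he⟩ := ih
      have hec : cc n (hs n) = -e / d := by simp only [cc, he.2]
      set c := cc n (hs n)
      have h5 := Lead.single (n : ℤ) c
      refine ⟨by rw [hss]; simpa using h1.add (h5.mono (by omega)), ?_⟩
      have h2 := lead_aeval_diff one_pos h1 (by omega) h5 p
      have h3 := (lead_sbt h5 1 (show 0 < d by omega)).mono (show (n : ℤ) - (d - 1) * 1 < d * n by nlinarith)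
      have h4 := (he.add ((show (n : ℤ) - (d - 1) * 1 = n - (d - 1) by ring) ▸ (h2.sub h3)))
      have h6 : Φ (hs (n + 1)) = Φ (hs n) + (aeval (hs n + HahnSeries.single (n : ℤ) c) p - aeval (hs n) p - sbt 1 d (HahnSeries.single (n : ℤ) c)) := by
        simp only [Φ, hss, map_add]; ring
      rw [h6]
      have h7 : e + (p.leadingCoeff * (p.natDegree * a ^ (p.natDegree - 1) * c) - 0) = 0 := by
        rw [← hdd, hec, show p.leadingCoeff * (d * a ^ (d - 1) * (-e / d)) = (p.leadingCoeff * a ^ (d - 1)) * (d * (-e / d)) by ring, hla]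
        field_simp; ring
      rw [h7] at h4
      obtain ⟨e', he'⟩ := h4.succ
      refine ⟨e', ?_⟩
      convert he' using 1
      push_cast; ring
  let c : ℕ → k := fun n => cc n (hs n)
  let Ψ : LS k := HahnSeries.single (-1) a + ((PowerSeries.mk c : PowerSeries k) : LaurentSeries k)
  have hdiff : ∀ n : ℕ, Lead (Ψ - hs n) n (c n) := by
    intro n
    have key : ∀ n : ℕ, ∀ i : ℤ, (hs n).coeff i = (HahnSeries.single (-1) a : LS k).coeff i + if 0 ≤ i ∧ i < n then c i.natAbs else 0 := by
      intro n
      induction n with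
      | zero => intro i; rw [hs0, if_neg (by push_cast; omega), add_zero]
      | succ n ih =>
        intro i
        rw [hss, HahnSeries.coeff_add, ih, add_assoc]
        congr 1
        by_cases h : i = n
        · subst h
          rw [HahnSeries.coeff_single_same, if_neg (by omega), if_pos (by push_cast; omega)]
          simp [c]
        · rw [HahnSeries.coeff_single_of_ne h, add_zero]
          congr 1
          apply propext; push_cast; omega
    have hΨ : ∀ i : ℤ, Ψ.coeff i = (HahnSeries.single (-1) a : LS k).coeff i + if 0 ≤ i then c i.natAbs else 0 := by
      intro i
      simp only [Ψ, HahnSeries.coeff_add]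
      congr 1
      rw [PowerSeries.coeff_coe]
      by_cases h : i < 0
      · rw [if_pos h, if_neg (by omega)]
      · rw [if_neg h, if_pos (by omega), PowerSeries.coeff_mk]
    constructor
    · intro i hi
      rw [HahnSeries.coeff_sub, hΨ, key]
      by_cases h : 0 ≤ i
      · rw [if_pos h, if_pos ⟨h, hi⟩]; ring
      · rw [if_neg h, if_neg (by omega)]; ring
    · rw [HahnSeries.coeff_sub, hΨ, key, if_pos (by omega), if_neg (by omega)]
      simp
  have hΨl : Lead Ψ (-1) a := by
    have := (hdiff 0).mono (show (-1 : ℤ) < (0 : ℕ) by simp)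
    have := this.add (hlead 0).1
    simpa using this
  refine ⟨Ψ, a, ha0, hΨl, ?_⟩
  rw [← sub_eq_zero]
  ext i
  change (Φ Ψ).coeff i = 0
  obtain ⟨n, hn⟩ : ∃ n : ℕ, i < n - ((d : ℤ) - 1) := ⟨(i + d).toNat, by omega⟩
  obtain ⟨h1, e, he⟩ := hlead n
  have h2 := lead_aeval_diff one_pos h1 (by omega) (hdiff n) p
  have h3 := (lead_sbt (hdiff n) 1 (show 0 < d by omega)).mono (show (n : ℤ) - (d - 1) * 1 < d * n by nlinarith)
  have h6 : Φ Ψ = Φ (hs n) + (aeval (hs n + (Ψ - hs n)) p - aeval (hs n) p - sbt 1 d (Ψ - hs n)) := by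
    simp only [Φ, map_sub, add_sub_cancel]; ring
  rw [h6, HahnSeries.coeff_add, he.1 i hn, zero_add]
  exact (h2.sub h3).1 i (by rw [← hdd]; linarith)

end

noncomputable section
open Polynomial

section
variable {k : Type} [Field k]

lemma coeff_algMap (c : k) {n : ℤ} (hn : n ≠ 0) : (algebraMap k (LS k) c).coeff n = 0 := by
  rw [HahnSeries.algebraMap_apply, HahnSeries.C_apply, HahnSeries.coeff_single_of_ne hn]

def NSer (Ψ : LS k) : Prop := ∃ n : ℤ, 2 ≤ n ∧ Ψ.coeff n ≠ 0

lemma fixed_const {γ : kˣ} {M : ℕ} (hM : 2 ≤ M) {x : LS k} (h : sbt γ M x = x) :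
    ∃ c : k, x = algebraMap k (LS k) c := by
  refine ⟨x.coeff 0, ?_⟩
  by_contra hne
  obtain ⟨N, e, he, hl⟩ := exists_lead (sub_ne_zero.mpr hne)
  have hN : N ≠ 0 := by
    rintro rfl
    apply he
    rw [← hl.2, HahnSeries.coeff_sub, (Lead.algebraMap (x.coeff 0)).2, sub_self]
  have h1 := lead_sbt hl γ (show 0 < M by omega)
  rw [map_sub, h, AlgHom.commutes] at h1
  have := (hl.unique h1 he (mul_ne_zero (Units.ne_zero _) he)).1
  have h3 : (N : ℤ) * (M - 1) = 0 := by linarith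
  rcases mul_eq_zero.mp h3 with h4 | h4
  · exact hN h4
  · omega

lemma poly_part {Ψ : LS k} {a : k} (ha : a ≠ 0) (hΨ : Lead Ψ (-1) a) (y : LS k) :
    ∃ Q : k[X], ∃ b, Lead (y - aeval Ψ Q) 1 b := by
  have key : ∀ n : ℕ, ∀ (y : LS k) (e : k), Lead y (-n) e → ∃ Q : k[X], ∃ b, Lead (y - aeval Ψ Q) 1 b := by
    intro n
    induction n with
    | zero =>
      intro y e h
      refine ⟨C e, ?_⟩
      have h1 := h.sub (show Lead (algebraMap k (LS k) e) (-((0:ℕ):ℤ)) e by simpa using Lead.algebraMap e)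
      rw [sub_self] at h1
      simpa using h1.succ
    | succ n ih =>
      intro y e h
      have h1 := (Lead.algebraMap (e / a ^ (n+1))).mul (hΨ.pow (n+1))
      have h2 := h.sub (y := algebraMap k (LS k) (e / a ^ (n+1)) * Ψ ^ (n+1)) (b := e) (by
        convert h1 using 1
        · push_cast; ring
        · field_simp)
      rw [sub_self] at h2
      obtain ⟨e', h3⟩ := h2.succ
      obtain ⟨Q, b, hb⟩ := ih _ e' (by convert h3 using 1; push_cast; ring)
      refine ⟨C (e / a ^ (n+1)) * X ^ (n+1) + Q, b, ?_⟩
      convert hb using 1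
      simp; ring
  by_cases hy : y = 0
  · exact ⟨0, 0, by subst hy; simpa using Lead.zero 1⟩
  obtain ⟨N, e, he, hl⟩ := exists_lead hy
  rcases lt_or_ge N 1 with h | h
  · exact key N.natAbs y e (by convert hl using 1; omega)
  · rcases h.lt_or_eq with h | h
    · exact ⟨0, 0, by simpa using hl.mono h⟩
    · exact ⟨0, e, by rw [h]; simpa using hl⟩

variable [CharZero k]

lemma eul_aeval (x : LS k) (g : k[X]) : eul (aeval x g) = aeval x (derivative g) * eul x := by
  rw [Derivation.map_aeval, smul_eq_mul]

lemma NN1_of {g : k[X]} (hg : 2 ≤ g.natDegree) {γ : kˣ} {Ψ : LS k} {a : k} (ha : a ≠ 0) (hΨ : Lead Ψ (-1) a)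
    (h : aeval Ψ g = sbt γ g.natDegree Ψ) (hN : NSer Ψ) : NN1 g := by
  intro z hz
  have h1 := congrArg (aeval Ψ) hz
  simp only [map_mul, map_sub, aeval_C, aeval_X, h] at h1
  have h2 := congrArg eul h
  rw [eul_aeval, eul_sbt _ (by omega)] at h2
  set s := sbt γ g.natDegree
  have hΨz : Lead (Ψ - algebraMap k (LS k) z) (-1) a := by
    simpa using hΨ.sub ((Lead.algebraMap z).mono (by norm_num : (-1:ℤ) < 0))
  have hne := hΨz.ne_zero ha
  have hM : (g.natDegree : LS k) ≠ 0 := by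
    have : (g.natDegree : LS k) = algebraMap k (LS k) g.natDegree := by simp
    rw [this]
    exact (Lead.algebraMap _).ne_zero (by exact_mod_cast (by omega))
  have hsne : s (Ψ - algebraMap k (LS k) z) ≠ 0 := by
    rw [Ne, map_eq_zero_iff s s.toRingHom.injective]; exact hne
  have h3 : s (eul Ψ / (Ψ - algebraMap k (LS k) z)) = eul Ψ / (Ψ - algebraMap k (LS k) z) := by
    rw [map_div₀, div_eq_div_iff hsne hne]
    apply mul_left_cancel₀ hM
    rw [map_sub, AlgHom.commutes]
    rw [← mul_assoc, ← h2]
    have : (algebraMap k (LS k) (g.natDegree : k)) = (g.natDegree : LS k) := by simp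
    rw [this] at h1
    linear_combination -(eul Ψ) * h1
  obtain ⟨c, hc⟩ := fixed_const hg h3
  rw [div_eq_iff hne] at hc
  have hl := lead_eul hΨ
  rw [hc] at hl
  have h4 := ((Lead.algebraMap c).mul hΨz)
  have h5 := h4.2
  rw [zero_add, hl.2] at h5
  have hc1 : c = 1 := by
    apply mul_right_cancel₀ ha; rw [← h5]; simp
  rw [hc1, map_one, one_mul] at hc
  obtain ⟨n, hn, hn0⟩ := hN
  have h6 := congrArg (fun x => HahnSeries.coeff x n) hc
  simp only [eul_coeff, HahnSeries.coeff_sub] at h6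
  rw [coeff_algMap z (by omega), sub_zero] at h6
  have h8 : ((n : k) + 1) * Ψ.coeff n = 0 := by linear_combination -h6
  rcases mul_eq_zero.mp h8 with h9 | h9
  · have : ((n + 1 : ℤ) : k) = 0 := by push_cast; exact h9
    rw [Int.cast_eq_zero] at this; omega
  · exact hn0 h9

lemma NN2_of {g : k[X]} (hg : 2 ≤ g.natDegree) {γ : kˣ} {Ψ : LS k} {a : k} (ha : a ≠ 0) (hΨ : Lead Ψ (-1) a)
    (h : aeval Ψ g = sbt γ g.natDegree Ψ) (hN : NSer Ψ) : NN2 g := by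
  intro s1 s2 hs hz
  have h1 := congrArg (aeval Ψ) hz
  simp only [map_mul, map_sub, map_pow, aeval_C, aeval_X, h] at h1
  have h2 := congrArg eul h
  rw [eul_aeval, eul_sbt _ (by omega)] at h2
  set s := sbt γ g.natDegree
  have hΨz : ∀ z, Lead (Ψ - algebraMap k (LS k) z) (-1) a := fun z => by
    simpa using hΨ.sub ((Lead.algebraMap z).mono (by norm_num : (-1:ℤ) < 0))
  have hM : (g.natDegree : LS k) ≠ 0 := by
    have : (g.natDegree : LS k) = algebraMap k (LS k) g.natDegree := by simp
    rw [this]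
    exact (Lead.algebraMap _).ne_zero (by exact_mod_cast (by omega))
  set p := (Ψ - algebraMap k (LS k) s1) * (Ψ - algebraMap k (LS k) s2) with hp
  have hpl : Lead p (-1 + -1) (a * a) := (hΨz s1).mul (hΨz s2)
  have hne := hpl.ne_zero (mul_ne_zero ha ha)
  have hsne : s p ≠ 0 := by
    rw [Ne, map_eq_zero_iff s s.toRingHom.injective]; exact hne
  have h3 : s (eul Ψ ^ 2 / p) = eul Ψ ^ 2 / p := by
    rw [map_div₀, div_eq_div_iff hsne hne]
    apply mul_left_cancel₀ (pow_ne_zero 2 hM)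
    rw [hp]
    simp only [map_mul, map_sub, map_pow, AlgHom.commutes]
    have : (algebraMap k (LS k) (g.natDegree : k)) = (g.natDegree : LS k) := by simp
    rw [this] at h1
    linear_combination -(eul Ψ) ^ 2 * h1 - p * (aeval Ψ (derivative g) * eul Ψ + g.natDegree * s (eul Ψ)) * h2
  obtain ⟨c, hc⟩ := fixed_const hg h3
  rw [div_eq_iff hne] at hc
  have hl := (lead_eul hΨ).pow 2
  rw [hc] at hl
  have h4 := ((Lead.algebraMap c).mul hpl)
  have h5 := h4.2
  norm_num at h5
  have h5' := hl.2
  norm_num at h5'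
  rw [h5] at h5'
  have hc1 : c = 1 := by
    apply mul_right_cancel₀ (mul_ne_zero ha ha); rw [h5']; ring
  rw [hc1, map_one, one_mul] at hc
  have h6 := congrArg eul hc
  rw [hp, pow_two] at h6
  simp only [Derivation.leibniz, smul_eq_mul, map_sub, Derivation.map_algebraMap, sub_zero] at h6
  have h7 : eul Ψ ≠ 0 := (lead_eul hΨ).ne_zero (by simpa using ha)
  have h8 : eul (eul Ψ) + eul (eul Ψ) = Ψ + Ψ - algebraMap k (LS k) (s1 + s2) := by
    apply mul_left_cancel₀ h7
    rw [map_add]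
    linear_combination h6
  obtain ⟨n, hn, hn0⟩ := hN
  have h6 := congrArg (fun x => HahnSeries.coeff x n) h8
  simp only [eul_coeff, HahnSeries.coeff_sub, HahnSeries.coeff_add] at h6
  rw [coeff_algMap _ (by omega), sub_zero] at h6
  have h8 : (2 * ((n : k) + 1) * (n - 1)) * Ψ.coeff n = 0 := by linear_combination h6
  rcases mul_eq_zero.mp h8 with h9 | h9
  · have : ((2 * (n + 1) * (n - 1) : ℤ) : k) = 0 := by push_cast; exact h9
    rw [Int.cast_eq_zero] at this
    have : 0 < 2 * (n + 1) * (n - 1) := by apply mul_pos <;> omega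
    omega
  · exact hn0 h9

lemma sbt_inj (γ : kˣ) (M : ℕ) : Function.Injective (sbt γ M : LS k →ₐ[k] LS k) :=
  (sbt γ M).toRingHom.injective

theorem R1ser [IsAlgClosed k] {g : k[X]} (hg : 2 ≤ g.natDegree) {γ : kˣ} {Ψ : LS k} {a : k} (ha : a ≠ 0)
    (hΨ : Lead Ψ (-1) a) (h : aeval Ψ g = sbt γ g.natDegree Ψ) (hN : NSer Ψ) {y : LS k} (hy : Dep k Ψ y)
    (h' : aeval y g = sbt γ g.natDegree y) : ∃ Q : k[X], y = aeval Ψ Q := by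
  obtain ⟨K, s, n, τ, q, p, hn, hx, hK, -⟩ := R1gen (sbt γ g.natDegree) g hg (NN1_of hg ha hΨ h hN) (NN2_of hg ha hΨ h hN)
    Ψ y (transc_lead one_pos ha hΨ) hy h.symm h'.symm
  have hτn : Lead (τ ^ n) (-1) a := by
    have : τ ^ n = Ψ - algebraMap k (LS k) s := by rw [hx]; ring
    rw [this]
    simpa using hΨ.sub ((Lead.algebraMap s).mono (by norm_num : (-1:ℤ) < 0))
  have hτ0 : τ ≠ 0 := by
    rintro rfl; apply hτn.ne_zero ha; rw [zero_pow (by omega)]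
  obtain ⟨N, e, he, hl⟩ := exists_lead hτ0
  have h1 := ((hl.pow n).unique hτn (pow_ne_zero _ he) ha).1
  have hn1 : n = 1 := by
    have : (n : ℤ) ∣ 1 := ⟨-N, by linarith⟩
    have := Int.le_of_dvd one_pos this
    omega
  subst hn1
  set σ := sbt γ g.natDegree
  have hτ : τ = aeval Ψ (X - C s) := by
    simp only [map_sub, aeval_X, aeval_C]; nth_rewrite 1 [hx]; ring
  obtain ⟨Q, b, hb⟩ := poly_part ha hΨ y
  have hit : ∀ K : ℕ, ∀ Q : k[X], ∃ Q' : k[X], σ^[K] (aeval Ψ Q) = aeval Ψ Q' := by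
    intro K
    induction K with
    | zero => exact fun Q => ⟨Q, rfl⟩
    | succ K ih =>
      intro Q
      have : σ (aeval Ψ Q) = aeval Ψ (Q.comp g) := by
        rw [aeval_comp, h, aeval_algHom_apply]
      rw [Function.iterate_succ_apply, this]
      exact ih _
  obtain ⟨Q', hQ'⟩ := hit K Q
  have hsub : ∀ K : ℕ, ∀ u v : LS k, σ^[K] (u - v) = σ^[K] u - σ^[K] v := by
    intro K
    induction K with
    | zero => intro u v; rfl
    | succ K ih => intro u v; rw [Function.iterate_succ_apply, map_sub, ih]; rfl
  have hlead : ∀ K : ℕ, ∀ u : LS k, ∀ b, Lead u 1 b → ∃ b, Lead (σ^[K] u) 1 b := by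
    intro K
    induction K with
    | zero => intro u b h; exact ⟨b, h⟩
    | succ K ih =>
      intro u b h
      have := lead_sbt h γ (show 0 < g.natDegree by omega)
      rw [Function.iterate_succ_apply]
      refine ih _ 0 (this.mono (by push_cast; omega))
  obtain ⟨b', hb'⟩ := hlead K _ b hb
  rw [hsub, hK, hQ', hτ, ← aeval_comp, ← map_sub] at hb'
  set R := q.comp (X - C s) - Q' with hR
  have hR0 : R = 0 := by
    by_contra hne
    have h2 := lead_aeval one_pos hΨ R
    have h3 := hb'.1 (-(R.natDegree * 1)) (by omega)
    rw [h2.2] at h3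
    exact mul_ne_zero (leadingCoeff_ne_zero.mpr hne) (pow_ne_zero _ ha) h3
  refine ⟨Q, ?_⟩
  have hz : σ^[K] y = σ^[K] (aeval Ψ Q) := by
    rw [hK, hQ', hτ, ← aeval_comp, ← sub_eq_zero, ← map_sub, ← hR, hR0, map_zero]
  exact (sbt_inj γ g.natDegree).iterate K hz

lemma rigid {F : k[X]} (hF : 2 ≤ F.natDegree) {Ψ : LS k} {a : k} (ha : a ≠ 0)
    (hΨ : Lead Ψ (-1) a) (h : aeval Ψ F = sbt 1 F.natDegree Ψ) {Y : LS k} {B : ℕ} (hB : 0 < B) {b : k} (hb : b ≠ 0)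
    (hY : Lead Y (-B) b) (h' : aeval Y F = sbt 1 F.natDegree Y) :
    ∃ β : kˣ, β ^ (F.natDegree) = β ∧ Y = sbt β B Ψ := by
  have hD : 0 < F.natDegree := by omega
  set D := F.natDegree with hDdef
  have hlc : F.leadingCoeff ≠ 0 := by rw [Ne, leadingCoeff_eq_zero]; rintro rfl; simp at hDdef; omega
  have e1 : F.leadingCoeff * a ^ D = a := by
    have h1 := lead_aeval one_pos hΨ F
    rw [h] at h1
    have := (h1.unique (lead_sbt hΨ 1 hD) (mul_ne_zero hlc (pow_ne_zero _ ha)) (by simpa using ha)).2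
    simpa using this
  have e2 : F.leadingCoeff * b ^ D = b := by
    have h1 := lead_aeval (by exact_mod_cast hB) hY F
    rw [h'] at h1
    have := (h1.unique (lead_sbt hY 1 hD) (mul_ne_zero hlc (pow_ne_zero _ hb)) (by simpa using hb)).2
    simpa using this
  let β : kˣ := Units.mk0 (b / a) (div_ne_zero hb ha)
  have hβ : β ^ D = β := by
    ext
    simp only [Units.val_pow_eq_pow_val, β, Units.val_mk0]
    rw [div_pow, div_eq_div_iff (pow_ne_zero _ ha) ha]
    apply mul_left_cancel₀ hlc
    linear_combination a * e2 - b * e1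
  refine ⟨β, hβ, ?_⟩
  have hl := lead_sbt hΨ β hB
  refine fix_unique (B := B) hF 1 (by exact_mod_cast hB) hb ?_ hY ?_ h'
  · convert hl using 1
    · ring
    · simp [β]; field_simp
  · rw [aeval_algHom_apply, h, sbt_sbt _ _ hB hD, sbt_sbt _ _ hD hB, hβ]
    simp [mul_comm]
end

noncomputable section
open Polynomial

section
variable {k : Type} [Field k]

lemma cheb_eval [CharZero k] (u : k) (hu : u ≠ 0) (n : ℕ) :
    (Chebyshev.T k n).eval ((u + u⁻¹) / 2) = (u ^ n + (u⁻¹) ^ n) / 2 := by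
  induction n using Nat.twoStepInduction with
  | zero => simp
  | one => simp
  | more n h1 h2 =>
    push_cast at *
    rw [Chebyshev.T_add_two]
    simp only [eval_sub, eval_mul, eval_X, h1, h2, eval_ofNat]
    have h3 : u * u⁻¹ = 1 := mul_inv_cancel₀ hu
    have h4 : u * (u⁻¹) ^ (n+1) = (u⁻¹) ^ n := by rw [pow_succ', ← mul_assoc, h3, one_mul]
    have h5 : u⁻¹ * u ^ (n+1) = u ^ n := by rw [pow_succ', ← mul_assoc, mul_comm u⁻¹, h3, one_mul]
    linear_combination h4 / 2 + h5 / 2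

def jouk (f : k[X]) (e c κ : k) : k[X] :=
  ∑ i ∈ Finset.range (f.natDegree + 1), C (f.coeff i) * (C e * X ^ 2 + C c * X + C κ) ^ i * X ^ (f.natDegree - i)

lemma jouk_aeval (f : k[X]) (e c κ : k) {L : Type} [Field L] [Algebra k L] (t : L) (ht : t ≠ 0) :
    aeval t (jouk f e c κ) = t ^ f.natDegree * aeval (algebraMap k L e * t + algebraMap k L c + algebraMap k L κ * t⁻¹) f := by
  rw [jouk, map_sum, aeval_eq_sum_range, Finset.mul_sum]
  refine Finset.sum_congr rfl fun i hi => ?_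
  rw [Finset.mem_range] at hi
  simp only [map_mul, map_pow, map_add, aeval_C, aeval_X, Algebra.smul_def]
  have h1 : algebraMap k L e * t ^ 2 + algebraMap k L c * t + algebraMap k L κ =
    t * (algebraMap k L e * t + algebraMap k L c + algebraMap k L κ * t⁻¹) := by field_simp
  have h2 : t ^ f.natDegree = t ^ i * t ^ (f.natDegree - i) := by rw [← pow_add]; congr 1; omega
  rw [h1, h2, mul_pow]
  ring

lemma single_pow' (n : ℤ) (m : ℕ) : (HahnSeries.single n (1:k) : LS k) ^ m = HahnSeries.single (m * n) 1 := by
  rw [HahnSeries.single_pow]; simp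

lemma jouk_id (f : k[X]) (hf : 2 ≤ f.natDegree) {Ψ : LS k} {a : k} (ha : a ≠ 0) (hΨ : Lead Ψ (-1) a)
    (h : aeval Ψ f = sbt 1 f.natDegree Ψ) (hN : ¬ NSer Ψ) :
    ∀ t : k, t ≠ 0 → eval (a * t + Ψ.coeff 0 + Ψ.coeff 1 * t⁻¹) f =
      a * t ^ f.natDegree + Ψ.coeff 0 + Ψ.coeff 1 * (t⁻¹) ^ f.natDegree := by
  set d := f.natDegree with hd
  set z : LS k := HahnSeries.single (-1) 1 with hz
  have hz0 : z ≠ 0 := (Lead.single (k := k) (-1) 1).ne_zero one_ne_zero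
  have hzi : z⁻¹ = HahnSeries.single 1 1 := by
    rw [inv_eq_iff_eq_inv, eq_comm, inv_eq_iff_eq_inv]
    apply eq_inv_of_mul_eq_one_left
    rw [hz, HahnSeries.single_mul_single]; simp
  have hform : Ψ = algebraMap k (LS k) a * z + algebraMap k (LS k) (Ψ.coeff 0) + algebraMap k (LS k) (Ψ.coeff 1) * z⁻¹ := by
    rw [hzi, hz]
    ext n
    simp only [HahnSeries.coeff_add, HahnSeries.algebraMap_apply, Algebra.algebraMap_self, RingHom.id_apply, HahnSeries.C_apply,
      HahnSeries.single_mul_single, HahnSeries.coeff_single, zero_add, mul_one]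
    rcases lt_trichotomy n (-1) with h1 | h1 | h1
    · rw [hΨ.1 n h1, if_neg (by omega), if_neg (by omega), if_neg (by omega)]; simp
    · subst h1; simp [hΨ.2]
    · by_cases h0 : n = 0
      · subst h0; simp
      by_cases h0 : n = 1
      · subst h0; simp
      rw [if_neg (by omega), if_neg (by omega), if_neg (by omega)]
      simp only [NSer, not_exists, not_and, not_not] at hN
      rw [hN n (by omega)]; simp
  have hzt : Transcendental k z := transc_lead one_pos one_ne_zero (Lead.single (k := k) (-1) 1)
  set κ := Ψ.coeff 1
  set c := Ψ.coeff 0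
  have hsz : sbt 1 d z = z ^ d := by
    rw [hz, single_pow']
    ext n
    by_cases h1 : (d : ℤ) ∣ n
    · obtain ⟨j, rfl⟩ := h1
      rw [sbt_coeff _ (by omega)]
      simp only [HahnSeries.coeff_single, one_zpow, Units.val_one, one_mul]
      have : (d : ℤ) ≠ 0 := by omega
      by_cases h2 : j = -1
      · subst h2; simp
      · rw [if_neg h2, if_neg]; intro h3; exact h2 (mul_left_cancel₀ this h3)
    · rw [sbt_coeff' _ (by omega) _ _ h1, HahnSeries.coeff_single, if_neg]
      rintro rfl; exact h1 (dvd_mul_right _ _)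
  have hP : jouk f a c κ = C a * X ^ (2 * d) + C c * X ^ d + C κ := by
    apply (transcendental_iff_injective.mp hzt)
    rw [jouk_aeval _ _ _ _ _ hz0, ← hform, h]
    nth_rewrite 1 [hform]
    simp only [map_add, map_mul, map_inv₀, AlgHom.commutes, hsz, aeval_C, aeval_X, map_pow]
    rw [← hd, two_mul, pow_add]
    have := mul_inv_cancel₀ (pow_ne_zero d hz0)
    linear_combination algebraMap k (LS k) κ * this
  intro t ht
  have h1 := jouk_aeval f a c κ t ht
  rw [hP] at h1
  simp only [map_add, map_mul, aeval_C, aeval_X, map_pow, Algebra.algebraMap_self, RingHom.id_apply] at h1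
  apply mul_left_cancel₀ (pow_ne_zero d ht)
  rw [coe_aeval_eq_eval] at h1
  rw [← h1, two_mul, pow_add, inv_pow]
  have := mul_inv_cancel₀ (pow_ne_zero d ht)
  linear_combination -κ * this

theorem nser_or [IsAlgClosed k] [CharZero k] (f : k[X]) (hf : 2 ≤ f.natDegree) {Ψ : LS k} {a : k} (ha : a ≠ 0) (hΨ : Lead Ψ (-1) a)
    (h : aeval Ψ f = sbt 1 f.natDegree Ψ) (hN : ¬ NSer Ψ) :
    ∃ a b : k, a ≠ 0 ∧ ∃ g : k[X],
    ((∃ d : ℕ, g = Polynomial.X ^ d) ∨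
     (∃ d, g = Polynomial.Chebyshev.T k d) ∨
     (∃ d, g = -Polynomial.Chebyshev.T k d)) ∧
    f.comp (Polynomial.C a * Polynomial.X + Polynomial.C b) =
      (Polynomial.C a * Polynomial.X + Polynomial.C b).comp g := by
  have key := jouk_id f hf ha hΨ h hN
  set d := f.natDegree with hd
  set κ := Ψ.coeff 1
  set c := Ψ.coeff 0
  by_cases hκ : κ = 0
  · refine ⟨a, c, ha, X ^ d, Or.inl ⟨d, rfl⟩, ?_⟩
    have : ∀ t : k, t ≠ 0 → eval t (f.comp (C a * X + C c)) = eval t ((C a * X + C c).comp (X ^ d)) := by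
      intro t ht
      have := key t ht
      simpa [hκ] using this
    apply eq_of_infinite_eval_eq
    refine Set.Infinite.mono (s := {0}ᶜ) (fun t ht => this t ht) (Set.finite_singleton 0).infinite_compl
  · obtain ⟨w, hw⟩ := IsAlgClosed.exists_pow_nat_eq (κ / a) (n := 2) (by norm_num)
    have hw0 : w ≠ 0 := by rintro rfl; simp at hw; exact (div_ne_zero hκ ha) hw.symm
    have hκw : κ = a * w ^ 2 := by rw [hw]; field_simp
    have key2 : ∀ u : k, u ≠ 0 → eval (a * w * (u + u⁻¹) + c) f = a * (w ^ d * u ^ d) + c + a * (w ^ 2 * (w⁻¹) ^ d * (u⁻¹) ^ d) := by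
      intro u hu
      have := key (w * u) (mul_ne_zero hw0 hu)
      rw [hκw, mul_inv, mul_pow, mul_pow] at this
      have e : a * (w * u) + c + a * w ^ 2 * (w⁻¹ * u⁻¹) = a * w * (u + u⁻¹) + c := by field_simp; ring
      rw [e] at this
      rw [this]; ring
    have hwd : w ^ d = w ^ 2 * (w⁻¹) ^ d := by
      have h1 := key2 2 two_ne_zero
      have h2 := key2 2⁻¹ (inv_ne_zero two_ne_zero)
      rw [inv_inv, add_comm, add_comm, add_comm (2⁻¹ : k) 2] at h2
      have h3 : a * ((w ^ d - w ^ 2 * (w⁻¹) ^ d) * (2 ^ d - (2⁻¹) ^ d)) = 0 := by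
        linear_combination h2 - h1
      have h4 : (2 ^ d - (2⁻¹) ^ d : k) ≠ 0 := by
        rw [inv_pow, sub_ne_zero]
        intro h5
        have h6 : (2 : k) ^ d * 2 ^ d = 1 := by nth_rewrite 1 [h5]; exact inv_mul_cancel₀ (pow_ne_zero _ two_ne_zero)
        have h7 : 2 ^ d * 2 ^ d = 1 := by exact_mod_cast h6
        have : 1 < 2 ^ d := Nat.one_lt_two_pow (by omega)
        nlinarith
      have := (mul_eq_zero.mp h3).resolve_left ha
      exact sub_eq_zero.mp ((mul_eq_zero.mp this).resolve_right h4)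
    obtain ⟨δ, hδ, hδw⟩ : ∃ δ : k, (δ = 1 ∨ δ = -1) ∧ w ^ d = δ * w := by
      refine ⟨w ^ d / w, ?_, by field_simp⟩
      have h1 : (w ^ d / w) ^ 2 = 1 := by
        rw [div_pow, div_eq_one_iff_eq (pow_ne_zero _ hw0), pow_two (w ^ d)]
        nth_rewrite 1 [hwd]
        rw [mul_assoc, ← mul_pow, inv_mul_cancel₀ hw0, one_pow, mul_one]
      rcases mul_eq_zero.mp (show (w ^ d / w - 1) * (w ^ d / w + 1) = 0 by linear_combination h1) with h2 | h2
      · exact Or.inl (sub_eq_zero.mp h2)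
      · exact Or.inr (eq_neg_of_add_eq_zero_left h2)
    have hall : ∀ x : k, eval x (f.comp (C (2 * a * w) * X + C c)) = eval x ((C (2 * a * w) * X + C c).comp (C δ * Chebyshev.T k d)) := by
      intro x
      obtain ⟨u, hu0, hux⟩ : ∃ u : k, u ≠ 0 ∧ x = (u + u⁻¹) / 2 := by
        obtain ⟨r, hr⟩ := IsAlgClosed.exists_pow_nat_eq (x ^ 2 - 1) (n := 2) (by norm_num)
        have h1 : (x + r) * (x - r) = 1 := by linear_combination -hr
        have h0 : x + r ≠ 0 := left_ne_zero_of_mul_eq_one h1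
        refine ⟨x + r, h0, ?_⟩
        rw [← eq_inv_of_mul_eq_one_right h1]; ring
      rw [hux]
      simp only [eval_comp, eval_add, eval_mul, eval_C, eval_X, cheb_eval u hu0]
      have := key2 u hu0
      rw [← hwd, hδw] at this
      convert this using 1
      · congr 1; ring
      · ring
    refine ⟨2 * a * w, c, mul_ne_zero (mul_ne_zero two_ne_zero ha) hw0, C δ * Chebyshev.T k d, ?_, Polynomial.funext hall⟩
    rcases hδ with rfl | rfl
    · right; left; exact ⟨d, by simp⟩
    · right; right; exact ⟨d, by simp⟩
end

noncomputable section
open Polynomial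

structure Bott (k : Type) [Field k] where
  f : k[X]
  hf : 2 ≤ f.natDegree
  Ψ : LS k
  a : k
  ha : a ≠ 0
  hΨ : Lead Ψ (-1) a
  eq : aeval Ψ f = sbt 1 f.natDegree Ψ
  hN : NSer Ψ

section
variable {k : Type} [Field k]

def itp (f : k[X]) (i : ℕ) : k[X] := (fun p => f.comp p)^[i] X

lemma itp_zero (f : k[X]) : itp f 0 = X := rfl
lemma itp_succ (f : k[X]) (i : ℕ) : itp f (i+1) = f.comp (itp f i) := by
  unfold itp; rw [Function.iterate_succ_apply']

lemma itp_natDegree (f : k[X]) (i : ℕ) : (itp f i).natDegree = f.natDegree ^ i := by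
  induction i with
  | zero => simp [itp_zero]
  | succ i ih => rw [itp_succ, natDegree_comp, ih, pow_succ']

lemma itp_aeval {A : Type} [CommRing A] [Algebra k A] (f : k[X]) (i : ℕ) (x : A) :
    aeval x (itp f i) = (fun y => aeval y f)^[i] x := by
  induction i with
  | zero => simp [itp_zero]
  | succ i ih => rw [itp_succ, aeval_comp, ih, Function.iterate_succ_apply']

lemma itp_aeval_sbt {g : k[X]} (hg : 0 < g.natDegree) {γ : kˣ} {Ψ : LS k} (h : aeval Ψ g = sbt γ g.natDegree Ψ) (i : ℕ) :
    ∃ δ : kˣ, aeval Ψ (itp g i) = sbt δ (g.natDegree ^ i) Ψ ∧ (γ = 1 → δ = 1) := by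
  induction i with
  | zero => exact ⟨1, by rw [itp_zero, aeval_X, pow_zero, sbt_one], fun _ => rfl⟩
  | succ i ih =>
    obtain ⟨δ, hδ, h1⟩ := ih
    refine ⟨γ * δ ^ g.natDegree, ?_, fun h2 => by rw [h2, h1 h2]; simp⟩
    rw [itp_succ, aeval_comp, hδ, aeval_algHom_apply, h, sbt_sbt _ _ (pow_pos hg _) hg, pow_succ']

namespace Bott
variable (B : Bott k)

def d : ℕ := B.f.natDegree
lemma hd : 2 ≤ B.d := B.hf
lemma d_pos : 0 < B.d := by have := B.hd; omega

lemma it_eq (i : ℕ) : aeval B.Ψ (itp B.f i) = sbt 1 (B.d ^ i) B.Ψ := by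
  obtain ⟨δ, h, h1⟩ := itp_aeval_sbt (by have := B.hf; omega) B.eq i
  rw [h, h1 rfl]; rfl

def S (c : kˣ) (A : ℕ) : LS k := sbt c A B.Ψ

lemma S_lead (c : kˣ) {A : ℕ} (hA : 0 < A) : Lead (B.S c A) (-A) (c * B.a) := by
  have := lead_sbt B.hΨ c hA
  rw [show (A : ℤ) * -1 = -A by ring] at this
  simpa [S] using this

lemma S_one : B.S 1 1 = B.Ψ := sbt_one _

variable [CharZero k]

lemma S_transc (c : kˣ) {A : ℕ} (hA : 0 < A) : Transcendental k (B.S c A) :=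
  transc_lead (by exact_mod_cast hA) (mul_ne_zero c.ne_zero B.ha) (B.S_lead c hA)

lemma sbt_S (c e : kˣ) {A m : ℕ} (hA : 0 < A) (hm : 0 < m) : sbt e m (B.S c A) = B.S (c * e ^ A) (A * m) :=
  sbt_sbt _ _ hm hA _

def Rel (c : kˣ) (A : ℕ) (c' : kˣ) (A' : ℕ) : Prop := Dep k (B.S c A) (B.S c' A')

variable {B}

lemma Rel.symm {c c' : kˣ} {A A' : ℕ} (h : B.Rel c A c' A') : B.Rel c' A' c A := Dep.symm h

lemma Rel.trans {c c' c'' : kˣ} {A A' A'' : ℕ} (h : B.Rel c A c' A') (h' : B.Rel c' A' c'' A'') (hA : 0 < A) (hA' : 0 < A') :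
    B.Rel c A c'' A'' := Dep.trans h h' (B.S_transc _ hA) (B.S_transc _ hA')

lemma Rel.refl (c : kˣ) (A : ℕ) : B.Rel c A c A := by
  have := Dep.aeval_self (k := k) (B.S c A) X
  rwa [aeval_X] at this

lemma Rel.sub {c c' : kˣ} {A A' : ℕ} (h : B.Rel c A c' A') (hA : 0 < A) (hA' : 0 < A') (e : kˣ) {m : ℕ} (hm : 0 < m) :
    B.Rel (c * e ^ A) (A * m) (c' * e ^ A') (A' * m) := by
  have := Dep.map (sbt e m) h
  rwa [sbt_S _ _ _ hA hm, sbt_S _ _ _ hA' hm] at this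

lemma Rel.desub {c c' : kˣ} {A A' : ℕ} (hA : 0 < A) (hA' : 0 < A') (e : kˣ) {m : ℕ} (hm : 0 < m)
    (h : B.Rel (c * e ^ A) (A * m) (c' * e ^ A') (A' * m)) : B.Rel c A c' A' := by
  unfold Rel at h
  rw [← sbt_S _ _ _ hA hm, ← sbt_S _ _ _ hA' hm] at h
  exact Dep.of_map (sbt e m) h

lemma Rel.fit (c : kˣ) {A : ℕ} (hA : 0 < A) (i : ℕ) : B.Rel c A (c ^ (B.d ^ i)) (A * B.d ^ i) := by
  have h := Dep.aeval_self (k := k) (B.S c A) (itp B.f i)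
  have : aeval (B.S c A) (itp B.f i) = B.S (c ^ (B.d ^ i)) (A * B.d ^ i) := by
    unfold S
    rw [aeval_algHom_apply, it_eq, sbt_sbt _ _ hA (pow_pos B.d_pos _), one_mul, mul_comm]
  rwa [this] at h

variable (B)

lemma lin {ε : kˣ} {Q : k[X]} (h : B.S ε 1 = aeval B.Ψ Q) {n : ℕ} (hn : 2 ≤ n) (hc : B.Ψ.coeff n ≠ 0) : ε ^ (n + 1) = 1 := by
  have h1 := lead_aeval one_pos B.hΨ Q
  rw [← h] at h1
  have h2 := B.S_lead ε one_pos
  have hQ0 : Q ≠ 0 := by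
    rintro rfl
    rw [map_zero] at h
    exact (B.S_lead ε one_pos).ne_zero (mul_ne_zero ε.ne_zero B.ha) h
  have h3 := h1.unique h2 (mul_ne_zero (leadingCoeff_ne_zero.mpr hQ0) (pow_ne_zero _ B.ha)) (mul_ne_zero ε.ne_zero B.ha)
  have hdeg : Q.natDegree = 1 := by have := h3.1; push_cast at this; omega
  have hlc : Q.coeff 1 = ε := by
    have := h3.2
    rw [hdeg, pow_one, leadingCoeff, hdeg] at this
    exact mul_right_cancel₀ B.ha this
  rw [eq_X_add_C_of_natDegree_le_one hdeg.le, hlc] at h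
  simp only [map_add, map_mul, aeval_C, aeval_X] at h
  have h4 := congrArg (fun x => HahnSeries.coeff x ((n:ℕ):ℤ)) h
  have h5 := sbt_coeff ε one_pos B.Ψ n
  simp only [Nat.cast_one, one_mul] at h5
  simp only [S, h5, HahnSeries.coeff_add, ← Algebra.smul_def, HahnSeries.coeff_smul, smul_eq_mul,
    coeff_algMap _ (show ((n:ℕ):ℤ) ≠ 0 by omega), add_zero] at h4
  have h6 := mul_right_cancel₀ hc h4
  have h7 : ε ^ (-(n:ℤ)) = ε := Units.ext h6
  rw [zpow_neg, inv_eq_iff_mul_eq_one, zpow_natCast] at h7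
  rw [pow_succ, h7]

lemma lin_ex : ∃ n : ℕ, 2 ≤ n ∧ ∀ (ε : kˣ) (Q : k[X]), B.S ε 1 = aeval B.Ψ Q → ε ^ (n + 1) = 1 := by
  obtain ⟨n, hn, hc⟩ := B.hN
  obtain ⟨m, rfl⟩ := Int.eq_ofNat_of_zero_le (show 0 ≤ n by omega)
  exact ⟨m, by exact_mod_cast hn, fun ε Q h => B.lin h (by exact_mod_cast hn) hc⟩

lemma poly_of_rel [IsAlgClosed k] {g : k[X]} (hg : 2 ≤ g.natDegree) {γ : kˣ} (h : aeval B.Ψ g = B.S γ g.natDegree)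
    {c : kˣ} {A : ℕ} (hA : 0 < A) (hr : B.Rel 1 1 c A) (hc : γ * c ^ g.natDegree = c * γ ^ A) : ∃ Q : k[X], B.S c A = aeval B.Ψ Q ∧ Q.natDegree = A := by
  have : ∃ Q : k[X], B.S c A = aeval B.Ψ Q := by
    refine R1ser hg B.ha B.hΨ h B.hN (by rw [← B.S_one]; exact hr) ?_
    rw [B.sbt_S _ _ hA (by omega)]
    unfold S at *
    rw [aeval_algHom_apply, h, sbt_sbt _ _ hA (by omega), hc, mul_comm A]
  obtain ⟨Q, hQ⟩ := this
  refine ⟨Q, hQ, ?_⟩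
  have h1 := lead_aeval one_pos B.hΨ Q
  rw [← hQ] at h1
  have h2 := B.S_lead c hA
  have hQ0 : Q ≠ 0 := by
    rintro rfl
    rw [map_zero] at hQ
    exact h2.ne_zero (mul_ne_zero c.ne_zero B.ha) hQ
  have h3 := h1.unique h2 (mul_ne_zero (leadingCoeff_ne_zero.mpr hQ0) (pow_ne_zero _ B.ha)) (mul_ne_zero c.ne_zero B.ha)
  have := h3.1; push_cast at this; omega
end Bott
end

noncomputable section
open Polynomial

section
variable {k : Type} [Field k]

def RU (c : kˣ) : Prop := ∃ N : ℕ, 1 ≤ N ∧ c ^ N = 1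

lemma RU.mul {c e : kˣ} (h : RU c) (h' : RU e) : RU (c * e) := by
  obtain ⟨N, hN, h⟩ := h
  obtain ⟨M, hM, h'⟩ := h'
  exact ⟨N * M, Nat.mul_pos hN hM, by rw [mul_pow, pow_mul, h, one_pow, mul_comm N, pow_mul, h', one_pow, one_mul]⟩
lemma RU.pow {c : kˣ} (h : RU c) (i : ℕ) : RU (c ^ i) := by
  obtain ⟨N, hN, h⟩ := h
  exact ⟨N, hN, by rw [← pow_mul, mul_comm, pow_mul, h, one_pow]⟩
lemma RU.inv {c : kˣ} (h : RU c) : RU c⁻¹ := by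
  obtain ⟨N, hN, h⟩ := h
  exact ⟨N, hN, by rw [inv_pow, h, inv_one]⟩
lemma RU.one : RU (1 : kˣ) := ⟨1, le_rfl, by simp⟩
lemma RU.root [IsAlgClosed k] {c : kˣ} (h : RU c) {m : ℕ} (hm : 0 < m) : ∃ e : kˣ, e ^ m = c ∧ RU e := by
  obtain ⟨e, he⟩ := IsAlgClosed.exists_pow_nat_eq (c : k) hm
  have he0 : e ≠ 0 := by rintro rfl; rw [zero_pow (by omega)] at he; exact c.ne_zero he.symm
  obtain ⟨N, hN, h⟩ := h
  have h1 : (Units.mk0 e he0) ^ m = c := Units.ext (by simpa using he)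
  exact ⟨Units.mk0 e he0, h1, m * N, Nat.mul_pos hm hN, by rw [pow_mul, h1, h]⟩
lemma RU.of_pow {c : kˣ} {m : ℕ} (hm : 0 < m) (h : RU (c ^ m)) : RU c := by
  obtain ⟨N, hN, h⟩ := h
  exact ⟨m * N, Nat.mul_pos hm hN, by rw [pow_mul, h]⟩

lemma RU.periodic {c : kˣ} (h : RU c) (d : ℕ) : ∃ i l : ℕ, 1 ≤ l ∧ (c ^ d ^ i) ^ d ^ l = c ^ d ^ i := by
  obtain ⟨N, hN, h⟩ := h
  haveI : NeZero N := ⟨by omega⟩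
  obtain ⟨i, j, hij, he⟩ := Finite.exists_ne_map_eq_of_infinite (fun i : ℕ => ((d ^ i : ℕ) : ZMod N))
  have key : ∀ i j : ℕ, ((d ^ i : ℕ) : ZMod N) = ((d ^ j : ℕ) : ZMod N) → c ^ d ^ i = c ^ d ^ j := by
    intro i j he
    rw [ZMod.natCast_eq_natCast_iff] at he
    have := pow_eq_pow_mod (d ^ i) h
    rw [this, he, ← pow_eq_pow_mod _ h]
  rcases lt_or_gt_of_ne hij with h1 | h1
  · exact ⟨i, j - i, by omega, by rw [← pow_mul, ← pow_add, show i + (j - i) = j by omega, key i j he]⟩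
  · exact ⟨j, i - j, by omega, by rw [← pow_mul, ← pow_add, show j + (i - j) = i by omega, key i j he]⟩

namespace Bott
variable {B : Bott k} [CharZero k] [IsAlgClosed k]

def RR (B : Bott k) (A A' : ℕ) : Prop := ∃ c : kˣ, RU c ∧ B.Rel 1 A c A'

lemma RR.mul {A A' C C' : ℕ} (h : B.RR A A') (h' : B.RR C C') (hA : 0 < A) (hA' : 0 < A') (hC : 0 < C) (hC' : 0 < C') :
    B.RR (A * C) (A' * C') := by
  obtain ⟨c, hc, h⟩ := h
  obtain ⟨c', hc', h'⟩ := h'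
  obtain ⟨e, he, hre⟩ := hc.root hC
  have h1 := h.sub hA hA' 1 hC
  have h2 := h'.sub hC hC' e hA'
  rw [one_mul, he, mul_comm C A', mul_comm C' A'] at h2
  simp only [one_pow, mul_one] at h1
  exact ⟨c' * e ^ C', hc'.mul (hre.pow _), h1.trans h2 (Nat.mul_pos hA hC) (Nat.mul_pos hA' hC)⟩

lemma RR.pow {A A' : ℕ} (h : B.RR A A') (hA : 0 < A) (hA' : 0 < A') (j : ℕ) : B.RR (A ^ j) (A' ^ j) := by
  induction j with
  | zero => exact ⟨1, RU.one, by simpa using Rel.refl 1 1⟩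
  | succ j ih => rw [pow_succ, pow_succ]; exact ih.mul h (pow_pos hA _) (pow_pos hA' _) hA hA'

lemma RR.cancel {A A' C : ℕ} (h : B.RR (A * C) (A' * C)) (hA : 0 < A) (hA' : 0 < A') (hC : 0 < C) : B.RR A A' := by
  obtain ⟨c, hc, h⟩ := h
  exact ⟨c, hc, Rel.desub hA hA' 1 hC (by simpa using h)⟩

/-- Ψ(z) ~ Ψ(c z^M) with c a root of unity can be made polynomial. -/
lemma RR.poly {M : ℕ} (hM : 0 < M) (h : B.RR 1 M) : ∃ (c : kˣ) (g : k[X]), g.natDegree = M ∧ aeval B.Ψ g = B.S c M := by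
  obtain ⟨c, hc, h⟩ := h
  obtain ⟨i, l, hl, hil⟩ := hc.periodic B.d
  have hdi := pow_pos B.d_pos i
  have h1 : B.Rel 1 (1 * B.d ^ i) (c ^ B.d ^ i) (M * B.d ^ i) := by
    have h2 := (h.symm.trans (Rel.fit 1 one_pos i) hM one_pos).symm.trans (Rel.fit c hM i) (by simpa using hdi) hM
    rwa [one_pow] at h2
  have h3 : B.Rel 1 1 (c ^ B.d ^ i) M := Rel.desub one_pos hM 1 hdi (by simpa using h1)
  have hD : 2 ≤ (itp B.f l).natDegree := by
    rw [itp_natDegree]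
    calc 2 ≤ B.d := B.hd
      _ ≤ B.d ^ l := Nat.le_self_pow (by omega) _
  obtain ⟨Q, hQ, hQd⟩ := B.poly_of_rel (g := itp B.f l) hD (γ := 1) (by rw [it_eq, itp_natDegree]; rfl) hM h3 (by
    rw [itp_natDegree, one_mul, one_pow, mul_one]; exact hil)
  exact ⟨_, Q, hQd, hQ.symm⟩

lemma mc_sym {a b : ℕ} (ha : 0 < a) (hb : 0 < b) (hab : Nat.Coprime a b) {β : kˣ} (h : B.Rel 1 a β b) (r : ℕ) :
    ∀ ε : kˣ, ε ^ a ^ r = 1 → B.Rel ε 1 1 1 := by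
  induction r with
  | zero => intro ε he; rw [pow_zero, pow_one] at he; subst he; exact Rel.refl _ _
  | succ r ih =>
    intro ε he
    obtain ⟨b', hb'⟩ : ∃ b' : ℕ, (ε ^ b') ^ b = ε := by
      have hcop : Nat.Coprime b (a ^ (r+1)) := (hab.pow_left _).symm
      by_cases h1 : a ^ (r+1) = 1
      · rw [h1, pow_one] at he; exact ⟨0, by simp [he]⟩
      · obtain ⟨m, -, hm⟩ := Nat.exists_mul_mod_eq_one_of_coprime hcop (by have := pow_pos ha (r+1); omega)
        refine ⟨m, ?_⟩
        rw [← pow_mul, mul_comm, pow_eq_pow_mod _ he, hm, pow_one]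
    set ζ := ε ^ b' with hζ
    have hζa : (ζ ^ a) ^ a ^ r = 1 := by
      rw [← pow_mul, ← pow_succ', hζ, ← pow_mul, mul_comm, pow_mul, he, one_pow]
    have h1 := (ih _ hζa).sub one_pos one_pos 1 ha
    have h2 := h.sub ha hb ζ one_pos
    simp only [one_pow, mul_one, one_mul] at h1 h2
    rw [hb'] at h2
    have h3 := (h2.symm.trans h1 hb ha).trans h hb ha
    obtain ⟨e, he'⟩ := IsAlgClosed.exists_pow_nat_eq (β : k) one_pos
    exact Rel.desub one_pos one_pos β hb (by simpa [mul_comm] using h3)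

lemma exists_M {a b d : ℕ} (ha : 1 < a) (hb : 1 < b) (hab : Nat.Coprime a b) (hd : 2 ≤ d) :
    ∃ p j k' M : ℕ, p.Prime ∧ p ∣ a ∧ M * a ^ j = b ^ j * d ^ k' ∧ ¬ p ∣ M ∧ 2 ≤ M := by
  have hne : a.primeFactors.Nonempty := Nat.nonempty_primeFactors.mpr ha
  obtain ⟨p, hp, hmin⟩ := Finset.exists_min_image a.primeFactors (fun q => (d.factorization q : ℚ) / a.factorization q) hne
  have hpp := Nat.prime_of_mem_primeFactors hp
  have hpa := Nat.dvd_of_mem_primeFactors hp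
  have hpos : ∀ q ∈ a.primeFactors, 0 < a.factorization q := fun q hq =>
    (Nat.prime_of_mem_primeFactors hq).factorization_pos_of_dvd (by omega) (Nat.dvd_of_mem_primeFactors hq)
  set j := d.factorization p with hj
  set k' := a.factorization p with hk'
  have hk'0 : 0 < k' := hpos p hp
  have hdvd : a ^ j ∣ d ^ k' := by
    rw [← Nat.factorization_le_iff_dvd (by positivity) (by positivity)]
    intro q
    rw [Nat.factorization_pow, Nat.factorization_pow, Finsupp.smul_apply, Finsupp.smul_apply, smul_eq_mul, smul_eq_mul]
    by_cases hq : q ∈ a.primeFactors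
    · have := hmin q hq
      rw [div_le_div_iff₀ (by exact_mod_cast hk'0) (by exact_mod_cast hpos q hq)] at this
      have h1 : j * a.factorization q ≤ d.factorization q * k' := by exact_mod_cast this
      linarith
    · have : a.factorization q = 0 := by
        rw [← Nat.support_factorization] at hq
        exact Finsupp.notMem_support_iff.mp hq
      rw [this]; simp
  obtain ⟨m, hm⟩ := hdvd
  have hm0 : m ≠ 0 := by rintro rfl; rw [mul_zero] at hm; have := pow_pos (show 0 < d by omega) k'; omega
  have hmp : m.factorization p = 0 := by
    have := congrArg (fun n => n.factorization p) hm
    beta_reduce at this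
    rw [Nat.factorization_mul (by positivity) hm0, Nat.factorization_pow, Nat.factorization_pow, Finsupp.add_apply,
      Finsupp.smul_apply, Finsupp.smul_apply, smul_eq_mul, smul_eq_mul, ← hj, ← hk', mul_comm] at this
    omega
  have hpm : ¬ p ∣ m := fun h => by
    have := hpp.factorization_pos_of_dvd hm0 h; omega
  have hpb : ¬ p ∣ b := fun h => by
    have := Nat.dvd_gcd hpa h
    rw [hab] at this
    exact hpp.one_lt.ne' (Nat.dvd_one.mp this)
  refine ⟨p, j, k', b ^ j * m, hpp, hpa, by rw [hm]; ring, ?_, ?_⟩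
  · rw [hpp.dvd_mul]; rintro (h | h)
    · exact hpb (hpp.dvd_of_dvd_pow h)
    · exact hpm h
  · by_contra hcon
    have h1 : b ^ j * m = 1 := by
      have : 0 < b ^ j * m := by positivity
      omega
    have h2 := Nat.eq_one_of_mul_eq_one_left h1
    have h3 := Nat.eq_one_of_mul_eq_one_right h1
    have hj0 : j = 0 := by
      by_contra h4
      have := Nat.one_lt_pow h4 hb
      omega
    rw [hj0, pow_zero, one_mul] at hm
    have := Nat.one_lt_pow hk'0.ne' (show 1 < d by omega)
    omega

theorem mc {a b : ℕ} (ha : 1 < a) (hb : 1 < b) (hab : Nat.Coprime a b) {α β : kˣ} (hα : RU α) (hβ : RU β)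
    (h : B.Rel α a β b) : False := by
  obtain ⟨e, he, hre⟩ := hα.inv.root (show 0 < a by omega)
  have h0 := h.sub (by omega) (by omega) e one_pos
  rw [he, mul_inv_cancel, mul_one, mul_one] at h0
  have hβ' : RU (β * e ^ b) := hβ.mul (hre.pow _)
  obtain ⟨p, j, k', M, hp, hpa, hM, hpM, hM2⟩ := exists_M ha hb hab B.hd
  have hRd : B.RR 1 B.d := ⟨1, RU.one, by simpa using Rel.fit (B := B) 1 one_pos 1⟩
  have hR := RR.mul (RR.pow ⟨_, hβ', h0⟩ (by omega) (by omega) j) (RR.pow hRd one_pos B.d_pos k')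
    (by positivity) (by positivity) (by positivity) (pow_pos B.d_pos _)
  rw [← hM, one_pow, mul_one] at hR
  obtain ⟨c, g, hg, hgS⟩ := RR.poly (B := B) (M := M) (by omega) (RR.cancel (C := a ^ j) (by rwa [one_mul]) one_pos (by omega) (by positivity))
  obtain ⟨n0, hn0, hlin⟩ := B.lin_ex
  have hpr : n0 + 1 < p ^ (n0 + 1) := Nat.lt_pow_self hp.one_lt
  haveI : NeZero ((p ^ (n0+1) : ℕ) : k) := ⟨by exact_mod_cast (pow_pos hp.pos _).ne'⟩
  obtain ⟨ζ, hζ⟩ := HasEnoughRootsOfUnity.exists_primitiveRoot k (p ^ (n0+1))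
  obtain ⟨ε, hε⟩ : ∃ ε : kˣ, (ε : k) = ζ := ⟨Units.mk0 ζ (hζ.ne_zero (pow_pos hp.pos _).ne'), rfl⟩
  have hε' : IsPrimitiveRoot ε (p ^ (n0+1)) := by rw [← hε] at hζ; exact IsPrimitiveRoot.coe_units_iff.mp hζ
  have hs := mc_sym (by omega) (by omega) hab h0 (n0+1) ε (by
    obtain ⟨q, rfl⟩ := hpa
    rw [mul_pow, pow_mul, hε'.pow_eq_one, one_pow])
  set i := Nat.totient (p ^ (n0+1)) with hi
  have hi1 : 1 ≤ i := Nat.totient_pos.mpr (pow_pos hp.pos _)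
  have hMi : ε ^ M ^ i = ε := by
    have h1 : M ^ i ≡ 1 [MOD p ^ (n0+1)] := Nat.ModEq.pow_totient (((Nat.Prime.coprime_iff_not_dvd hp).mpr hpM).symm.pow_right _)
    rw [pow_eq_pow_mod _ hε'.pow_eq_one, h1, ← pow_eq_pow_mod _ hε'.pow_eq_one, pow_one]
  subst hg
  obtain ⟨δ, hδ, -⟩ := itp_aeval_sbt (by omega) hgS i
  obtain ⟨Q, hQ, -⟩ := B.poly_of_rel (g := itp g i) (by
      rw [itp_natDegree]
      calc 2 ≤ g.natDegree := hM2
        _ ≤ _ := Nat.le_self_pow (by omega) _) (γ := δ) (by rw [itp_natDegree]; exact hδ) one_pos hs.symm (by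
      rw [itp_natDegree, hMi, pow_one, mul_comm])
  have h5 := hlin _ _ hQ
  have h6 := hε'.dvd_of_pow_eq_one _ h5
  have := Nat.le_of_dvd (by omega) h6
  omega
end Bott
end

noncomputable section
open Polynomial

section
variable {k : Type} [Field k]

lemma aev_map {A A' : Type} [CommRing A] [Algebra k A] [CommRing A'] [Algebra k A'] (φ : A →ₐ[k] A') (x y : A) (G : k[X][X]) :
    G.aevalAeval (φ x) (φ y) = φ (G.aevalAeval x y) := by
  have : (aevalAeval (φ x) (φ y) : k[X][X] →ₐ[k] A') = φ.comp (aevalAeval x y) := by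
    apply Polynomial.algHom_ext'
    · ext; simp
    · simp
  rw [this, AlgHom.comp_apply]

lemma poly_id_of_transc {E : Type} [Field E] [Algebra k E] {t : E} (ht : Transcendental k t) {p q : k[X]}
    (h : aeval t p = aeval t q) : p = q := transcendental_iff_injective.mp ht h

namespace Bott

def IsG (B : Bott k) (g : k[X]) : Prop :=
  1 ≤ g.natDegree ∧ ∃ (c : kˣ) (l : ℕ), 1 ≤ l ∧ c ^ B.d ^ l = c ∧ aeval B.Ψ g = B.S c g.natDegree

variable {B : Bott k} [CharZero k] [IsAlgClosed k]

lemma itp_deg2 {i : ℕ} (hi : 1 ≤ i) : 2 ≤ (itp B.f i).natDegree := by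
  rw [itp_natDegree]
  calc 2 ≤ B.d := B.hd
    _ ≤ B.d ^ i := Nat.le_self_pow (by omega) _

lemma thmE_aux {G : k[X][X]} {A b : ℕ} (hA : 0 < A) (hb : 0 < b) {α β : kˣ} {i : ℕ} (hi : 1 ≤ i) (hα : α ^ B.d ^ i = α) (hβ : β ^ B.d ^ i = β)
    (hR : B.Rel α 1 β b) (h : G.aevalAeval (B.S α 1) (B.S β b) = 0) :
    ∃ g, B.IsG g ∧ G.aevalAeval (X : k[X]) g = 0 := by
  have h1 := hR.sub one_pos hb α⁻¹ one_pos
  simp only [pow_one, mul_inv_cancel, mul_one] at h1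
  set c := β * α⁻¹ ^ b with hc
  have hcD : c ^ B.d ^ i = c := by
    rw [hc, mul_pow, hβ, ← pow_mul, mul_comm b, pow_mul, inv_pow, hα]
  obtain ⟨Q, hQ, hQd⟩ := B.poly_of_rel (g := itp B.f i) (itp_deg2 hi) (γ := 1) (by rw [it_eq, itp_natDegree]; rfl) hb h1 (by
    rw [itp_natDegree, one_mul, one_pow, mul_one]; exact hcD)
  refine ⟨Q, ⟨by omega, c, i, hi, hcD, by rw [hQd]; exact hQ.symm⟩, ?_⟩
  have h2 := aev_map (sbt α⁻¹ 1) (B.S α 1) (B.S β b) G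
  rw [h, map_zero, B.sbt_S _ _ one_pos one_pos, B.sbt_S _ _ hb one_pos, mul_one, pow_one, mul_one, mul_inv_cancel, ← hc, hQ, S_one] at h2
  have h3 := aev_map (aeval B.Ψ) (X : k[X]) Q G
  rw [aeval_X, h2] at h3
  have ht : Transcendental k B.Ψ := by have := B.S_transc 1 one_pos; rwa [S_one] at this
  exact poly_id_of_transc ht (by rw [← h3, map_zero])

theorem thmE {E : Type} [Field E] [Algebra k E] (σ : E →ₐ[k] E) (x y : E) (hx : Transcendental k x) (hy : Transcendental k y)
    {i : ℕ} (hi : 1 ≤ i) (hσx : σ x = aeval x (itp B.f i)) (hσy : σ y = aeval y (itp B.f i)) {G : k[X][X]} (hG : G ≠ 0)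
    (hGxy : G.aevalAeval x y = 0) :
    ∃ g, B.IsG g ∧ (G.aevalAeval (X : k[X]) g = 0 ∨ G.aevalAeval g (X : k[X]) = 0) := by
  set F := itp B.f i with hF
  have hF2 : 2 ≤ F.natDegree := itp_deg2 hi
  have hFD : F.natDegree = B.d ^ i := itp_natDegree _ _
  have hFΨ : aeval B.Ψ F = sbt 1 F.natDegree B.Ψ := by rw [hFD, it_eq]
  obtain ⟨K, s, n, τ, q, p, hn, hxτ, hK, hστ⟩ := R1gen σ F hF2 (NN1_of hF2 B.ha B.hΨ hFΨ B.hN) (NN2_of hF2 B.ha B.hΨ hFΨ B.hN)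
    x y hx ⟨G, hG, hGxy⟩ hσx hσy
  have hτ : Transcendental k τ := by
    intro h
    apply hx
    rw [hxτ]
    exact (isAlgebraic_algebraMap s).add (h.pow n)
  -- x = (C s + X^n)(τ)
  have hxτ' : x = aeval τ (C s + X ^ n) := by simp [hxτ]
  have e1 : (C s + X ^ n).comp p = F.comp (C s + X ^ n) := by
    apply poly_id_of_transc hτ
    rw [aeval_comp, aeval_comp, ← hxτ', ← hστ, aeval_algHom_apply, ← hxτ', hσx]
  have hiterF : ∀ j, σ^[j] (aeval y F) = aeval (σ^[j] y) F := by
    intro j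
    induction j with
    | zero => rfl
    | succ j ih => rw [Function.iterate_succ_apply', ih, Function.iterate_succ_apply', aeval_algHom_apply]
  have hiterx : ∀ j, σ^[j] x = aeval x (itp F j) := by
    intro j
    induction j with
    | zero => simp [itp_zero]
    | succ j ih => rw [Function.iterate_succ_apply', ih, ← aeval_algHom_apply, hσx, itp_aeval F j, itp_aeval F (j+1), Function.iterate_succ_apply]
  have e2 : q.comp p = F.comp q := by
    apply poly_id_of_transc hτ
    rw [aeval_comp, aeval_comp, ← hK, ← hiterF, ← hσy, ← Function.iterate_succ_apply, Function.iterate_succ_apply', hK, ← hστ, aeval_algHom_apply]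
  have hdn : (C s + X ^ n : k[X]).natDegree = n := by
    rw [add_comm, natDegree_X_pow_add_C]
  have hpd : p.natDegree = F.natDegree := by
    have := congrArg natDegree e1
    rw [natDegree_comp, natDegree_comp, hdn, mul_comm] at this
    exact mul_right_cancel₀ (show n ≠ 0 by omega) this
  have hq1 : 1 ≤ q.natDegree := by
    by_contra hcon
    have h0 : q.natDegree = 0 := by omega
    rw [eq_C_of_natDegree_eq_zero h0, aeval_C] at hK
    have hinj : Function.Injective σ^[K] := σ.toRingHom.injective.iterate K
    have hc : ∀ j c, σ^[j] (algebraMap k E c) = algebraMap k E c := by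
      intro j c
      induction j with
      | zero => rfl
      | succ j ih => rw [Function.iterate_succ_apply', ih, AlgHom.commutes]
    apply hy
    rw [hinj (hK.trans (hc K _).symm)]
    exact isAlgebraic_algebraMap _
  obtain ⟨Φ, a', ha', hΦ, hΦp⟩ := bottcher p (by omega)
  rw [hpd] at hΦp
  set b := q.natDegree with hb
  have hlq : q.leadingCoeff ≠ 0 := by rw [Ne, leadingCoeff_eq_zero]; rintro rfl; simp at hb; omega
  set X' := aeval Φ (C s + X ^ n) with hX'
  set Y' := aeval Φ q with hY'
  have hX'l := lead_aeval one_pos hΦ (C s + X ^ n)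
  have hY'l := lead_aeval one_pos hΦ q
  rw [hdn, mul_one] at hX'l
  rw [mul_one] at hY'l
  have hlc : (C s + X ^ n : k[X]).leadingCoeff ≠ 0 := by
    rw [Ne, leadingCoeff_eq_zero]; intro h0; rw [h0] at hdn; simp at hdn; omega
  obtain ⟨α, hα, hXα⟩ := rigid hF2 B.ha B.hΨ hFΨ (Y := X') (B := n) hn (mul_ne_zero hlc (pow_ne_zero _ ha')) hX'l (by
    rw [hX', ← aeval_comp, ← e1, aeval_comp, hΦp, aeval_algHom_apply])
  obtain ⟨β, hβ, hYβ⟩ := rigid hF2 B.ha B.hΨ hFΨ (Y := Y') (B := b) hq1 (mul_ne_zero hlq (pow_ne_zero _ ha')) hY'l (by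
    rw [hY', ← aeval_comp, ← e2, aeval_comp, hΦp, aeval_algHom_apply])
  change X' = B.S α n at hXα
  change Y' = B.S β b at hYβ
  -- transfer G
  have hG1 : ∀ H : k[X][X], H.aevalAeval x y = 0 → H.aevalAeval ((itp F K).comp (C s + X ^ n)) q = 0 := by
    intro H hH
    have h1 : σ^[K] (H.aevalAeval x y) = H.aevalAeval (σ^[K] x) (σ^[K] y) := by
      clear hK
      induction K with
      | zero => rfl
      | succ j ih => simp only [Function.iterate_succ_apply', aev_map, ih]
    have hz : σ^[K] (0 : E) = 0 := by
      have : ∀ j : ℕ, σ^[j] (0 : E) = 0 := by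
        intro j; induction j with
        | zero => rfl
        | succ j ih => rw [Function.iterate_succ_apply', ih, map_zero]
      exact this K
    rw [hH, hz, hiterx, hK, hxτ', ← aeval_comp, aev_map] at h1
    exact poly_id_of_transc hτ (by rw [← h1, map_zero])
  have hXK : aeval Φ ((itp F K).comp (C s + X ^ n)) = B.S α (n * B.d ^ (i * K)) := by
    rw [aeval_comp, ← hX', hXα]
    obtain ⟨δ, hδ, hδ1⟩ := itp_aeval_sbt (by omega) hFΨ K
    rw [S, aeval_algHom_apply, hδ, hδ1 rfl, sbt_sbt _ _ hn (pow_pos (by omega) _), one_mul, hFD, ← pow_mul, mul_comm n, S]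
    congr 2
    have : ∀ j, α ^ (B.d ^ (i * j)) = α := by
      intro j
      induction j with
      | zero => simp
      | succ j ih => rw [mul_add, mul_one, pow_add, pow_mul, ih, ← hFD, hα]
    exact this K
  set A := n * B.d ^ (i * K) with hAdef
  have hA : 0 < A := Nat.mul_pos hn (pow_pos B.d_pos _)
  have hG2 : ∀ H : k[X][X], H.aevalAeval x y = 0 → H.aevalAeval (B.S α A) (B.S β b) = 0 := by
    intro H hH
    rw [← hXK, ← hYβ, hY', aev_map, hG1 H hH, map_zero]
  set u := Nat.gcd A b with hu
  have hu0 : 0 < u := Nat.gcd_pos_of_pos_left _ hA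
  obtain ⟨A', hA'⟩ : u ∣ A := Nat.gcd_dvd_left _ _
  obtain ⟨b', hb'⟩ : u ∣ b := Nat.gcd_dvd_right _ _
  have hA'0 : 0 < A' := Nat.pos_of_ne_zero (by rintro rfl; simp at hA'; omega)
  have hb'0 : 0 < b' := Nat.pos_of_ne_zero (by rintro rfl; simp at hb'; omega)
  have hcop : Nat.Coprime A' b' := by
    have h1 : u * Nat.gcd A' b' = u * 1 := by rw [← Nat.gcd_mul_left, ← hA', ← hb', mul_one]
    exact mul_left_cancel₀ hu0.ne' h1
  have hG3 : G.aevalAeval (B.S α A') (B.S β b') = 0 := by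
    apply (map_eq_zero_iff (sbt 1 u) (sbt_inj 1 u)).mp
    rw [← aev_map, B.sbt_S _ _ hA'0 hu0, B.sbt_S _ _ hb'0 hu0]
    simp only [one_pow, mul_one]
    rw [mul_comm A', mul_comm b', ← hA', ← hb']
    exact hG2 G hGxy
  have hR : B.Rel α A' β b' := ⟨G, hG, hG3⟩
  have hru : ∀ c : kˣ, c ^ F.natDegree = c → RU c := by
    intro c hc
    refine ⟨F.natDegree - 1, by omega, ?_⟩
    apply mul_right_cancel (b := c)
    rw [← pow_succ, show F.natDegree - 1 + 1 = F.natDegree by omega, hc, one_mul]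
  have hor : A' = 1 ∨ b' = 1 := by
    by_contra hcon
    push Not at hcon
    exact mc (by omega) (by omega) hcop (hru α hα) (hru β hβ) hR
  rw [hFD] at hα hβ
  rcases hor with h1 | h1
  · subst h1
    obtain ⟨g, hg, h2⟩ := thmE_aux (B := B) one_pos hb'0 hi hα hβ hR hG3
    exact ⟨g, hg, Or.inl h2⟩
  · subst h1
    have := Bivariate.aevalAeval_swap (B.S β 1) (B.S α A') G
    rw [hG3] at this
    obtain ⟨g, hg, h2⟩ := thmE_aux (B := B) (G := Bivariate.swap G) one_pos hA'0 hi hβ hα hR.symm this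
    rw [Bivariate.aevalAeval_swap] at h2
    exact ⟨g, hg, Or.inr h2⟩

lemma IsG.comm {g : k[X]} (h : B.IsG g) : ∃ l, 1 ≤ l ∧ g.comp (itp B.f l) = (itp B.f l).comp g := by
  obtain ⟨h1, c, l, hl, hc, hg⟩ := h
  refine ⟨l, hl, ?_⟩
  have ht : Transcendental k B.Ψ := by have := B.S_transc 1 one_pos; rwa [S_one] at this
  apply poly_id_of_transc ht
  rw [aeval_comp, aeval_comp, hg, it_eq, aeval_algHom_apply, hg, B.sbt_S _ _ h1 (pow_pos B.d_pos _)]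
  unfold S
  rw [aeval_algHom_apply, it_eq, sbt_sbt _ _ h1 (pow_pos B.d_pos _), one_mul, hc, one_pow, mul_one, mul_comm]

theorem finite_G (m : ℕ) : {g : k[X] | B.IsG g ∧ g.natDegree = m}.Finite := by
  by_cases hm : m = 0
  · subst hm
    convert Set.finite_empty (α := k[X])
    ext g; simp [IsG]; intro h1; omega
  by_contra hinf
  have hinf : {g : k[X] | B.IsG g ∧ g.natDegree = m}.Infinite := hinf
  obtain ⟨n0, hn0, hlin⟩ := B.lin_ex
  have ht : Transcendental k B.Ψ := by have := B.S_transc 1 one_pos; rwa [S_one] at this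
  obtain ⟨g0, ⟨⟨hg0, c0, l0, hl0, hc0, hS0⟩, hgm0⟩⟩ := hinf.nonempty
  -- every g has c with (c/c0)^(n0+1) = 1
  have key : ∀ g : k[X], B.IsG g → g.natDegree = m → ∃ c : kˣ, c ^ (m * (n0 + 1)) = c0 ^ (m * (n0 + 1)) ∧ aeval B.Ψ g = B.S c m := by
    rintro g ⟨hg, c, l, hl, hc, hS⟩ hgm
    rw [hgm] at hS hg
    rw [hgm0] at hS0
    refine ⟨c, ?_, hS⟩
    have hr : B.Rel c m c0 m := by
      have h1 := Dep.aeval_self (k := k) B.Ψ g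
      have h2 := Dep.aeval_self (k := k) B.Ψ g0
      rw [hS, ] at h1
      rw [hS0] at h2
      exact h1.symm.trans h2 (B.S_transc c hg) ht
    have hil : ∀ (c : kˣ) (l : ℕ), c ^ B.d ^ l = c → ∀ j, c ^ B.d ^ (l * j) = c := by
      intro c l hc j
      induction j with
      | zero => simp
      | succ j ih => rw [mul_add, mul_one, pow_add, pow_mul, ih, hc]
    -- c c0⁻¹ = ε ; choose e with e^m = c0⁻¹
    set ε := c * c0⁻¹ with hε
    have hr' : B.Rel 1 1 ε 1 := by
      obtain ⟨e, he, -⟩ := RU.root (k := k) (c := c0⁻¹) (by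
        apply RU.inv
        refine ⟨B.d ^ l0 - 1, ?_, ?_⟩
        · have : 2 ≤ B.d ^ l0 := by have := itp_deg2 (B := B) hl0; rwa [itp_natDegree] at this
          omega
        · apply mul_right_cancel (b := c0)
          rw [← pow_succ, Nat.sub_add_cancel (pow_pos B.d_pos _), hc0, one_mul]) (show 0 < m by omega)
      have h1 := hr.sub (by omega) (by omega) e one_pos
      rw [he, mul_inv_cancel] at h1
      refine (Rel.desub one_pos one_pos 1 (m := m) (by omega) ?_).symm
      simpa using h1
    have hεl : ε ^ B.d ^ (l * l0) = ε := by
      rw [hε, mul_pow, inv_pow, hil c l hc, mul_comm l, hil c0 l0 hc0]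
    obtain ⟨Q, hQ, -⟩ := B.poly_of_rel (g := itp B.f (l * l0)) (itp_deg2 (Nat.mul_pos hl hl0)) (γ := 1) (by rw [it_eq, itp_natDegree]; rfl) one_pos hr' (by
      rw [itp_natDegree, one_mul, one_pow, mul_one]; exact hεl)
    have := hlin ε Q hQ
    rw [mul_comm m, pow_mul, pow_mul]
    congr 1
    rw [hε, mul_pow, inv_pow, mul_inv_eq_one] at this
    exact this
  choose! c hc hcS using key
  apply hinf
  have hN : 0 < m * (n0 + 1) := Nat.mul_pos (by omega) (by omega)
  refine Set.Finite.of_finite_image (f := fun g => (c g : k)) ?_ ?_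
  · refine ((nthRootsFinset (m * (n0+1)) ((c0 ^ (m * (n0 + 1)) : kˣ) : k)).finite_toSet).subset ?_
    rintro _ ⟨g, ⟨hg, hgm⟩, rfl⟩
    rw [Finset.mem_coe, mem_nthRootsFinset hN, ← hc g hg hgm]
    simp
  · rintro g ⟨hg, hgm⟩ g' ⟨hg', hgm'⟩ he
    apply poly_id_of_transc ht
    rw [hcS g hg hgm, hcS g' hg' hgm', Units.ext he]
end Bott
end

noncomputable section
open Polynomial

section
variable {k : Type} [Field k]

/-- `h` involves both variables. -/
def Dep2 (h : k[X][X]) : Prop :=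
  ∀ p : k[X], p ≠ 0 → ¬ h ∣ aeval (C X : k[X][X]) p ∧ ¬ h ∣ aeval (X : k[X][X]) p

lemma aeval_CX (p : k[X]) : aeval (C X : k[X][X]) p = C p := by
  have : (aeval (C X : k[X][X]) : k[X] →ₐ[k] k[X][X]) = (CAlgHom : k[X] →ₐ[k[X]] k[X][X]).restrictScalars k := by
    ext; simp
  rw [this]; rfl

lemma prod_form {G : k[X][X]} (hG : G ≠ 0) (h : ∀ p, Prime p → p ∣ G → ¬ Dep2 p) :
    ∃ a b : k[X], G = aeval (C X : k[X][X]) a * aeval (X : k[X][X]) b := by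
  revert h
  refine UniqueFactorizationMonoid.induction_on_prime (P := fun G => (∀ p, Prime p → p ∣ G → ¬ Dep2 p) →
    ∃ a b : k[X], G = aeval (C X : k[X][X]) a * aeval (X : k[X][X]) b) G ?_ ?_ ?_
  · exact fun _ => ⟨0, 0, by simp⟩
  · intro u hu _
    obtain ⟨r, hr, hr2⟩ := Polynomial.isUnit_iff.mp hu
    exact ⟨r, 1, by rw [aeval_CX, hr2]; simp⟩
  · intro a p ha hp ih h
    obtain ⟨b, c, hbc⟩ := ih (fun q hq hqa => h q hq (hqa.mul_left _))
    have h1 := h p hp (dvd_mul_right _ _)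
    rw [Dep2] at h1
    push Not at h1
    obtain ⟨q, hq, h2⟩ := h1
    by_cases h3 : p ∣ aeval (C X : k[X][X]) q
    · rw [aeval_CX] at h3
      have : p.natDegree = 0 := by
        have := Polynomial.natDegree_le_of_dvd h3 (by simpa using hq)
        simpa using this
      rw [Polynomial.natDegree_eq_zero] at this
      obtain ⟨r, hr⟩ := this
      refine ⟨r * b, c, ?_⟩
      rw [hbc, ← hr, map_mul, aeval_CX r, mul_assoc]
    · have h4 := h2 h3
      obtain ⟨w, hw⟩ := h4
      have h5 : (C q : k[X][X]) = Bivariate.swap p * Bivariate.swap w := by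
        rw [← map_mul, ← hw, ← aeval_CX, ← Polynomial.aeval_algHom_apply]
        congr 1
        simp [Bivariate.swap_apply]
      have : (Bivariate.swap p).natDegree = 0 := by
        have := Polynomial.natDegree_le_of_dvd (Dvd.intro _ h5.symm) (by simpa using hq)
        simpa using this
      rw [Polynomial.natDegree_eq_zero] at this
      obtain ⟨r, hr⟩ := this
      refine ⟨b, r * c, ?_⟩
      have : p = aeval (X : k[X][X]) r := by
        rw [← Bivariate.swap_swap_apply p, ← hr, ← aeval_CX, ← Polynomial.aeval_algHom_apply]
        congr 1
        simp [Bivariate.swap_apply]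
      rw [hbc, this, map_mul]; ring

/-- substitution of `F` in both variables -/
def sub2 (F : k[X]) : k[X][X] →ₐ[k] k[X][X] := aevalAeval (aeval (C X : k[X][X]) F) (aeval (X : k[X][X]) F)

lemma sub2_X (F : k[X]) (p : k[X]) : sub2 F (aeval (C X : k[X][X]) p) = aeval (C X : k[X][X]) (p.comp F) := by
  rw [← Polynomial.aeval_algHom_apply, aeval_comp, sub2, aevalAeval_X]
lemma sub2_Y (F : k[X]) (p : k[X]) : sub2 F (aeval (X : k[X][X]) p) = aeval (X : k[X][X]) (p.comp F) := by
  rw [← Polynomial.aeval_algHom_apply, aeval_comp, sub2, aevalAeval_Y]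

lemma sub2_dvd (F : k[X]) {a b : k[X][X]} (h : a ∣ b) : sub2 F a ∣ sub2 F b := by
  obtain ⟨c, rfl⟩ := h
  exact ⟨sub2 F c, map_mul _ _ _⟩

lemma cyc {F : k[X]} (hF : 1 ≤ F.natDegree) {G : k[X][X]} (hG : G ≠ 0) (hdvd : G ∣ sub2 F G)
    {p : k[X][X]} (hp : Prime p) (hpG : p ∣ G) (hp2 : Dep2 p) :
    ∃ h : k[X][X], Prime h ∧ Dep2 h ∧ h ∣ G ∧ ∃ r, 1 ≤ r ∧ h ∣ (sub2 F)^[r] h := by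
  classical
  obtain ⟨s, hsp, hsG⟩ := UniqueFactorizationMonoid.exists_prime_factors G hG
  let T := {h : k[X][X] // h ∈ s ∧ Dep2 h}
  have hfin : Finite T := (s.toFinset.finite_toSet.subset (t := {h | h ∈ s ∧ Dep2 h}) (fun h hh => by simpa using hh.1)).to_subtype
  have hpr : ∀ h : T, Prime h.1 := fun h => hsp _ h.2.1
  have hTG : ∀ h : T, h.1 ∣ G := fun h => (Multiset.dvd_prod h.2.1).trans hsG.dvd
  have hstep : ∀ h : T, ∃ h' : T, h.1 ∣ sub2 F h'.1 := by
    intro h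
    have h1 : h.1 ∣ sub2 F s.prod := by
      refine (hTG h).trans (hdvd.trans ?_)
      exact sub2_dvd F hsG.symm.dvd
    rw [map_multiset_prod] at h1
    obtain ⟨q, hq, hq2⟩ := (hpr h).exists_mem_multiset_map_dvd h1
    refine ⟨⟨q, hq, ?_⟩, hq2⟩
    intro w hw
    have hw' : w.comp F ≠ 0 := by
      intro h0
      rw [Polynomial.comp_eq_zero_iff] at h0
      rcases h0 with h0 | h0
      · exact hw h0
      · rw [h0.2] at hF; simp at hF
    constructor
    · intro hd
      apply (h.2.2 _ hw').1
      rw [← sub2_X]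
      exact hq2.trans (sub2_dvd F hd)
    · intro hd
      apply (h.2.2 _ hw').2
      rw [← sub2_Y]
      exact hq2.trans (sub2_dvd F hd)
  choose t ht using hstep
  have hiter : ∀ (n : ℕ) (h : T), h.1 ∣ (sub2 F)^[n] (t^[n] h).1 := by
    intro n
    induction n with
    | zero => intro h; simp
    | succ n ih =>
      intro h
      rw [Function.iterate_succ_apply', Function.iterate_succ_apply]
      exact (ht h).trans (sub2_dvd F (ih (t h)))
  have hT0 : Nonempty T := by
    obtain ⟨q, hq, hpq'⟩ := hp.exists_mem_multiset_dvd (hpG.trans hsG.symm.dvd)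
    have hpq : Associated p q := hp.irreducible.associated_of_dvd (hsp q hq).irreducible hpq'
    refine ⟨⟨q, hq, fun w hw => ?_⟩⟩
    obtain ⟨h1, h2⟩ := hp2 w hw
    exact ⟨fun h => h1 (hpq.dvd.trans h), fun h => h2 (hpq.dvd.trans h)⟩
  obtain ⟨h0⟩ := hT0
  obtain ⟨m, n, hmn, he⟩ := Finite.exists_ne_map_eq_of_infinite (fun n => t^[n] h0)
  wlog hlt : m < n generalizing m n
  · exact this n m hmn.symm he.symm (by omega)
  refine ⟨(t^[m] h0).1, hpr _, (t^[m] h0).2.2, hTG _, n - m, by omega, ?_⟩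
  have := hiter (n - m) (t^[m] h0)
  rw [← Function.iterate_add_apply, Nat.sub_add_cancel hlt.le] at this
  beta_reduce at he
  rwa [← he] at this

lemma sub2_iter_X (F : k[X]) (r : ℕ) : (sub2 F)^[r] (C X) = aeval (C X : k[X][X]) (itp F r) := by
  induction r with
  | zero => simp [itp_zero]
  | succ r ih =>
    rw [Function.iterate_succ_apply', ih, sub2_X, aeval_comp, itp_aeval, itp_aeval, ← Function.iterate_succ_apply (fun y => aeval y F)]

lemma sub2_iter_Y (F : k[X]) (r : ℕ) : (sub2 F)^[r] X = aeval (X : k[X][X]) (itp F r) := by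
  induction r with
  | zero => simp [itp_zero]
  | succ r ih =>
    rw [Function.iterate_succ_apply', ih, sub2_Y, aeval_comp, itp_aeval, itp_aeval, ← Function.iterate_succ_apply (fun y => aeval y F)]

lemma itp_itp (f : k[X]) (i r : ℕ) : itp (itp f i) r = itp f (i * r) := by
  have h1 := itp_aeval (itp f i) r (X : k[X])
  have h2 := itp_aeval f (i * r) (X : k[X])
  have h3 : (fun y : k[X] => aeval y (itp f i)) = (fun y => aeval y f)^[i] := by
    funext y; exact itp_aeval f i y
  rw [h3, ← Function.iterate_mul, ← h2] at h1
  simpa using h1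

end
end

noncomputable section
open Polynomial

section
variable {k : Type} [Field k]

lemma alg_aeval {R A : Type} [CommRing R] [IsDomain R] [CommRing A] [Algebra R A] {y : A} (hy : IsAlgebraic R y) (q : R[X]) :
    IsAlgebraic R (aeval y q) := 
  Algebra.isAlgebraic_adjoin_singleton_iff.mpr hy _ (aeval_mem_adjoin_singleton _ _)

lemma abs_quot {R : Type} [CommRing R] [IsDomain R] [Algebra k R] {h : R} (hp : Prime h) : 
    ∃ (A : Type) (_ : CommRing A) (_ : IsDomain A) (_ : Algebra k A) (π : R →ₐ[k] A), Function.Surjective π ∧ (∀ z, π z = 0 ↔ h ∣ z) ∧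
      ∀ Φ : R →ₐ[k] R, h ∣ Φ h → ∃ σ0 : A →ₐ[k] A, ∀ z, σ0 (π z) = π (Φ z) := by
  haveI : (Ideal.span {h}).IsPrime := (Ideal.span_singleton_prime hp.ne_zero).mpr hp
  have hπ : ∀ z, Ideal.Quotient.mkₐ k (Ideal.span {h}) z = 0 ↔ h ∣ z := fun z => by
    rw [← Ideal.mem_span_singleton]; exact Ideal.Quotient.eq_zero_iff_mem
  refine ⟨R ⧸ Ideal.span {h}, inferInstance, inferInstance, inferInstance, Ideal.Quotient.mkₐ k _, Ideal.Quotient.mkₐ_surjective k _, hπ, ?_⟩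
  intro Φ hΦ
  refine ⟨Ideal.Quotient.liftₐ _ ((Ideal.Quotient.mkₐ k _).comp Φ) ?_, fun z => rfl⟩
  intro a ha
  obtain ⟨c, rfl⟩ := Ideal.mem_span_singleton.mp ha
  rw [AlgHom.comp_apply, hπ, map_mul]
  exact hΦ.mul_right _

lemma quot_hA {A : Type} [CommRing A] [IsDomain A] [Algebra k A] (π : k[X][X] →ₐ[k] A) (hs : Function.Surjective π)
    {h : k[X][X]} (h0 : h ≠ 0) (hh : π h = 0) (a : A) (ha : a ≠ 0) :
    ∃ w : k[X], w ≠ 0 ∧ a ∣ aeval (π (C X)) w := by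
  letI : Algebra k[X] A := (π.toRingHom.comp C).toAlgebra
  have hal : ∀ w : k[X], algebraMap k[X] A w = π (C w) := fun w => rfl
  let π' : k[X][X] →ₐ[k[X]] A := { π.toRingHom with commutes' := fun r => rfl }
  have hπ' : ∀ z, π' z = π z := fun z => rfl
  have hae : ∀ q : k[X][X], aeval (π X) q = π q := fun q => by
    rw [← hπ', Polynomial.aeval_algHom_apply, aeval_X_left_apply, hπ']
  have hY : IsAlgebraic k[X] (π X) := ⟨h, h0, by rw [hae, hh]⟩
  obtain ⟨q, rfl⟩ := hs a
  have h2 := alg_aeval hY q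
  rw [hae] at h2
  have h1 := Ideal.comap_ne_bot_of_algebraic_mem (I := Ideal.span {π q}) ha (Ideal.mem_span_singleton_self _) h2
  rw [Ne, Submodule.eq_bot_iff] at h1
  push Not at h1
  obtain ⟨w, hw, hw0⟩ := h1
  refine ⟨w, hw0, ?_⟩
  rw [Polynomial.aeval_algHom_apply, aeval_CX]
  exact Ideal.mem_span_singleton.mp hw

theorem Bott.E2_abs [CharZero k] [IsAlgClosed k] (B : Bott k) {A : Type} [CommRing A] [IsDomain A] [Algebra k A] (x y : A)
    (hx : Transcendental k x) (hy : Transcendental k y) (σ0 : A →ₐ[k] A) {i : ℕ} (hi : 1 ≤ i)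
    (hσx : σ0 x = aeval x (itp B.f i)) (hσy : σ0 y = aeval y (itp B.f i))
    (hA : ∀ a : A, a ≠ 0 → ∃ w : k[X], w ≠ 0 ∧ a ∣ aeval x w) {G : k[X][X]} (hG : G ≠ 0) (hGxy : G.aevalAeval x y = 0) :
    ∃ g, B.IsG g ∧ (G.aevalAeval (X : k[X]) g = 0 ∨ G.aevalAeval g (X : k[X]) = 0) := by
  set F := itp B.f i with hF
  have hFd' : 2 ≤ F.natDegree := itp_deg2 hi
  have hinj : Function.Injective σ0 := by
    rw [injective_iff_map_eq_zero]
    intro a ha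
    by_contra hne
    obtain ⟨w, hw, b, hb⟩ := hA a hne
    have h2 : σ0 (aeval x w) = 0 := by rw [hb, map_mul, ha, zero_mul]
    rw [← Polynomial.aeval_algHom_apply, hσx, ← aeval_comp] at h2
    have h0 := (transcendental_iff.mp hx) _ h2
    rw [Polynomial.comp_eq_zero_iff] at h0
    rcases h0 with h0 | h0
    · exact hw h0
    · rw [h0.2] at hFd'; simp at hFd'
  let E := FractionRing A
  let ι : A →ₐ[k] E := IsScalarTower.toAlgHom k A E
  have hι : Function.Injective ι := IsFractionRing.injective A E
  have hg : Function.Injective (ι.comp σ0) := hι.comp hinj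
  let σ : E →ₐ[k] E := IsFractionRing.liftAlgHom (K := E) (g := ι.comp σ0) hg
  have hσ : ∀ z, σ (ι z) = ι (σ0 z) := fun z => by
    exact IsFractionRing.lift_algebraMap (K := E) (g := (ι.comp σ0).toRingHom) hg z
  have key : ∀ w : A, Transcendental k w → Transcendental k (ι w) := by
    intro w hw
    rintro ⟨q, hq, hq2⟩
    apply hw 
    refine ⟨q, hq, ?_⟩
    apply hι
    rw [← Polynomial.aeval_algHom_apply, hq2, map_zero]
  refine B.thmE σ (ι x) (ι y) (key _ hx) (key _ hy) hi ?_ ?_ hG ?_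
  · rw [hσ, hσx, ← Polynomial.aeval_algHom_apply]
  · rw [hσ, hσy, ← Polynomial.aeval_algHom_apply]
  · rw [aev_map, hGxy, map_zero]

theorem Bott.E2 [CharZero k] [IsAlgClosed k] (B : Bott k) {i : ℕ} (hi : 1 ≤ i) {G : k[X][X]} (hG : G ≠ 0) (hdvd : G ∣ sub2 (itp B.f i) G)
    {p : k[X][X]} (hp : Prime p) (hpG : p ∣ G) (hp2 : Dep2 p) :
    ∃ g, B.IsG g ∧ (G.aevalAeval (X : k[X]) g = 0 ∨ G.aevalAeval g (X : k[X]) = 0) := by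
  have hFd : 2 ≤ (itp B.f i).natDegree := itp_deg2 hi
  obtain ⟨h, hh, hh2, hhG, r, hr, hdr⟩ := cyc (by omega) hG hdvd hp hpG hp2
  have hir : 1 ≤ i * r := Nat.one_le_iff_ne_zero.mpr (by positivity)
  have hX := sub2_iter_X (itp B.f i) r
  have hY := sub2_iter_Y (itp B.f i) r
  rw [itp_itp] at hX hY
  let ΦR : k[X][X] →ₐ[k] k[X][X] := (sub2 (itp B.f i)) ^ r
  have hΦ : ∀ z, ΦR z = (sub2 (itp B.f i))^[r] z := by
    intro z
    exact congrFun (AlgHom.coe_pow _ _) z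
  obtain ⟨A, _, _, _, π, hsur, hπ, hlift⟩ := abs_quot (k := k) hh
  obtain ⟨σ0, hσ0⟩ := hlift ΦR (by rw [hΦ]; exact hdr)
  have key : ∀ w : k[X][X], (∀ q : k[X], q ≠ 0 → ¬ h ∣ aeval w q) → Transcendental k (π w) := by
    intro w hw
    rintro ⟨q, hq, hq2⟩
    apply hw q hq
    rw [← hπ, ← Polynomial.aeval_algHom_apply, hq2]
  refine B.E2_abs (π (C X)) (π X) (key _ fun q hq => (hh2 q hq).1) (key _ fun q hq => (hh2 q hq).2) σ0 hir ?_ ?_ (quot_hA π hsur hh.ne_zero ((hπ h).mpr dvd_rfl)) hG ?_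
  · rw [hσ0, hΦ, hX, ← Polynomial.aeval_algHom_apply]
  · rw [hσ0, hΦ, hY, ← Polynomial.aeval_algHom_apply]
  · rw [aev_map]
    have : G.aevalAeval (C X : k[X][X]) X = G := by
      have : (aevalAeval (C X : k[X][X]) X : k[X][X] →ₐ[k] k[X][X]) = AlgHom.id k _ := by
        apply Polynomial.algHom_ext'
        · ext; simp
        · simp
      rw [this]; rfl
    rw [this, (hπ G).mpr hhG]

/-- degree bound -/
lemma deg_bound {G : k[X][X]} (hG : G ≠ 0) {N : ℕ} (hN : ∀ j, (G.coeff j).natDegree ≤ N) {g : k[X]} 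
    (h : G.aevalAeval (X : k[X]) g = 0) : g.natDegree ≤ N := by
  by_contra hlt
  push Not at hlt
  have h1 : G.aevalAeval (X : k[X]) g = G.sum (fun e c => c * g ^ e) := by
    have : (aevalAeval (X : k[X]) g : k[X][X] →ₐ[k] k[X]) = (aeval g : k[X][X] →ₐ[k[X]] k[X]).restrictScalars k := by
      apply Polynomial.algHom_ext'
      · ext; simp
      · simp
    rw [this]
    simp [aeval_eq_sum_range, Polynomial.sum_over_range]
  have hg0 : g ≠ 0 := by rintro rfl; simp at hlt
  have hdeg : ∀ e, G.coeff e ≠ 0 → (G.coeff e * g ^ e).natDegree = (G.coeff e).natDegree + e * g.natDegree := by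
    intro e he
    rw [natDegree_mul he (pow_ne_zero _ hg0), natDegree_pow]
  have h2 : (G.sum (fun e c => c * g ^ e)).degree = G.support.sup (fun e => (G.coeff e * g ^ e).degree) := by
    apply Polynomial.degree_sum_eq_of_disjoint
    intro e he e' he' hne heq
    simp only [Set.mem_setOf_eq, mem_support_iff] at he he'
    have := hdeg e he.1
    have h4 := hdeg e' he'.1
    have h5 : (G.coeff e * g ^ e).natDegree = (G.coeff e' * g ^ e').natDegree := natDegree_eq_of_degree_eq heq
    rw [this, h4] at h5
    have a1 := hN e
    have a2 := hN e'
    apply hne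
    rcases lt_trichotomy e e' with hl | hl | hl
    · nlinarith
    · exact hl
    · nlinarith
  rw [← h1, h, degree_zero] at h2
  have h3 : G.natDegree ∈ G.support := by simpa using hG
  have h4 := Finset.le_sup (f := fun e => (G.coeff e * g ^ e).degree) h3
  rw [← h2, le_bot_iff, degree_eq_bot, mul_eq_zero] at h4
  rcases h4 with h4 | h4
  · exact mem_support_iff.mp h3 h4
  · exact pow_ne_zero _ hg0 h4

end
end

noncomputable section
open Polynomial

section
variable {k : Type} [Field k]

lemma itp_add_eval (f : k[X]) (i : ℕ) (x : k) : eval x (itp f i) = (fun y => eval y f)^[i] x := by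
  have := itp_aeval f i x
  simpa [Polynomial.coe_aeval_eq_eval] using this

lemma rm_two [CharZero k] {h : k[X]} (hd : 2 ≤ h.natDegree) {ζ : k} (hζ : eval ζ h = ζ)
    (hl : (derivative h).eval ζ ^ 2 = 1 → (derivative h).eval ζ = 1) :
    (h.comp h - X).rootMultiplicity ζ ≤ (h - X).rootMultiplicity ζ := by
  have hne : h - X ≠ 0 := by
    intro h0; rw [sub_eq_zero] at h0; rw [h0] at hd; simp at hd
  have hd2 : (h.comp h).natDegree = h.natDegree * h.natDegree := natDegree_comp
  have hne2 : h.comp h - X ≠ 0 := by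
    intro h0; rw [sub_eq_zero] at h0; rw [h0] at hd2; rw [natDegree_X] at hd2; nlinarith
  have hroot : (h - X).IsRoot ζ := by simp [hζ]
  have hpos := (rootMultiplicity_pos hne).mpr hroot
  by_cases h1 : (derivative h).eval ζ = 1
  · obtain ⟨u, hu, hu2⟩ := Polynomial.exists_eq_pow_rootMultiplicity_mul_and_not_dvd (h - X) hne ζ
    set e := (h - X).rootMultiplicity ζ with he
    have he2 : 1 < e := by
      rw [he, Polynomial.one_lt_rootMultiplicity_iff_isRoot hne]
      exact ⟨hroot, by simp [h1]⟩
    have huζ : u.eval ζ ≠ 0 := fun h0 => hu2 (dvd_iff_isRoot.mpr h0)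
    clear_value e
    obtain ⟨e', rfl⟩ : ∃ e', e = e' + 2 := ⟨e - 2, by omega⟩
    set v := (1 + (X - C ζ) ^ (e' + 1) * u) ^ (e' + 2) * u.comp h + u with hv
    have h3 : h = X + (X - C ζ) ^ (e' + 2) * u := by rw [← hu]; ring
    have h4 : (h - X).comp h = (h - C ζ) ^ (e' + 2) * u.comp h := by rw [hu]; simp
    have h5 : h - C ζ = (X - C ζ) * (1 + (X - C ζ) ^ (e' + 1) * u) := by
      calc h - C ζ = X + (X - C ζ) ^ (e' + 2) * u - C ζ := by rw [← h3]
        _ = _ := by ring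
    have h6 : h.comp h - X = (X - C ζ) ^ (e' + 2) * v := by
      have : h.comp h - X = (h - X).comp h + (h - X) := by simp
      rw [this, h4, h5, hv, hu, mul_pow, mul_add, mul_assoc]
    have hvζ : v.eval ζ ≠ 0 := by
      have : v.eval ζ = 2 * u.eval ζ := by
        rw [hv]; simp [eval_comp, hζ]; ring
      rw [this]; exact mul_ne_zero two_ne_zero huζ
    by_contra hlt
    push Not at hlt
    have h7 : (X - C ζ) ^ (e' + 3) ∣ h.comp h - X := (le_rootMultiplicity_iff hne2).mp hlt
    rw [h6, pow_succ] at h7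
    have h8 := (mul_dvd_mul_iff_left (pow_ne_zero (e' + 2) (X_sub_C_ne_zero ζ))).mp h7
    exact hvζ (dvd_iff_isRoot.mp h8)
  · by_contra hlt
    push Not at hlt
    have : 1 < (h.comp h - X).rootMultiplicity ζ := by omega
    rw [Polynomial.one_lt_rootMultiplicity_iff_isRoot hne2] at this
    have h2 := this.2
    simp only [derivative_sub, derivative_comp, derivative_X, IsRoot.def, eval_sub, eval_mul, eval_comp, hζ, eval_one] at h2
    exact h1 (hl (by linear_combination h2))

lemma itp_deriv (f : k[X]) {ζ : k} (i : ℕ) (h : eval ζ f = ζ) : (derivative (itp f i)).eval ζ = (derivative f).eval ζ ^ i ∧ eval ζ (itp f i) = ζ := by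
  induction i with
  | zero => simp [itp_zero]
  | succ i ih => 
    rw [itp_succ, derivative_comp]
    simp [eval_comp, ih.1, ih.2, h, pow_succ, mul_comm]

theorem per_infinite [CharZero k] [IsAlgClosed k] (f : k[X]) (hf : 2 ≤ f.natDegree) :
    {ζ : k | ∃ m, 1 ≤ m ∧ eval ζ (itp f m) = ζ}.Infinite := by
  intro hfin
  classical
  set S := hfin.toFinset with hS
  have hmem : ∀ ζ, ζ ∈ S ↔ ∃ m, 1 ≤ m ∧ eval ζ (itp f m) = ζ := fun ζ => by simp [hS]
  have hex : ∀ ζ : k, ∃ m, 1 ≤ m ∧ (ζ ∈ S → eval ζ (itp f m) = ζ) := by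
    intro ζ
    by_cases h : ζ ∈ S
    · obtain ⟨m, h1, h2⟩ := (hmem ζ).mp h
      exact ⟨m, h1, fun _ => h2⟩
    · exact ⟨1, le_rfl, fun h' => absurd h' h⟩
  choose m hm1 hm2 using hex
  set N := ∏ ζ ∈ S, m ζ with hN
  have hNpos : 1 ≤ N := Nat.one_le_iff_ne_zero.mpr (Finset.prod_ne_zero_iff.mpr (fun ζ _ => by have := hm1 ζ; omega))
  have hfix : ∀ ζ ∈ S, eval ζ (itp f N) = ζ := by
    intro ζ hζ
    obtain ⟨c, hc⟩ := Finset.dvd_prod_of_mem m hζ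
    rw [hN, hc, ← itp_itp]
    exact (itp_deriv _ _ (hm2 ζ hζ)).2
  set g := itp f N with hg
  let o : k → ℕ := fun ζ => max 1 (orderOf ((derivative g).eval ζ))
  set O := ∏ ζ ∈ S, o ζ with hO
  have hOpos : 1 ≤ O := Nat.one_le_iff_ne_zero.mpr (Finset.prod_ne_zero_iff.mpr (fun ζ _ => by
    have : 1 ≤ o ζ := le_max_left _ _
    omega))
  set h := itp g O with hh
  have hgd : 2 ≤ g.natDegree := by
    rw [hg, itp_natDegree]
    exact hf.trans (Nat.le_self_pow (by omega) _)
  have hhd : 2 ≤ h.natDegree := by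
    rw [hh, itp_natDegree]
    exact hgd.trans (Nat.le_self_pow (by omega) _)
  have hhe : h = itp f (N * O) := by rw [hh, hg, itp_itp]
  have hle : ∀ ζ ∈ S, (h.comp h - X).rootMultiplicity ζ ≤ (h - X).rootMultiplicity ζ := by
    intro ζ hζ
    obtain ⟨h1, h2⟩ := itp_deriv g O (hfix ζ hζ)
    refine rm_two hhd h2 ?_
    rw [hh, h1]
    intro h3
    set l := (derivative g).eval ζ with hl
    have h4 : 0 < orderOf l := by
      rw [orderOf_pos_iff, isOfFinOrder_iff_pow_eq_one]
      exact ⟨O * 2, by omega, by rw [pow_mul]; exact h3⟩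
    have h5 : orderOf l ∣ O := by
      have : o ζ = orderOf l := max_eq_right h4
      rw [← this]
      exact Finset.dvd_prod_of_mem o hζ
    exact orderOf_dvd_iff_pow_eq_one.mp h5
  have hd2 : (h.comp h).natDegree = h.natDegree * h.natDegree := natDegree_comp
  have hcard : ∀ q : k[X], 2 ≤ q.natDegree → Multiset.card (q - X).roots = q.natDegree := by
    intro q hq
    rw [IsAlgClosed.card_roots_eq_natDegree]
    exact natDegree_sub_eq_left_of_natDegree_lt (by rw [natDegree_X]; omega)
  have hlem : (h.comp h - X).roots ≤ (h - X).roots := by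
    rw [Multiset.le_iff_count]
    intro ζ
    rw [count_roots, count_roots]
    by_cases hζ : ζ ∈ S
    · exact hle ζ hζ
    · rw [rootMultiplicity_eq_zero]
      · exact Nat.zero_le _
      · intro hr
        apply hζ
        rw [hmem]
        refine ⟨N * O * 2, by nlinarith, ?_⟩
        rw [← itp_itp, ← hhe]
        simp only [itp_succ, itp_zero, comp_X]
        simpa [sub_eq_zero] using hr
  have := Multiset.card_le_card hlem
  rw [hcard _ hhd, hcard _ (by rw [hd2]; nlinarith), hd2] at this
  nlinarith
end
end

noncomputable section
open Polynomial

section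
variable {k : Type} [Field k]

def DB (N : ℕ) (G : k[X][X]) : Prop := ∀ j, (G.coeff j).natDegree ≤ N

lemma DB.mul {N M : ℕ} {G H : k[X][X]} (h : DB N G) (h' : DB M H) : DB (N + M) (G * H) := by
  intro j
  rw [coeff_mul]
  refine natDegree_sum_le_of_forall_le _ _ (fun x _ => ?_)
  exact natDegree_mul_le.trans (add_le_add (h _) (h' _))
lemma DB.one : DB 0 (1 : k[X][X]) := by
  intro j; rw [coeff_one]; split_ifs <;> simp
lemma DB.pow {N : ℕ} {G : k[X][X]} (h : DB N G) (e : ℕ) : DB (e * N) (G ^ e) := by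
  induction e with
  | zero => simpa using DB.one
  | succ e ih => rw [pow_succ, Nat.succ_mul]; exact ih.mul h
lemma DB.prod {ι : Type} (s : Finset ι) {N : ι → ℕ} {G : ι → k[X][X]} (h : ∀ i ∈ s, DB (N i) (G i)) : DB (∑ i ∈ s, N i) (∏ i ∈ s, G i) := by
  classical
  induction s using Finset.induction_on with
  | empty => simpa using DB.one
  | insert a s ha ih =>
    rw [Finset.sum_insert ha, Finset.prod_insert ha]
    exact (h a (Finset.mem_insert_self _ _)).mul (ih fun i hi => h i (Finset.mem_insert_of_mem hi))
lemma DB.sum {ι : Type} (s : Finset ι) {N : ℕ} {G : ι → k[X][X]} (h : ∀ i ∈ s, DB N (G i)) : DB N (∑ i ∈ s, G i) := by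
  intro j
  rw [finset_sum_coeff]
  exact natDegree_sum_le_of_forall_le _ _ (fun x hx => h x hx j)
lemma DB.mono {N M : ℕ} {G : k[X][X]} (h : DB N G) (hNM : N ≤ M) : DB M G := fun j => (h j).trans hNM

variable {ι : Type} [DecidableEq ι]

def v2 (i j : ι) (P : ι → k) (l : ι) : k[X][X] := if l = i then C X else if l = j then X else C (C (P l))
def FP (i j : ι) (P : ι → k) : MvPolynomial ι k →ₐ[k] k[X][X] := MvPolynomial.aeval (v2 i j P)

lemma FP_DB (i j : ι) (P : ι → k) (F : MvPolynomial ι k) : DB F.totalDegree (FP i j P F) := by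
  rw [FP, MvPolynomial.aeval_def, MvPolynomial.eval₂_eq]
  refine DB.sum _ fun s hs => ?_
  have h1 : DB (k := k) 0 (algebraMap k k[X][X] (F.coeff s)) := by
    intro j
    have : algebraMap k k[X][X] (F.coeff s) = C (C (F.coeff s)) := rfl
    rw [this, coeff_C]; split_ifs <;> simp
  have hv : ∀ l, DB 1 (v2 i j P l) := by
    intro l m
    rw [v2]
    split_ifs
    · rw [coeff_C]; split_ifs <;> simp
    · rw [coeff_X]; split_ifs <;> simp
    · rw [coeff_C]; split_ifs <;> simp
  refine (h1.mul (DB.prod s.support (fun l _ => (hv l).pow (s l)))).mono ?_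
  have := MvPolynomial.le_totalDegree hs
  simpa [Finsupp.sum] using this

lemma FP_swap {i j : ι} (hij : i ≠ j) (P : ι → k) (F : MvPolynomial ι k) : Bivariate.swap (FP i j P F) = FP j i P F := by
  have : ((Bivariate.swap : k[X][X] ≃ₐ[k] k[X][X]) : k[X][X] →ₐ[k] k[X][X]).comp (FP i j P) = FP j i P := by
    apply MvPolynomial.algHom_ext
    intro l
    simp only [FP, AlgHom.comp_apply, MvPolynomial.aeval_X, v2]
    by_cases h1 : l = i
    · subst h1; simp [hij, Bivariate.swap_apply]
    · by_cases h2 : l = j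
      · simp [h1, h2, Bivariate.swap_apply, hij.symm]
      · simp [h1, h2, Bivariate.swap_C_C]
  exact congrArg (fun φ => φ F) this

def phiS (Q : k[X]) : MvPolynomial ι k →ₐ[k] MvPolynomial ι k := MvPolynomial.aeval (fun i => aeval (MvPolynomial.X i : MvPolynomial ι k) Q)

lemma FP_phi (i j : ι) (P : ι → k) (Q : k[X]) (hP : ∀ l, eval (P l) Q = P l) (F : MvPolynomial ι k) :
    FP i j P (phiS Q F) = sub2 Q (FP i j P F) := by
  have : (FP i j P).comp (phiS Q) = (sub2 Q).comp (FP i j P) := by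
    apply MvPolynomial.algHom_ext
    intro l
    simp only [AlgHom.comp_apply, phiS, MvPolynomial.aeval_X]
    rw [← Polynomial.aeval_algHom_apply]
    simp only [FP, MvPolynomial.aeval_X, v2]
    split_ifs
    · rw [sub2, aevalAeval_X]
    · rw [sub2, aevalAeval_Y]
    · have h1 : (C (C (P l)) : k[X][X]) = algebraMap k k[X][X] (P l) := rfl
      rw [h1, AlgHom.commutes, aeval_algebraMap_apply, coe_aeval_eq_eval, hP]
  exact congrArg (fun φ => φ F) this

def sbs (j : ι) (q : MvPolynomial ι k) : MvPolynomial ι k →ₐ[k] MvPolynomial ι k :=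
  MvPolynomial.aeval (fun l => if l = j then q else MvPolynomial.X l)

lemma eval_sbs (j : ι) (q F : MvPolynomial ι k) (P : ι → k) :
    MvPolynomial.eval P (sbs j q F) = MvPolynomial.eval (Function.update P j (MvPolynomial.eval P q)) F := by
  have : (MvPolynomial.aeval P).comp (sbs j q) = (MvPolynomial.aeval (Function.update P j (MvPolynomial.eval P q)) : MvPolynomial ι k →ₐ[k] k) := by
    apply MvPolynomial.algHom_ext
    intro l
    simp only [AlgHom.comp_apply, sbs, MvPolynomial.aeval_X, Function.update_apply]
    split_ifs <;> simp [MvPolynomial.aeval_eq_eval]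
  exact congrArg (fun φ => φ F) this

lemma FP_eval {i j : ι} (hij : i ≠ j) (P : ι → k) (x y : k) (F : MvPolynomial ι k) :
    (FP i j P F).aevalAeval x y = MvPolynomial.eval (Function.update (Function.update P i x) j y) F := by
  have : (aevalAeval x y).comp (FP i j P) = (MvPolynomial.aeval (Function.update (Function.update P i x) j y) : MvPolynomial ι k →ₐ[k] k) := by
    apply MvPolynomial.algHom_ext
    intro l
    simp only [AlgHom.comp_apply, FP, MvPolynomial.aeval_X, v2, Function.update_apply]
    by_cases h1 : l = i
    · subst h1; simp [hij]
    · by_cases h2 : l = j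
      · simp [h1, h2, hij.symm]
      · simp [h1, h2]
  exact congrArg (fun φ => φ F) this

lemma FP_g {i j : ι} (hij : i ≠ j) (P : ι → k) (g : k[X]) (F : MvPolynomial ι k) (h : (FP i j P F).aevalAeval (X : k[X]) g = 0) :
    MvPolynomial.eval P (sbs j (aeval (MvPolynomial.X i : MvPolynomial ι k) g) F) = 0 := by
  have h1 := aev_map (aeval (P i) : k[X] →ₐ[k] k) X g (FP i j P F)
  rw [h, map_zero, FP_eval hij] at h1
  rw [eval_sbs]
  have : MvPolynomial.eval P (aeval (MvPolynomial.X i : MvPolynomial ι k) g) = aeval (P i) g := by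
    rw [← MvPolynomial.aeval_eq_eval, ← Polynomial.aeval_algHom_apply]; simp
  rw [this]
  convert h1 using 3
  simp

lemma dvd_sub_sbs (j : ι) (q F : MvPolynomial ι k) : MvPolynomial.X j - q ∣ F - sbs j q F := by
  rw [← Ideal.mem_span_singleton, ← Ideal.Quotient.eq]
  have : (Ideal.Quotient.mkₐ k (Ideal.span {MvPolynomial.X j - q})) = (Ideal.Quotient.mkₐ k (Ideal.span {MvPolynomial.X j - q})).comp (sbs j q) := by
    apply MvPolynomial.algHom_ext
    intro l
    simp only [AlgHom.comp_apply, sbs, MvPolynomial.aeval_X]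
    split_ifs with h
    · subst h
      exact Ideal.Quotient.eq.mpr (Ideal.mem_span_singleton_self _)
    · rfl
  exact congrArg (fun φ => φ F) this

lemma assoc_of_sbs {F : MvPolynomial ι k} (hF : Irreducible F) {j : ι} {q : MvPolynomial ι k} (h : sbs j q F = 0)
    (P : ι → k) (hP : MvPolynomial.eval P q = P j) : Associated F (MvPolynomial.X j - q) := by
  have h1 := dvd_sub_sbs j q F
  rw [h, sub_zero] at h1
  refine ((hF.dvd_iff.mp h1).resolve_left ?_)
  intro hu
  have := hu.map (MvPolynomial.eval P)
  simp [hP] at this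
end
end

noncomputable section
open Polynomial

section
variable {k : Type} [Field k]
variable {ι : Type} [DecidableEq ι]

lemma sbs_not_dvd {F : MvPolynomial ι k} {i : ι} (hi : i ∈ F.vars) (s : k) (h0 : sbs i (MvPolynomial.C s) F ≠ 0) :
    ¬ F ∣ sbs i (MvPolynomial.C s) F := by
  rintro ⟨q, hq⟩
  have h1 : sbs i (MvPolynomial.C s) F ∈ MvPolynomial.supported k ({i}ᶜ : Set ι) := by
    clear hq h0 hi
    induction F using MvPolynomial.induction_on with
    | C a => rw [← MvPolynomial.algebraMap_eq, AlgHom.commutes]; exact Subalgebra.algebraMap_mem _ _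
    | add p q hp hq => rw [map_add]; exact add_mem hp hq
    | mul_X p l hp =>
      rw [map_mul]
      refine mul_mem hp ?_
      rw [sbs, MvPolynomial.aeval_X]
      split_ifs with h
      · rw [← MvPolynomial.algebraMap_eq]; exact Subalgebra.algebraMap_mem _ _
      · exact MvPolynomial.X_mem_supported.mpr (by simpa using h)
  rw [MvPolynomial.mem_supported] at h1
  have h2 : MvPolynomial.degreeOf i (sbs i (MvPolynomial.C s) F) = 0 := by
    by_contra hne
    exact h1 (MvPolynomial.mem_vars_iff_degreeOf_ne_zero.mpr hne) rfl
  have hF0 : F ≠ 0 := by rintro rfl; simp at h0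
  have hq0 : q ≠ 0 := by rintro rfl; rw [mul_zero] at hq; exact h0 hq
  rw [hq, MvPolynomial.degreeOf_mul_eq hF0 hq0] at h2
  have h3 : MvPolynomial.degreeOf i F = 0 := by omega
  exact MvPolynomial.mem_vars_iff_degreeOf_ne_zero.mp hi h3

variable [Fintype ι] [CharZero k] [IsAlgClosed k]

theorem redC (B : Bott k) {F : MvPolynomial ι k} (hF : Irreducible F) {K : ℕ} (hK : 1 ≤ K) (hd : F ∣ phiS (itp B.f K) F) :
    (∃ i ζ, Associated F (MvPolynomial.X i - MvPolynomial.C ζ) ∧ eval ζ (itp B.f K) = ζ) ∨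
    ∃ i j g, i ≠ j ∧ B.IsG g ∧ Associated F (MvPolynomial.X j - aeval (MvPolynomial.X i) g) := by
  classical
  by_cases hone : ∃ (i : ι) (p : k[X]), p ≠ 0 ∧ F ∣ aeval (MvPolynomial.X i : MvPolynomial ι k) p
  · left
    obtain ⟨i, p, hp, hdp⟩ := hone
    rw [(IsAlgClosed.splits p).eq_prod_roots, map_mul, aeval_C] at hdp
    have h1 : F ∣ aeval (MvPolynomial.X i : MvPolynomial ι k) (Multiset.map (fun a => X - C a) p.roots).prod := by
      rcases hF.prime.dvd_or_dvd hdp with h | h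
      · exfalso
        apply hF.not_isUnit
        exact isUnit_of_dvd_unit h ((isUnit_iff_ne_zero.mpr (leadingCoeff_ne_zero.mpr hp)).map (algebraMap k (MvPolynomial ι k)))
      · exact h
    rw [map_multiset_prod, Multiset.map_map] at h1
    obtain ⟨ζ, hζ, h2⟩ := hF.prime.exists_mem_multiset_map_dvd h1
    simp only [Function.comp_apply, map_sub, aeval_X, aeval_C, MvPolynomial.algebraMap_eq] at h2
    obtain ⟨r, hr⟩ := h2
    have hsb : sbs i (MvPolynomial.C ζ) F = 0 := by
      have h3 := congrArg (sbs i (MvPolynomial.C ζ)) hr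
      rw [map_sub, map_mul] at h3
      have h4 : sbs i (MvPolynomial.C ζ) (MvPolynomial.X i) - sbs i (MvPolynomial.C ζ) (MvPolynomial.C ζ) = 0 := by
        simp [sbs, ← MvPolynomial.algebraMap_eq]
      rw [h4] at h3
      rcases mul_eq_zero.mp h3.symm with h5 | h5
      · exact h5
      · by_contra hne
        -- `r` is then divisible by `X i - C ζ`
        have h6 := dvd_sub_sbs i (MvPolynomial.C ζ) r
        rw [h5, sub_zero] at h6
        obtain ⟨w, hw⟩ := h6
        rw [hw] at hr
        have h7 : (MvPolynomial.X i - MvPolynomial.C ζ : MvPolynomial ι k) ≠ 0 := by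
          intro h0
          have := congrArg (MvPolynomial.eval (fun _ => ζ + 1)) h0
          simp at this
        apply hF.not_isUnit
        apply IsUnit.of_mul_eq_one w
        apply mul_left_cancel₀ h7
        linear_combination -hr
    have hass : Associated F (MvPolynomial.X i - MvPolynomial.C ζ) := assoc_of_sbs hF hsb (fun _ => ζ) (by simp)
    refine ⟨i, ζ, hass, ?_⟩
    obtain ⟨w, hw⟩ := hd
    have h8 := congrArg (MvPolynomial.eval (Function.update (0 : ι → k) i ζ)) hw
    have hFz : ∀ P : ι → k, MvPolynomial.eval P F = 0 ↔ P i = ζ := by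
      intro P
      obtain ⟨u, hu⟩ := hass
      have h9 := congrArg (MvPolynomial.eval P) hu
      simp only [map_mul, map_sub, MvPolynomial.eval_X, MvPolynomial.eval_C] at h9
      have h10 : MvPolynomial.eval P (u : MvPolynomial ι k) ≠ 0 := (u.isUnit.map (MvPolynomial.eval P)).ne_zero
      constructor
      · intro h; rw [h, zero_mul] at h9; exact (sub_eq_zero.mp h9.symm)
      · intro h; rw [h, sub_self] at h9; exact (mul_eq_zero.mp h9).resolve_right h10
    rw [map_mul, (hFz _).mpr (by simp), zero_mul] at h8
    have h11 : ∀ P : ι → k, MvPolynomial.eval P (phiS (itp B.f K) F) = MvPolynomial.eval (fun l => eval (P l) (itp B.f K)) F := by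
      intro P
      have : (MvPolynomial.aeval P).comp (phiS (itp B.f K)) = (MvPolynomial.aeval (fun l => eval (P l) (itp B.f K)) : MvPolynomial ι k →ₐ[k] k) := by
        apply MvPolynomial.algHom_ext
        intro l
        simp only [AlgHom.comp_apply, phiS, MvPolynomial.aeval_X]
        rw [← Polynomial.aeval_algHom_apply]
        simp [coe_aeval_eq_eval]
      exact congrArg (fun φ => φ F) this
    rw [h11, hFz] at h8
    simpa using h8
  · right
    have hv : ∃ i ∈ F.vars, ∃ j ∈ F.vars, i ≠ j := by
      by_contra hcon
      push Not at hcon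
      by_cases hne : F.vars = ∅
      · rw [MvPolynomial.vars_eq_empty_iff_eq_C] at hne
        have hu : F.coeff 0 ≠ 0 := by
          intro h0; rw [h0] at hne; simp at hne; exact hF.ne_zero hne
        apply hF.not_isUnit
        rw [hne]
        exact (isUnit_iff_ne_zero.mpr hu).map MvPolynomial.C
      · obtain ⟨i, hi⟩ := Finset.nonempty_iff_ne_empty.mpr hne
        have h1 : F ∈ MvPolynomial.supported k ({i} : Set ι) := by
          rw [MvPolynomial.mem_supported]
          intro j hj
          exact (hcon i hi j hj).symm
        rw [MvPolynomial.supported, Set.image_singleton, Algebra.adjoin_singleton_eq_range_aeval] at h1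
        obtain ⟨p, hp⟩ := h1
        apply hone
        refine ⟨i, p, ?_, by rw [← hp]; rfl⟩
        rintro rfl
        apply hF.ne_zero
        rw [← hp]; exact map_zero _
    obtain ⟨i, hi, j, hj, hij⟩ := hv
    obtain ⟨Q, hQ⟩ : ∃ Q, MvPolynomial.eval Q F ≠ 0 := by
      by_contra hcon
      push Not at hcon
      exact hF.ne_zero (MvPolynomial.funext fun x => by rw [hcon x, map_zero])
    set Si := sbs i (MvPolynomial.C (Q i)) F with hSi
    set Sj := sbs j (MvPolynomial.C (Q j)) F with hSj
    have hSi0 : Si ≠ 0 := by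
      intro h0
      have := congrArg (MvPolynomial.eval Q) h0
      rw [hSi, eval_sbs] at this
      simp [hQ] at this
    have hSj0 : Sj ≠ 0 := by
      intro h0
      have := congrArg (MvPolynomial.eval Q) h0
      rw [hSj, eval_sbs] at this
      simp [hQ] at this
    set U := F * sbs i (MvPolynomial.C (Q i)) Sj - Si * Sj with hU
    have hU0 : U ≠ 0 := by
      intro h0
      rw [hU, sub_eq_zero] at h0
      rcases hF.prime.dvd_or_dvd (Dvd.intro _ h0) with h | h
      · exact sbs_not_dvd hi _ hSi0 h
      · exact sbs_not_dvd hj _ hSj0 h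
    -- the finite set of `g`
    have hfin : {g : k[X] | B.IsG g ∧ g.natDegree ≤ F.totalDegree}.Finite := by
      refine ((Set.finite_le_nat F.totalDegree).biUnion (fun m _ => B.finite_G m)).subset ?_
      intro g hg
      simp only [Set.mem_iUnion, Set.mem_setOf_eq]
      exact ⟨g.natDegree, hg.2, hg.1, rfl⟩
    set S := hfin.toFinset with hS
    set W := U * ((∏ g ∈ S, sbs j (aeval (MvPolynomial.X i : MvPolynomial ι k) g) F) * ∏ g ∈ S, sbs i (aeval (MvPolynomial.X j : MvPolynomial ι k) g) F) with hW
    have hW0 : W = 0 := by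
      refine MvPolynomial.funext_set (fun _ : ι => {ζ : k | ∃ m, 1 ≤ m ∧ eval ζ (itp B.f m) = ζ}) (fun _ => per_infinite B.f B.hf) ?_
      intro P hP
      have hP' : ∀ l, ∃ m, 1 ≤ m ∧ eval (P l) (itp B.f m) = P l := fun l => hP l trivial
      rw [hW, map_mul, map_mul, map_prod, map_prod, map_zero]
      by_cases hUP : MvPolynomial.eval P U = 0
      · rw [hUP, zero_mul]
      set G := FP i j P F with hG
      have hUP' : MvPolynomial.eval P U = G.aevalAeval (P i) (P j) * G.aevalAeval (Q i) (Q j) - G.aevalAeval (Q i) (P j) * G.aevalAeval (P i) (Q j) := by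
        rw [hU, hSi, hSj]
        simp only [map_sub, map_mul, eval_sbs, MvPolynomial.eval_C, hG, FP_eval hij, Function.update_eq_self]
        congr 2
        · congr 2
          rw [Function.update_comm hij, Function.update_eq_self]
      have hprod : ¬ ∃ a b : k[X], G = aeval (C X : k[X][X]) a * aeval (X : k[X][X]) b := by
        rintro ⟨a, b, hab⟩
        apply hUP
        have h1 : ∀ x y : k, G.aevalAeval x y = aeval x a * aeval y b := by
          intro x y
          rw [hab, map_mul, ← Polynomial.aeval_algHom_apply, ← Polynomial.aeval_algHom_apply, aevalAeval_X, aevalAeval_Y]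
        rw [hUP', h1, h1, h1, h1]; ring
      have hG0 : G ≠ 0 := by
        intro h0; exact hprod ⟨0, 0, by simp [h0]⟩
      have hex : ∃ p, Prime p ∧ p ∣ G ∧ Dep2 p := by
        by_contra hcon
        push Not at hcon
        exact hprod (prod_form hG0 hcon)
      obtain ⟨p, hp, hpG, hp2⟩ := hex
      choose m hm1 hm2 using hP'
      set M := K * ∏ l, m l with hM
      have hM1 : 1 ≤ M := by
        rw [hM]
        refine Nat.one_le_iff_ne_zero.mpr (mul_ne_zero (by omega) (Finset.prod_ne_zero_iff.mpr fun l _ => ?_))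
        have := hm1 l; omega
      have hfix : ∀ l, eval (P l) (itp B.f M) = P l := by
        intro l
        obtain ⟨c, hc⟩ := (Finset.dvd_prod_of_mem m (Finset.mem_univ l)).mul_left K
        rw [hM, hc, ← itp_itp]
        exact (itp_deriv _ _ (hm2 l)).2
      have hdM : F ∣ phiS (itp B.f M) F := by
        have h1 : ∀ r, F ∣ phiS (itp (itp B.f K) r) F := by
          intro r
          induction r with
          | zero => 
            have : phiS (ι := ι) (itp (itp B.f K) 0) = AlgHom.id k _ := by
              apply MvPolynomial.algHom_ext
              intro l; simp [phiS, itp_zero]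
            rw [this]; exact dvd_rfl
          | succ r ih =>
            have : phiS (ι := ι) (itp (itp B.f K) (r+1)) = (phiS (itp (itp B.f K) r)).comp (phiS (itp B.f K)) := by
              apply MvPolynomial.algHom_ext
              intro l
              simp only [phiS, AlgHom.comp_apply, MvPolynomial.aeval_X]
              rw [← Polynomial.aeval_algHom_apply, MvPolynomial.aeval_X, itp_succ, aeval_comp]
            rw [this, AlgHom.comp_apply]
            exact ih.trans (map_dvd _ hd)
        rw [hM, ← itp_itp]; exact h1 _
      have hGd : G ∣ sub2 (itp B.f M) G := by
        rw [hG, ← FP_phi i j P _ hfix]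
        obtain ⟨w, hw⟩ := hdM
        exact ⟨FP i j P w, by rw [hw, map_mul]⟩
      obtain ⟨g, hg, hg2⟩ := B.E2 hM1 hG0 hGd hp hpG hp2
      rcases hg2 with hg2 | hg2
      · have hb := deg_bound hG0 (FP_DB i j P F) hg2
        have h3 : MvPolynomial.eval P (sbs j (aeval (MvPolynomial.X i : MvPolynomial ι k) g) F) = 0 := FP_g hij P g F hg2
        rw [Finset.prod_eq_zero (i := g) (by rw [hS]; simpa using ⟨hg, hb⟩) h3]; simp
      · rw [← Bivariate.aevalAeval_swap, hG, FP_swap hij] at hg2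
        have hb := deg_bound (by rw [← FP_swap hij]; simpa using hG0) (FP_DB j i P F) hg2
        have h3 : MvPolynomial.eval P (sbs i (aeval (MvPolynomial.X j : MvPolynomial ι k) g) F) = 0 := FP_g hij.symm P g F hg2
        rw [Finset.prod_eq_zero (s := S) (i := g) (f := fun g => MvPolynomial.eval P (sbs i (aeval (MvPolynomial.X j : MvPolynomial ι k) g) F)) (by rw [hS]; simpa using ⟨hg, hb⟩) h3]; simp
    rw [hW, mul_eq_zero, mul_eq_zero, Finset.prod_eq_zero_iff, Finset.prod_eq_zero_iff] at hW0
    have key : ∀ i j : ι, i ≠ j → (∃ g ∈ S, sbs j (aeval (MvPolynomial.X i : MvPolynomial ι k) g) F = 0) → 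
        ∃ i j g, i ≠ j ∧ B.IsG g ∧ Associated F (MvPolynomial.X j - aeval (MvPolynomial.X i) g) := by
      rintro i j hij ⟨g, hg, h⟩
      refine ⟨i, j, g, hij, ?_, assoc_of_sbs hF h (Function.update 0 j (eval 0 g)) ?_⟩
      · rw [hS] at hg; exact ((Set.Finite.mem_toFinset hfin).mp hg).1
      · rw [← MvPolynomial.aeval_eq_eval, ← Polynomial.aeval_algHom_apply, MvPolynomial.aeval_X]
        simp [Function.update_apply, hij, coe_aeval_eq_eval]
    rcases hW0 with h | h | h
    · exact absurd h hU0
    · exact key i j hij h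
    · exact key j i hij.symm h
end
end

noncomputable section
open Polynomial

section
open Height Height.AdmissibleAbsValues
variable {K : Type} [Field K] [AdmissibleAbsValues K]

lemma lh_le_sum {ι : Type} [Fintype ι] [DecidableEq ι] (A : ι → K) :
    logHeight A ≤ ∑ i, logHeight₁ (A i) := by
  have h := logHeight_fun_prod_eq (K := K) (α := ι) (ι := fun _ => Fin 2) (x := fun a => ![A a, 1])
    (fun a h => by simpa using congrFun h 1)
  simp only [← logHeight₁_eq_logHeight] at h
  rw [← h]
  refine le_trans (le_of_eq ?_) (logHeight_comp_le (fun (i : ι) (a : ι) => if a = i then (0 : Fin 2) else 1) _)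
  congr 1
  ext i
  simp only [Function.comp]
  rw [Finset.prod_eq_single i]
  · simp
  · intro b _ hb; simp [hb]
  · simp

lemma lh_pow (x : K) (m : ℕ) : logHeight (fun i : Fin (m+1) => x ^ (i : ℕ)) ≤ m * logHeight₁ x := by
  have h := logHeight_fun_prod_eq (K := K) (α := Fin m) (ι := fun _ => Fin 2) (x := fun a => ![x, 1])
    (fun a h => by simpa using congrFun h 1)
  simp only [← logHeight₁_eq_logHeight] at h
  rw [Finset.sum_const, Finset.card_univ, Fintype.card_fin, nsmul_eq_mul] at h
  rw [← h]
  refine le_trans (le_of_eq ?_) (logHeight_comp_le (fun (i : Fin (m+1)) (a : Fin m) => if (a : ℕ) < i then (0 : Fin 2) else 1) _)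
  congr 1
  ext i
  simp only [Function.comp]
  have : ∀ a : Fin m, (![x, 1] : Fin 2 → K) (if (a : ℕ) < i then (0 : Fin 2) else 1) = if (a : ℕ) < i then x else 1 := by
    intro a; split_ifs <;> simp
  simp only [this]
  rw [Fin.prod_univ_eq_prod_range (fun a => if a < (i : ℕ) then x else 1) m, Finset.prod_ite]
  simp only [Finset.prod_const, one_pow, mul_one]
  congr 1
  have : (Finset.range m).filter (fun a => a < (i : ℕ)) = Finset.range i := by
    ext a; simp; have := i.2; omega
  rw [this, Finset.card_range]

/-- height of `u` where `(u, 1)` is a linear image of `w`. -/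
lemma lh_lin {ι : Type} [Fintype ι] [DecidableEq ι] (w : ι → K) (c e : ι → K) (u : K)
    (hc : u = ∑ i, c i * w i) (he : 1 = ∑ i, e i * w i) :
    logHeight₁ u ≤ totalWeight K * Real.log (Nat.card ι) +
      (∑ i, logHeight₁ (c i) + ∑ i, logHeight₁ (e i)) + logHeight w := by
  have h := logHeight_linearMap_apply_le (K := K) (ι' := Fin 2) (fun q : Fin 2 × ι => ![c q.2, e q.2] q.1) w
  have h2 := lh_le_sum (fun q : Fin 2 × ι => (![c q.2, e q.2] : Fin 2 → K) q.1)
  rw [Fintype.sum_prod_type, Fin.sum_univ_two] at h2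
  have h3 : (fun j : Fin 2 => ∑ i, (![c i, e i] : Fin 2 → K) j * w i) = ![u, 1] := by
    ext j; fin_cases j
    · simp [hc]
    · simp [he]
  rw [logHeight₁_eq_logHeight, ← h3]
  simp only [Matrix.cons_val_zero, Matrix.cons_val_one] at h2
  linarith

lemma sum_ite_h {ι : Type} [Fintype ι] [DecidableEq ι] (i₀ : ι) :
    ∑ i, logHeight₁ (if i = i₀ then (1 : K) else 0) = 0 := by
  refine Finset.sum_eq_zero fun i _ => ?_
  split_ifs <;> simp

lemma lh_up (p : K[X]) (m : ℕ) (hm : p.natDegree ≤ m) (x : K) :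
    logHeight₁ (p.eval x) ≤ totalWeight K * Real.log (m+1 : ℕ) + ∑ i : Fin (m+1), logHeight₁ (p.coeff i) + m * logHeight₁ x := by
  have h := lh_lin (fun i : Fin (m+1) => x ^ (i : ℕ)) (fun i => p.coeff i) (fun i => if i = 0 then 1 else 0) (p.eval x)
    (by rw [eval_eq_sum_range' (Nat.lt_succ_of_le hm), Fin.sum_univ_eq_sum_range (fun i => p.coeff i * x ^ i)])
    (by simp)
  rw [sum_ite_h] at h
  have := lh_pow x m
  simp only [Nat.card_eq_fintype_card, Fintype.card_fin] at h
  linarith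

lemma lh_down (p : K[X]) (d : ℕ) (hd : p.natDegree = d + 1) (x : K) :
    (d + 1 : ℕ) * logHeight₁ x ≤ logHeight₁ (p.eval x) + totalWeight K * Real.log ((d+1)*2 : ℕ) +
      (∑ i : Fin (d+1), logHeight₁ ((X ^ (2*d+1) / p : K[X]).coeff i) +
      ∑ i : Fin (d+1), logHeight₁ ((X ^ (2*d+1) % p : K[X]).coeff i)) := by
  have hp0 : p ≠ 0 := by rintro rfl; simp at hd
  have hq : (X ^ (2*d+1) / p : K[X]).natDegree < d + 1 := by
    by_cases hq0 : (X ^ (2*d+1) / p : K[X]) = 0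
    · rw [hq0]; simp
    have h1 := degree_add_div hp0 (p := (X ^ (2*d+1) : K[X])) (by
      rw [degree_X_pow, degree_eq_natDegree hp0, hd]; norm_cast; omega)
    rw [degree_X_pow, degree_eq_natDegree hp0, degree_eq_natDegree hq0] at h1
    norm_cast at h1
    omega
  have hr : (X ^ (2*d+1) % p : K[X]).natDegree < d + 1 := by
    rw [← hd]; exact natDegree_mod_lt _ (by omega)
  have hqr : x ^ (2*d+1) = (X ^ (2*d+1) / p : K[X]).eval x * p.eval x + (X ^ (2*d+1) % p : K[X]).eval x := by
    have := congrArg (eval x) (EuclideanDomain.div_add_mod (X ^ (2*d+1) : K[X]) p)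
    rw [eval_add, eval_mul, eval_pow, eval_X] at this
    rw [← this]; ring
  generalize X ^ (2*d+1) / p = q at *
  generalize X ^ (2*d+1) % p = r at *
  have h := lh_lin (fun a : Fin (d+1) × Fin 2 => (fun i : Fin (d+1) => x ^ (i : ℕ)) a.1 * (![p.eval x, 1] : Fin 2 → K) a.2)
    (fun a => (![q.coeff a.1, r.coeff a.1] : Fin 2 → K) a.2) (fun a => if a = (0, 1) then 1 else 0) (x ^ (2*d+1)) ?_ ?_
  · rw [sum_ite_h, logHeight_fun_mul_eq (x := (fun i : Fin (d+1) => x ^ (i : ℕ))) (y := ![p.eval x, 1]), ← logHeight₁_eq_logHeight, logHeight₁_pow, Fintype.sum_prod_type] at h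
    · simp only [Fin.sum_univ_two, Matrix.cons_val_zero, Matrix.cons_val_one, Finset.sum_add_distrib] at h
      have := lh_pow x d
      simp only [Nat.card_eq_fintype_card, Fintype.card_fin, Fintype.card_prod] at h
      push_cast at h ⊢
      linarith
    · intro h; simpa using congrFun h 0
    · intro h; simpa using congrFun h 1
  · rw [hqr, Fintype.sum_prod_type]
    simp only [Fin.sum_univ_two, Matrix.cons_val_zero, Matrix.cons_val_one, Finset.sum_add_distrib]
    rw [eval_eq_sum_range' hq, eval_eq_sum_range' hr, Finset.sum_mul, Fin.sum_univ_eq_sum_range (fun i => q.coeff i * (x ^ i * p.eval x)), Fin.sum_univ_eq_sum_range (fun i => r.coeff i * (x ^ i * 1))]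
    simp [mul_assoc]
  · simp

lemma lh_root (N : ℕ) (y : K) (c : Fin (N+1) → K) (hy : y ^ (N+1) = ∑ i, c i * y ^ (i : ℕ)) :
    logHeight₁ y ≤ totalWeight K * Real.log (N+1 : ℕ) + ∑ i, logHeight₁ (c i) := by
  have h := lh_lin (fun i : Fin (N+1) => y ^ (i : ℕ)) c (fun i => if i = 0 then 1 else 0) (y ^ (N+1)) hy (by simp)
  rw [sum_ite_h, logHeight₁_pow] at h
  have := lh_pow y N
  simp only [Nat.card_eq_fintype_card, Fintype.card_fin] at h
  push_cast at h ⊢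
  linarith
end
end

noncomputable section
open Polynomial

section
open NumberField
variable {E : Type} [Field E] [NumberField E]

/-- finite part of the height -/
def finh (x : E) : ℝ := ∏ᶠ v : FinitePlace E, max (v x) 1

lemma finh_supp (x : E) : (fun v : FinitePlace E => max (v x) 1).HasFiniteMulSupport := by
  rcases eq_or_ne x 0 with rfl | hx
  · simp [Function.HasFiniteMulSupport]
  · exact (FinitePlace.hasFiniteMulSupport hx).max Function.hasFiniteMulSupport_one

lemma iSup2 {α : Type} (a b : α) (f : α → ℝ) : (⨆ i : Fin 2, f ((![a, b] : Fin 2 → α) i)) = max (f a) (f b) := by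
  refine le_antisymm (ciSup_le fun i => by fin_cases i <;> simp) (max_le ?_ ?_)
  · exact Finite.le_ciSup_of_le (0 : Fin 2) (by simp)
  · exact Finite.le_ciSup_of_le (1 : Fin 2) (by simp)

lemma finh_div (p q : 𝓞 E) (hq : q ≠ 0) :
    finh ((p : E) / q) * (Ideal.span (Set.range ![p, q])).absNorm = (Ideal.span {q}).absNorm := by
  have h1 := absNorm_mul_finprod_finitePlace_eq_one (x := ![p, q]) (fun h => hq (by simpa using congrFun h 1))
  have h2 := absNorm_mul_finprod_finitePlace_eq_one (x := fun _ : Unit => q) (fun h => hq (by simpa using congrFun h ()))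
  simp only [Set.range_const, ciSup_unique] at h2
  have h3 : (∏ᶠ v : FinitePlace E, ⨆ i, v ((![p, q] i : 𝓞 E) : E)) = finh ((p : E) / q) * ∏ᶠ v : FinitePlace E, v (q : E) := by
    rw [finh, ← finprod_mul_distrib (finh_supp _) (FinitePlace.hasFiniteMulSupport_int hq)]
    refine finprod_congr fun v => ?_
    rw [iSup2 p q (fun z : 𝓞 E => v (z : E))]
    have hq' : (q : E) ≠ 0 := by exact_mod_cast hq
    have h0 : 0 < v (q : E) := FinitePlace.pos_iff.2 hq'
    rw [max_mul_of_nonneg _ _ h0.le, ← map_mul, div_mul_cancel₀ _ hq', one_mul]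
  rw [h3] at h1
  have e1 : ((Ideal.span {q}).absNorm : ℝ) ≠ 0 := left_ne_zero_of_mul_eq_one h2
  have e2 : (∏ᶠ v : FinitePlace E, v (q : E)) ≠ 0 := right_ne_zero_of_mul_eq_one h2
  apply mul_right_cancel₀ e2
  rw [h2, ← h1]; ring

lemma absNorm_map_e (e : 𝓞 E ≃+* 𝓞 E) (I : Ideal (𝓞 E)) : (I.map (e : 𝓞 E →+* 𝓞 E)).absNorm = I.absNorm := by
  rw [Ideal.absNorm_apply, Ideal.absNorm_apply, Submodule.cardQuot_apply, Submodule.cardQuot_apply]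
  exact (Nat.card_congr (Ideal.quotientEquiv I _ e rfl).toEquiv).symm

lemma finh_aut (g : E ≃+* E) (x : E) : finh (g x) = finh x := by
  obtain ⟨p, q, hq, rfl⟩ := IsFractionRing.div_surjective (A := 𝓞 E) x
  have hq0 : q ≠ 0 := nonZeroDivisors.ne_zero hq
  let e := RingOfIntegers.mapRingEquiv g
  have h1 := finh_div p q hq0
  have h2 := finh_div (e p) (e q) (by simpa using hq0)
  have h3 : Ideal.span (Set.range ![e p, e q]) = (Ideal.span (Set.range ![p, q])).map (e : 𝓞 E →+* 𝓞 E) := by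
    rw [Ideal.map_span, ← Set.range_comp]
    congr 2; ext i; fin_cases i <;> simp
  have h4 : Ideal.span {e q} = (Ideal.span {q}).map (e : 𝓞 E →+* 𝓞 E) := by
    rw [Ideal.map_span, Set.image_singleton]; rfl
  rw [h3, h4, absNorm_map_e, absNorm_map_e, ← h1] at h2
  have hne : ((Ideal.span (Set.range ![p, q])).absNorm : ℝ) ≠ 0 := by
    intro h
    rw [h, mul_zero] at h1
    have : (Ideal.span {q}).absNorm = 0 := by exact_mod_cast h1.symm
    rw [Ideal.absNorm_eq_zero_iff, Ideal.span_singleton_eq_bot] at this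
    exact hq0 this
  have := mul_right_cancel₀ hne h2
  rw [map_div₀]
  exact this

lemma finh_multiset (s : Multiset E) : (fun v : FinitePlace E => (s.map (fun r => max (v r) 1)).prod).HasFiniteMulSupport ∧
    (s.map finh).prod = ∏ᶠ v : FinitePlace E, (s.map (fun r => max (v r) 1)).prod := by
  induction s using Multiset.induction with
  | empty => simp [Function.HasFiniteMulSupport]
  | cons a s ih =>
    simp only [Multiset.map_cons, Multiset.prod_cons]
    refine ⟨(finh_supp a).mul ih.1, ?_⟩
    rw [finprod_mul_distrib (finh_supp a) ih.1, ih.2, finh]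

lemma gaussNorm_X_sub_C (v : AbsoluteValue E ℝ) (r : E) : (X - C r : E[X]).gaussNorm v 1 = max (v r) 1 := by
  apply le_antisymm
  · obtain ⟨i, hi⟩ := (X - C r : E[X]).exists_eq_gaussNorm v 1
    rw [hi]
    simp only [one_pow, mul_one]
    rcases i with _ | _ | i
    · simp
    · simp [coeff_X, coeff_C]
    · simp [coeff_X, coeff_C]
  · apply max_le
    · have h := (X - C r : E[X]).le_gaussNorm v zero_le_one 0
      have e : (X - C r : E[X]).coeff 0 = - r := by simp
      rw [e] at h
      simpa using h
    · have h := (X - C r : E[X]).le_gaussNorm v zero_le_one 1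
      have e : (X - C r : E[X]).coeff 1 = 1 := by simp [coeff_X, coeff_C]
      rw [e] at h
      simpa using h

lemma gaussNorm_prod (v : AbsoluteValue E ℝ) (hv : IsNonarchimedean v) (s : Multiset E) :
    ((s.map (fun r => X - C r)).prod : E[X]).gaussNorm v 1 = (s.map (fun r => max (v r) 1)).prod := by
  induction s using Multiset.induction with
  | empty => 
    simp only [Multiset.map_zero, Multiset.prod_zero]
    have := gaussNorm_C v 1 (1 : E)
    simpa using this
  | cons a s ih =>
    simp only [Multiset.map_cons, Multiset.prod_cons]
    rw [gaussNorm_mul hv zero_lt_one, ih, gaussNorm_X_sub_C]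

lemma gaussNorm_iSup (v : AbsoluteValue E ℝ) (p : E[X]) : p.gaussNorm v 1 = ⨆ i : Fin (p.natDegree + 1), v (p.coeff i) := by
  apply le_antisymm
  · obtain ⟨i, hi⟩ := p.exists_eq_gaussNorm v 1
    rw [hi]
    simp only [one_pow, mul_one]
    by_cases h : i < p.natDegree + 1
    · exact Finite.le_ciSup_of_le (⟨i, h⟩ : Fin (p.natDegree + 1)) (by simp)
    · rw [coeff_eq_zero_of_natDegree_lt (by omega)]
      simp only [map_zero]
      exact Real.iSup_nonneg fun i => v.nonneg _
  · exact ciSup_le fun i => by simpa using p.le_gaussNorm v zero_le_one i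
end
end

noncomputable section
open Polynomial

section
def denL (P : ℚ[X]) : ℕ := P.support.lcm fun i => (P.coeff i).den

lemma denL_ne (P : ℚ[X]) : denL P ≠ 0 := by
  rw [denL, Ne, Finset.lcm_eq_zero_iff]
  simp

lemma denL_dvd (P : ℚ[X]) (i : ℕ) : (P.coeff i).den ∣ denL P := by
  by_cases h : i ∈ P.support
  · exact Finset.dvd_lcm (f := fun i => (P.coeff i).den) h
  · rw [notMem_support_iff.1 h]; simp

lemma denL_num (P : ℚ[X]) : ∃ n : ℕ → ℤ, ∀ i, (denL P : ℚ) * P.coeff i = n i := by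
  have : ∀ i, ∃ n : ℤ, (denL P : ℚ) * P.coeff i = n := by
    intro i
    obtain ⟨b, hb⟩ := denL_dvd P i
    refine ⟨b * (P.coeff i).num, ?_⟩
    rw [hb]
    push_cast
    rw [mul_comm ((P.coeff i).den : ℚ), mul_assoc, Rat.den_mul_eq_num]
  choose n hn using this
  exact ⟨n, hn⟩

lemma denL_span (P : ℚ[X]) (hP : P.Monic) (n : ℕ → ℤ) (hn : ∀ i, (denL P : ℚ) * P.coeff i = n i) :
    Ideal.span (Set.range fun i : Fin (P.natDegree + 1) => n i) = ⊤ := by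
  set I := Ideal.span (Set.range fun i : Fin (P.natDegree + 1) => n i) with hI
  obtain ⟨g, hg⟩ := (IsPrincipalIdealRing.principal I).principal
  have hg' : I = Ideal.span {g} := hg
  have hdv : ∀ i, g ∣ n i := by
    intro i
    by_cases h : i < P.natDegree + 1
    · rw [← Ideal.mem_span_singleton, ← hg']
      exact Ideal.subset_span ⟨⟨i, h⟩, rfl⟩
    · have := hn i
      rw [coeff_eq_zero_of_natDegree_lt (by omega), mul_zero] at this
      have h0 : n i = 0 := by exact_mod_cast this.symm
      rw [h0]; exact dvd_zero _
  have ha : (denL P : ℤ) = n P.natDegree := by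
    have := hn P.natDegree
    rw [hP.coeff_natDegree, mul_one] at this
    exact_mod_cast this
  have ha0 := denL_ne P
  obtain ⟨b, hb⟩ : g ∣ (denL P : ℤ) := ha ▸ hdv _
  have hb0 : b ≠ 0 := by rintro rfl; simp at hb; exact ha0 hb
  have hg0 : g ≠ 0 := by rintro rfl; simp at hb; exact ha0 hb
  have key : (denL P) ∣ b.natAbs := by
    apply Finset.lcm_dvd
    intro i _
    obtain ⟨m, hm⟩ := hdv i
    have h1 : P.coeff i = (m : ℚ) / (b : ℚ) := by
      have h2 := hn i
      have h3 : (denL P : ℚ) = g * b := by exact_mod_cast hb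
      rw [h3, hm] at h2
      push_cast at h2
      have hgq : (g : ℚ) ≠ 0 := by exact_mod_cast hg0
      have hbq : (b : ℚ) ≠ 0 := by exact_mod_cast hb0
      rw [eq_div_iff hbq]
      apply mul_left_cancel₀ hgq
      rw [← h2]; ring
    have := Rat.den_dvd m b
    rw [Rat.divInt_eq_div, ← h1] at this
    exact Int.natCast_dvd.1 this
  have h4 : denL P = g.natAbs * b.natAbs := by
    rw [← Int.natAbs_mul, ← hb]; simp
  have h5 : g.natAbs = 1 := by
    have hbp : 0 < b.natAbs := Int.natAbs_pos.2 hb0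
    rw [h4] at key
    have := Nat.le_of_dvd hbp key
    have hgp : 0 < g.natAbs := Int.natAbs_pos.2 hg0
    nlinarith
  rw [hg', Ideal.span_singleton_eq_top]
  exact Int.isUnit_iff_natAbs_eq.2 h5

open NumberField
variable {E : Type} [Field E] [NumberField E]

lemma finh_link (P : ℚ[X]) (hP : P.Monic) (s : Multiset E) (hs : P.map (algebraMap ℚ E) = (s.map (fun r => X - C r)).prod) :
    (s.map finh).prod = (denL P : ℝ) ^ (Module.finrank ℚ E) := by
  obtain ⟨n, hn⟩ := denL_num P
  have hsp := denL_span P hP n hn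
  rw [(finh_multiset s).2]
  have ha0 := denL_ne P
  have hq0 : ((denL P : ℕ) : 𝓞 E) ≠ 0 := by exact_mod_cast ha0
  have h1 := absNorm_mul_finprod_finitePlace_eq_one (x := fun i : Fin (P.natDegree + 1) => ((n i : ℤ) : 𝓞 E)) (by
    intro h
    have h2 : Ideal.span (Set.range fun i : Fin (P.natDegree + 1) => n i) = ⊥ := by
      rw [Ideal.span_eq_bot]
      rintro _ ⟨i, rfl⟩
      have h5 : ((n i : ℤ) : 𝓞 E) = 0 := congrFun h i
      have h6 : n i = 0 := by exact_mod_cast h5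
      exact h6
    rw [hsp] at h2
    exact top_ne_bot h2)
  have e1 : Ideal.span (Set.range fun i : Fin (P.natDegree + 1) => ((n i : ℤ) : 𝓞 E)) = ⊤ := by
    have := congrArg (Ideal.map (Int.castRingHom (𝓞 E))) hsp
    rw [Ideal.map_span, Ideal.map_top, ← Set.range_comp] at this
    exact this
  rw [e1, Ideal.absNorm_top, Nat.cast_one, one_mul] at h1
  have h2 := absNorm_mul_finprod_finitePlace_eq_one (x := fun _ : Unit => ((denL P : ℕ) : 𝓞 E)) (fun h => hq0 (by simpa using congrFun h ()))
  simp only [Set.range_const, ciSup_unique] at h2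
  rw [Ideal.absNorm_span_natCast, RingOfIntegers.rank] at h2
  have h3 : (∏ᶠ v : FinitePlace E, ⨆ i : Fin (P.natDegree + 1), v (((n i : ℤ) : 𝓞 E) : E)) =
     (∏ᶠ v : FinitePlace E, v (((denL P : ℕ) : 𝓞 E) : E)) * ∏ᶠ v : FinitePlace E, (s.map (fun r => max (v r) 1)).prod := by
    rw [← finprod_mul_distrib (FinitePlace.hasFiniteMulSupport_int hq0) (finh_multiset s).1]
    refine finprod_congr fun v => ?_
    have hv : IsNonarchimedean v.val := by
      intro x y; exact FinitePlace.add_le v x y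
    have h4 := gaussNorm_mul hv zero_lt_one (C ((denL P : ℕ) : E)) (P.map (algebraMap ℚ E))
    rw [gaussNorm_C, hs, gaussNorm_prod _ hv, ← hs, gaussNorm_iSup] at h4
    have e2 : (C ((denL P : ℕ) : E) * P.map (algebraMap ℚ E)).natDegree = P.natDegree := by
      rw [natDegree_C_mul (by exact_mod_cast ha0), natDegree_map]
    rw [e2] at h4
    refine Eq.trans ?_ (h4.trans ?_)
    · congr 1; ext i
      rw [coeff_C_mul, coeff_map]
      have := congrArg (algebraMap ℚ E) (hn i)
      simp only [map_mul, map_natCast, map_intCast] at this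
      rw [this]
      simp
      rfl
    · simp
      rfl
  rw [h1] at h3
  rw [Nat.cast_pow] at h2
  generalize (∏ᶠ v : FinitePlace E, v (((denL P : ℕ) : 𝓞 E) : E)) = t at *
  generalize (∏ᶠ v : FinitePlace E, (s.map (fun r => max (v r) 1)).prod) = w at *
  have ht : t ≠ 0 := right_ne_zero_of_mul_eq_one h2
  apply mul_left_cancel₀ ht
  rw [← h3, mul_comm t]
  exact h2.symm
end
end

noncomputable section
open Polynomial

section
open NumberField
variable {E : Type} [Field E] [NumberField E]

lemma inf_sum (F : ℝ → ℝ) (x : E) : ∑ v : InfinitePlace E, (v.mult : ℝ) * F (v x) = ∑ σ : E →+* ℂ, F ‖σ x‖ := by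
  classical
  rw [← Finset.sum_fiberwise Finset.univ InfinitePlace.mk (fun σ : E →+* ℂ => F ‖σ x‖)]
  refine Finset.sum_congr rfl fun w _ => ?_
  have : ∀ φ ∈ ({φ | InfinitePlace.mk φ = w} : Finset (E →+* ℂ)), F ‖φ x‖ = F (w x) := by
    intro φ hφ
    rw [← (Finset.mem_filter.mp hφ).2, InfinitePlace.apply]
  rw [Finset.sum_congr rfl this, Finset.sum_const, InfinitePlace.card_filter_mk_eq, nsmul_eq_mul]

lemma finh_pos (x : E) : 0 < finh x := finprod_induction (fun t : ℝ => 0 < t) one_pos (fun _ _ => mul_pos) (fun v => lt_max_of_lt_right one_pos)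

lemma lh_eq (x : E) : Height.logHeight₁ x = ∑ σ : E →+* ℂ, Real.log (max 1 ‖σ x‖) + Real.log (finh x) := by
  rw [Height.logHeight₁_eq_log_mulHeight₁, NumberField.mulHeight₁_eq, ← finh, Real.log_mul, Real.log_prod]
  · simp only [Real.log_pow]
    rw [inf_sum (fun t => Real.log (max t 1)) x]
    simp only [max_comm]
  · intro v _; positivity
  · exact Finset.prod_ne_zero_iff.2 fun v _ => by positivity
  · exact (finh_pos x).ne'

lemma lh_aut (g : E ≃+* E) (x : E) : Height.logHeight₁ (g x) = Height.logHeight₁ x := by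
  rw [lh_eq, lh_eq, finh_aut]
  congr 1
  refine Fintype.sum_equiv ⟨fun σ => σ.comp (g : E →+* E), fun σ => σ.comp (g.symm : E →+* E), ?_, ?_⟩ _ _ ?_
  · intro σ; ext; simp
  · intro σ; ext; simp
  · intro σ; rfl

lemma log_ms_sum (s : Multiset E) : (s.map (fun r => Real.log (finh r))).sum = Real.log (s.map finh).prod := by
  induction s using Multiset.induction with
  | empty => simp
  | cons a s ih =>
    simp only [Multiset.map_cons, Multiset.prod_cons, Multiset.sum_cons]
    rw [Real.log_mul (finh_pos a).ne', ih]
    apply ne_of_gt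
    exact Multiset.prod_pos (by simp; intro a _; exact finh_pos a)

lemma ms_sum_comm {ι : Type} [Fintype ι] (s : Multiset E) (F : ι → E → ℝ) : (s.map (fun r => ∑ i, F i r)).sum = ∑ i, (s.map (F i)).sum := by
  induction s using Multiset.induction with
  | empty => simp
  | cons a s ih => simp [ih, Finset.sum_add_distrib]

lemma lh_link [Normal ℚ E] (x : E) : ((minpoly ℚ x).natDegree : ℝ) * Height.logHeight₁ x =
    Module.finrank ℚ E * (Real.log (denL (minpoly ℚ x)) + (((minpoly ℚ x).aroots ℂ).map fun z => Real.log (max 1 ‖z‖)).sum) := by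
  set P := minpoly ℚ x with hPdef
  have hxi : IsIntegral ℚ x := Algebra.IsIntegral.isIntegral x
  have hP : P.Monic := minpoly.monic hxi
  have hspl : (P.map (algebraMap ℚ E)).Splits := Normal.splits inferInstance x
  have hs := hspl.eq_prod_roots_of_monic (hP.map _)
  set s := (P.map (algebraMap ℚ E)).roots with hsdef
  have h1 := finh_link P hP s hs
  have hcard : Multiset.card s = P.natDegree := by
    rw [hsdef, ← hspl.natDegree_eq_card_roots, natDegree_map]
  have hconj : ∀ r ∈ s, Height.logHeight₁ r = Height.logHeight₁ x := by
    intro r hr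
    have hr' : aeval r P = 0 := by
      have := isRoot_of_mem_roots hr
      rwa [IsRoot, eval_map_algebraMap] at this
    obtain ⟨e, he⟩ := minpoly.exists_algEquiv_of_root' hxi.isAlgebraic hr'
    rw [← he]
    exact lh_aut e.toRingEquiv x
  have h2 : (s.map Height.logHeight₁).sum = P.natDegree * Height.logHeight₁ x := by
    rw [Multiset.map_congr rfl hconj, Multiset.map_const', Multiset.sum_replicate, hcard, nsmul_eq_mul]
  rw [← h2]
  simp only [lh_eq]
  rw [Multiset.sum_map_add, log_ms_sum, h1, Real.log_pow, ms_sum_comm s (fun (σ : E →+* ℂ) r => Real.log (max 1 ‖σ r‖)), mul_add, add_comm]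
  congr 1
  have : ∀ σ : E →+* ℂ, (s.map fun r => Real.log (max 1 ‖σ r‖)).sum = ((P.aroots ℂ).map fun z => Real.log (max 1 ‖z‖)).sum := by
    intro σ
    have : P.aroots ℂ = s.map σ := by
      rw [aroots, ← hspl.roots_map σ, map_map]
      congr 2
      exact Subsingleton.elim _ _
    rw [this, Multiset.map_map]; rfl
  rw [Finset.sum_congr rfl (fun σ _ => this σ), Finset.sum_const, Finset.card_univ, Embeddings.card, nsmul_eq_mul]

lemma weil_link [Normal ℚ E] (φ : E →ₐ[ℚ] Qbar) (x : E) : Height.logHeight₁ x = Module.finrank ℚ E * weilHeight (φ x) := by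
  have h := lh_link x
  have hm : minpoly ℚ (φ x) = minpoly ℚ x := minpoly.algHom_eq φ φ.injective x
  have hd : ((minpoly ℚ x).natDegree : ℝ) ≠ 0 := by
    have := minpoly.natDegree_pos (Algebra.IsIntegral.isIntegral (R := ℚ) x)
    positivity
  rw [weilHeight, hm, mul_div_assoc', eq_div_iff hd, mul_comm _ ((minpoly ℚ x).natDegree : ℝ), h]
  rfl
end
end

noncomputable section
open Polynomial

section
lemma rat_alg_eq : (DivisionRing.toRatAlgebra : Algebra ℚ Qbar) = AlgebraicClosure.instAlgebra ℚ :=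
  Subsingleton.elim _ _

lemma qbar_alg : Algebra.IsAlgebraic ℚ Qbar := by
  have h := AlgebraicClosure.isAlgebraic ℚ
  rw [← rat_alg_eq] at h
  exact h

lemma qbar_norm : Normal ℚ Qbar := by
  haveI := qbar_alg
  haveI : IsAlgClosure ℚ Qbar := ⟨inferInstance, inferInstance⟩
  exact IsAlgClosure.normal ℚ Qbar

lemma ex_field (s : Set Qbar) (hs : s.Finite) : ∃ E : IntermediateField ℚ Qbar, FiniteDimensional ℚ E ∧ Normal ℚ E ∧ s ⊆ E := by
  haveI := qbar_alg
  haveI : FiniteDimensional ℚ (IntermediateField.adjoin ℚ s) :=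
    haveI := hs.to_subtype
    IntermediateField.finiteDimensional_adjoin (fun x _ => Algebra.IsIntegral.isIntegral x)
  haveI : Normal ℚ Qbar := qbar_norm
  refine ⟨IntermediateField.normalClosure ℚ (IntermediateField.adjoin ℚ s) Qbar, inferInstance, ?_, ?_⟩
  · exact normalClosure.normal ℚ _ Qbar
  exact (IntermediateField.subset_adjoin ℚ s).trans (IntermediateField.le_normalClosure _)

lemma W_nonneg (x : Qbar) : 0 ≤ weilHeight x := by
  unfold weilHeight
  apply div_nonneg _ (Nat.cast_nonneg _)
  apply add_nonneg
  · exact Real.log_natCast_nonneg _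
  · apply Multiset.sum_nonneg
    intro y hy
    obtain ⟨z, _, rfl⟩ := Multiset.mem_map.1 hy
    exact Real.log_nonneg (le_max_left _ _)

variable (E : IntermediateField ℚ Qbar) [FiniteDimensional ℚ E] [Normal ℚ E]

instance nfE : NumberField E := ⟨⟩

lemma W_lk (x : E) : Height.logHeight₁ x = Module.finrank ℚ E * weilHeight x := weil_link E.val x

lemma W_tw : (Height.totalWeight E : ℝ) = Module.finrank ℚ E := by
  rw [NumberField.totalWeight_eq_finrank]

lemma W_fr : (0 : ℝ) < Module.finrank ℚ E := by
  have : 0 < Module.finrank ℚ E := Module.finrank_pos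
  exact_mod_cast this
end

section
lemma lift_poly (E : IntermediateField ℚ Qbar) (p : Qbar[X]) (h : ∀ i, p.coeff i ∈ E) :
    ∃ q : E[X], q.map (algebraMap E Qbar) = p := by
  have : p ∈ lifts (algebraMap E Qbar) := by
    rw [lifts_iff_coeff_lifts]
    intro n; exact ⟨⟨_, h n⟩, rfl⟩
  exact (mem_lifts _).1 this

lemma poly_coeff_fin (p : Qbar[X]) : (Set.range p.coeff).Finite := by
  apply Set.Finite.subset ((Set.finite_singleton (0 : Qbar)).union (p.support.finite_toSet.image p.coeff))
  rintro _ ⟨i, rfl⟩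
  by_cases h : p.coeff i = 0
  · left; exact h
  · right; exact ⟨i, mem_support_iff.2 h, rfl⟩

lemma W_up (p : Qbar[X]) (m : ℕ) (hm : p.natDegree ≤ m) (x : Qbar) :
    weilHeight (p.eval x) ≤ Real.log (m+1 : ℕ) + ∑ i : Fin (m+1), weilHeight (p.coeff i) + m * weilHeight x := by
  obtain ⟨E, h1, h2, h3⟩ := ex_field (insert x (Set.range p.coeff)) ((poly_coeff_fin p).insert x)
  obtain ⟨q, rfl⟩ := lift_poly E p (fun i => h3 (Or.inr ⟨i, rfl⟩))
  have hx : x ∈ E := h3 (Or.inl rfl)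
  obtain ⟨x, rfl⟩ : ∃ y : E, (y : Qbar) = x := ⟨⟨x, hx⟩, rfl⟩
  rw [natDegree_map] at hm
  have h := lh_up q m hm x
  have e : (q.map (algebraMap E Qbar)).eval (x : Qbar) = ((q.eval x : E) : Qbar) := by
    exact eval_map_apply (algebraMap E Qbar) x
  simp only [W_lk, W_tw] at h
  rw [e]
  simp only [coeff_map]
  rw [← Finset.mul_sum] at h
  have hp := W_fr E
  apply le_of_mul_le_mul_left _ hp
  refine h.trans (le_of_eq ?_)
  simp only [IntermediateField.algebraMap_apply]
  ring

lemma W_down (p : Qbar[X]) (d : ℕ) (hd : p.natDegree = d + 1) : ∃ c : ℝ, ∀ (x : Qbar),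
    (d + 1 : ℕ) * weilHeight x ≤ weilHeight (p.eval x) + c := by
  refine ⟨Real.log ((d+1)*2 : ℕ) +
      (∑ i : Fin (d+1), weilHeight ((X ^ (2*d+1) / p : Qbar[X]).coeff i) +
      ∑ i : Fin (d+1), weilHeight ((X ^ (2*d+1) % p : Qbar[X]).coeff i)), fun x => ?_⟩
  obtain ⟨E, h1, h2, h3⟩ := ex_field (insert x (Set.range p.coeff)) ((poly_coeff_fin p).insert x)
  obtain ⟨q, rfl⟩ := lift_poly E p (fun i => h3 (Or.inr ⟨i, rfl⟩))
  have hx : x ∈ E := h3 (Or.inl rfl)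
  obtain ⟨x, rfl⟩ : ∃ y : E, (y : Qbar) = x := ⟨⟨x, hx⟩, rfl⟩
  rw [natDegree_map] at hd
  have h := lh_down q d hd x
  have e : (q.map (algebraMap E Qbar)).eval (x : Qbar) = ((q.eval x : E) : Qbar) := by
    exact eval_map_apply (algebraMap E Qbar) x
  have e1 : (X ^ (2*d+1) / q.map (algebraMap E Qbar) : Qbar[X]) = (X ^ (2*d+1) / q).map (algebraMap E Qbar) := by
    rw [Polynomial.map_div, Polynomial.map_pow, map_X]
  have e2 : (X ^ (2*d+1) % q.map (algebraMap E Qbar) : Qbar[X]) = (X ^ (2*d+1) % q).map (algebraMap E Qbar) := by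
    rw [Polynomial.map_mod, Polynomial.map_pow, map_X]
  simp only [W_lk, W_tw] at h
  rw [e, e1, e2]
  simp only [coeff_map]
  rw [← Finset.mul_sum, ← Finset.mul_sum] at h
  have hp := W_fr E
  apply le_of_mul_le_mul_left _ hp
  refine le_trans (le_of_eq ?_) (h.trans (le_of_eq ?_))
  · ring
  · simp only [IntermediateField.algebraMap_apply]
    ring

lemma W_root (N : ℕ) (y : Qbar) (c : Fin (N+1) → Qbar) (hy : y ^ (N+1) = ∑ i, c i * y ^ (i : ℕ)) :
    weilHeight y ≤ Real.log (N+1 : ℕ) + ∑ i, weilHeight (c i) := by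
  obtain ⟨E, h1, h2, h3⟩ := ex_field (insert y (Set.range c)) ((Set.finite_range c).insert y)
  have hx : y ∈ E := h3 (Or.inl rfl)
  obtain ⟨y, rfl⟩ : ∃ z : E, (z : Qbar) = y := ⟨⟨y, hx⟩, rfl⟩
  have hc : ∀ i, c i ∈ E := fun i => h3 (Or.inr ⟨i, rfl⟩)
  have h := lh_root N y (fun i => ⟨c i, hc i⟩) (by
    apply Subtype.ext
    push_cast
    exact hy)
  simp only [W_lk, W_tw] at h
  rw [← Finset.mul_sum] at h
  have hp := W_fr E
  apply le_of_mul_le_mul_left _ hp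
  refine h.trans (le_of_eq ?_)
  ring

lemma W_div (a b : Qbar) : weilHeight (a / b) ≤ weilHeight a + weilHeight b := by
  obtain ⟨E, h1, h2, h3⟩ := ex_field {a, b} (by simp)
  obtain ⟨a, rfl⟩ : ∃ z : E, (z : Qbar) = a := ⟨⟨a, h3 (by simp)⟩, rfl⟩
  obtain ⟨b, rfl⟩ : ∃ z : E, (z : Qbar) = b := ⟨⟨b, h3 (by simp)⟩, rfl⟩
  have h := Height.logHeight₁_mul_le a b⁻¹
  rw [Height.logHeight₁_inv, ← div_eq_mul_inv] at h
  simp only [W_lk] at h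
  have hp := W_fr E
  apply le_of_mul_le_mul_left _ hp
  refine le_trans (le_of_eq ?_) (h.trans (le_of_eq ?_))
  · simp
  · ring

lemma W_neg (a : Qbar) : weilHeight (-a) = weilHeight a := by
  obtain ⟨E, h1, h2, h3⟩ := ex_field {a} (by simp)
  obtain ⟨a, rfl⟩ : ∃ z : E, (z : Qbar) = a := ⟨⟨a, h3 (by simp)⟩, rfl⟩
  have h := Height.logHeight₁_neg a
  simp only [W_lk] at h
  have hp := W_fr E
  have := mul_left_cancel₀ hp.ne' h
  simpa using this

lemma W_zero : weilHeight 0 = 0 := by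
  obtain ⟨E, h1, h2, h3⟩ := ex_field {0} (by simp)
  have h := Height.logHeight₁_zero (K := E)
  simp only [W_lk] at h
  have hp := W_fr E
  have := (mul_eq_zero.1 h).resolve_left hp.ne'
  simpa using this

lemma W_inv (a : Qbar) : weilHeight (a⁻¹) = weilHeight a := by
  obtain ⟨E, h1, h2, h3⟩ := ex_field {a} (by simp)
  obtain ⟨a, rfl⟩ : ∃ z : E, (z : Qbar) = a := ⟨⟨a, h3 (by simp)⟩, rfl⟩
  have h := Height.logHeight₁_inv a
  simp only [W_lk] at h
  have hp := W_fr E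
  have := mul_left_cancel₀ hp.ne' h
  simpa using this
end
end

noncomputable section
open Polynomial

section
lemma W_H3 (G : Qbar[X][X]) : ∃ A B : ℝ, 0 ≤ A ∧ 0 ≤ B ∧ ∀ x y : Qbar, G.map (evalRingHom x) ≠ 0 →
    eval y (G.map (evalRingHom x)) = 0 → weilHeight y ≤ A * weilHeight x + B := by
  set M := G.natDegree with hM
  let c : ℕ → ℝ := fun i => Real.log ((G.coeff i).natDegree + 1 : ℕ) + ∑ j : Fin ((G.coeff i).natDegree+1), weilHeight ((G.coeff i).coeff j)
  have hc : ∀ i, 0 ≤ c i := fun i => add_nonneg (Real.log_natCast_nonneg _) (Finset.sum_nonneg fun j _ => W_nonneg _)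
  let a : ℕ → ℝ := fun i => (G.coeff i).natDegree
  have ha : ∀ i, 0 ≤ a i := fun i => Nat.cast_nonneg _
  have h1 : ∀ i x, weilHeight ((G.coeff i).eval x) ≤ c i + a i * weilHeight x := fun i x => W_up _ _ le_rfl x
  set SC := ∑ i ∈ Finset.range (M+1), c i with hSC
  set SA := ∑ i ∈ Finset.range (M+1), a i with hSA
  have hSC0 : 0 ≤ SC := Finset.sum_nonneg fun i _ => hc i
  have hSA0 : 0 ≤ SA := Finset.sum_nonneg fun i _ => ha i
  have h2 : ∀ i ≤ M, ∀ x, weilHeight ((G.coeff i).eval x) ≤ SC + SA * weilHeight x := by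
    intro i hi x
    refine (h1 i x).trans ?_
    have e1 : c i ≤ SC := Finset.single_le_sum (f := c) (fun i _ => hc i) (Finset.mem_range.2 (by omega))
    have e2 : a i ≤ SA := Finset.single_le_sum (f := a) (fun i _ => ha i) (Finset.mem_range.2 (by omega))
    have := mul_le_mul_of_nonneg_right e2 (W_nonneg x)
    linarith
  clear h1
  clear_value SC SA
  clear_value c a
  refine ⟨M * (2 * SA), Real.log (M+1 : ℕ) + M * (2 * SC), by positivity, add_nonneg (Real.log_natCast_nonneg _) (by positivity), fun x y hx hy => ?_⟩
  set q := G.map (evalRingHom x) with hq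
  have hN : q.natDegree ≤ M := natDegree_map_le
  obtain ⟨N, hN'⟩ : ∃ N, q.natDegree = N + 1 := by
    apply Nat.exists_eq_succ_of_ne_zero
    intro h0
    rw [eq_C_of_natDegree_eq_zero h0] at hx hy
    simp at hx hy
    exact hx hy
  have hl : q.coeff (N+1) ≠ 0 := by
    rw [← hN']; exact leadingCoeff_ne_zero.2 hx
  have hroot : y^(N+1) = ∑ i : Fin (N+1), (-(q.coeff i / q.coeff (N+1))) * y^(i:ℕ) := by
    rw [eval_eq_sum_range, hN', Finset.sum_range_succ, Finset.sum_range] at hy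
    have : y^(N+1) = (q.coeff (N+1) * y^(N+1)) / q.coeff (N+1) := by field_simp
    rw [this, eq_neg_of_add_eq_zero_right hy, neg_div, Finset.sum_div, ← Finset.sum_neg_distrib]
    apply Finset.sum_congr rfl
    intro i _
    ring
  have h3 := W_root N y _ hroot
  have h4 : ∀ i, i ≤ M → weilHeight (q.coeff i) ≤ SC + SA * weilHeight x := by
    intro i hi
    have := h2 i hi x
    rwa [hq, coeff_map]
  refine h3.trans ?_
  have hNM : ((N+1 : ℕ) : ℝ) ≤ M := by exact_mod_cast (by omega)
  have h5 : ∑ i : Fin (N+1), weilHeight (-(q.coeff i / q.coeff (N+1))) ≤ ∑ i : Fin (N+1), 2 * (SC + SA * weilHeight x) := by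
    apply Finset.sum_le_sum
    intro i _
    rw [W_neg]
    have := W_div (q.coeff i) (q.coeff (N+1))
    have := h4 i (by omega)
    have := h4 (N+1) (by omega)
    linarith
  rw [Finset.sum_const, Finset.card_univ, Fintype.card_fin, nsmul_eq_mul] at h5
  have h6 : Real.log (N+1 : ℕ) ≤ Real.log (M+1 : ℕ) := by
    apply Real.log_le_log
    · positivity
    · exact_mod_cast (by omega)
  have h7 : 0 ≤ SC + SA * weilHeight x := add_nonneg hSC0 (mul_nonneg hSA0 (W_nonneg x))
  have h8 := mul_le_mul_of_nonneg_right hNM (by positivity : 0 ≤ 2 * (SC + SA * weilHeight x))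
  linarith

lemma W_iter (f : Qbar[X]) (hd : 2 ≤ f.natDegree) : ∃ c : ℝ, 0 ≤ c ∧ ∀ (i : ℕ) (x : Qbar),
    weilHeight (eval x (itp f i)) ≤ f.natDegree ^ i * (weilHeight x) + (f.natDegree ^ i - 1) * c ∧
    f.natDegree ^ i * (weilHeight x) ≤ weilHeight (eval x (itp f i)) + (f.natDegree ^ i - 1) * c := by
  obtain ⟨e, he⟩ : ∃ e, f.natDegree = e + 1 := ⟨f.natDegree - 1, by omega⟩
  obtain ⟨c1, hc1⟩ := W_down f e he
  set c2 := Real.log (f.natDegree+1 : ℕ) + ∑ i : Fin (f.natDegree+1), weilHeight (f.coeff i)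
  have hc2 : ∀ x, weilHeight (f.eval x) ≤ c2 + f.natDegree * weilHeight x := W_up f _ le_rfl
  rw [← he] at hc1
  refine ⟨max 0 (max c1 c2), le_max_left _ _, ?_⟩
  set c := max 0 (max c1 c2)
  have k0 : 0 ≤ c := le_max_left _ _
  have k1 : c1 ≤ c := (le_max_left _ _).trans (le_max_right _ _)
  have k2 : c2 ≤ c := (le_max_right _ _).trans (le_max_right _ _)
  have hd' : (2:ℝ) ≤ f.natDegree := by exact_mod_cast hd
  generalize (f.natDegree : ℝ) = D at *
  intro i x
  induction i with
  | zero => simp [itp_zero]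
  | succ i ih =>
    rw [itp_succ, eval_comp]
    have a1 := hc1 (eval x (itp f i))
    have a2 := hc2 (eval x (itp f i))
    obtain ⟨i1, i2⟩ := ih
    have b1 := mul_le_mul_of_nonneg_left i1 (by linarith : 0 ≤ D)
    have b2 := mul_le_mul_of_nonneg_left i2 (by linarith : 0 ≤ D)
    have b3 : 0 ≤ (D - 2) * c := mul_nonneg (by linarith) k0
    rw [pow_succ']
    constructor <;> nlinarith

lemma W_per (f : Qbar[X]) (hd : 2 ≤ f.natDegree) : ∃ c : ℝ, ∀ (k : ℕ) (x : Qbar), 1 ≤ k → eval x (itp f k) = x → weilHeight x ≤ c := by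
  obtain ⟨c, h0, hc⟩ := W_iter f hd
  refine ⟨c, fun k x hk hx => ?_⟩
  have h := (hc k x).2
  rw [hx] at h
  have hd' : (1:ℝ) < f.natDegree := by exact_mod_cast (by omega)
  have : (1:ℝ) < f.natDegree ^ k := one_lt_pow₀ hd' (by omega)
  nlinarith

lemma W_comm (f : Qbar[X]) (hd : 2 ≤ f.natDegree) : ∃ c : ℝ, 0 ≤ c ∧ ∀ (g : Qbar[X]) (l : ℕ), 1 ≤ l → 1 ≤ g.natDegree →
    g.comp (itp f l) = (itp f l).comp g → ∀ x : Qbar, g.natDegree * weilHeight x ≤ weilHeight (eval x g) + (g.natDegree + 1) * c := by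
  obtain ⟨c, h0, hc⟩ := W_iter f hd
  refine ⟨c, h0, fun g l hl hg hgf x => ?_⟩
  obtain ⟨e, he⟩ : ∃ e, g.natDegree = e + 1 := ⟨g.natDegree - 1, by omega⟩
  obtain ⟨c1, hc1⟩ := W_down g e he
  rw [← he] at hc1
  have hcm : Function.Commute (fun y => eval y g) (fun y => eval y (itp f l)) := by
    intro y
    have := congrArg (eval y) hgf
    simpa [eval_comp] using this
  have key : ∀ i : ℕ, g.natDegree * weilHeight x - (weilHeight (eval x g) + (g.natDegree + 1) * c) ≤ |c1| / (f.natDegree:ℝ) ^ i := by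
    intro i
    have h1 := (hcm.iterate_right i).eq x
    simp only [← itp_add_eval, itp_itp] at h1
    have h2 := hc1 (eval x (itp f (l*i)))
    rw [h1] at h2
    have h3 := (hc (l*i) (eval x g)).1
    have h4 := (hc (l*i) x).2
    have hd' : (1:ℝ) < f.natDegree := by exact_mod_cast (by omega)
    have p1 : (f.natDegree:ℝ) ^ i ≤ f.natDegree ^ (l*i) := pow_le_pow_right₀ hd'.le (by nlinarith)
    have p0 : (0:ℝ) < f.natDegree ^ i := by positivity
    have p2 : (0:ℝ) < f.natDegree ^ (l*i) := by positivity
    refine le_trans ?_ (div_le_div_of_nonneg_left (abs_nonneg c1) p0 p1)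
    rw [le_div_iff₀ p2]
    have h5 := mul_le_mul_of_nonneg_left h4 (Nat.cast_nonneg g.natDegree : (0:ℝ) ≤ g.natDegree)
    have h6 := le_abs_self c1
    have h7 : 0 ≤ (g.natDegree : ℝ) * c := by positivity
    nlinarith
  have hd' : (1:ℝ) < f.natDegree := by exact_mod_cast (by omega)
  have lim : Filter.Tendsto (fun i : ℕ => |c1| / (f.natDegree:ℝ) ^ i) Filter.atTop (nhds 0) :=
    Filter.Tendsto.const_div_atTop (tendsto_pow_atTop_atTop_of_one_lt hd') _
  have := ge_of_tendsto' lim key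
  linarith
end
end

noncomputable section
open Polynomial

section
variable {n : ℕ}

/-- The homogeneous coordinate ring. -/
abbrev RR (n : ℕ) : Type := MvPolynomial (Fin n × Fin 2) Qbar

/-- Torus orbit restriction, killing the coordinates before `j`. -/
def torj (P : PPt n) (j : ℕ) : RR n →ₐ[Qbar] MvPolynomial (Fin n) Qbar :=
  MvPolynomial.aeval (fun q => if (q.1 : ℕ) < j then 0 else MvPolynomial.C ((P q.1).rep q.2) * MvPolynomial.X q.1)

def tor (P : PPt n) : RR n →ₐ[Qbar] MvPolynomial (Fin n) Qbar := torj P 0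

lemma tor_eval (P : PPt n) (f : RR n) (l : Fin n → Qbar) :
    MvPolynomial.eval l (tor P f) = MvPolynomial.eval (fun q => l q.1 * (P q.1).rep q.2) f := by
  have : (MvPolynomial.eval l).comp (tor P : RR n →+* MvPolynomial (Fin n) Qbar) = MvPolynomial.eval (fun q => l q.1 * (P q.1).rep q.2) := by
    apply MvPolynomial.ringHom_ext
    · intro r; simp [tor, torj]
    · intro q; simp [tor, torj, mul_comm]
  exact congrArg (fun g => g f) this

lemma isRep_iff (P : P1) (v : Fin 2 → Qbar) : IsRep P v ↔ ∃ l : Qbar, l ≠ 0 ∧ ∀ e, v e = l * P.rep e := by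
  constructor
  · rintro ⟨h, hP⟩
    obtain ⟨a, ha⟩ := Projectivization.exists_smul_eq_mk_rep Qbar v h
    rw [hP] at ha
    refine ⟨(a⁻¹ : Qbarˣ), by simp, fun e => ?_⟩
    rw [← ha]
    simp [Units.smul_def]
  · rintro ⟨l, hl, h⟩
    have hv : v = l • P.rep := by ext e; simp [h]
    have h0 : v ≠ 0 := by rw [hv]; exact smul_ne_zero hl P.rep_nonzero
    refine ⟨h0, ?_⟩
    conv_rhs => rw [← P.mk_rep]
    rw [Projectivization.mk_eq_mk_iff']
    exact ⟨l, hv.symm⟩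

lemma poly_zero_of_units (f : MvPolynomial (Fin n) Qbar) (h : ∀ l : Fin n → Qbar, (∀ i, l i ≠ 0) → MvPolynomial.eval l f = 0) : f = 0 := by
  have h1 : f * ∏ i, MvPolynomial.X i = 0 := by
    apply MvPolynomial.funext
    intro l
    by_cases hl : ∀ i, l i ≠ 0
    · simp [h l hl]
    · push Not at hl
      obtain ⟨i, hi⟩ := hl
      rw [map_mul, map_prod, map_zero]
      rw [Finset.prod_eq_zero (Finset.mem_univ i) (by simpa using hi), mul_zero]
  rcases mul_eq_zero.1 h1 with h2 | h2
  · exact h2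
  · exact absurd h2 (Finset.prod_ne_zero_iff.2 fun i _ => MvPolynomial.X_ne_zero i)

lemma van_iff (P : PPt n) (f : RR n) : (∀ v : Fin n → Fin 2 → Qbar,
      (∀ i, IsRep (P i) (v i)) → MvPolynomial.eval (fun q => v q.1 q.2) f = 0) ↔ tor P f = 0 := by
  constructor
  · intro h
    apply poly_zero_of_units
    intro l hl
    rw [tor_eval]
    exact h (fun i e => l i * (P i).rep e) (fun i => (isRep_iff _ _).2 ⟨l i, hl i, fun e => rfl⟩)
  · intro h v hv
    simp only [isRep_iff] at hv
    choose l hl h2 using hv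
    have := tor_eval P f l
    rw [h, map_zero] at this
    rw [this]
    congr 1
    congr 1
    funext q
    rw [h2]

/-- zero set -/
def ZS (I : Set (RR n)) : Set (PPt n) := {P | ∀ f ∈ I, tor P f = 0}

lemma closed_iff (S : Set (PPt n)) : PClosed S ↔ ∃ I, S = ZS I := by
  unfold PClosed ZS
  simp only [van_iff]

lemma ZS_closed (I : Set (RR n)) : PClosed (ZS I) := (closed_iff _).2 ⟨I, rfl⟩

/-- vanishing ideal -/
def IS (S : Set (PPt n)) : Ideal (RR n) := ⨅ P ∈ S, RingHom.ker (tor P)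

lemma mem_IS (S : Set (PPt n)) (f : RR n) : f ∈ IS S ↔ ∀ P ∈ S, tor P f = 0 := by
  simp [IS, Ideal.mem_iInf, RingHom.mem_ker]

lemma IS_anti {S T : Set (PPt n)} (h : S ⊆ T) : IS T ≤ IS S := by
  intro f; rw [mem_IS, mem_IS]; exact fun hf P hP => hf P (h hP)

lemma closed_mem {S : Set (PPt n)} (hS : PClosed S) {P : PPt n} (h : ∀ f ∈ IS S, tor P f = 0) : P ∈ S := by
  obtain ⟨I, rfl⟩ := (closed_iff _).1 hS
  intro f hf
  exact h f ((mem_IS _ _).2 fun Q hQ => hQ f hf)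

lemma IS_lt {S T : Set (PPt n)} (hS : PClosed S) (h : S ⊂ T) : IS T < IS S := by
  refine lt_of_le_of_ne (IS_anti h.1) fun he => h.2 ?_
  intro P hP
  apply closed_mem hS
  intro f hf
  rw [← he] at hf
  exact (mem_IS _ _).1 hf P hP

lemma IS_prime {S : Set (PPt n)} (h : PIrred S) : (IS S).IsPrime := by
  constructor
  · intro ht
    obtain ⟨P, hP⟩ := h.1
    have := (mem_IS S 1).1 (by rw [ht]; trivial) P hP
    rw [map_one] at this
    exact one_ne_zero this
  · intro f g hfg
    rw [mem_IS] at hfg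
    have := h.2 (ZS {f}) (ZS {g}) (ZS_closed _) (ZS_closed _) (by
      intro P hP
      have := hfg P hP
      rw [map_mul, mul_eq_zero] at this
      rcases this with h | h
      · left; intro f' hf'; rw [Set.mem_singleton_iff.1 hf']; exact h
      · right; intro f' hf'; rw [Set.mem_singleton_iff.1 hf']; exact h)
    rcases this with h | h
    · left; rw [mem_IS]; exact fun P hP => h hP f rfl
    · right; rw [mem_IS]; exact fun P hP => h hP g rfl

lemma closed_inter {S T : Set (PPt n)} (hS : PClosed S) (hT : PClosed T) : PClosed (S ∩ T) := by
  obtain ⟨I, rfl⟩ := (closed_iff _).1 hS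
  obtain ⟨J, rfl⟩ := (closed_iff _).1 hT
  rw [closed_iff]
  refine ⟨I ∪ J, ?_⟩
  ext P
  constructor
  · rintro ⟨h1, h2⟩ f (hf | hf)
    · exact h1 f hf
    · exact h2 f hf
  · intro h; exact ⟨fun f hf => h f (Or.inl hf), fun f hf => h f (Or.inr hf)⟩

lemma singleton_closed (P : PPt n) : PClosed {P} := by
  rw [closed_iff]
  refine ⟨{f | tor P f = 0}, ?_⟩
  ext Q
  constructor
  · rintro rfl; exact fun f hf => hf
  · intro h
    rw [Set.mem_singleton_iff]
    funext i
    have h1 := h (MvPolynomial.X (i,0) * MvPolynomial.C ((P i).rep 1) - MvPolynomial.X (i,1) * MvPolynomial.C ((P i).rep 0)) (by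
      simp [tor, torj]; ring)
    have h2 := congrArg (MvPolynomial.eval (fun _ => (1:Qbar))) h1
    rw [tor_eval] at h2
    simp at h2
    rw [← (Q i).mk_rep, ← (P i).mk_rep, Projectivization.mk_eq_mk_iff']
    have hP := (P i).rep_nonzero
    by_cases h0 : (P i).rep 0 = 0
    · have h3 : (P i).rep 1 ≠ 0 := fun h3 => hP (by ext e; fin_cases e <;> simp [h0, h3])
      refine ⟨(Q i).rep 1 / (P i).rep 1, ?_⟩
      ext e
      fin_cases e
      · rw [h0, mul_zero, sub_zero] at h2
        simp [h0, (mul_eq_zero.1 h2).resolve_right h3]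
      · simp [h3]
    · refine ⟨(Q i).rep 0 / (P i).rep 0, ?_⟩
      ext e
      fin_cases e
      · simp [h0]
      · simp; field_simp; linear_combination h2

lemma singleton_irred (P : PPt n) : PIrred ({P} : Set (PPt n)) := by
  refine ⟨⟨P, rfl⟩, fun Z1 Z2 _ _ h => ?_⟩
  rcases h rfl with h | h
  · left; rintro _ rfl; exact h
  · right; rintro _ rfl; exact h

lemma ker_torj_lt (P : PPt n) (j : ℕ) (hj : j < n) : RingHom.ker (torj P j) < RingHom.ker (torj P (j+1)) := by
  refine lt_of_le_of_ne ?_ ?_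
  · intro f hf
    rw [RingHom.mem_ker] at hf ⊢
    let τ : MvPolynomial (Fin n) Qbar →ₐ[Qbar] MvPolynomial (Fin n) Qbar :=
      MvPolynomial.aeval (fun i => if (i : ℕ) < j + 1 then 0 else MvPolynomial.X i)
    have : torj P (j+1) = τ.comp (torj P j) := by
      apply MvPolynomial.algHom_ext
      intro q
      by_cases h1 : (q.1 : ℕ) < j
      · simp [torj, τ, h1, h1.trans (Nat.lt_succ_self j)]
        intro h; omega
      · by_cases h2 : (q.1 : ℕ) < j + 1
        · simp [torj, τ, h1, h2]
        · simp only [torj, τ, h1, h2, MvPolynomial.aeval_X, if_false, AlgHom.comp_apply, map_mul]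
          congr 1
          rw [← MvPolynomial.algebraMap_eq, AlgHom.commutes]
    rw [this, AlgHom.comp_apply, hf, map_zero]
  · intro he
    have : ∃ e, (P ⟨j, hj⟩).rep e ≠ 0 := by
      by_contra hc
      push Not at hc
      exact (P ⟨j, hj⟩).rep_nonzero (funext hc)
    obtain ⟨e, he'⟩ := this
    have h1 : (MvPolynomial.X (⟨j, hj⟩, e) : RR n) ∈ RingHom.ker (torj P (j+1)) := by
      rw [RingHom.mem_ker]; simp [torj]
    rw [← he, RingHom.mem_ker] at h1
    simp [torj, he'] at h1

def kerS (P : PPt n) (j : ℕ) : PrimeSpectrum (RR n) := ⟨RingHom.ker (torj P j), RingHom.ker_isPrime _⟩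

lemma ht_le (p : PrimeSpectrum (RR n)) : Order.height p ≤ (2 * n : ℕ) := by
  have h : ringKrullDim (RR n) = (2 * n : ℕ) := by
    rw [MvPolynomial.ringKrullDim_of_isNoetherianRing]
    simp [mul_comm]
  have h2 := Order.height_le_krullDim p
  unfold ringKrullDim at h
  rw [h] at h2
  exact WithBot.coe_le_coe.1 h2

lemma ht_ker (P : PPt n) (j : ℕ) (hj : j ≤ n) : Order.height (kerS P 0) + j ≤ Order.height (kerS P j) := by
  induction j with
  | zero => simp
  | succ j ih =>
    have := Order.height_add_one_le (show kerS P j < kerS P (j+1) from ker_torj_lt P j (by omega))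
    refine le_trans ?_ this
    push_cast
    rw [← add_assoc]
    gcongr
    exact ih (by omega)

/-- The basic chain estimate. -/
lemma chain_le {S : Set (PPt n)} (hS : PIrred S) (m d : ℕ) (hm : (m : ℕ∞) ≤ Order.height (⟨IS S, IS_prime hS⟩ : PrimeSpectrum (RR n)))
    (Z : Fin (d + 1) → Set (PPt n)) (hZ : ∀ i, PClosed (Z i) ∧ PIrred (Z i) ∧ Z i ⊆ S)
    (hlt : ∀ i j : Fin (d + 1), i < j → Z i ⊂ Z j) : m + d ≤ n := by
  have key : ∀ j : ℕ, ∀ hj : j ≤ d, ((m + j : ℕ) : ℕ∞) ≤ Order.height (⟨IS (Z ⟨d - j, by omega⟩), IS_prime (hZ _).2.1⟩ : PrimeSpectrum (RR n)) := by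
    intro j
    induction j with
    | zero =>
      intro hj
      refine hm.trans (Order.height_mono ?_)
      exact IS_anti (hZ _).2.2
    | succ j ih =>
      intro hj
      have h1 := ih (by omega)
      have h2 := Order.height_add_one_le (show (⟨IS (Z ⟨d - j, by omega⟩), IS_prime (hZ _).2.1⟩ : PrimeSpectrum (RR n)) < ⟨IS (Z ⟨d - (j+1), by omega⟩), IS_prime (hZ _).2.1⟩ from
        IS_lt (hZ _).1 (hlt _ _ (by simp; omega)))
      refine le_trans ?_ h2
      push_cast at h1 ⊢
      rw [← add_assoc]
      gcongr
  have h1 := key d le_rfl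
  obtain ⟨P, hP⟩ := (hZ ⟨d - d, by omega⟩).2.1.1
  have h2 : (⟨IS (Z ⟨d - d, by omega⟩), IS_prime (hZ _).2.1⟩ : PrimeSpectrum (RR n)) ≤ kerS P 0 := by
    intro f hf
    exact (mem_IS _ _).1 hf P hP
  have h3 := h1.trans (Order.height_mono h2)
  have h4 := (add_le_add_left h3 (n : ℕ∞)).trans ((ht_ker P n le_rfl).trans (ht_le _))
  have h5 : (m + d) + n ≤ 2 * n := by exact_mod_cast h4
  omega

lemma pdim_bdd {S : Set (PPt n)} (hS : PIrred S) : BddAbove {d : ℕ | ∃ Z : Fin (d + 1) → Set (PPt n),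
    (∀ i, PClosed (Z i) ∧ PIrred (Z i) ∧ Z i ⊆ S) ∧
    ∀ i j : Fin (d + 1), i < j → Z i ⊂ Z j} := by
  refine ⟨n, ?_⟩
  rintro d ⟨Z, hZ, hlt⟩
  have := chain_le hS 0 d (by simp) Z hZ hlt
  omega

lemma pdim_attained {S : Set (PPt n)} (hc : PClosed S) (hS : PIrred S) : ∃ Z : Fin (pdim S + 1) → Set (PPt n),
    (∀ i, PClosed (Z i) ∧ PIrred (Z i) ∧ Z i ⊆ S) ∧
    ∀ i j : Fin (pdim S + 1), i < j → Z i ⊂ Z j := by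
  have := Nat.sSup_mem (s := {d : ℕ | ∃ Z : Fin (d + 1) → Set (PPt n),
    (∀ i, PClosed (Z i) ∧ PIrred (Z i) ∧ Z i ⊆ S) ∧
    ∀ i j : Fin (d + 1), i < j → Z i ⊂ Z j}) ⟨0, fun _ => S, fun _ => ⟨hc, hS, subset_rfl⟩, fun i j hij => by
      have h1 := i.2; have h2 := j.2; have h3 : (i:ℕ) < j := hij; omega⟩ (pdim_bdd hS)
  exact this

/-- A hypersurface has principal ideal. -/
lemma hyp_principal {V : Set (PPt n)} (hc : PClosed V) (hV : PIrred V) (hd : pdim V + 1 = n) (h0 : IS V ≠ ⊥) :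
    ∃ F : RR n, F ≠ 0 ∧ IS V = Ideal.span {F} := by
  haveI := IS_prime hV
  obtain ⟨F, hF, hFp⟩ : ∃ F ∈ IS V, Prime F := by
    exact Ideal.IsPrime.exists_mem_prime_of_ne_bot (IS_prime hV) h0
  refine ⟨F, hFp.ne_zero, ?_⟩
  by_contra hne
  have hlt : Ideal.span {F} < IS V := lt_of_le_of_ne (by rwa [Ideal.span_singleton_le_iff_mem]) (Ne.symm hne)
  have hFP : (Ideal.span {F}).IsPrime := (Ideal.span_singleton_prime hFp.ne_zero).2 hFp
  have hbot : (⊥ : Ideal (RR n)) < Ideal.span {F} := by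
    rw [bot_lt_iff_ne_bot, Ne, Ideal.span_singleton_eq_bot]; exact hFp.ne_zero
  have h1 := Order.height_add_one_le (show (⟨⊥, Ideal.isPrime_bot⟩ : PrimeSpectrum (RR n)) < ⟨Ideal.span {F}, hFP⟩ from hbot)
  have h2 := Order.height_add_one_le (show (⟨Ideal.span {F}, hFP⟩ : PrimeSpectrum (RR n)) < ⟨IS V, IS_prime hV⟩ from hlt)
  have h3 : ((2 : ℕ) : ℕ∞) ≤ Order.height (⟨IS V, IS_prime hV⟩ : PrimeSpectrum (RR n)) := by
    refine le_trans ?_ h2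
    refine le_trans ?_ (add_le_add_left h1 1)
    rw [add_assoc]
    refine le_trans ?_ le_add_self
    norm_num
  obtain ⟨Z, hZ, hlt⟩ := pdim_attained hc hV
  have := chain_le hV 2 _ h3 Z hZ hlt
  omega

/-- Proper closed subsets of a curve are finite. -/
lemma curve_fin {C : Set (PPt n)} (hC : IsCurve C) : ∀ I : Ideal (RR n), ∀ S : Set (PPt n), IS S = I → PClosed S → S ⊂ C → S.Finite := by
  intro I
  induction I using WellFoundedGT.induction with
  | ind I ih =>
  rintro S rfl hS hSC
  by_cases hirr : PIrred S
  · by_cases hsub : S.Subsingleton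
    · exact hsub.finite
    · exfalso
      obtain ⟨P, hP⟩ := hirr.1
      have hlt : {P} ⊂ S := by
        refine ⟨by simpa using hP, fun h => hsub ?_⟩
        exact (Set.subsingleton_singleton).anti h
      have : 2 ≤ pdim C := by
        apply le_csSup (pdim_bdd hC.2.1)
        refine ⟨![{P}, S, C], ?_, ?_⟩
        · intro i
          fin_cases i
          · exact ⟨singleton_closed P, singleton_irred P, hlt.1.trans hSC.1⟩
          · exact ⟨hS, hirr, hSC.1⟩
          · exact ⟨hC.1, hC.2.1, subset_rfl⟩
        · intro i j hij
          fin_cases i <;> fin_cases j <;> first | exact hlt | exact hSC | exact hlt.trans hSC | (exact absurd hij (by decide))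
      rw [hC.2.2] at this
      omega
  · by_cases hne : S.Nonempty
    · unfold PIrred at hirr
      push Not at hirr
      obtain ⟨Z1, Z2, hZ1, hZ2, hu, h1, h2⟩ := hirr hne
      have e1 : S ∩ Z1 ⊂ S := ⟨Set.inter_subset_left, fun h => h1 (h.trans Set.inter_subset_right)⟩
      have e2 : S ∩ Z2 ⊂ S := ⟨Set.inter_subset_left, fun h => h2 (h.trans Set.inter_subset_right)⟩
      have c1 := closed_inter hS hZ1
      have c2 := closed_inter hS hZ2
      have f1 := ih _ (IS_lt c1 e1) _ rfl c1 (e1.trans hSC)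
      have f2 := ih _ (IS_lt c2 e2) _ rfl c2 (e2.trans hSC)
      apply (f1.union f2).subset
      intro P hP
      rcases hu hP with h | h
      · left; exact ⟨hP, h⟩
      · right; exact ⟨hP, h⟩
    · rw [Set.not_nonempty_iff_eq_empty.1 hne]; exact Set.finite_empty
end
end

noncomputable section
open Polynomial

section
variable {n : ℕ}

def x1 (P : P1) : Qbar := P.rep 0 / P.rep 1
def xc (P : PPt n) : Fin n → Qbar := fun i => x1 (P i)
def finP (P : PPt n) : Prop := ∀ i, (P i).rep 1 ≠ 0

lemma mk_fin (v : Fin 2 → Qbar) (h : v ≠ 0) (h1 : v 1 ≠ 0) : (Projectivization.mk Qbar v h).rep 1 ≠ 0 ∧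
    x1 (Projectivization.mk Qbar v h) = v 0 / v 1 := by
  obtain ⟨a, ha⟩ := Projectivization.exists_smul_eq_mk_rep Qbar v h
  unfold x1
  rw [← ha]
  simp only [Units.smul_def, Pi.smul_apply, smul_eq_mul]
  have := a.ne_zero
  refine ⟨mul_ne_zero this h1, ?_⟩
  field_simp

def aff (x : Fin n → Qbar) : PPt n := fun i => Projectivization.mk Qbar ![x i, 1] (by
  intro h; have := congrFun h 1; simp at this)

lemma aff_fin (x : Fin n → Qbar) : finP (aff x) := fun i => (mk_fin _ _ (by simp)).1
lemma aff_xc (x : Fin n → Qbar) : xc (aff x) = x := by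
  funext i; exact ((mk_fin _ _ (by simp)).2).trans (by simp)

lemma pact_fin (f : Qbar[X]) (P : P1) (h : P.rep 1 ≠ 0) : (pact f P).rep 1 ≠ 0 ∧ x1 (pact f P) = f.eval (x1 P) := by
  have h1 : pvec f P.rep 1 ≠ 0 := by simp [pvec, h]
  have h0 : pvec f P.rep ≠ 0 := fun h0 => h1 (by rw [h0]; rfl)
  unfold pact
  rw [dif_pos h0]
  obtain ⟨a, b⟩ := mk_fin _ h0 h1
  refine ⟨a, b.trans ?_⟩
  rw [eval_eq_sum_range]
  simp only [pvec, Matrix.cons_val_zero, Matrix.cons_val_one, x1]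
  rw [Finset.sum_div]
  apply Finset.sum_congr rfl
  intro j hj
  have hj : j ≤ f.natDegree := by have := Finset.mem_range.1 hj; omega
  rw [div_eq_iff (pow_ne_zero _ h), div_pow]
  have : P.rep 1 ^ f.natDegree = P.rep 1 ^ j * P.rep 1 ^ (f.natDegree - j) := by rw [← pow_add]; congr 1; omega
  rw [this]
  field_simp

lemma split_fin (f : Qbar[X]) (P : PPt n) (h : finP P) (k : ℕ) :
    finP ((splitMap (fun _ => f))^[k] P) ∧ xc ((splitMap (fun _ => f))^[k] P) = fun i => eval (xc P i) (itp f k) := by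
  induction k with
  | zero => simp [h, itp_zero]
  | succ k ih =>
    rw [Function.iterate_succ_apply']
    refine ⟨fun i => (pact_fin f _ (ih.1 i)).1, ?_⟩
    funext i
    rw [itp_succ, eval_comp]
    have := congrFun ih.2 i
    rw [← this]
    exact (pact_fin f _ (ih.1 i)).2

def deh : RR n →ₐ[Qbar] MvPolynomial (Fin n) Qbar :=
  MvPolynomial.aeval (fun q => if q.2 = 0 then MvPolynomial.X q.1 else 1)

def sc (l : Fin n → Qbar) : RR n →ₐ[Qbar] RR n :=
  MvPolynomial.aeval (fun q => MvPolynomial.C (l q.1) * MvPolynomial.X q)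

lemma sc_eval (l : Fin n → Qbar) (v : Fin n × Fin 2 → Qbar) (f : RR n) :
    MvPolynomial.eval v (sc l f) = MvPolynomial.eval (fun q => l q.1 * v q) f := by
  have : (MvPolynomial.eval v).comp (sc l : RR n →+* RR n) = MvPolynomial.eval (fun q => l q.1 * v q) := by
    apply MvPolynomial.ringHom_ext
    · intro r; simp [sc]
    · intro q; simp [sc]
  exact congrArg (fun g => g f) this

lemma deh_eval (x : Fin n → Qbar) (f : RR n) :
    MvPolynomial.eval x (deh f) = MvPolynomial.eval (fun q => if q.2 = 0 then x q.1 else 1) f := by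
  have : (MvPolynomial.eval x).comp (deh (n := n)).toRingHom = MvPolynomial.eval (fun q => if q.2 = 0 then x q.1 else 1) := by
    apply MvPolynomial.ringHom_ext
    · intro r; simp [deh]
    · intro q
      by_cases h : q.2 = 0 <;> simp [deh, h]
  exact congrArg (fun g => g f) this

lemma sc_IS {S : Set (PPt n)} (l : Fin n → Qbar) {f : RR n} (hf : f ∈ IS S) : sc l f ∈ IS S := by
  rw [mem_IS] at hf ⊢
  intro P hP
  apply MvPolynomial.funext
  intro m
  rw [tor_eval, sc_eval, map_zero]
  have h1 := tor_eval P f (fun i => l i * m i)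
  rw [hf P hP, map_zero] at h1
  rw [h1]
  congr 2
  funext q; ring

lemma tor_sc {P : PPt n} (hP : finP P) (f : RR n) (l : Fin n → Qbar) :
    MvPolynomial.eval (xc P) (deh (sc l f)) = MvPolynomial.eval (fun i => l i / (P i).rep 1) (tor P f) := by
  rw [deh_eval, sc_eval, tor_eval]
  congr 2
  funext ⟨i, e⟩
  have := hP i
  fin_cases e
  · simp [xc, x1]; field_simp
  · simp; field_simp

lemma tor_zero_iff {P : PPt n} (hP : finP P) (f : RR n) : tor P f = 0 ↔ ∀ l : Fin n → Qbar, (∀ i, l i ≠ 0) →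
    MvPolynomial.eval (xc P) (deh (sc l f)) = 0 := by
  constructor
  · intro h l _
    rw [tor_sc hP, h, map_zero]
  · intro h
    apply poly_zero_of_units
    intro m hm
    have := h (fun i => m i * (P i).rep 1) (fun i => mul_ne_zero (hm i) (hP i))
    rw [tor_sc hP] at this
    rw [← this]
    congr 2
    funext i
    have := hP i
    field_simp

lemma deh_van {P : PPt n} (hP : finP P) {f : RR n} (h : tor P f = 0) : MvPolynomial.eval (xc P) (deh f) = 0 := by
  have h1 := (tor_zero_iff hP f).1 h (fun _ => 1) (fun _ => one_ne_zero)
  rw [deh_eval, sc_eval] at h1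
  rw [deh_eval]
  simpa using h1

lemma hyp_mem {V : Set (PPt n)} (hc : PClosed V) {F : RR n} (hI : IS V = Ideal.span {F})
    {P : PPt n} (hP : finP P) (h : MvPolynomial.eval (xc P) (deh F) = 0) : P ∈ V := by
  have hFt : tor P F = 0 := by
    rw [tor_zero_iff hP]
    intro l hl
    have h1 : sc l F ∈ IS V := sc_IS l (by rw [hI]; exact Ideal.mem_span_singleton_self F)
    rw [hI, Ideal.mem_span_singleton] at h1
    obtain ⟨u, hu⟩ := h1
    rw [hu, map_mul, map_mul, h, zero_mul]
  apply closed_mem hc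
  intro f hf
  rw [hI, Ideal.mem_span_singleton] at hf
  obtain ⟨u, rfl⟩ := hf
  rw [map_mul, hFt, zero_mul]

/-- homogenisation -/
lemma homog (G : MvPolynomial (Fin n) Qbar) : ∃ H : RR n, deh H = G ∧ ∃ D : ℕ, 1 ≤ D ∧
    (∀ v : Fin n × Fin 2 → Qbar, (∀ i, v (i,1) ≠ 0) → MvPolynomial.eval v H = (∏ i, v (i,1)) ^ D * MvPolynomial.eval (fun i => v (i,0) / v (i,1)) G) ∧
    (∀ v : Fin n × Fin 2 → Qbar, ∀ i, v (i,1) = 0 → MvPolynomial.eval v H = 0) := by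
  classical
  have hp : deh (∏ i, MvPolynomial.X (i,1) : RR n) = 1 := by simp [deh]
  have he : ∀ v : Fin n × Fin 2 → Qbar, MvPolynomial.eval v (∏ i, MvPolynomial.X (i,1) : RR n) = ∏ i, v (i,1) := by intro v; simp
  induction G using MvPolynomial.induction_on with
  | C a =>
    refine ⟨MvPolynomial.C a * ∏ i, MvPolynomial.X (i,1), ?_, 1, le_rfl, ?_, ?_⟩
    · rw [map_mul, hp, mul_one]; simp [deh]
    · intro v hv; simp [mul_comm]
    · intro v i hi
      rw [map_mul, he, Finset.prod_eq_zero (Finset.mem_univ i) hi, mul_zero]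
  | add p q hp' hq' =>
    obtain ⟨H1, a1, D1, b1, c1, d1⟩ := hp'
    obtain ⟨H2, a2, D2, b2, c2, d2⟩ := hq'
    refine ⟨H1 * (∏ i, MvPolynomial.X (i,1)) ^ D2 + H2 * (∏ i, MvPolynomial.X (i,1)) ^ D1, ?_, D1 + D2, by omega, ?_, ?_⟩
    · simp only [map_add, map_mul, map_pow, hp, a1, a2, one_pow, mul_one]
    · intro v hv
      rw [map_add, map_mul, map_mul, map_pow, map_pow, he, c1 v hv, c2 v hv, map_add]
      ring
    · intro v i hi
      rw [map_add, map_mul, map_mul, d1 v i hi, d2 v i hi]; ring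
  | mul_X p j hp' =>
    obtain ⟨H1, a1, D1, b1, c1, d1⟩ := hp'
    refine ⟨H1 * (MvPolynomial.X (j,0) * ∏ i ∈ Finset.univ.erase j, MvPolynomial.X (i,1)), ?_, D1 + 1, by omega, ?_, ?_⟩
    · rw [map_mul, a1]
      congr 1
      simp [deh]
    · intro v hv
      rw [map_mul, c1 v hv]
      have := Finset.mul_prod_erase Finset.univ (fun i => v (i,1)) (Finset.mem_univ j)
      simp only [map_mul, map_prod, MvPolynomial.eval_X]
      rw [pow_succ]
      nth_rewrite 3 [← this]
      have := hv j
      field_simp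
    · intro v i hi
      rw [map_mul, d1 v i hi, zero_mul]

lemma homog_van {H : RR n} {G : MvPolynomial (Fin n) Qbar} {D : ℕ} (hD : 1 ≤ D)
    (h1 : ∀ v : Fin n × Fin 2 → Qbar, (∀ i, v (i,1) ≠ 0) → MvPolynomial.eval v H = (∏ i, v (i,1)) ^ D * MvPolynomial.eval (fun i => v (i,0) / v (i,1)) G)
    (h2 : ∀ v : Fin n × Fin 2 → Qbar, ∀ i, v (i,1) = 0 → MvPolynomial.eval v H = 0) (P : PPt n) :
    tor P H = 0 ↔ (¬ finP P ∨ MvPolynomial.eval (xc P) G = 0) := by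
  by_cases hP : finP P
  · simp only [hP, not_true, false_or]
    have key : ∀ l : Fin n → Qbar, (∀ i, l i ≠ 0) → MvPolynomial.eval l (tor P H) = (∏ i, l i * (P i).rep 1) ^ D * MvPolynomial.eval (xc P) G := by
      intro l hl
      rw [tor_eval, h1 _ (fun i => mul_ne_zero (hl i) (hP i))]
      congr 3
      funext i
      have := hl i
      have := hP i
      simp only [xc, x1]
      field_simp
    constructor
    · intro h
      have := key (fun _ => 1) (fun _ => one_ne_zero)
      rw [h, map_zero] at this
      refine (mul_eq_zero.1 this.symm).resolve_left (pow_ne_zero _ (Finset.prod_ne_zero_iff.2 fun i _ => ?_))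
      simpa using hP i
    · intro h
      apply poly_zero_of_units
      intro l hl
      rw [key l hl, h, mul_zero]
  · simp only [hP, not_false_eq_true, true_or, iff_true]
    apply poly_zero_of_units
    intro l hl
    rw [tor_eval]
    unfold finP at hP
    push Not at hP
    obtain ⟨i, hi⟩ := hP
    exact h2 _ i (by simp [hi])

lemma homog' (G : MvPolynomial (Fin n) Qbar) : ∃ H : RR n, deh H = G ∧ ∀ P : PPt n, tor P H = 0 ↔ (¬ finP P ∨ MvPolynomial.eval (xc P) G = 0) := by
  obtain ⟨H, h, D, hD, h1, h2⟩ := homog G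
  exact ⟨H, h, homog_van hD h1 h2⟩

lemma closed_G (G : MvPolynomial (Fin n) Qbar) : PClosed {P : PPt n | ¬ finP P ∨ MvPolynomial.eval (xc P) G = 0} := by
  obtain ⟨H, h, h1⟩ := homog' G
  rw [closed_iff]
  refine ⟨{H}, ?_⟩
  ext P
  simp [ZS, h1]
end
end

noncomputable section
open Polynomial

section
lemma zar_aux {R A : Type} [CommRing R] [IsDomain R] [CommRing A] [IsDomain A] [Algebra R A] [Algebra.FiniteType R A]
    (hinj : Function.Injective (algebraMap R A)) (b : A) (hb : Transcendental R b) :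
    ∃ q : Ideal A, q.IsPrime ∧ q ≠ ⊥ ∧ ∀ r : R, r ≠ 0 → algebraMap R A r ∉ q := by
  let M := nonZeroDivisors R
  let N := Algebra.algebraMapSubmonoid A M
  let K := Localization M
  let B := Localization N
  letI : Field K := inferInstanceAs (Field (FractionRing R))
  have hN : N ≤ nonZeroDivisors A := by
    rintro _ ⟨r, hr, rfl⟩
    exact mem_nonZeroDivisors_of_ne_zero (by
      have h0 := nonZeroDivisors.ne_zero hr
      intro h; exact h0 (hinj (by rw [h, map_zero])))
  haveI : IsDomain B := IsLocalization.isDomain_localization hN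
  have hBinj : Function.Injective (algebraMap A B) := IsLocalization.injective B hN
  haveI : IsScalarTower R K B := inferInstance
  have hft : Algebra.FiniteType K B := by
    haveI : IsLocalization (Submonoid.map (algebraMap R A) M) B := inferInstanceAs (IsLocalization N (Localization N))
    have := RingHom.finiteType_localizationPreserves (algebraMap R A) M K B
      (RingHom.finiteType_algebraMap.2 inferInstance)
    exact this
  have hnf : ¬ IsField B := by
    intro hf
    letI : Field B := hf.toField
    have hfin : Module.Finite K B := finite_of_finite_type_of_isJacobsonRing K B
    have h1 : IsAlgebraic K (algebraMap A B b) := Algebra.IsAlgebraic.isAlgebraic _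
    have h2 : IsAlgebraic R (algebraMap A B b) := (IsFractionRing.isAlgebraic_iff R K B).2 h1
    apply hb
    obtain ⟨p, hp, hp2⟩ := h2
    refine ⟨p, hp, hBinj ?_⟩
    rw [map_zero, ← hp2, aeval_algebraMap_apply]
  obtain ⟨p, hp, hpp⟩ := (Ring.not_isField_iff_exists_prime).1 hnf
  refine ⟨p.comap (algebraMap A B), Ideal.IsPrime.comap _, ?_, ?_⟩
  · intro h
    apply hp
    rw [eq_bot_iff]
    intro z hz
    obtain ⟨⟨a, s⟩, ha⟩ := IsLocalization.surj N z
    have h1 : a ∈ p.comap (algebraMap A B) := by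
      rw [Ideal.mem_comap, ← ha]; exact p.mul_mem_right _ hz
    rw [h, Ideal.mem_bot] at h1
    simp only [h1, map_zero] at ha
    have := IsLocalization.map_units B s
    rw [Ideal.mem_bot]
    exact (mul_eq_zero.1 ha).resolve_right this.ne_zero
  · intro r hr h
    rw [Ideal.mem_comap] at h
    have := IsLocalization.map_units B (⟨algebraMap R A r, r, mem_nonZeroDivisors_of_ne_zero hr, rfl⟩ : N)
    exact hpp.ne_top (Ideal.eq_top_of_isUnit_mem _ h this)

lemma zar_aux2 {k A : Type} [Field k] [CommRing A] [IsDomain A] [Algebra k A] [Algebra.FiniteType k A]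
    (a b : A) (ha : ∀ p : k[X], p ≠ 0 → aeval a p ≠ 0)
    (hab : ∀ G : k[X][X], G ≠ 0 → eval₂ (aeval a : k[X] →ₐ[k] A).toRingHom b G ≠ 0) :
    ∃ q : Ideal A, q.IsPrime ∧ q ≠ ⊥ ∧ ∀ p : k[X], p ≠ 0 → aeval a p ∉ q := by
  letI : Algebra k[X] A := (aeval a : k[X] →ₐ[k] A).toRingHom.toAlgebra
  haveI : IsScalarTower k k[X] A := IsScalarTower.of_algebraMap_eq (fun x => by
    change _ = aeval a (algebraMap k k[X] x)
    rw [AlgHom.commutes])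
  haveI : Algebra.FiniteType k[X] A := Algebra.FiniteType.of_restrictScalars_finiteType k k[X] A
  have hinj : Function.Injective (algebraMap k[X] A) := by
    rw [injective_iff_map_eq_zero]
    intro p hp
    by_contra h
    exact ha p h hp
  obtain ⟨q, h1, h2, h3⟩ := zar_aux hinj b (by
    rintro ⟨G, hG, hG2⟩
    exact hab G hG hG2)
  exact ⟨q, h1, h2, h3⟩
end
end

noncomputable section
open Polynomial

section
lemma zar_aux3 {k S : Type} [Field k] [CommRing S] [Algebra k S] [Algebra.FiniteType k S] (J : Ideal S) (hJ : J.IsPrime)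
    (a b : S) (ha : ∀ p : k[X], p ≠ 0 → aeval a p ∉ J)
    (hab : ∀ G : k[X][X], G ≠ 0 → eval₂ (aeval a : k[X] →ₐ[k] S).toRingHom b G ∉ J) :
    ∃ q : Ideal S, q.IsPrime ∧ J < q ∧ ∀ p : k[X], p ≠ 0 → aeval a p ∉ q := by
  obtain ⟨A, i1, i2, i3, i4, π, hπ, hker⟩ : ∃ (A : Type) (_ : CommRing A) (_ : IsDomain A) (_ : Algebra k A) (_ : Algebra.FiniteType k A) (π : S →ₐ[k] A),
      Function.Surjective π ∧ ∀ x, π x = 0 ↔ x ∈ J :=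
    ⟨S ⧸ J, inferInstance, inferInstance, inferInstance, inferInstance, Ideal.Quotient.mkₐ k J, Ideal.Quotient.mkₐ_surjective k J, fun x => Ideal.Quotient.eq_zero_iff_mem⟩
  obtain ⟨q, h1, h2, h3⟩ := zar_aux2 (k := k) (π a) (π b) (by
      intro p hp h
      rw [aeval_algHom_apply, hker] at h
      exact ha p hp h) (by
      intro G hG h
      apply hab G hG
      rw [← hker, ← h]
      change (π : S →+* A) _ = _
      rw [hom_eval₂]
      congr 1
      ext p
      · simp
      · simp)
  refine ⟨q.comap π, Ideal.IsPrime.comap _, ?_, ?_⟩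
  · refine lt_of_le_of_ne ?_ ?_
    · intro x hx
      rw [Ideal.mem_comap, (hker x).2 hx]; exact q.zero_mem
    · intro he
      apply h2
      rw [eq_bot_iff]
      intro z hz
      obtain ⟨x, rfl⟩ := hπ z
      have : x ∈ J := by rw [he]; exact hz
      rw [Ideal.mem_bot]; exact (hker x).2 this
  · intro p hp h
    rw [Ideal.mem_comap, ← aeval_algHom_apply] at h
    exact h3 p hp h

variable {n : ℕ} {C : Set (PPt n)}

lemma curve_fin_ex (hC : IsCurve C) (hnv : NonVertical C) : ∃ P ∈ C, finP P := by
  by_contra hc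
  push Not at hc
  have h1 : (∏ i, MvPolynomial.X (i,1) : RR n) ∈ IS C := by
    rw [mem_IS]
    intro P hP
    have := hc P hP
    unfold finP at this
    push Not at this
    obtain ⟨i, hi⟩ := this
    rw [map_prod]
    apply Finset.prod_eq_zero (Finset.mem_univ i)
    simp [tor, torj, hi]
  haveI := IS_prime hC.2.1
  rw [Ideal.IsPrime.prod_mem_iff] at h1
  obtain ⟨i, _, hi⟩ := h1
  obtain ⟨P, hP, hPi⟩ := hnv i (aff (fun _ => 0) i)
  have h2 := (mem_IS _ _).1 hi P hP
  have h3 := aff_fin (n := n) (fun _ => 0) i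
  rw [← hPi] at h3
  simp [tor, torj, h3] at h2

lemma curve_G (hC : IsCurve C) (G : MvPolynomial (Fin n) Qbar) (h : ∃ P ∈ C, finP P ∧ MvPolynomial.eval (xc P) G ≠ 0) :
    {P | P ∈ C ∧ (¬ finP P ∨ MvPolynomial.eval (xc P) G = 0)}.Finite := by
  apply curve_fin hC _ _ rfl (closed_inter hC.1 (closed_G G))
  obtain ⟨P, hP, h1, h2⟩ := h
  refine ⟨Set.inter_subset_left, fun hs => ?_⟩
  rcases (hs hP).2 with h | h
  · exact h h1
  · exact h2 h

lemma curve_inf (hC : IsCurve C) (hnv : NonVertical C) : {P | P ∈ C ∧ ¬ finP P}.Finite := by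
  obtain ⟨P, hP, h1⟩ := curve_fin_ex hC hnv
  exact (curve_G hC 1 ⟨P, hP, h1, by simp⟩).subset (fun Q hQ => ⟨hQ.1, Or.inl hQ.2⟩)

/-- affine vanishing ideal -/
def JJ (C : Set (PPt n)) : Ideal (MvPolynomial (Fin n) Qbar) := ⨅ P ∈ {P | P ∈ C ∧ finP P}, RingHom.ker (MvPolynomial.eval (xc P))

lemma mem_JJ (G : MvPolynomial (Fin n) Qbar) : G ∈ JJ C ↔ ∀ P ∈ C, finP P → MvPolynomial.eval (xc P) G = 0 := by
  simp [JJ, Ideal.mem_iInf, RingHom.mem_ker]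

lemma homog_IS (S : Set (PPt n)) {H : RR n} {G} (h : ∀ P : PPt n, tor P H = 0 ↔ (¬ finP P ∨ MvPolynomial.eval (xc P) G = 0)) :
    H ∈ IS S ↔ G ∈ JJ S := by
  rw [mem_IS, mem_JJ]
  simp only [h]
  constructor
  · intro h P hP hf; exact (h P hP).resolve_left (not_not.2 hf)
  · intro h P hP; by_cases hf : finP P
    · exact Or.inr (h P hP hf)
    · exact Or.inl hf

lemma JJ_prime {S : Set (PPt n)} (hS : PIrred S) (hf : ∃ P ∈ S, finP P) : (JJ S).IsPrime := by
  constructor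
  · intro ht
    obtain ⟨P, hP, hf⟩ := hf
    have := (mem_JJ 1).1 (by rw [ht]; trivial) P hP hf
    simp at this
  · intro G1 G2 h
    obtain ⟨H1, _, h1⟩ := homog' G1
    obtain ⟨H2, _, h2⟩ := homog' G2
    have : H1 * H2 ∈ IS S := by
      rw [mem_IS]
      intro P hP
      rw [map_mul]
      by_cases hf : finP P
      · have := (mem_JJ _).1 h P hP hf
        rw [map_mul, mul_eq_zero] at this
        rcases this with h | h
        · rw [(h1 P).2 (Or.inr h), zero_mul]
        · rw [(h2 P).2 (Or.inr h), mul_zero]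
      · rw [(h1 P).2 (Or.inl hf), zero_mul]
    rcases (IS_prime hS).mem_or_mem this with h | h
    · left; exact (homog_IS S h1).1 h
    · right; exact (homog_IS S h2).1 h

lemma aff_mem (hC : PClosed C) (x : Fin n → Qbar) (h : ∀ G ∈ JJ C, MvPolynomial.eval x G = 0) : aff x ∈ C := by
  apply closed_mem hC
  intro f hf
  rw [tor_zero_iff (aff_fin x), aff_xc]
  intro l _
  apply h
  rw [mem_JJ]
  intro P hP hPf
  exact deh_van hPf ((mem_IS _ _).1 (sc_IS l hf) P hP)

lemma curve_tr (hC : IsCurve C) (hnv : NonVertical C) (i : Fin n) (p : Qbar[X]) (hp : p ≠ 0) :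
    aeval (MvPolynomial.X i : MvPolynomial (Fin n) Qbar) p ∉ JJ C := by
  intro h
  classical
  rw [mem_JJ] at h
  have hfin := (curve_inf hC hnv).image (fun P => x1 (P i))
  have hfin2 : (p.roots.toFinset : Set Qbar).Finite := Finset.finite_toSet _
  obtain ⟨y, hy⟩ := ((hfin.union hfin2).infinite_compl).nonempty
  obtain ⟨P, hP, hPi⟩ := hnv i (aff (fun _ => y) i)
  have hx : x1 (P i) = y := by rw [hPi]; exact congrFun (aff_xc (fun _ => y)) i
  apply hy
  by_cases hf : finP P
  · right
    have h1 := h P hP hf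
    rw [← MvPolynomial.coe_aeval_eq_eval] at h1
    change MvPolynomial.aeval (xc P) _ = 0 at h1
    rw [← aeval_algHom_apply, MvPolynomial.aeval_X] at h1
    change aeval (x1 (P i)) p = 0 at h1
    rw [hx, coe_aeval_eq_eval] at h1
    simp [hp, h1]
  · left
    exact ⟨P, ⟨hP, hf⟩, hx⟩

lemma curve_dep (hC : IsCurve C) (hnv : NonVertical C) (i j : Fin n) : ∃ G : Qbar[X][X], G ≠ 0 ∧
    ∀ P ∈ C, finP P → eval (xc P j) (G.map (evalRingHom (xc P i))) = 0 := by
  by_contra hc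
  push Not at hc
  obtain ⟨q, hq, hJq, hqp⟩ := zar_aux3 (k := Qbar) (JJ C) (JJ_prime hC.2.1 (curve_fin_ex hC hnv)) (MvPolynomial.X i) (MvPolynomial.X j)
    (curve_tr hC hnv i) (by
      intro G hG h
      obtain ⟨P, hP, hf, hne⟩ := hc G hG
      apply hne
      have h1 := (mem_JJ _).1 h P hP hf
      rw [hom_eval₂, MvPolynomial.eval_X] at h1
      rw [eval_map, ← h1]
      congr 1
      ext p
      · simp
      · simp)
  obtain ⟨g, hgq, hgJ⟩ := SetLike.exists_of_lt hJq
  have hfin : {P | P ∈ C ∧ (¬ finP P ∨ MvPolynomial.eval (xc P) g = 0)}.Finite := by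
    apply curve_G hC
    by_contra hc
    push Not at hc
    exact hgJ ((mem_JJ _).2 hc)
  have hfin2 := hfin.image (fun P => x1 (P i))
  set p : Qbar[X] := ∏ t ∈ hfin2.toFinset, (X - Polynomial.C t) with hp
  have hp0 : p ≠ 0 := Finset.prod_ne_zero_iff.2 fun t _ => X_sub_C_ne_zero t
  apply hqp p hp0
  rw [← MvPolynomial.IsPrime.vanishingIdeal_zeroLocus (K := Qbar) q, MvPolynomial.mem_vanishingIdeal_iff]
  intro x hx
  rw [MvPolynomial.mem_zeroLocus_iff] at hx
  have hx' : ∀ G ∈ q, MvPolynomial.eval x G = 0 := by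
    intro G hG
    have := hx G hG
    rw [← MvPolynomial.coe_aeval_eq_eval]; exact this
  have hxC : aff x ∈ C := aff_mem hC.1 x (fun G hG => hx' G (hJq.le hG))
  have hxT : x i ∈ hfin2.toFinset := by
    rw [Set.Finite.mem_toFinset]
    refine ⟨aff x, ⟨hxC, Or.inr ?_⟩, congrFun (aff_xc x) i⟩
    rw [aff_xc]; exact hx' g hgq
  rw [← aeval_algHom_apply, MvPolynomial.aeval_X, coe_aeval_eq_eval, hp, eval_prod]
  apply Finset.prod_eq_zero hxT
  simp
end
end

noncomputable section
open Polynomial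

section
variable {n : ℕ} {C : Set (PPt n)}

lemma fin_bound {T : Set (PPt n)} (hT : T.Finite) : ∃ M : ℝ, 0 ≤ M ∧ ∀ P ∈ T, ∀ i, weilHeight (xc P i) ≤ M := by
  refine ⟨∑ P ∈ hT.toFinset, ∑ i, weilHeight (xc P i), Finset.sum_nonneg fun P _ => Finset.sum_nonneg fun i _ => W_nonneg _, ?_⟩
  intro P hP i
  have h1 : weilHeight (xc P i) ≤ ∑ i, weilHeight (xc P i) :=
    Finset.single_le_sum (f := fun i => weilHeight (xc P i)) (fun i _ => W_nonneg _) (Finset.mem_univ i)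
  refine h1.trans ?_
  exact Finset.single_le_sum (f := fun P => ∑ i, weilHeight (xc P i)) (fun P _ => Finset.sum_nonneg fun i _ => W_nonneg _) (hT.mem_toFinset.2 hP)

lemma ev_aeval (P : PPt n) (i : Fin n) (p : Qbar[X]) :
    MvPolynomial.eval (xc P) (aeval (MvPolynomial.X i : MvPolynomial (Fin n) Qbar) p) = eval (xc P i) p := by
  rw [← MvPolynomial.coe_aeval_eq_eval]
  change MvPolynomial.aeval (xc P) _ = _
  rw [← aeval_algHom_apply, MvPolynomial.aeval_X, coe_aeval_eq_eval]

lemma curve_h (hC : IsCurve C) (hnv : NonVertical C) (i j : Fin n) : ∃ A B : ℝ, 0 ≤ A ∧ 0 ≤ B ∧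
    ∀ P ∈ C, weilHeight (xc P j) ≤ A * weilHeight (xc P i) + B := by
  obtain ⟨G, hG, hGC⟩ := curve_dep hC hnv i j
  obtain ⟨A, B, hA, hB, h⟩ := W_H3 G
  obtain ⟨m, hm⟩ : ∃ m, G.coeff m ≠ 0 := by
    by_contra hc
    push Not at hc
    exact hG (Polynomial.ext fun m => by simp [hc m])
  have hfin : {P | P ∈ C ∧ (¬ finP P ∨ MvPolynomial.eval (xc P) (aeval (MvPolynomial.X i : MvPolynomial (Fin n) Qbar) (G.coeff m)) = 0)}.Finite := by
    apply curve_G hC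
    by_contra hc
    push Not at hc
    exact curve_tr hC hnv i _ hm ((mem_JJ _).2 hc)
  obtain ⟨M, hM, hMT⟩ := fin_bound hfin
  refine ⟨A, B + M, hA, by positivity, fun P hP => ?_⟩
  have h0 := mul_nonneg hA (W_nonneg (xc P i))
  by_cases hbad : ¬ finP P ∨ MvPolynomial.eval (xc P) (aeval (MvPolynomial.X i : MvPolynomial (Fin n) Qbar) (G.coeff m)) = 0
  · have := hMT P ⟨hP, hbad⟩ j
    linarith
  · push Not at hbad
    have := h (xc P i) (xc P j) (by
      intro h0
      apply hbad.2
      rw [ev_aeval]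
      have := congrArg (fun q => q.coeff m) h0
      simpa using this) (hGC P hP hbad.1)
    linarith

lemma curve_h_all (hC : IsCurve C) (hnv : NonVertical C) : ∃ A B : ℝ, 0 ≤ A ∧ 0 ≤ B ∧
    ∀ i j, ∀ P ∈ C, weilHeight (xc P j) ≤ A * weilHeight (xc P i) + B := by
  choose A B hA hB h using fun p : Fin n × Fin n => curve_h hC hnv p.1 p.2
  refine ⟨∑ p, A p, ∑ p, B p, Finset.sum_nonneg fun p _ => hA p, Finset.sum_nonneg fun p _ => hB p, ?_⟩
  intro i j P hP
  have h1 := h (i,j) P hP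
  have h2 : A (i,j) ≤ ∑ p, A p := Finset.single_le_sum (fun p _ => hA p) (Finset.mem_univ _)
  have h3 : B (i,j) ≤ ∑ p, B p := Finset.single_le_sum (fun p _ => hB p) (Finset.mem_univ _)
  have := mul_le_mul_of_nonneg_right h2 (W_nonneg (xc P i))
  linarith

lemma bott_exists (f : Qbar[X]) (hd : 2 ≤ f.natDegree) (hns : ¬ IsSpecial f) : ∃ B : Bott Qbar, B.f = f := by
  obtain ⟨Ψ, a, ha, hΨ, h⟩ := bottcher f hd
  by_cases hN : NSer Ψ
  · exact ⟨⟨f, hd, Ψ, a, ha, hΨ, h, hN⟩, rfl⟩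
  · exact absurd (nser_or f hd ha hΨ h hN) hns

lemma phiS_eval (Q : Qbar[X]) (x : Fin n → Qbar) (F : MvPolynomial (Fin n) Qbar) :
    MvPolynomial.eval x (phiS Q F) = MvPolynomial.eval (fun i => eval (x i) Q) F := by
  have : (MvPolynomial.eval x).comp (phiS Q : MvPolynomial (Fin n) Qbar →ₐ[Qbar] _).toRingHom = MvPolynomial.eval (fun i => eval (x i) Q) := by
    apply MvPolynomial.ringHom_ext
    · intro r; simp [phiS]
    · intro i
      have := ev_aeval (aff x) i Q
      rw [aff_xc] at this
      simp [phiS, this]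
  exact congrArg (fun g => g F) this

lemma hyp_case (B : Bott Qbar) (hC : IsCurve C) (hnv : NonVertical C) {V : Set (PPt n)} (hV : IsPeriodicHyp (fun _ => B.f) V)
    (hCV : ¬ C ⊆ V) {P : PPt n} (hPV : P ∈ V) (hP : finP P) :
    (∃ i k, 1 ≤ k ∧ eval (xc P i) (itp B.f k) = xc P i) ∨
    ∃ i j g, B.IsG g ∧ xc P j = eval (xc P i) g ∧ ∃ Q ∈ C, finP Q ∧ xc Q j ≠ eval (xc Q i) g := by
  obtain ⟨hc, hirr, hdim, k, hk, hkV⟩ := hV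
  have h0 : IS V ≠ ⊥ := by
    intro h0
    apply hCV
    intro Q _
    apply closed_mem hc
    intro f hf
    rw [h0, Ideal.mem_bot] at hf
    rw [hf, map_zero]
  obtain ⟨F, hF, hI⟩ := hyp_principal hc hirr hdim h0
  have hFV : ∀ Q ∈ V, finP Q → MvPolynomial.eval (xc Q) (deh F) = 0 := by
    intro Q hQ hf
    apply deh_van hf
    exact (mem_IS V F).1 (by rw [hI]; exact Ideal.mem_span_singleton_self F) Q hQ
  obtain ⟨Q, hQC, hQf, hQ⟩ : ∃ Q ∈ C, finP Q ∧ MvPolynomial.eval (xc Q) (deh F) ≠ 0 := by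
    by_contra hcon
    push Not at hcon
    rcases hC.2.1.2 V _ hc (closed_G 1) (by
      intro Q hQ
      by_cases hf : finP Q
      · exact Or.inl (hyp_mem hc hI hf (hcon Q hQ hf))
      · exact Or.inr (Or.inl hf)) with h | h
    · exact hCV h
    · obtain ⟨Q, hQ, hf⟩ := curve_fin_ex hC hnv
      rcases h hQ with h | h
      · exact h hf
      · simp at h
  have hdvd : ∀ G ∈ JJ V, deh F ∣ G := by
    intro G hG
    obtain ⟨H, hH, hH2⟩ := homog' G
    have := (homog_IS V hH2).2 hG
    rw [hI, Ideal.mem_span_singleton] at this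
    obtain ⟨u, hu⟩ := this
    exact ⟨deh u, by rw [← map_mul, ← hu, hH]⟩
  have hJ : JJ V = Ideal.span {deh F} := by
    apply le_antisymm
    · intro G hG; rw [Ideal.mem_span_singleton]; exact hdvd G hG
    · rw [Ideal.span_singleton_le_iff_mem, mem_JJ]; exact hFV
  have hne : deh F ≠ 0 := by intro h; rw [h, map_zero] at hQ; exact hQ rfl
  have hpr : Prime (deh F) := by
    rw [← Ideal.span_singleton_prime hne, ← hJ]
    exact JJ_prime hirr ⟨P, hPV, hP⟩
  have hphi : deh F ∣ phiS (itp B.f k) (deh F) := by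
    apply hdvd
    rw [mem_JJ]
    intro R hR hRf
    obtain ⟨a, b⟩ := split_fin B.f R hRf k
    rw [phiS_eval, ← b]
    apply hFV _ _ a
    rw [← hkV]
    exact ⟨R, hR, rfl⟩
  rcases redC B hpr.irreducible hk hphi with ⟨i, ζ, ha, hζ⟩ | ⟨i, j, g, hij, hg, ha⟩
  · left
    refine ⟨i, k, hk, ?_⟩
    obtain ⟨u, hu⟩ := ha.dvd
    have := congrArg (MvPolynomial.eval (xc P)) hu
    rw [map_mul, hFV P hPV hP, zero_mul, map_sub, MvPolynomial.eval_X, MvPolynomial.eval_C, sub_eq_zero] at this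
    rw [this, hζ]
  · right
    refine ⟨i, j, g, hg, ?_, Q, hQC, hQf, ?_⟩
    · obtain ⟨u, hu⟩ := ha.dvd
      have := congrArg (MvPolynomial.eval (xc P)) hu
      rw [map_mul, hFV P hPV hP, zero_mul, map_sub, MvPolynomial.eval_X, ev_aeval, sub_eq_zero] at this
      exact this
    · intro he
      obtain ⟨u, hu⟩ := ha.symm.dvd
      apply hQ
      have := congrArg (MvPolynomial.eval (xc Q)) hu
      rw [map_mul, map_sub, MvPolynomial.eval_X, ev_aeval, he, sub_self, zero_mul] at this
      exact this

theorem main_bound (f : Qbar[X]) (hdeg : 2 ≤ f.natDegree) (hns : ¬ IsSpecial f)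
    (hC : IsCurve C) (hnv : NonVertical C)
    (hCV : ∀ V : Set (PPt n), IsPeriodicHyp (fun _ => f) V → ¬ C ⊆ V) :
    ∃ B : ℝ, ∀ P ∈ C,
      (∃ V : Set (PPt n), IsPeriodicHyp (fun _ => f) V ∧ P ∈ V) →
      ∑ i, hP1 (P i) ≤ B := by
  obtain ⟨Bt, rfl⟩ := bott_exists f hdeg hns
  obtain ⟨c1, hc1⟩ := W_per Bt.f hdeg
  obtain ⟨c2, hc20, hc2⟩ := W_comm Bt.f hdeg
  obtain ⟨A, B, hA, hB, hAB⟩ := curve_h_all hC hnv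
  obtain ⟨m0, hm0⟩ := exists_nat_ge (A + 1)
  let gs : Set Qbar[X] := ⋃ m ∈ Set.Iic m0, {g | Bt.IsG g ∧ g.natDegree = m}
  have hgs : gs.Finite := (Set.finite_Iic m0).biUnion fun m _ => Bt.finite_G m
  let D : Fin n → Fin n → Qbar[X] → Set (PPt n) := fun i j g =>
    {P | P ∈ C ∧ finP P ∧ xc P j = eval (xc P i) g ∧ ∃ Q ∈ C, finP Q ∧ xc Q j ≠ eval (xc Q i) g}
  have hD : ∀ i j g, (D i j g).Finite := by
    intro i j g
    by_cases hq : ∃ Q ∈ C, finP Q ∧ xc Q j ≠ eval (xc Q i) g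
    · obtain ⟨Q, h1, h2, h3⟩ := hq
      refine (curve_G hC (MvPolynomial.X j - aeval (MvPolynomial.X i : MvPolynomial (Fin n) Qbar) g) ⟨Q, h1, h2, ?_⟩).subset ?_
      · rw [map_sub, MvPolynomial.eval_X, ev_aeval]; exact sub_ne_zero.2 h3
      · rintro P ⟨a, b, c, _⟩
        refine ⟨a, Or.inr ?_⟩
        rw [map_sub, MvPolynomial.eval_X, ev_aeval, c, sub_self]
    · refine Set.finite_empty.subset ?_
      rintro P ⟨_, _, _, h⟩; exact hq h
  let T : Set (PPt n) := (⋃ i, ⋃ j, ⋃ g ∈ gs, D i j g) ∪ {P | P ∈ C ∧ ¬ finP P}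
  have hT : T.Finite := by
    refine Set.Finite.union ?_ (curve_inf hC hnv)
    exact Set.finite_iUnion fun i => Set.finite_iUnion fun j => hgs.biUnion fun g _ => hD i j g
  obtain ⟨M, hM, hMT⟩ := fin_bound hT
  set M2 := |c1| + (B + (A + 2) * c2) with hM2
  have hM20 : 0 ≤ M2 := by positivity
  refine ⟨n * (M + (A * M2 + B)), ?_⟩
  rintro P hP ⟨V, hV, hPV⟩
  suffices h : ∀ i, weilHeight (xc P i) ≤ M + (A * M2 + B) by
    calc ∑ i, hP1 (P i) = ∑ i, weilHeight (xc P i) := rfl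
      _ ≤ ∑ i : Fin n, (M + (A * M2 + B)) := Finset.sum_le_sum fun i _ => h i
      _ = _ := by simp; ring
  have hpos : 0 ≤ A * M2 + B := by positivity
  by_cases hPT : P ∈ T
  · intro i; have := hMT P hPT i; linarith
  have hf : finP P := by
    by_contra hf; exact hPT (Or.inr ⟨hP, hf⟩)
  suffices h : ∃ i, weilHeight (xc P i) ≤ M2 by
    obtain ⟨i, hi⟩ := h
    intro j
    have h1 := hAB i j P hP
    have := mul_le_mul_of_nonneg_left hi hA
    linarith
  rcases hyp_case Bt hC hnv hV (hCV V hV) hPV hf with ⟨i, k, hk, h⟩ | ⟨i, j, g, hg, h1, h2⟩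
  · refine ⟨i, ?_⟩
    have a1 := hc1 k _ hk h
    have a2 := le_abs_self c1
    have a3 : 0 ≤ B + (A + 2) * c2 := by positivity
    linarith
  · refine ⟨i, ?_⟩
    obtain ⟨l, hl, hcm⟩ := hg.comm
    have a1 := hc2 g l hl hg.1 hcm (xc P i)
    rw [← h1] at a1
    have a2 := hAB i j P hP
    have hm : m0 < g.natDegree := by
      by_contra hcon
      push Not at hcon
      apply hPT
      left
      simp only [Set.mem_iUnion]
      refine ⟨i, j, g, ?_, hP, hf, h1, h2⟩
      simp only [gs, Set.mem_iUnion]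
      exact ⟨g.natDegree, hcon, hg, rfl⟩
    have hm' : (m0 : ℝ) ≤ g.natDegree := by exact_mod_cast hm.le
    have a3 := abs_nonneg c1
    generalize (g.natDegree : ℝ) = m at *
    generalize weilHeight (xc P i) = h at *
    have e1 : 1 ≤ m - A := by linarith
    have e2 : (m - A) * h ≤ B + (m + 1) * c2 := by linarith
    have e3 : B ≤ (m - A) * B := by nlinarith
    have e4 : (m + 1) * c2 ≤ (m - A) * ((A + 2) * c2) := by
      have : m + 1 ≤ (m - A) * (A + 2) := by nlinarith
      calc (m+1) * c2 ≤ ((m - A) * (A + 2)) * c2 := mul_le_mul_of_nonneg_right this hc20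
        _ = _ := by ring
    have e5 : (m - A) * h ≤ (m - A) * (B + (A + 2) * c2) := by linarith
    have e6 : h ≤ B + (A + 2) * c2 := le_of_mul_le_mul_left e5 (by linarith)
    linarith
end
end


/-- Nguyen. Points of the curve `C` lying on some periodic
hypersurface have bounded Weil height. -/
theorem nguyen_bounded_height
    (n : ℕ) (K : IntermediateField ℚ Qbar) [FiniteDimensional ℚ K]
    (f : Polynomial Qbar) (hfK : ∀ j, f.coeff j ∈ K)
    (hdeg : 2 ≤ f.natDegree) (hns : ¬ IsSpecial f)
    (C : Set (PPt n)) (hC : IsCurve C) (hnv : NonVertical C)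
    (hCV : ∀ V : Set (PPt n), IsPeriodicHyp (fun _ => f) V → ¬ C ⊆ V) :
    ∃ B : ℝ, ∀ P ∈ C,
      (∃ V : Set (PPt n), IsPeriodicHyp (fun _ => f) V ∧ P ∈ V) →
      ∑ i, hP1 (P i) ≤ B := by
  exact main_bound f hdeg hns hC hnv hCV

end
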